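/- Suppose α > λ₁. Then there exists an irreducible GL solution with de Gennes–Neumann boundary conditions. Moreover, every field pair (a,φ) with E(a,φ) = inf{E(a',φ') : (a',φ') a field pair} is irreducible. -/

import Mathlib

open MeasureTheory Complex

noncomputable section

/-- Partial derivative in the first coordinate direction. -/
def pd1 {E : Type*} [NormedAddCommGroup E] [NormedSpace ℝ E]
    (f : ℝ × ℝ → E) (x : ℝ × ℝ) : E := fderiv ℝ f x (1, 0)

/-- Partial derivative in the second coordinate direction. -/
def pd2 {E : Type*} [NormedAddCommGroup E] [NormedSpace ℝ E]
    (f : ℝ × ℝ → E) (x : ℝ × ℝ) : E := fderiv ℝ f x (0, 1)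

/-- Covariant derivative `D₁φ = ∂₁φ + i a₁ φ`. -/
def D1 (a1 : ℝ × ℝ → ℝ) (φ : ℝ × ℝ → ℂ) : ℝ × ℝ → ℂ :=
  fun x => pd1 φ x + Complex.I * (a1 x : ℂ) * φ x

/-- Covariant derivative `D₂φ = ∂₂φ + i a₂ φ`. -/
def D2 (a2 : ℝ × ℝ → ℝ) (φ : ℝ × ℝ → ℂ) : ℝ × ℝ → ℂ :=
  fun x => pd2 φ x + Complex.I * (a2 x : ℂ) * φ x

/-- Curvature `F(a) = ∂₁a₂ − ∂₂a₁`. -/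
def curv (a1 a2 : ℝ × ℝ → ℝ) : ℝ × ℝ → ℝ :=
  fun x => pd1 a2 x - pd2 a1 x

/-- The closed unit disk `D̄ ⊆ ℝ²`. -/
def disk : Set (ℝ × ℝ) := { x : ℝ × ℝ | x.1 ^ 2 + x.2 ^ 2 ≤ 1 }

/-- A field pair on the disk: a pair of smooth maps `(a, φ)`. -/
structure DiskPair where
  a1 : ℝ × ℝ → ℝ
  a2 : ℝ × ℝ → ℝ
  φ : ℝ × ℝ → ℂ
  smooth_a1 : ContDiff ℝ (⊤ : ℕ∞) a1
  smooth_a2 : ContDiff ℝ (⊤ : ℕ∞) a2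
  smooth_φ : ContDiff ℝ (⊤ : ℕ∞) φ

/-- The Ginzburg–Landau free energy on the disk. -/
def energyD (α β : ℝ) (F₀ : ℝ × ℝ → ℝ) (P : DiskPair) : ℝ :=
  (1 / 2) * ∫ x in disk,
    ((curv P.a1 P.a2 x - F₀ x) ^ 2 + ‖D1 P.a1 P.φ x‖ ^ 2 + ‖D2 P.a2 P.φ x‖ ^ 2
      - α * ‖P.φ x‖ ^ 2 + (β / 2) * ‖P.φ x‖ ^ 4)

/-- The Ginzburg–Landau equations on the disk with de Gennes–Neumann boundary
conditions. -/
def IsGLSolutionD (α β : ℝ) (F₀ : ℝ × ℝ → ℝ) (P : DiskPair) : Prop :=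
  (∀ x ∈ disk,
      pd2 (fun y => curv P.a1 P.a2 y - F₀ y) x
        + ((starRingEnd ℂ) (P.φ x) * D1 P.a1 P.φ x).im = 0) ∧
  (∀ x ∈ disk,
      -pd1 (fun y => curv P.a1 P.a2 y - F₀ y) x
        + ((starRingEnd ℂ) (P.φ x) * D2 P.a2 P.φ x).im = 0) ∧
  (∀ x ∈ disk,
      -(D1 P.a1 (D1 P.a1 P.φ) x + D2 P.a2 (D2 P.a2 P.φ) x)
        = (α : ℂ) * P.φ x - (β : ℂ) * (‖P.φ x‖ : ℂ) ^ 2 * P.φ x) ∧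
  (∀ x : ℝ × ℝ, x.1 ^ 2 + x.2 ^ 2 = 1 →
      curv P.a1 P.a2 x = F₀ x ∧
      (x.1 : ℂ) * D1 P.a1 P.φ x + (x.2 : ℂ) * D2 P.a2 P.φ x = 0)

/-- The set of energies of all field pairs on the disk. -/
def energySetD (α β : ℝ) (F₀ : ℝ × ℝ → ℝ) : Set ℝ :=
  { t : ℝ | ∃ P : DiskPair, t = energyD α β F₀ P }

/-- `λ₁` on the disk. -/
def lambda1D (F₀ : ℝ × ℝ → ℝ) : ℝ :=
  sInf { t : ℝ | ∃ P : DiskPair,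
    (∀ x ∈ disk, curv P.a1 P.a2 x = F₀ x) ∧
    (∫ x in disk, ‖P.φ x‖ ^ 2) = 1 ∧
    t = ∫ x in disk, (‖D1 P.a1 P.φ x‖ ^ 2 + ‖D2 P.a2 P.φ x‖ ^ 2) }

namespace DiskGL

open MvPolynomial Set Filter Topology

/-- Real polynomials in two variables. -/
abbrev Poly := MvPolynomial (Fin 2) ℝ

/-- The value of a polynomial at a point of the plane. -/
def ev (p : Poly) (z : ℝ × ℝ) : ℝ := eval ![z.1, z.2] p

/-- The first coordinate. -/
def xx : Poly := X 0

/-- The second coordinate. -/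
def yy : Poly := X 1

/-- The derivative in the first coordinate. -/
def dx (p : Poly) : Poly := pderiv 0 p

/-- The derivative in the second coordinate. -/
def dy (p : Poly) : Poly := pderiv 1 p

section Algebra

variable (p q : Poly) (z : ℝ × ℝ) (c : ℝ) (n : ℕ)

@[simp] lemma ev_add : ev (p + q) z = ev p z + ev q z := by simp [ev]
@[simp] lemma ev_sub : ev (p - q) z = ev p z - ev q z := by simp [ev]
@[simp] lemma ev_mul : ev (p * q) z = ev p z * ev q z := by simp [ev]
@[simp] lemma ev_neg : ev (-p) z = -ev p z := by simp [ev]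
@[simp] lemma ev_smul : ev (c • p) z = c * ev p z := by simp [ev, smul_eval]
@[simp] lemma ev_pow : ev (p ^ n) z = ev p z ^ n := by simp [ev]
@[simp] lemma ev_C : ev (C c) z = c := by simp [ev]
@[simp] lemma ev_zero : ev 0 z = 0 := by simp [ev]
@[simp] lemma ev_one : ev 1 z = 1 := by simp [ev]
@[simp] lemma ev_ofNat [n.AtLeastTwo] : ev (ofNat(n)) z = ofNat(n) := by simp [ev]
@[simp] lemma ev_natCast : ev (n : Poly) z = n := by simp [ev]
@[simp] lemma ev_xx : ev xx z = z.1 := by simp [ev, xx]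
@[simp] lemma ev_yy : ev yy z = z.2 := by simp [ev, yy]
lemma ev_sum {ι : Type*} (s : Finset ι) (f : ι → Poly) :
    ev (∑ i ∈ s, f i) z = ∑ i ∈ s, ev (f i) z := by simp [ev]

@[simp] lemma dx_add : dx (p + q) = dx p + dx q := by simp [dx]
@[simp] lemma dx_sub : dx (p - q) = dx p - dx q := by simp [dx]
@[simp] lemma dx_mul : dx (p * q) = dx p * q + p * dx q := by simp [dx]; ring
@[simp] lemma dx_neg : dx (-p) = -dx p := by simp [dx]
@[simp] lemma dx_smul : dx (c • p) = c • dx p := by simp [dx]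
@[simp] lemma dx_pow : dx (p ^ n) = n * p ^ (n - 1) * dx p := by simp [dx, Derivation.leibniz_pow, mul_assoc]
@[simp] lemma dx_C : dx (C c) = 0 := by simp [dx]
@[simp] lemma dx_zero : dx 0 = 0 := by simp [dx]
@[simp] lemma dx_one : dx 1 = 0 := by simp [dx]
@[simp] lemma dx_ofNat [n.AtLeastTwo] : dx (ofNat(n)) = 0 := Derivation.map_natCast (pderiv 0) n
@[simp] lemma dx_natCast : dx (n : Poly) = 0 := Derivation.map_natCast (pderiv 0) n
@[simp] lemma dx_xx : dx xx = 1 := by simp [dx, xx]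
@[simp] lemma dx_yy : dx yy = 0 := by simp [dx, yy]

@[simp] lemma dy_add : dy (p + q) = dy p + dy q := by simp [dy]
@[simp] lemma dy_sub : dy (p - q) = dy p - dy q := by simp [dy]
@[simp] lemma dy_mul : dy (p * q) = dy p * q + p * dy q := by simp [dy]; ring
@[simp] lemma dy_neg : dy (-p) = -dy p := by simp [dy]
@[simp] lemma dy_smul : dy (c • p) = c • dy p := by simp [dy]
@[simp] lemma dy_pow : dy (p ^ n) = n * p ^ (n - 1) * dy p := by simp [dy, Derivation.leibniz_pow, mul_assoc]
@[simp] lemma dy_C : dy (C c) = 0 := by simp [dy]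
@[simp] lemma dy_zero : dy 0 = 0 := by simp [dy]
@[simp] lemma dy_one : dy 1 = 0 := by simp [dy]
@[simp] lemma dy_ofNat [n.AtLeastTwo] : dy (ofNat(n)) = 0 := Derivation.map_natCast (pderiv 1) n
@[simp] lemma dy_natCast : dy (n : Poly) = 0 := Derivation.map_natCast (pderiv 1) n
@[simp] lemma dy_xx : dy xx = 0 := by simp [dy, xx]
@[simp] lemma dy_yy : dy yy = 1 := by simp [dy, yy]

@[simp] lemma dy_dx : dy (dx p) = dx (dy p) := by
  induction p using MvPolynomial.induction_on with
  | C a => simp [dx, dy]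
  | add p q hp hq => simp [hp, hq]
  | mul_X p i hp =>
    fin_cases i
    · have : (X ((fun i => i) ⟨0, by omega⟩) : Poly) = xx := rfl
      rw [this]; simp [hp]
    · have : (X ((fun i => i) ⟨1, by omega⟩) : Poly) = yy := rfl
      rw [this]; simp [hp]

end Algebra

lemma poly_induction {P : Poly → Prop} (hC : ∀ a, P (C a)) (hadd : ∀ p q, P p → P q → P (p + q))
    (hx : ∀ p, P p → P (p * xx)) (hy : ∀ p, P p → P (p * yy)) (p : Poly) : P p := by
  induction p using MvPolynomial.induction_on with
  | C a => exact hC a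
  | add p q hp hq => exact hadd p q hp hq
  | mul_X p i hp =>
    fin_cases i
    · exact hx p hp
    · exact hy p hp

lemma hasFDerivAt_ev (p : Poly) (z : ℝ × ℝ) : HasFDerivAt (ev p)
    (ev (dx p) z • ContinuousLinearMap.fst ℝ ℝ ℝ + ev (dy p) z • ContinuousLinearMap.snd ℝ ℝ ℝ) z := by
  induction p using poly_induction with
  | hC a =>
    have : ev (C a : Poly) = fun _ => a := by ext; simp
    rw [this]; simpa using hasFDerivAt_const a z
  | hadd p q hp hq =>
    have : ev (p + q) = ev p + ev q := by ext; simp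
    rw [this]
    exact (hp.add hq).congr_fderiv (by ext <;> simp)
  | hx p hp =>
    have : ev (p * xx) = ev p * Prod.fst := by ext; simp
    rw [this]
    exact (hp.mul (hasFDerivAt_fst (p := z) (𝕜 := ℝ))).congr_fderiv (by ext <;> simp <;> ring)
  | hy p hp =>
    have : ev (p * yy) = ev p * Prod.snd := by ext; simp
    rw [this]
    exact (hp.mul (hasFDerivAt_snd (p := z) (𝕜 := ℝ))).congr_fderiv (by ext <;> simp <;> ring)

lemma contDiff_ev (p : Poly) {n : WithTop ℕ∞} : ContDiff ℝ n (ev p) := by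
  induction p using poly_induction with
  | hC a =>
    rw [show ev (C a) = fun _ => a by ext; simp]
    exact contDiff_const
  | hadd p q hp hq =>
    rw [show ev (p + q) = fun z => ev p z + ev q z by ext; simp]
    exact hp.add hq
  | hx p hp =>
    rw [show ev (p * xx) = fun z => ev p z * z.1 by ext; simp]
    exact hp.mul contDiff_fst
  | hy p hp =>
    rw [show ev (p * yy) = fun z => ev p z * z.2 by ext; simp]
    exact hp.mul contDiff_snd

@[fun_prop] lemma continuous_ev (p : Poly) : Continuous (ev p) := (contDiff_ev p (n := 0)).continuous

lemma isCompact_disk : IsCompact disk := by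
  refine Metric.isCompact_of_isClosed_isBounded ?_ ?_
  · exact isClosed_le (by fun_prop) (by fun_prop)
  · refine (Metric.isBounded_closedBall (x := (0 : ℝ × ℝ)) (r := 1)).subset ?_
    intro z hz
    have hz : z.1 ^ 2 + z.2 ^ 2 ≤ 1 := hz
    rw [mem_closedBall_zero_iff, Prod.norm_def, Real.norm_eq_abs, Real.norm_eq_abs]
    refine max_le (abs_le_one_iff_mul_self_le_one.2 ?_) (abs_le_one_iff_mul_self_le_one.2 ?_) <;>
      nlinarith [sq_nonneg z.1, sq_nonneg z.2]

lemma measurableSet_disk : MeasurableSet disk := isCompact_disk.measurableSet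

instance : IsFiniteMeasure ((volume : Measure (ℝ × ℝ)).restrict disk) :=
  ⟨by simpa using isCompact_disk.measure_lt_top⟩

lemma integrable_disk {f : ℝ × ℝ → ℝ} (hf : Continuous f) : Integrable f (volume.restrict disk) :=
  hf.continuousOn.integrableOn_compact isCompact_disk

/-- Integration over the disk in polar coordinates. -/
lemma integral_disk_polar {f : ℝ × ℝ → ℝ} (hf : Continuous f) :
    ∫ z in disk, f z = ∫ t in (-Real.pi)..Real.pi, ∫ r in (0 : ℝ)..1,
      r * f (r * Real.cos t, r * Real.sin t) := by
  have h1 : ∫ z in disk, f z = ∫ p in (Ioi (0:ℝ) ×ˢ Ioo (-Real.pi) Real.pi),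
      p.1 * disk.indicator f (p.1 * Real.cos p.2, p.1 * Real.sin p.2) := by
    rw [← integral_indicator measurableSet_disk, ← integral_comp_polarCoord_symm]
    rfl
  have h2 : ∫ z in disk, f z = ∫ p in (Ioc (0:ℝ) 1 ×ˢ Ioc (-Real.pi) Real.pi),
      p.1 * f (p.1 * Real.cos p.2, p.1 * Real.sin p.2) := by
    rw [h1]
    have e1 : (Ioc (0:ℝ) 1 ×ˢ Ioc (-Real.pi) Real.pi : Set (ℝ × ℝ)) =ᵐ[volume]
        (Ioc (0:ℝ) 1 ×ˢ Ioo (-Real.pi) Real.pi : Set (ℝ × ℝ)) :=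
      Measure.set_prod_ae_eq (ae_eq_refl _) Ioo_ae_eq_Ioc.symm
    rw [setIntegral_congr_set e1]
    have hs : (Ioc (0:ℝ) 1 ×ˢ Ioo (-Real.pi) Real.pi : Set (ℝ × ℝ)) ⊆
        (Ioi (0:ℝ) ×ˢ Ioo (-Real.pi) Real.pi) :=
      prod_mono Ioc_subset_Ioi_self le_rfl
    rw [setIntegral_eq_of_subset_of_forall_sdiff_eq_zero
      (measurableSet_Ioi.prod measurableSet_Ioo) hs]
    · refine setIntegral_congr_fun (measurableSet_Ioc.prod measurableSet_Ioo) ?_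
      rintro ⟨r, t⟩ ⟨hr, -⟩
      have hr0 : 0 < r := hr.1
      have hr1 : r ≤ 1 := hr.2
      have : ((r * Real.cos t, r * Real.sin t) : ℝ × ℝ) ∈ disk := by
        have := Real.sin_sq_add_cos_sq t
        change (r * Real.cos t) ^ 2 + (r * Real.sin t) ^ 2 ≤ 1
        rw [mul_pow, mul_pow, ← mul_add, add_comm, this]
        nlinarith
      simp [indicator_of_mem this]
    · rintro ⟨r, t⟩ ⟨⟨hr, ht⟩, hn⟩
      have hr0 : 0 < r := hr
      have hr1 : 1 < r := by
        by_contra! h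
        exact hn ⟨⟨hr, h⟩, ht⟩
      have : ((r * Real.cos t, r * Real.sin t) : ℝ × ℝ) ∉ disk := by
        have := Real.sin_sq_add_cos_sq t
        intro h
        have h : (r * Real.cos t) ^ 2 + (r * Real.sin t) ^ 2 ≤ 1 := h
        rw [mul_pow, mul_pow, ← mul_add, add_comm, this] at h
        nlinarith
      change r * disk.indicator f (r * Real.cos t, r * Real.sin t) = 0
      rw [indicator_of_notMem this, mul_zero]
  have hpi : -Real.pi ≤ Real.pi := by linarith [Real.pi_pos]
  rw [h2, intervalIntegral.integral_of_le hpi, Measure.volume_eq_prod, ← Measure.prod_restrict]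
  rw [integral_prod_symm]
  · refine integral_congr_ae (Eventually.of_forall fun t => ?_)
    simp only
    rw [intervalIntegral.integral_of_le zero_le_one]
  · rw [Measure.prod_restrict, ← Measure.volume_eq_prod]
    have : Continuous fun p : ℝ × ℝ => p.1 * f (p.1 * Real.cos p.2, p.1 * Real.sin p.2) := by fun_prop
    exact (this.continuousOn.integrableOn_compact (isCompact_Icc.prod isCompact_Icc)).mono_set
      (prod_mono Ioc_subset_Icc_self Ioc_subset_Icc_self)

/-- The integral of a polynomial over the disk. -/
def intD (p : Poly) : ℝ := ∫ z in disk, ev p z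

/-- The integral of a polynomial over the unit circle. -/
def circ (p : Poly) : ℝ := ∫ t in (-Real.pi)..Real.pi, ev p (Real.cos t, Real.sin t)

/-- The `L¹` norm of a polynomial on the disk. -/
def nrm1 (p : Poly) : ℝ := ∫ z in disk, |ev p z|

/-- The Euler field `x ∂₁ + y ∂₂`. -/
def eul (p : Poly) : Poly := xx * dx p + yy * dy p

/-- The rotation field `x ∂₂ - y ∂₁`. -/
def rot (p : Poly) : Poly := xx * dy p - yy * dx p

/-- The Laplacian. -/
def lap (p : Poly) : Poly := dx (dx p) + dy (dy p)

/-- The square of the distance to the origin. -/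
def rr : Poly := xx ^ 2 + yy ^ 2

/-- The defining function `1 - x² - y²` of the disk. -/
def bd : Poly := 1 - rr

lemma neg_pi_le_pi : -Real.pi ≤ Real.pi := by linarith [Real.pi_pos]

lemma integrable_ev (p : Poly) : Integrable (ev p) (volume.restrict disk) :=
  integrable_disk (continuous_ev p)

lemma integrable_abs_ev (p : Poly) : Integrable (fun z => |ev p z|) (volume.restrict disk) :=
  integrable_disk (continuous_ev p).abs

@[simp] lemma intD_add (p q : Poly) : intD (p + q) = intD p + intD q := by
  simp [intD, integral_add (integrable_ev p) (integrable_ev q)]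
@[simp] lemma intD_sub (p q : Poly) : intD (p - q) = intD p - intD q := by
  simp [intD, integral_sub (integrable_ev p) (integrable_ev q)]
@[simp] lemma intD_neg (p : Poly) : intD (-p) = -intD p := by simp [intD, integral_neg]
@[simp] lemma intD_smul (c : ℝ) (p : Poly) : intD (c • p) = c * intD p := by
  simp [intD, integral_const_mul]
@[simp] lemma intD_C_mul (c : ℝ) (p : Poly) : intD (C c * p) = c * intD p := by
  simp [intD, integral_const_mul]
@[simp] lemma intD_ofNat_mul (n : ℕ) [n.AtLeastTwo] (p : Poly) :
    intD (ofNat(n) * p) = ofNat(n) * intD p := by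
  simp [intD, integral_const_mul]
@[simp] lemma intD_zero : intD 0 = 0 := by simp [intD]

lemma nrm1_nonneg (p : Poly) : 0 ≤ nrm1 p := integral_nonneg fun _ => abs_nonneg _

lemma nrm1_add (p q : Poly) : nrm1 (p + q) ≤ nrm1 p + nrm1 q := by
  rw [nrm1, nrm1, nrm1, ← integral_add (integrable_abs_ev p) (integrable_abs_ev q)]
  exact integral_mono (integrable_abs_ev _) ((integrable_abs_ev p).add (integrable_abs_ev q))
    fun z => by simpa using abs_add_le (ev p z) (ev q z)

lemma nrm1_sub (p q : Poly) : nrm1 (p - q) ≤ nrm1 p + nrm1 q := by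
  rw [nrm1, nrm1, nrm1, ← integral_add (integrable_abs_ev p) (integrable_abs_ev q)]
  exact integral_mono (integrable_abs_ev _) ((integrable_abs_ev p).add (integrable_abs_ev q))
    fun z => by simpa using abs_sub (ev p z) (ev q z)

lemma nrm1_mul_le {p q : Poly} {c : ℝ} (h : ∀ z ∈ disk, |ev p z| ≤ c) :
    nrm1 (p * q) ≤ c * nrm1 q := by
  rw [nrm1, nrm1, ← integral_const_mul]
  refine setIntegral_mono_on (integrable_abs_ev _) ((integrable_abs_ev q).const_mul c)
    measurableSet_disk fun z hz => ?_
  rw [ev_mul, abs_mul]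
  exact mul_le_mul_of_nonneg_right (h z hz) (abs_nonneg _)

lemma abs_fst_le_one {z : ℝ × ℝ} (hz : z ∈ disk) : |z.1| ≤ 1 := by
  have hz : z.1 ^ 2 + z.2 ^ 2 ≤ 1 := hz
  exact abs_le_one_iff_mul_self_le_one.2 (by nlinarith [sq_nonneg z.2])

lemma abs_snd_le_one {z : ℝ × ℝ} (hz : z ∈ disk) : |z.2| ≤ 1 := by
  have hz : z.1 ^ 2 + z.2 ^ 2 ≤ 1 := hz
  exact abs_le_one_iff_mul_self_le_one.2 (by nlinarith [sq_nonneg z.1])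

lemma nrm1_eul_le (p : Poly) : nrm1 (eul p) ≤ nrm1 (dx p) + nrm1 (dy p) := by
  refine (nrm1_add _ _).trans (add_le_add ?_ ?_)
  · simpa using nrm1_mul_le (p := xx) (q := dx p) (c := 1) fun z hz => by
      simpa using abs_fst_le_one hz
  · simpa using nrm1_mul_le (p := yy) (q := dy p) (c := 1) fun z hz => by
      simpa using abs_snd_le_one hz

lemma nrm1_rot_le (p : Poly) : nrm1 (rot p) ≤ nrm1 (dx p) + nrm1 (dy p) := by
  refine (nrm1_sub _ _).trans ?_
  rw [add_comm]
  refine (add_le_add ?_ ?_)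
  · simpa using nrm1_mul_le (p := yy) (q := dx p) (c := 1) fun z hz => by
      simpa using abs_snd_le_one hz
  · simpa using nrm1_mul_le (p := xx) (q := dy p) (c := 1) fun z hz => by
      simpa using abs_fst_le_one hz

lemma intervalIntegral_swap {f : ℝ → ℝ → ℝ} (hf : Continuous fun p : ℝ × ℝ => f p.1 p.2)
    {a b c d : ℝ} (hcd : c ≤ d) :
    ∫ t in a..b, ∫ r in c..d, f t r = ∫ r in c..d, ∫ t in a..b, f t r := by
  simp only [intervalIntegral.integral_of_le hcd]
  refine intervalIntegral_integral_swap ?_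
  rw [Measure.prod_restrict, ← Measure.volume_eq_prod]
  exact (hf.continuousOn.integrableOn_compact (isCompact_uIcc.prod isCompact_Icc)).mono_set
      (prod_mono uIoc_subset_uIcc Ioc_subset_Icc_self)

lemma hasDerivAt_radius' {f f₁ f₂ : ℝ × ℝ → ℝ}
    (hf : ∀ z, HasFDerivAt f (f₁ z • ContinuousLinearMap.fst ℝ ℝ ℝ +
    f₂ z • ContinuousLinearMap.snd ℝ ℝ ℝ) z)
    (r t : ℝ) :
    HasDerivAt (fun r => f (r * Real.cos t, r * Real.sin t))
      (Real.cos t * f₁ (r * Real.cos t, r * Real.sin t)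
        + Real.sin t * f₂ (r * Real.cos t, r * Real.sin t)) r := by
  refine ((hf _).comp_hasDerivAt r (((hasDerivAt_id r).mul_const (Real.cos t)).prodMk
    ((hasDerivAt_id r).mul_const (Real.sin t)))).congr_deriv ?_
  simp; ring

lemma hasDerivAt_angle' {f f₁ f₂ : ℝ × ℝ → ℝ}
    (hf : ∀ z, HasFDerivAt f (f₁ z • ContinuousLinearMap.fst ℝ ℝ ℝ +
    f₂ z • ContinuousLinearMap.snd ℝ ℝ ℝ) z)
    (r t : ℝ) :
    HasDerivAt (fun t => f (r * Real.cos t, r * Real.sin t))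
      (r * Real.cos t * f₂ (r * Real.cos t, r * Real.sin t) -
        r * Real.sin t * f₁ (r * Real.cos t, r * Real.sin t)) t := by
  refine ((hf _).comp_hasDerivAt t (((Real.hasDerivAt_cos t).const_mul r).prodMk
    ((Real.hasDerivAt_sin t).const_mul r))).congr_deriv ?_
  simp; ring

/-- Gauss theorem on the disk, first component. -/
lemma integral_partial_fst {f f₁ f₂ : ℝ × ℝ → ℝ}
    (hf : ∀ z, HasFDerivAt f (f₁ z • ContinuousLinearMap.fst ℝ ℝ ℝ +
    f₂ z • ContinuousLinearMap.snd ℝ ℝ ℝ) z)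
    (c₁ : Continuous f₁) (c₂ : Continuous f₂) :
    ∫ z in disk, f₁ z = ∫ t in (-Real.pi)..Real.pi, Real.cos t * f (Real.cos t, Real.sin t) := by
  have c₀ : Continuous f := continuous_iff_continuousAt.2 fun z => (hf z).continuousAt
  have key : ∀ t r : ℝ, r * f₁ (r * Real.cos t, r * Real.sin t) =
      (Real.cos t * f (r * Real.cos t, r * Real.sin t) +
        (r * Real.cos t) * (Real.cos t * f₁ (r * Real.cos t, r * Real.sin t)
        + Real.sin t * f₂ (r * Real.cos t, r * Real.sin t))) +
      (-Real.cos t * f (r * Real.cos t, r * Real.sin t) +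
        (-Real.sin t) * (r * Real.cos t * f₂ (r * Real.cos t, r * Real.sin t) -
        r * Real.sin t * f₁ (r * Real.cos t, r * Real.sin t))) := by
    intro t r
    have := Real.sin_sq_add_cos_sq t
    linear_combination (-r * f₁ (r * Real.cos t, r * Real.sin t)) * this
  rw [integral_disk_polar c₁]
  simp_rw [key]
  have h1 : ∀ t : ℝ, ∫ r in (0:ℝ)..1, ((Real.cos t * f (r * Real.cos t, r * Real.sin t) +
        (r * Real.cos t) * (Real.cos t * f₁ (r * Real.cos t, r * Real.sin t)
        + Real.sin t * f₂ (r * Real.cos t, r * Real.sin t)))) =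
        Real.cos t * f (Real.cos t, Real.sin t) := by
    intro t
    rw [intervalIntegral.integral_eq_sub_of_hasDerivAt
      (f := fun r => (r * Real.cos t) * f (r * Real.cos t, r * Real.sin t))]
    · simp
    · intro r _
      refine ((((hasDerivAt_id r).mul_const (Real.cos t))).mul
        (hasDerivAt_radius' hf r t)).congr_deriv ?_
      simp
    · exact Continuous.intervalIntegrable (by fun_prop) _ _
  have h2 : ∀ r : ℝ, ∫ t in (-Real.pi)..Real.pi,
      (-Real.cos t * f (r * Real.cos t, r * Real.sin t) +
        (-Real.sin t) * (r * Real.cos t * f₂ (r * Real.cos t, r * Real.sin t) -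
        r * Real.sin t * f₁ (r * Real.cos t, r * Real.sin t))) = 0 := by
    intro r
    rw [intervalIntegral.integral_eq_sub_of_hasDerivAt
      (f := fun t => (-Real.sin t) * f (r * Real.cos t, r * Real.sin t))]
    · simp
    · intro t _
      exact ((Real.hasDerivAt_sin t).neg).mul (hasDerivAt_angle' hf r t)
    · exact Continuous.intervalIntegrable (by fun_prop) _ _
  have h3 : ∀ t : ℝ, ∫ r in (0:ℝ)..1, ((Real.cos t * f (r * Real.cos t, r * Real.sin t) +
        (r * Real.cos t) * (Real.cos t * f₁ (r * Real.cos t, r * Real.sin t)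
        + Real.sin t * f₂ (r * Real.cos t, r * Real.sin t))) +
      (-Real.cos t * f (r * Real.cos t, r * Real.sin t) +
        (-Real.sin t) * (r * Real.cos t * f₂ (r * Real.cos t, r * Real.sin t) -
        r * Real.sin t * f₁ (r * Real.cos t, r * Real.sin t)))) =
      Real.cos t * f (Real.cos t, Real.sin t) + ∫ r in (0:ℝ)..1,
      (-Real.cos t * f (r * Real.cos t, r * Real.sin t) +
        (-Real.sin t) * (r * Real.cos t * f₂ (r * Real.cos t, r * Real.sin t) -
        r * Real.sin t * f₁ (r * Real.cos t, r * Real.sin t))) := by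
    intro t
    rw [← h1, intervalIntegral.integral_add] <;>
    exact Continuous.intervalIntegrable (by fun_prop) _ _
  simp_rw [h3]
  rw [intervalIntegral.integral_add, intervalIntegral_swap (by fun_prop) zero_le_one]
  · simp_rw [h2]; simp
  · exact Continuous.intervalIntegrable (by fun_prop) _ _
  · exact Continuous.intervalIntegrable
      (intervalIntegral.continuous_parametric_intervalIntegral_of_continuous' (by fun_prop) _ _) _ _

/-- Gauss theorem on the disk, second component. -/
lemma integral_partial_snd {f f₁ f₂ : ℝ × ℝ → ℝ}
    (hf : ∀ z, HasFDerivAt f (f₁ z • ContinuousLinearMap.fst ℝ ℝ ℝ +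
    f₂ z • ContinuousLinearMap.snd ℝ ℝ ℝ) z)
    (c₁ : Continuous f₁) (c₂ : Continuous f₂) :
    ∫ z in disk, f₂ z = ∫ t in (-Real.pi)..Real.pi, Real.sin t * f (Real.cos t, Real.sin t) := by
  have c₀ : Continuous f := continuous_iff_continuousAt.2 fun z => (hf z).continuousAt
  have key : ∀ t r : ℝ, r * f₂ (r * Real.cos t, r * Real.sin t) =
      (Real.sin t * f (r * Real.cos t, r * Real.sin t) +
        (r * Real.sin t) * (Real.cos t * f₁ (r * Real.cos t, r * Real.sin t)
        + Real.sin t * f₂ (r * Real.cos t, r * Real.sin t))) +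
      (-Real.sin t * f (r * Real.cos t, r * Real.sin t) +
        Real.cos t * (r * Real.cos t * f₂ (r * Real.cos t, r * Real.sin t) -
        r * Real.sin t * f₁ (r * Real.cos t, r * Real.sin t))) := by
    intro t r
    have := Real.sin_sq_add_cos_sq t
    linear_combination (-r * f₂ (r * Real.cos t, r * Real.sin t)) * this
  rw [integral_disk_polar c₂]
  simp_rw [key]
  have h1 : ∀ t : ℝ, ∫ r in (0:ℝ)..1, ((Real.sin t * f (r * Real.cos t, r * Real.sin t) +
        (r * Real.sin t) * (Real.cos t * f₁ (r * Real.cos t, r * Real.sin t)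
        + Real.sin t * f₂ (r * Real.cos t, r * Real.sin t)))) =
        Real.sin t * f (Real.cos t, Real.sin t) := by
    intro t
    rw [intervalIntegral.integral_eq_sub_of_hasDerivAt
      (f := fun r => (r * Real.sin t) * f (r * Real.cos t, r * Real.sin t))]
    · simp
    · intro r _
      refine ((((hasDerivAt_id r).mul_const (Real.sin t))).mul
        (hasDerivAt_radius' hf r t)).congr_deriv ?_
      simp
    · exact Continuous.intervalIntegrable (by fun_prop) _ _
  have h2 : ∀ r : ℝ, ∫ t in (-Real.pi)..Real.pi,
      (-Real.sin t * f (r * Real.cos t, r * Real.sin t) +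
        Real.cos t * (r * Real.cos t * f₂ (r * Real.cos t, r * Real.sin t) -
        r * Real.sin t * f₁ (r * Real.cos t, r * Real.sin t))) = 0 := by
    intro r
    rw [intervalIntegral.integral_eq_sub_of_hasDerivAt
      (f := fun t => Real.cos t * f (r * Real.cos t, r * Real.sin t))]
    · simp
    · intro t _
      exact (Real.hasDerivAt_cos t).mul (hasDerivAt_angle' hf r t)
    · exact Continuous.intervalIntegrable (by fun_prop) _ _
  have h3 : ∀ t : ℝ, ∫ r in (0:ℝ)..1, ((Real.sin t * f (r * Real.cos t, r * Real.sin t) +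
        (r * Real.sin t) * (Real.cos t * f₁ (r * Real.cos t, r * Real.sin t)
        + Real.sin t * f₂ (r * Real.cos t, r * Real.sin t))) +
      (-Real.sin t * f (r * Real.cos t, r * Real.sin t) +
        Real.cos t * (r * Real.cos t * f₂ (r * Real.cos t, r * Real.sin t) -
        r * Real.sin t * f₁ (r * Real.cos t, r * Real.sin t)))) =
      Real.sin t * f (Real.cos t, Real.sin t) + ∫ r in (0:ℝ)..1,
      (-Real.sin t * f (r * Real.cos t, r * Real.sin t) +
        Real.cos t * (r * Real.cos t * f₂ (r * Real.cos t, r * Real.sin t) -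
        r * Real.sin t * f₁ (r * Real.cos t, r * Real.sin t))) := by
    intro t
    rw [← h1, intervalIntegral.integral_add] <;>
    exact Continuous.intervalIntegrable (by fun_prop) _ _
  simp_rw [h3]
  rw [intervalIntegral.integral_add, intervalIntegral_swap (by fun_prop) zero_le_one]
  · simp_rw [h2]; simp
  · exact Continuous.intervalIntegrable (by fun_prop) _ _
  · exact Continuous.intervalIntegrable
      (intervalIntegral.continuous_parametric_intervalIntegral_of_continuous' (by fun_prop) _ _) _ _

lemma hasDerivAt_radius (p : Poly) (r t : ℝ) :
    HasDerivAt (fun r => ev p (r * Real.cos t, r * Real.sin t))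
      (Real.cos t * ev (dx p) (r * Real.cos t, r * Real.sin t)
        + Real.sin t * ev (dy p) (r * Real.cos t, r * Real.sin t)) r :=
  hasDerivAt_radius' (hasFDerivAt_ev p) r t

lemma hasDerivAt_angle (p : Poly) (r t : ℝ) :
    HasDerivAt (fun t => ev p (r * Real.cos t, r * Real.sin t))
      (ev (rot p) (r * Real.cos t, r * Real.sin t)) t :=
  (hasDerivAt_angle' (hasFDerivAt_ev p) r t).congr_deriv (by simp [rot])

lemma intD_dx (p : Poly) : intD (dx p) = circ (xx * p) := by
  simpa [intD, circ] using
    integral_partial_fst (hasFDerivAt_ev p) (continuous_ev _) (continuous_ev _)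

lemma intD_dy (p : Poly) : intD (dy p) = circ (yy * p) := by
  simpa [intD, circ] using
    integral_partial_snd (hasFDerivAt_ev p) (continuous_ev _) (continuous_ev _)

@[simp] lemma circ_add (p q : Poly) : circ (p + q) = circ p + circ q := by
  simp only [circ, ev_add]
  exact intervalIntegral.integral_add (Continuous.intervalIntegrable (by fun_prop) _ _)
    (Continuous.intervalIntegrable (by fun_prop) _ _)

lemma circ_mul_rr (p : Poly) : circ (rr * p) = circ p := by
  simp [circ, rr]

lemma circ_mul_bd (p : Poly) : circ (bd * p) = 0 := by
  simp [circ, rr, bd]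

/-- The divergence theorem, for radial fields. -/
lemma intD_eul (p : Poly) : intD (eul p) + 2 * intD p = circ p := by
  have h : eul p + 2 * p = dx (xx * p) + dy (yy * p) := by
    simp [eul]; ring
  have := congrArg intD h
  rw [intD_add, intD_ofNat_mul, intD_add, intD_dx, intD_dy, ← circ_add] at this
  rw [this, ← circ_mul_rr p]
  congr 1
  simp [rr]; ring

lemma intD_rot (p : Poly) : intD (rot p) = 0 := by
  have h : rot p = dy (xx * p) - dx (yy * p) := by
    simp [rot]
  rw [h, intD_sub, intD_dx, intD_dy]
  rw [show yy * (xx * p) = xx * (yy * p) by ring, sub_self]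

/-- A radial Hardy type bound. -/
lemma sq_mul_abs_ev_le (p : Poly) {r : ℝ} (t : ℝ) (h0 : 0 ≤ r) (h1 : r ≤ 1) :
    r ^ 2 * |ev p (r * Real.cos t, r * Real.sin t)| ≤
      ∫ s in (0:ℝ)..1, s * |ev (eul p + 2 * p) (s * Real.cos t, s * Real.sin t)| := by
  have e : ∫ s in (0:ℝ)..r, s * ev (eul p + 2 * p) (s * Real.cos t, s * Real.sin t) =
      r ^ 2 * ev p (r * Real.cos t, r * Real.sin t) := by
    rw [intervalIntegral.integral_eq_sub_of_hasDerivAt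
      (f := fun r => r ^ 2 * ev p (r * Real.cos t, r * Real.sin t))]
    · simp
    · intro s _
      refine ((hasDerivAt_pow 2 s).mul (hasDerivAt_radius p s t)).congr_deriv ?_
      simp [eul]; ring
    · exact Continuous.intervalIntegrable (by fun_prop) _ _
  have hc : Continuous fun s : ℝ =>
    s * |ev (eul p + 2 * p) (s * Real.cos t, s * Real.sin t)| := by fun_prop
  calc r ^ 2 * |ev p (r * Real.cos t, r * Real.sin t)|
      = |∫ s in (0:ℝ)..r, s * ev (eul p + 2 * p) (s * Real.cos t, s * Real.sin t)| := by
        rw [e, abs_mul, abs_of_nonneg (sq_nonneg r)]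
    _ ≤ ∫ s in (0:ℝ)..r, |s * ev (eul p + 2 * p) (s * Real.cos t, s * Real.sin t)| :=
        intervalIntegral.abs_integral_le_integral_abs h0
    _ = ∫ s in (0:ℝ)..r, s * |ev (eul p + 2 * p) (s * Real.cos t, s * Real.sin t)| := by
        refine intervalIntegral.integral_congr fun s hs => ?_
        rw [uIcc_of_le h0] at hs
        rw [abs_mul, abs_of_nonneg hs.1]
    _ ≤ _ := by
        refine intervalIntegral.integral_mono_interval le_rfl h0 h1 ?_ (hc.intervalIntegrable _ _)
        refine (ae_restrict_iff' measurableSet_Ioc).2 (Eventually.of_forall fun s hs => ?_)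
        exact mul_nonneg hs.1.le (abs_nonneg _)

/-- The `L¹` norm of a polynomial and its gradient. -/
def sob1 (p : Poly) : ℝ := nrm1 p + nrm1 (dx p) + nrm1 (dy p)

lemma sob1_nonneg (p : Poly) : 0 ≤ sob1 p :=
  add_nonneg (add_nonneg (nrm1_nonneg _) (nrm1_nonneg _)) (nrm1_nonneg _)

lemma nrm1_two_mul (p : Poly) : nrm1 (2 * p) = 2 * nrm1 p := by
  simp [nrm1, abs_mul, integral_const_mul]

lemma nrm1_eul_add_le (p : Poly) : nrm1 (eul p + 2 * p) ≤ 2 * sob1 p := by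
  have := nrm1_add (eul p) (2 * p)
  have := nrm1_eul_le p
  have := nrm1_two_mul p
  have := nrm1_nonneg (dx p)
  have := nrm1_nonneg (dy p)
  rw [sob1]; linarith

/-- A trace bound: the mass of a function near the circle is controlled by its gradient. -/
lemma trace_bound (p : Poly) {n : ℕ} (hn : 1 ≤ n) :
    2 * n * nrm1 (rr ^ n * p) ≤ nrm1 (eul p + 2 * p) := by
  set A : ℝ → ℝ := fun t =>
    ∫ s in (0:ℝ)..1, s * |ev (eul p + 2 * p) (s * Real.cos t, s * Real.sin t)| with hA
  have hAc : Continuous A :=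
    intervalIntegral.continuous_parametric_intervalIntegral_of_continuous' (by fun_prop) _ _
  have hk : nrm1 (eul p + 2 * p) = ∫ t in (-Real.pi)..Real.pi, A t :=
    integral_disk_polar (continuous_ev _).abs
  rw [hk, nrm1, integral_disk_polar (continuous_ev _).abs, ← intervalIntegral.integral_const_mul]
  refine intervalIntegral.integral_mono_on neg_pi_le_pi ?_ (hAc.intervalIntegrable _ _) ?_
  · exact Continuous.intervalIntegrable (continuous_const.mul
      (intervalIntegral.continuous_parametric_intervalIntegral_of_continuous' (by fun_prop) _ _)) _ _
  intro t _
  have h1 : ∫ r in (0:ℝ)..1, r * |ev (rr ^ n * p) (r * Real.cos t, r * Real.sin t)| ≤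
      ∫ r in (0:ℝ)..1, r ^ (2 * n - 1) * A t := by
    refine intervalIntegral.integral_mono_on zero_le_one
      (Continuous.intervalIntegrable (by fun_prop) _ _)
      (Continuous.intervalIntegrable (by fun_prop) _ _) fun r hr => ?_
    have e : |ev (rr ^ n * p) (r * Real.cos t, r * Real.sin t)| =
        r ^ (2 * n) * |ev p (r * Real.cos t, r * Real.sin t)| := by
      have : (r * Real.cos t) ^ 2 + (r * Real.sin t) ^ 2 = r ^ 2 := by
        have := Real.sin_sq_add_cos_sq t
        linear_combination r ^ 2 * this
      simp [rr, this, abs_mul, pow_mul]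
    rw [e]
    have := mul_le_mul_of_nonneg_left (sq_mul_abs_ev_le p t hr.1 hr.2) (pow_nonneg hr.1 (2 * n - 1))
    calc _ = r ^ (2 * n - 1) * (r ^ 2 * |ev p (r * Real.cos t, r * Real.sin t)|) := by
          obtain ⟨m, rfl⟩ := Nat.exists_eq_add_of_le' hn
          rw [show 2 * (m + 1) - 1 = 2 * m + 1 by omega]; ring
      _ ≤ _ := this
  rw [intervalIntegral.integral_mul_const, integral_pow] at h1
  have hn' : (0:ℝ) < n := by exact_mod_cast hn
  have e2 : ((1:ℝ) ^ (2 * n - 1 + 1) - 0 ^ (2 * n - 1 + 1)) / ((2 * n - 1 : ℕ) + 1) = 1 / (2 * n) := by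
    have : ((2 * n - 1 : ℕ) : ℝ) + 1 = 2 * n := by
      rw [Nat.cast_sub (by omega)]; push_cast; ring
    rw [this]; simp
  rw [e2] at h1
  calc 2 * n * ∫ r in (0:ℝ)..1, r * |ev (rr ^ n * p) (r * Real.cos t, r * Real.sin t)|
      ≤ 2 * n * (1 / (2 * n) * A t) := by gcongr
    _ = A t := by field_simp

/-- The square of the positive part is continuously differentiable. -/
lemma hasDerivAt_posPart_sq (s : ℝ) :
    HasDerivAt (fun s : ℝ => max 0 s ^ 2) (2 * max 0 s) s := by
  rcases lt_trichotomy s 0 with h | rfl | h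
  · rw [max_eq_left h.le, mul_zero]
    refine (hasDerivAt_const s (0:ℝ)).congr_of_eventuallyEq ?_
    filter_upwards [Iio_mem_nhds h] with x hx
    rw [max_eq_left (le_of_lt hx)]; simp
  · simp only [max_self, mul_zero]
    rw [hasDerivAt_iff_isLittleO]
    have h1 : (fun x : ℝ => max 0 x ^ 2 - max 0 0 ^ 2 - (x - 0) • (0:ℝ)) =O[𝓝 0]
        fun x : ℝ => x ^ 2 := by
      refine Asymptotics.IsBigO.of_bound 1 (Eventually.of_forall fun x => ?_)
      have : |max 0 x| ≤ |x| := by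
        rcases le_total 0 x with hx | hx <;> simp [hx]
      simp only [max_self, smul_zero, norm_pow, Real.norm_eq_abs, one_mul]
      simpa using pow_le_pow_left₀ (abs_nonneg _) this 2
    refine h1.trans_isLittleO ?_
    simpa using Asymptotics.isLittleO_pow_id (𝕜 := ℝ) one_lt_two
  · rw [max_eq_right h.le]
    have : HasDerivAt (fun s : ℝ => s ^ 2) (2 * s) s := by simpa using hasDerivAt_pow 2 s
    refine this.congr_of_eventuallyEq ?_
    filter_upwards [Ioi_mem_nhds h] with x hx
    rw [max_eq_right (le_of_lt hx)]

lemma contDiff_posPart_sq : ContDiff ℝ 1 fun s : ℝ => max 0 s ^ 2 := by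
  rw [contDiff_one_iff_deriv]
  refine ⟨fun s => (hasDerivAt_posPart_sq s).differentiableAt, ?_⟩
  rw [show deriv (fun s : ℝ => max 0 s ^ 2) = fun s => 2 * max 0 s from
    funext fun s => (hasDerivAt_posPart_sq s).deriv]
  fun_prop

lemma norm_smul_fst_add_smul_snd_le (a b : ℝ) :
    ‖a • ContinuousLinearMap.fst ℝ ℝ ℝ + b • ContinuousLinearMap.snd ℝ ℝ ℝ‖ ≤ |a| + |b| := by
  refine (norm_add_le _ _).trans ?_
  rw [norm_smul, norm_smul, Real.norm_eq_abs, Real.norm_eq_abs]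
  refine add_le_add ?_ ?_
  · exact mul_le_of_le_one_right (abs_nonneg _) (ContinuousLinearMap.norm_fst_le ..)
  · exact mul_le_of_le_one_right (abs_nonneg _) (ContinuousLinearMap.norm_snd_le ..)

lemma ev_rr (z : ℝ × ℝ) : ev rr z = z.1 ^ 2 + z.2 ^ 2 := by simp [rr]

lemma ev_rr_nonneg (z : ℝ × ℝ) : 0 ≤ ev rr z := by rw [ev_rr]; positivity

lemma mem_disk_iff {z : ℝ × ℝ} : z ∈ disk ↔ ev rr z ≤ 1 := by rw [ev_rr]; rfl

/-- The cut-off of a polynomial near the circle, extended by zero. -/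
def cutoff (n : ℕ) (p : Poly) (z : ℝ × ℝ) : ℝ := max 0 (ev (1 - rr ^ n) z) ^ 2 * ev p z

lemma ev_one_sub_rr_pow_nonpos {n : ℕ} {z : ℝ × ℝ} (hz : z ∉ disk) : ev (1 - rr ^ n) z ≤ 0 := by
  rw [mem_disk_iff, not_le] at hz
  simpa using one_le_pow₀ (n := n) hz.le

lemma ev_one_sub_rr_pow_mem {n : ℕ} {z : ℝ × ℝ} (hz : z ∈ disk) :
    ev (1 - rr ^ n) z ∈ Icc (0:ℝ) 1 := by
  rw [mem_disk_iff] at hz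
  have h0 := ev_rr_nonneg z
  have h1 := pow_le_one₀ (n := n) h0 hz
  have h2 := pow_nonneg h0 n
  simp only [ev_sub, ev_one, ev_pow, mem_Icc]
  constructor <;> linarith

lemma cutoff_eq_zero {n : ℕ} {p : Poly} {z : ℝ × ℝ} (hz : z ∉ disk) : cutoff n p z = 0 := by
  simp [cutoff, -ev_sub, max_eq_left (ev_one_sub_rr_pow_nonpos hz)]

lemma hasFDerivAt_cutoff (n : ℕ) (p : Poly) (z : ℝ × ℝ) : HasFDerivAt (cutoff n p)
    ((max 0 (ev (1 - rr ^ n) z) ^ 2 * ev (dx p) z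
        + 2 * max 0 (ev (1 - rr ^ n) z) * ev (dx (1 - rr ^ n)) z * ev p z) •
      ContinuousLinearMap.fst ℝ ℝ ℝ +
    (max 0 (ev (1 - rr ^ n) z) ^ 2 * ev (dy p) z
        + 2 * max 0 (ev (1 - rr ^ n) z) * ev (dy (1 - rr ^ n)) z * ev p z) •
      ContinuousLinearMap.snd ℝ ℝ ℝ) z := by
  have h := ((hasDerivAt_posPart_sq (ev (1 - rr ^ n) z)).comp_hasFDerivAt z
    (hasFDerivAt_ev (1 - rr ^ n) z)).mul (hasFDerivAt_ev p z)
  refine h.congr_fderiv ?_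
  ext <;> simp <;> ring

lemma contDiff_cutoff (n : ℕ) (p : Poly) : ContDiff ℝ 1 (cutoff n p) :=
  (contDiff_posPart_sq.comp (contDiff_ev _)).mul (contDiff_ev p)

lemma hasCompactSupport_cutoff (n : ℕ) (p : Poly) : HasCompactSupport (cutoff n p) :=
  HasCompactSupport.intro isCompact_disk fun _ hz => cutoff_eq_zero hz

lemma norm_fderiv_cutoff_le (n : ℕ) (p : Poly) (z : ℝ × ℝ) :
    ‖fderiv ℝ (cutoff n p) z‖ ≤ disk.indicator
      (fun z => |ev (dx p) z| + |ev (dy p) z| + 8 * n * |ev (rr ^ (n - 1) * p) z|) z := by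
  rw [(hasFDerivAt_cutoff n p z).fderiv]
  by_cases hz : z ∈ disk
  · rw [indicator_of_mem hz]
    refine (norm_smul_fst_add_smul_snd_le _ _).trans ?_
    obtain ⟨h0, h1⟩ := ev_one_sub_rr_pow_mem (n := n) hz
    rw [max_eq_right h0]
    set b := ev (1 - rr ^ n) z
    have hx : |ev (dx (1 - rr ^ n)) z| ≤ 2 * n * ev rr z ^ (n - 1) := by
      have : ev (dx (1 - rr ^ n)) z = -(2 * n * ev rr z ^ (n - 1) * z.1) := by
        simp [rr]; ring
      rw [this, abs_neg, abs_mul, abs_of_nonneg (mul_nonneg (by positivity)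
        (pow_nonneg (ev_rr_nonneg z) _))]
      exact mul_le_of_le_one_right (mul_nonneg (by positivity)
        (pow_nonneg (ev_rr_nonneg z) _)) (abs_fst_le_one hz)
    have hy : |ev (dy (1 - rr ^ n)) z| ≤ 2 * n * ev rr z ^ (n - 1) := by
      have : ev (dy (1 - rr ^ n)) z = -(2 * n * ev rr z ^ (n - 1) * z.2) := by
        simp [rr]; ring
      rw [this, abs_neg, abs_mul, abs_of_nonneg (mul_nonneg (by positivity)
        (pow_nonneg (ev_rr_nonneg z) _))]
      exact mul_le_of_le_one_right (mul_nonneg (by positivity)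
        (pow_nonneg (ev_rr_nonneg z) _)) (abs_snd_le_one hz)
    have aux : ∀ d e : ℝ, |e| ≤ 2 * n * ev rr z ^ (n - 1) →
        |b ^ 2 * d + 2 * b * e * ev p z| ≤ |d| + 4 * n * (ev rr z ^ (n - 1) * |ev p z|) := by
      intro d e he
      refine (abs_add_le _ _).trans (add_le_add ?_ ?_)
      · rw [abs_mul, abs_of_nonneg (sq_nonneg b)]
        exact mul_le_of_le_one_left (abs_nonneg _) (pow_le_one₀ h0 h1)
      · rw [abs_mul, abs_mul, abs_of_nonneg (show 0 ≤ 2 * b by linarith)]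
        calc 2 * b * |e| * |ev p z| ≤ 2 * 1 * (2 * n * ev rr z ^ (n - 1)) * |ev p z| := by gcongr
          _ = _ := by ring
    have e3 : |ev (rr ^ (n - 1) * p) z| = ev rr z ^ (n - 1) * |ev p z| := by
      rw [ev_mul, ev_pow, abs_mul, abs_of_nonneg (pow_nonneg (ev_rr_nonneg z) _)]
    rw [e3]
    have h1 := aux (ev (dx p) z) _ hx
    have h2 := aux (ev (dy p) z) _ hy
    linarith
  · rw [indicator_of_notMem hz, max_eq_left (ev_one_sub_rr_pow_nonpos hz)]
    simp

lemma integral_norm_fderiv_cutoff_le (p : Poly) (m : ℕ) :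
    ∫ z, ‖fderiv ℝ (cutoff (m + 2) p) z‖ ≤ 20 * sob1 p := by
  have hi1 : Integrable (fun z => |ev (dx p) z| + |ev (dy p) z|) (volume.restrict disk) :=
    (integrable_abs_ev _).add (integrable_abs_ev _)
  have hi2 : Integrable (fun z => 8 * ((m + 2 : ℕ) : ℝ) * |ev (rr ^ (m + 2 - 1) * p) z|)
      (volume.restrict disk) := (integrable_abs_ev _).const_mul _
  calc ∫ z, ‖fderiv ℝ (cutoff (m + 2) p) z‖ ≤ ∫ z, disk.indicator (fun z =>
        |ev (dx p) z| + |ev (dy p) z| + 8 * ((m + 2 : ℕ) : ℝ) * |ev (rr ^ (m + 2 - 1) * p) z|) z := by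
        refine integral_mono_of_nonneg (Eventually.of_forall fun _ => norm_nonneg _) ?_
          (Eventually.of_forall fun z => norm_fderiv_cutoff_le _ _ _)
        exact (integrable_indicator_iff measurableSet_disk).2 (hi1.add hi2)
    _ = nrm1 (dx p) + nrm1 (dy p) + 8 * ((m + 2 : ℕ) : ℝ) * nrm1 (rr ^ (m + 1) * p) := by
        rw [integral_indicator measurableSet_disk, integral_add hi1 hi2,
          integral_add (integrable_abs_ev _) (integrable_abs_ev _), integral_const_mul]
        rfl
    _ ≤ nrm1 (dx p) + nrm1 (dy p) + 8 * nrm1 (eul p + 2 * p) := by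
        refine add_le_add le_rfl ?_
        have h := trace_bound p (n := m + 1) (by omega)
        have h0 := nrm1_nonneg (rr ^ (m + 1) * p)
        push_cast at h ⊢
        nlinarith [mul_nonneg (Nat.cast_nonneg (α := ℝ) m) h0]
    _ ≤ _ := by
        have h1 := nrm1_eul_add_le p
        have h2 : nrm1 (dx p) + nrm1 (dy p) ≤ sob1 p := by
          rw [sob1]; linarith [nrm1_nonneg p]
        linarith [sob1_nonneg p]

/-- The constant of the planar Gagliardo-Nirenberg-Sobolev inequality. -/
def gnsConst : ℝ := eLpNormLESNormFDerivOneConst (volume : Measure (ℝ × ℝ)) 2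

lemma gnsConst_nonneg : 0 ≤ gnsConst := NNReal.coe_nonneg _

lemma integral_cutoff_sq_le (n : ℕ) (p : Poly) :
    ∫ z, cutoff n p z ^ 2 ≤ (gnsConst * ∫ z, ‖fderiv ℝ (cutoff n p) z‖) ^ 2 := by
  have hc := contDiff_cutoff n p
  have hs := hasCompactSupport_cutoff n p
  have h := eLpNorm_le_eLpNorm_fderiv_one (volume : Measure (ℝ × ℝ)) hc hs (p := 2) (by
    have : Module.finrank ℝ (ℝ × ℝ) = 2 := by simp
    rw [this]
    exact NNReal.HolderConjugate.two_two)
  have hd : Integrable (fderiv ℝ (cutoff n p)) :=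
    (hc.continuous_fderiv one_ne_zero).integrable_of_hasCompactSupport (hs.fderiv (𝕜 := ℝ))
  have hm : MemLp (cutoff n p) 2 := hc.continuous.memLp_of_hasCompactSupport hs
  rw [eLpNorm_one_eq_lintegral_enorm, ← ofReal_integral_norm_eq_lintegral_enorm hd] at h
  have h2 := ENNReal.toReal_mono (by finiteness) h
  rw [ENNReal.toReal_mul, ENNReal.toReal_ofReal (integral_nonneg fun _ => norm_nonneg _)] at h2
  have h3 : (eLpNorm (cutoff n p) 2 volume).toReal ^ 2 = ∫ z, cutoff n p z ^ 2 := by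
    rw [← Lp.norm_toLp _ hm, ← real_inner_self_eq_norm_sq, L2.inner_def]
    refine integral_congr_ae ?_
    filter_upwards [hm.coeFn_toLp] with z hz
    rw [hz]; simp [sq]
  rw [← h3]
  exact pow_le_pow_left₀ ENNReal.toReal_nonneg h2 2

/-- The Gagliardo-Nirenberg inequality on the disk. -/
lemma intD_mul_self_le (p : Poly) : intD (p * p) ≤ (20 * gnsConst * sob1 p) ^ 2 := by
  have hb : ∀ m : ℕ, ∫ z in disk, cutoff (m + 2) p z ^ 2 ≤ (20 * gnsConst * sob1 p) ^ 2 := by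
    intro m
    have h1 : ∫ z in disk, cutoff (m + 2) p z ^ 2 = ∫ z, cutoff (m + 2) p z ^ 2 := by
      refine setIntegral_eq_integral_of_forall_compl_eq_zero fun z hz => ?_
      rw [cutoff_eq_zero hz]; simp
    rw [h1]
    refine (integral_cutoff_sq_le _ _).trans ?_
    have h0 : 0 ≤ ∫ z, ‖fderiv ℝ (cutoff (m + 2) p) z‖ := integral_nonneg fun _ => norm_nonneg _
    refine pow_le_pow_left₀ (mul_nonneg gnsConst_nonneg h0) ?_ 2
    calc _ ≤ gnsConst * (20 * sob1 p) :=
          mul_le_mul_of_nonneg_left (integral_norm_fderiv_cutoff_le p m) gnsConst_nonneg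
      _ = _ := by ring
  set T := nrm1 (eul (p * p) + 2 * (p * p)) with hT
  have hp : ∀ m : ℕ, intD (p * p) ≤ (20 * gnsConst * sob1 p) ^ 2 + 2 * T * (1 / ((m : ℝ) + 1)) := by
    intro m
    have h1 : intD (p * p) ≤ ∫ z in disk, (cutoff (m + 2) p z ^ 2 + 4 * |ev (rr ^ (m + 2) * (p * p)) z|) := by
      refine setIntegral_mono_on (integrable_ev _) ?_ measurableSet_disk fun z hz => ?_
      · exact integrable_disk (((contDiff_cutoff _ p).continuous.pow 2).add
          ((continuous_ev _).abs.const_mul _))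
      · obtain ⟨h0, h1⟩ := ev_one_sub_rr_pow_mem (n := m + 2) hz
        rw [cutoff, max_eq_right h0, ev_mul, ev_mul, ev_mul]
        simp only [ev_sub, ev_one] at h0 h1 ⊢
        set s := ev (rr ^ (m + 2)) z
        have hs : 0 ≤ s := by linarith
        rw [abs_of_nonneg (mul_nonneg hs (mul_self_nonneg _))]
        have : 0 ≤ (1 - s) ^ 4 - 1 + 4 * s := by nlinarith [sq_nonneg s, sq_nonneg (s * (s - 2)), mul_nonneg hs hs]
        nlinarith [mul_nonneg this (mul_self_nonneg (ev p z))]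
    rw [integral_add, integral_const_mul] at h1
    · have h2 := trace_bound (p * p) (n := m + 2) (by omega)
      have h3 : 4 * nrm1 (rr ^ (m + 2) * (p * p)) ≤ 2 * T * (1 / ((m : ℝ) + 1)) := by
        have h0 := nrm1_nonneg (rr ^ (m + 2) * (p * p))
        rw [mul_one_div, le_div_iff₀ (by positivity)]
        push_cast at h2
        nlinarith
      exact h1.trans (add_le_add (hb m) h3)
    · exact integrable_disk ((contDiff_cutoff _ p).continuous.pow 2)
    · exact (integrable_abs_ev _).const_mul _
  have hlim : Tendsto (fun m : ℕ => (20 * gnsConst * sob1 p) ^ 2 + 2 * T * (1 / ((m : ℝ) + 1))) atTop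
      (𝓝 ((20 * gnsConst * sob1 p) ^ 2 + 2 * T * 0)) :=
    (tendsto_one_div_add_atTop_nhds_zero_nat.const_mul _).const_add _
  simpa using ge_of_tendsto' hlim hp

/-- The `L¹` norm of a polynomial and its first and second derivatives. -/
def sob2 (p : Poly) : ℝ := sob1 p + sob1 (dx p) + sob1 (dy p)

/-- A Sobolev bound on a circle. -/
lemma abs_ev_circle_le (p : Poly) (r : ℝ) {t : ℝ} (ht : t ∈ Icc (-Real.pi) Real.pi) :
    |ev p (r * Real.cos t, r * Real.sin t)| ≤
      ∫ s in (-Real.pi)..Real.pi, (|ev p (r * Real.cos s, r * Real.sin s)| +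
        |ev (rot p) (r * Real.cos s, r * Real.sin s)|) := by
  set f : ℝ → ℝ := fun t => ev p (r * Real.cos t, r * Real.sin t) with hf
  set g : ℝ → ℝ := fun t => ev (rot p) (r * Real.cos t, r * Real.sin t) with hg
  have hfc : Continuous f := by fun_prop
  have hgc : Continuous g := by fun_prop
  have hpi := neg_pi_le_pi
  set G := ∫ s in (-Real.pi)..Real.pi, |g s| with hG
  have hG0 : 0 ≤ G := intervalIntegral.integral_nonneg hpi fun _ _ => abs_nonneg _
  have h1 : ∀ u ∈ Icc (-Real.pi) Real.pi, |f t| ≤ |f u| + G := by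
    intro u hu
    have e : ∫ s in u..t, g s = f t - f u :=
      intervalIntegral.integral_eq_sub_of_hasDerivAt (fun s _ => hasDerivAt_angle p r s)
        (hgc.intervalIntegrable _ _)
    have : |f t - f u| ≤ G := by
      rw [← e, hG, intervalIntegral.integral_of_le hpi]
      refine (intervalIntegral.norm_integral_le_integral_norm_uIoc (f := g)).trans ?_
      have hI : IntegrableOn (fun s => |g s|) (Icc (-Real.pi) Real.pi) volume :=
        hgc.abs.integrableOn_Icc
      exact setIntegral_mono_set (hI.mono_set Ioc_subset_Icc_self)
        (Eventually.of_forall fun _ => abs_nonneg _)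
        (LE.le.eventuallyLE (Ioc_subset_Ioc (le_min hu.1 ht.1) (max_le hu.2 ht.2)))
    have := abs_sub_abs_le_abs_sub (f t) (f u)
    linarith
  have h2 := intervalIntegral.integral_mono_on (μ := volume) hpi (f := fun _ => |f t|) (g := fun u => |f u| + G)
    (Continuous.intervalIntegrable (by fun_prop) _ _)
    (Continuous.intervalIntegrable (by fun_prop) _ _) h1
  rw [intervalIntegral.integral_const, intervalIntegral.integral_add
    (Continuous.intervalIntegrable (by fun_prop) _ _)
    (Continuous.intervalIntegrable (by fun_prop) _ _), intervalIntegral.integral_const,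
    smul_eq_mul, smul_eq_mul] at h2
  rw [intervalIntegral.integral_add (Continuous.intervalIntegrable (by fun_prop) _ _)
    (Continuous.intervalIntegrable (by fun_prop) _ _)]
  have hF0 : 0 ≤ ∫ s in (-Real.pi)..Real.pi, |f s| :=
    intervalIntegral.integral_nonneg hpi fun _ _ => abs_nonneg _
  have h3 := Real.pi_gt_three
  change |f t| ≤ (∫ s in (-Real.pi)..Real.pi, |f s|) + G
  by_contra! hlt
  nlinarith [mul_lt_mul_of_pos_left hlt (show 0 < Real.pi - -Real.pi by linarith)]

lemma rr_mul_abs_ev_le (p : Poly) {z : ℝ × ℝ} (hz : z ∈ disk) :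
    ev rr z * |ev p z| ≤ nrm1 (eul p + 2 * p) + nrm1 (rot (eul p + 2 * p)) := by
  obtain ⟨r, t, hr0, ht, rfl⟩ : ∃ r t : ℝ, 0 ≤ r ∧ t ∈ Icc (-Real.pi) Real.pi ∧
      z = (r * Real.cos t, r * Real.sin t) := by
    refine ⟨‖Complex.mk z.1 z.2‖, (Complex.mk z.1 z.2).arg, norm_nonneg _,
      ⟨(Complex.neg_pi_lt_arg _).le, Complex.arg_le_pi _⟩, ?_⟩
    ext
    · simp [Complex.norm_mul_cos_arg]
    · simp [Complex.norm_mul_sin_arg]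
  have hr : ev rr (r * Real.cos t, r * Real.sin t) = r ^ 2 := by
    rw [ev_rr]
    linear_combination r ^ 2 * Real.sin_sq_add_cos_sq t
  have hr1 : r ≤ 1 := by
    rw [mem_disk_iff, hr] at hz
    nlinarith
  rw [hr]
  refine (sq_mul_abs_ev_le p t hr0 hr1).trans ?_
  set k := eul p + 2 * p
  rw [nrm1, nrm1, ← integral_add (integrable_abs_ev _) (integrable_abs_ev _),
    integral_disk_polar (by fun_prop), intervalIntegral_swap (by fun_prop) zero_le_one]
  refine intervalIntegral.integral_mono_on zero_le_one
    (Continuous.intervalIntegrable (by fun_prop) _ _)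
    (Continuous.intervalIntegrable
      (intervalIntegral.continuous_parametric_intervalIntegral_of_continuous' (by fun_prop) _ _) _ _)
    fun s hs => ?_
  rw [intervalIntegral.integral_const_mul]
  exact mul_le_mul_of_nonneg_left (abs_ev_circle_le k s ht) hs.1

lemma nrm1_bound (p : Poly) :
    nrm1 (eul p + 2 * p) + nrm1 (rot (eul p + 2 * p)) ≤ 10 * sob2 p := by
  have h1 := nrm1_eul_add_le p
  have h2 : nrm1 (rot (eul p + 2 * p)) ≤ 8 * sob2 p := by
    have e : rot (eul p + 2 * p) = eul (rot p) + 2 * rot p := by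
      simp [rot, eul]; ring
    rw [e]
    refine (nrm1_eul_add_le _).trans ?_
    have a := nrm1_rot_le p
    have b : nrm1 (dx (rot p)) ≤ nrm1 (dy p) + (nrm1 (dx (dx p)) + nrm1 (dy (dx p))) := by
      have : dx (rot p) = dy p + rot (dx p) := by simp [rot]; ring
      rw [this]
      exact (nrm1_add _ _).trans (add_le_add le_rfl (nrm1_rot_le _))
    have c : nrm1 (dy (rot p)) ≤ nrm1 (dx p) + (nrm1 (dx (dy p)) + nrm1 (dy (dy p))) := by
      have : dy (rot p) = rot (dy p) - dx p := by simp [rot]; ring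
      rw [this]
      refine (nrm1_sub _ _).trans ?_
      rw [add_comm]
      exact (add_le_add le_rfl (nrm1_rot_le _))
    simp only [sob2, sob1] at *
    have := nrm1_nonneg p
    have := nrm1_nonneg (dx p)
    have := nrm1_nonneg (dy p)
    have := nrm1_nonneg (dx (dx p))
    have := nrm1_nonneg (dy (dy p))
    have := nrm1_nonneg (dy (dx p))
    have := nrm1_nonneg (dx (dy p))
    linarith
  have h3 : sob1 p ≤ sob2 p := by
    rw [sob2]; linarith [sob1_nonneg (dx p), sob1_nonneg (dy p)]
  linarith

/-- Composition with the affine map `z ↦ (1/4, 0) + (3/4) z`. -/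
def shrink (p : Poly) : Poly := aeval ![C (1 / 4) + C (3 / 4) * xx, C (3 / 4) * yy] p

lemma ev_shrink (p : Poly) (z : ℝ × ℝ) :
    ev (shrink p) z = ev p (1 / 4 + 3 / 4 * z.1, 3 / 4 * z.2) := by
  induction p using poly_induction with
  | hC a => simp [shrink, algebraMap_eq]
  | hadd p q hp hq => simp_all [shrink]
  | hx p hp => simp_all [shrink, xx, ev]
  | hy p hp => simp_all [shrink, yy, ev]

lemma dx_shrink (p : Poly) : dx (shrink p) = C (3 / 4) * shrink (dx p) := by
  induction p using poly_induction with
  | hC a => simp [shrink, algebraMap_eq]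
  | hadd p q hp hq => simp_all [shrink, mul_add]
  | hx p hp =>
    have : ∀ q, shrink (q * xx) = shrink q * (C (1 / 4) + C (3 / 4) * xx) := fun q => by
      simp [shrink, xx]
    rw [this, dx_mul, hp, dx_mul, dx_xx, mul_one]
    rw [show shrink (dx p * xx + p) = shrink (dx p * xx) + shrink p by simp [shrink], this]
    simp; ring
  | hy p hp =>
    have : ∀ q, shrink (q * yy) = shrink q * (C (3 / 4) * yy) := fun q => by
      simp [shrink, yy]
    rw [this, dx_mul, hp, dx_mul p yy, dx_yy, mul_zero, add_zero, this]
    simp; ring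

lemma dy_shrink (p : Poly) : dy (shrink p) = C (3 / 4) * shrink (dy p) := by
  induction p using poly_induction with
  | hC a => simp [shrink, algebraMap_eq]
  | hadd p q hp hq => simp_all [shrink, mul_add]
  | hx p hp =>
    have : ∀ q, shrink (q * xx) = shrink q * (C (1 / 4) + C (3 / 4) * xx) := fun q => by
      simp [shrink, xx]
    rw [this, dy_mul, hp, dy_mul, dy_xx, mul_zero, add_zero, this]
    simp; ring
  | hy p hp =>
    have : ∀ q, shrink (q * yy) = shrink q * (C (3 / 4) * yy) := fun q => by
      simp [shrink, yy]
    rw [this, dy_mul, hp, dy_mul p yy, dy_yy, mul_one]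
    rw [show shrink (dy p * yy + p) = shrink (dy p * yy) + shrink p by simp [shrink], this]
    simp; ring

lemma nrm1_shrink_le (p : Poly) : nrm1 (shrink p) ≤ 2 * nrm1 p := by
  have h0 : ∀ z : ℝ × ℝ, 0 ≤ disk.indicator (fun z => |ev p z|) z := fun z =>
    indicator_nonneg (fun _ _ => abs_nonneg _) z
  have hi : Integrable (disk.indicator (fun z => |ev p z|)) :=
    (integrable_indicator_iff measurableSet_disk).2 (integrable_abs_ev p)
  have hi2 : Integrable fun z : ℝ × ℝ =>
      disk.indicator (fun z => |ev p z|) ((1 / 4, 0) + (3 / 4 : ℝ) • z) := by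
    have := hi.comp_add_left ((1 / 4, 0) : ℝ × ℝ)
    exact (integrable_comp_smul_iff volume _ (by norm_num : (3 / 4 : ℝ) ≠ 0)).2 this
  calc nrm1 (shrink p) ≤ ∫ z in disk,
        disk.indicator (fun z => |ev p z|) ((1 / 4, 0) + (3 / 4 : ℝ) • z) := by
        refine setIntegral_mono_on (integrable_abs_ev _) hi2.integrableOn measurableSet_disk
          fun z hz => ?_
        have hmem : ((1 / 4, 0) + (3 / 4 : ℝ) • z : ℝ × ℝ) ∈ disk := by
          have h1 := abs_le.1 (abs_fst_le_one hz)
          have hz : z.1 ^ 2 + z.2 ^ 2 ≤ 1 := hz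
          change (1 / 4 + 3 / 4 * z.1) ^ 2 + (0 + 3 / 4 * z.2) ^ 2 ≤ 1
          nlinarith
        rw [indicator_of_mem hmem, ev_shrink]
        refine le_of_eq ?_
        congr 2
        ext <;> simp
    _ ≤ ∫ z, disk.indicator (fun z => |ev p z|) ((1 / 4, 0) + (3 / 4 : ℝ) • z) :=
        setIntegral_le_integral hi2 (Eventually.of_forall fun z => h0 _)
    _ = |((3 / 4 : ℝ) ^ 2)⁻¹| * nrm1 p := by
        rw [Measure.integral_comp_smul volume
          (fun z => disk.indicator (fun z => |ev p z|) ((1 / 4, 0) + z))]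
        rw [integral_add_left_eq_self (μ := (volume : Measure (ℝ × ℝ)))
          (fun z => disk.indicator (fun z => |ev p z|) z) ((1 / 4, 0) : ℝ × ℝ),
          integral_indicator measurableSet_disk]
        simp [nrm1]
    _ ≤ _ := by
        refine mul_le_mul_of_nonneg_right ?_ (nrm1_nonneg _)
        norm_num [abs_of_pos]

lemma nrm1_C_mul (c : ℝ) (p : Poly) : nrm1 (C c * p) = |c| * nrm1 p := by
  simp [nrm1, abs_mul, integral_const_mul]

lemma sob1_shrink_le (p : Poly) : sob1 (shrink p) ≤ 2 * sob1 p := by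
  simp only [sob1, dx_shrink, dy_shrink, nrm1_C_mul]
  have h1 := nrm1_shrink_le p
  have h2 := nrm1_shrink_le (dx p)
  have h3 := nrm1_shrink_le (dy p)
  have h4 := nrm1_nonneg (shrink (dx p))
  have h5 := nrm1_nonneg (shrink (dy p))
  rw [abs_of_pos (by norm_num : (0:ℝ) < 3 / 4)]
  linarith

lemma sob1_C_mul (c : ℝ) (p : Poly) : sob1 (C c * p) = |c| * sob1 p := by
  simp [sob1, nrm1_C_mul]; ring

lemma sob2_shrink_le (p : Poly) : sob2 (shrink p) ≤ 2 * sob2 p := by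
  simp only [sob2, dx_shrink, dy_shrink, sob1_C_mul]
  have h1 := sob1_shrink_le p
  have h2 := sob1_shrink_le (dx p)
  have h3 := sob1_shrink_le (dy p)
  have h4 := sob1_nonneg (shrink (dx p))
  have h5 := sob1_nonneg (shrink (dy p))
  rw [abs_of_pos (by norm_num : (0:ℝ) < 3 / 4)]
  linarith

lemma sob2_nonneg (p : Poly) : 0 ≤ sob2 p :=
  add_nonneg (add_nonneg (sob1_nonneg _) (sob1_nonneg _)) (sob1_nonneg _)

/-- The Sobolev inequality on the disk. -/
lemma abs_ev_le_sob2 (p : Poly) {z : ℝ × ℝ} (hz : z ∈ disk) : |ev p z| ≤ 1280 * sob2 p := by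
  have hp := sob2_nonneg p
  rcases le_total (1 / 64) (ev rr z) with h | h
  · have h1 := (rr_mul_abs_ev_le p hz).trans (nrm1_bound p)
    nlinarith [mul_le_mul_of_nonneg_right h (abs_nonneg (ev p z))]
  · rw [ev_rr] at h
    have ha : |z.1| ≤ 1 / 8 := by
      refine abs_le_of_sq_le_sq ?_ (by norm_num)
      nlinarith [sq_nonneg z.2]
    set w : ℝ × ℝ := (4 / 3 * (z.1 - 1 / 4), 4 / 3 * z.2) with hw
    have hb := abs_le.1 ha
    have e : ev p z = ev (shrink p) w := by
      rw [ev_shrink]; congr 1; ext <;> simp [hw] <;> ring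
    have hwd : w ∈ disk := by
      change (4 / 3 * (z.1 - 1 / 4)) ^ 2 + (4 / 3 * z.2) ^ 2 ≤ 1
      nlinarith
    have hwr : 1 / 64 ≤ ev rr w := by
      rw [ev_rr, hw]
      change 1 / 64 ≤ (4 / 3 * (z.1 - 1 / 4)) ^ 2 + (4 / 3 * z.2) ^ 2
      nlinarith [sq_nonneg z.2]
    rw [e]
    have h1 := (rr_mul_abs_ev_le (shrink p) hwd).trans (nrm1_bound _)
    have h2 := sob2_shrink_le p
    nlinarith [mul_le_mul_of_nonneg_right hwr (abs_nonneg (ev (shrink p) w))]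

/-- The Hilbert space of square integrable functions on the disk. -/
abbrev L2D := Lp ℝ 2 ((volume : Measure (ℝ × ℝ)).restrict disk)

lemma memLp_disk {f : ℝ × ℝ → ℝ} (hf : Continuous f) :
    MemLp f 2 ((volume : Measure (ℝ × ℝ)).restrict disk) := by
  obtain ⟨c, hc⟩ := isCompact_disk.exists_bound_of_continuousOn hf.continuousOn
  refine MemLp.of_bound hf.aestronglyMeasurable c ?_
  filter_upwards [ae_restrict_mem measurableSet_disk] with z hz using hc z hz

/-- The class of a continuous function. -/
def emb : C(ℝ × ℝ, ℝ) →ₗ[ℝ] L2D where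
  toFun f := (memLp_disk f.continuous).toLp f
  map_add' _ _ := rfl
  map_smul' _ _ := rfl

lemma inner_emb (f g : C(ℝ × ℝ, ℝ)) : inner ℝ (emb f) (emb g) = ∫ z in disk, f z * g z := by
  rw [L2.inner_def]
  refine integral_congr_ae ?_
  filter_upwards [(memLp_disk f.continuous).coeFn_toLp, (memLp_disk g.continuous).coeFn_toLp]
    with z h1 h2
  change inner ℝ ((memLp_disk f.continuous).toLp f z) ((memLp_disk g.continuous).toLp g z) = _
  rw [h1, h2]
  simp [mul_comm]

/-- The polynomial function as a continuous function. -/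
def evc : Poly →ₗ[ℝ] C(ℝ × ℝ, ℝ) where
  toFun p := ⟨ev p, continuous_ev p⟩
  map_add' p q := by ext; simp
  map_smul' c p := by ext; simp

@[simp] lemma evc_apply (p : Poly) (z : ℝ × ℝ) : evc p z = ev p z := rfl

/-- The class of a polynomial function. -/
def ι : Poly →ₗ[ℝ] L2D := emb ∘ₗ evc

lemma inner_ι (p q : Poly) : inner ℝ (ι p) (ι q) = intD (p * q) := by
  simp [ι, inner_emb, intD]

lemma inner_emb_ι (f : C(ℝ × ℝ, ℝ)) (q : Poly) :
    inner ℝ (emb f) (ι q) = ∫ z in disk, f z * ev q z := by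
  simp [ι, inner_emb]

/-- The `L²` norm of a polynomial. -/
def nrm (p : Poly) : ℝ := ‖ι p‖

lemma nrm_sq (p : Poly) : nrm p ^ 2 = intD (p * p) := by
  rw [nrm, ← real_inner_self_eq_norm_sq, inner_ι]

lemma nrm_nonneg (p : Poly) : 0 ≤ nrm p := norm_nonneg _

lemma nrm_add (p q : Poly) : nrm (p + q) ≤ nrm p + nrm q := by
  simpa [nrm] using norm_add_le (ι p) (ι q)

lemma nrm_sub (p q : Poly) : nrm (p - q) ≤ nrm p + nrm q := by
  simpa [nrm] using norm_sub_le (ι p) (ι q)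

@[simp] lemma nrm_neg (p : Poly) : nrm (-p) = nrm p := by simp [nrm]

lemma nrm_smul (c : ℝ) (p : Poly) : nrm (c • p) = |c| * nrm p := by simp [nrm, norm_smul]

@[simp] lemma nrm_zero : nrm 0 = 0 := by simp [nrm]

lemma intD_mul_le (p q : Poly) : intD (p * q) ≤ nrm p * nrm q := by
  rw [← inner_ι]; exact real_inner_le_norm _ _

lemma abs_intD_mul_le (p q : Poly) : |intD (p * q)| ≤ nrm p * nrm q := by
  rw [← inner_ι]; exact abs_real_inner_le_norm _ _

lemma nrm1_mul_le_nrm (p q : Poly) : nrm1 (p * q) ≤ nrm p * nrm q := by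
  have key : ∀ p : Poly, ‖emb ⟨fun z => |ev p z|, (continuous_ev p).abs⟩‖ = nrm p := fun p => by
    rw [← sq_eq_sq₀ (norm_nonneg _) (nrm_nonneg _), nrm_sq, ← real_inner_self_eq_norm_sq, inner_emb]
    simp [intD]
  have := real_inner_le_norm (emb ⟨fun z => |ev p z|, (continuous_ev p).abs⟩)
    (emb ⟨fun z => |ev q z|, (continuous_ev q).abs⟩)
  rw [key, key, inner_emb] at this
  simpa [nrm1, abs_mul] using this

lemma nrm_le_of_abs_le {p q : Poly} {c : ℝ} (h : ∀ z ∈ disk, |ev p z| ≤ c) :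
    nrm (p * q) ≤ c * nrm q := by
  have h0 : 0 ≤ c := (abs_nonneg _).trans (h 0 (by simp [disk]))
  refine abs_le_of_sq_le_sq' ?_ (mul_nonneg h0 (nrm_nonneg q)) |>.2
  rw [mul_pow, nrm_sq, nrm_sq, intD, intD, ← integral_const_mul]
  refine setIntegral_mono_on (integrable_ev _) ((integrable_ev _).const_mul _) measurableSet_disk
    fun z hz => ?_
  have := pow_le_pow_left₀ (abs_nonneg _) (h z hz) 2
  rw [sq_abs] at this
  simp only [ev_mul]
  nlinarith [mul_le_mul_of_nonneg_right this (sq_nonneg (ev q z))]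

lemma convex_disk : Convex ℝ disk := by
  intro a ha b hb s t hs ht hst
  change (s * a.1 + t * b.1) ^ 2 + (s * a.2 + t * b.2) ^ 2 ≤ 1
  have ha : a.1 ^ 2 + a.2 ^ 2 ≤ 1 := ha
  have hb : b.1 ^ 2 + b.2 ^ 2 ≤ 1 := hb
  obtain rfl : t = 1 - s := by linarith
  nlinarith [mul_nonneg hs ht, mul_nonneg (mul_nonneg hs ht) (sq_nonneg (a.1 - b.1)),
    mul_nonneg (mul_nonneg hs ht) (sq_nonneg (a.2 - b.2)), mul_le_mul_of_nonneg_left ha hs,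
    mul_le_mul_of_nonneg_left hb ht]

lemma disk_subset_closure_interior : disk ⊆ closure (interior disk) := by
  rw [convex_disk.closure_interior_eq_closure_of_nonempty_interior]
  · exact subset_closure
  · refine ⟨0, mem_interior.2 ⟨{z | z.1 ^ 2 + z.2 ^ 2 < 1}, fun z hz => ?_, ?_, by simp⟩⟩
    · exact le_of_lt (show z.1 ^ 2 + z.2 ^ 2 < 1 from hz)
    · exact isOpen_lt (by fun_prop) continuous_const

lemma eqOn_zero_of_setIntegral_sq {f : ℝ × ℝ → ℝ} (hf : ContinuousOn f disk)
    (h : ∫ z in disk, f z * f z = 0) : EqOn f 0 disk := by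
  refine Measure.eqOn_of_ae_eq (μ := volume) ?_ hf continuousOn_const disk_subset_closure_interior
  rw [integral_eq_zero_iff_of_nonneg (fun _ => mul_self_nonneg _)] at h
  · filter_upwards [h] with z hz using mul_self_eq_zero.1 hz
  · exact (hf.mul hf).integrableOn_compact isCompact_disk

lemma ev_eq_zero_of_disk {p : Poly} (h : ∀ z ∈ disk, ev p z = 0) : p = 0 := by
  refine MvPolynomial.funext_set (fun _ => Icc 0 (1 / 2 : ℝ))
    (fun _ => Icc_infinite (by norm_num)) fun x hx => ?_
  have h0 := hx 0 (mem_univ _)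
  have h1 := hx 1 (mem_univ _)
  have := h (x 0, x 1) (show x 0 ^ 2 + x 1 ^ 2 ≤ 1 by nlinarith [h0.1, h0.2, h1.1, h1.2])
  rw [ev] at this
  rw [map_zero, ← this]
  congr 2
  ext i; fin_cases i <;> rfl

lemma nrm_eq_zero {p : Poly} (h : nrm p = 0) : p = 0 := by
  refine ev_eq_zero_of_disk (eqOn_zero_of_setIntegral_sq (continuous_ev p).continuousOn ?_)
  have := nrm_sq p
  rw [h] at this
  simpa [intD] using this.symm

/-- Sobolev norms. -/
def N : ℕ → Poly → ℝ
  | 0, p => nrm p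
  | k + 1, p => N k p + N k (dx p) + N k (dy p)

@[simp] lemma N_zero' (p : Poly) : N 0 p = nrm p := rfl

lemma N_succ (k : ℕ) (p : Poly) : N (k + 1) p = N k p + N k (dx p) + N k (dy p) := rfl

lemma N_nonneg (k : ℕ) (p : Poly) : 0 ≤ N k p := by
  induction k generalizing p with
  | zero => exact nrm_nonneg p
  | succ k ih => exact add_nonneg (add_nonneg (ih _) (ih _)) (ih _)

lemma N_add (k : ℕ) (p q : Poly) : N k (p + q) ≤ N k p + N k q := by
  induction k generalizing p q with
  | zero => exact nrm_add p q
  | succ k ih => simp only [N_succ, dx_add, dy_add]; linarith [ih p q, ih (dx p) (dx q), ih (dy p) (dy q)]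

lemma N_smul (k : ℕ) (c : ℝ) (p : Poly) : N k (c • p) = |c| * N k p := by
  induction k generalizing p with
  | zero => exact nrm_smul c p
  | succ k ih => simp only [N_succ, dx_smul, dy_smul, ih]; ring

@[simp] lemma N_neg (k : ℕ) (p : Poly) : N k (-p) = N k p := by
  rw [← neg_one_smul ℝ p, N_smul]; simp

lemma N_sub (k : ℕ) (p q : Poly) : N k (p - q) ≤ N k p + N k q := by
  rw [sub_eq_add_neg, ← N_neg k q]; exact N_add _ _ _

lemma N_sub_comm (k : ℕ) (p q : Poly) : N k (p - q) = N k (q - p) := by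
  rw [← N_neg, neg_sub]

@[simp] lemma N_zero (k : ℕ) : N k 0 = 0 := by
  rw [← zero_smul ℝ (0 : Poly), N_smul]; simp

lemma N_le_succ (k : ℕ) (p : Poly) : N k p ≤ N (k + 1) p := by
  rw [N_succ]; linarith [N_nonneg k (dx p), N_nonneg k (dy p)]

lemma N_mono {k l : ℕ} (h : k ≤ l) (p : Poly) : N k p ≤ N l p :=
  monotone_nat_of_le_succ (f := fun k => N k p) (fun k => N_le_succ k p) h

lemma N_dx (k : ℕ) (p : Poly) : N k (dx p) ≤ N (k + 1) p := by
  rw [N_succ]; linarith [N_nonneg k p, N_nonneg k (dy p)]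

lemma N_dy (k : ℕ) (p : Poly) : N k (dy p) ≤ N (k + 1) p := by
  rw [N_succ]; linarith [N_nonneg k p, N_nonneg k (dx p)]

lemma nrm_le_N (k : ℕ) (p : Poly) : nrm p ≤ N k p := N_mono (Nat.zero_le k) p

/-- The constant of the Gagliardo–Nirenberg inequality on the disk. -/
def cG : ℝ := 20 * gnsConst

lemma cG_nonneg : 0 ≤ cG := mul_nonneg (by norm_num) gnsConst_nonneg

lemma nrm_le_sob1 (p : Poly) : nrm p ≤ cG * sob1 p := by
  refine abs_le_of_sq_le_sq' ?_ (mul_nonneg cG_nonneg (sob1_nonneg p)) |>.2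
  rw [nrm_sq]; exact intD_mul_self_le p

lemma N_one (p : Poly) : N 1 p = nrm p + nrm (dx p) + nrm (dy p) := rfl

lemma N_two (p : Poly) : N 2 p = N 1 p + N 1 (dx p) + N 1 (dy p) := rfl

lemma sob1_mul_le (p q : Poly) : sob1 (p * q) ≤ N 1 p * N 1 q := by
  have h0 := nrm1_mul_le_nrm p q
  have h1 := (nrm1_add (dx p * q) (p * dx q)).trans
    (add_le_add (nrm1_mul_le_nrm _ _) (nrm1_mul_le_nrm _ _))
  have h2 := (nrm1_add (dy p * q) (p * dy q)).trans
    (add_le_add (nrm1_mul_le_nrm _ _) (nrm1_mul_le_nrm _ _))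
  have a0 := nrm_nonneg p
  have a1 := nrm_nonneg (dx p)
  have a2 := nrm_nonneg (dy p)
  have b0 := nrm_nonneg q
  have b1 := nrm_nonneg (dx q)
  have b2 := nrm_nonneg (dy q)
  rw [sob1, dx_mul, dy_mul, N_one, N_one]
  nlinarith [mul_nonneg a1 b1, mul_nonneg a1 b2, mul_nonneg a2 b1, mul_nonneg a2 b2]

/-- The product of two functions in `H¹` is in `L²`. -/
lemma nrm_mul_le (p q : Poly) : nrm (p * q) ≤ cG * (N 1 p * N 1 q) :=
  (nrm_le_sob1 _).trans (mul_le_mul_of_nonneg_left (sob1_mul_le p q) cG_nonneg)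

lemma nrm_mul_self_le (p : Poly) : nrm (p * p) ≤ 2 * cG * (nrm p * N 1 p) := by
  have h0 := nrm1_mul_le_nrm p p
  have h1 := (nrm1_add (dx p * p) (p * dx p)).trans
    (add_le_add (nrm1_mul_le_nrm _ _) (nrm1_mul_le_nrm _ _))
  have h2 := (nrm1_add (dy p * p) (p * dy p)).trans
    (add_le_add (nrm1_mul_le_nrm _ _) (nrm1_mul_le_nrm _ _))
  have a0 := nrm_nonneg p
  have : sob1 (p * p) ≤ 2 * (nrm p * N 1 p) := by
    rw [sob1, dx_mul, dy_mul, N_one]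
    nlinarith [mul_nonneg a0 a0]
  calc _ ≤ _ := nrm_le_sob1 _
    _ ≤ cG * (2 * (nrm p * N 1 p)) := mul_le_mul_of_nonneg_left this cG_nonneg
    _ = _ := by ring

lemma nrm_mul_sq_le (p q : Poly) : nrm (p * q) ^ 2 ≤ nrm (p * p) * nrm (q * q) := by
  rw [nrm_sq]
  convert intD_mul_le (p * p) (q * q) using 2
  ring

/-- The product of three functions in `H¹` is in `L²`. -/
lemma nrm_mul_mul_le (p q r : Poly) :
    nrm (p * q * r) ≤ 7 * cG ^ 2 * (N 1 p * N 1 q * N 1 r) := by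
  have hm : ∀ a b c : Poly, nrm1 (a * b * c) ≤ cG * (nrm a * (N 1 b * N 1 c)) := fun a b c => by
    rw [mul_assoc]
    refine (nrm1_mul_le_nrm _ _).trans ?_
    calc _ ≤ nrm a * (cG * (N 1 b * N 1 c)) :=
          mul_le_mul_of_nonneg_left (nrm_mul_le _ _) (nrm_nonneg _)
      _ = _ := by ring
  set Q := cG * (N 1 p * N 1 q * N 1 r) with hQ
  have key : ∀ {a a' b c x : Poly}, nrm a ≤ N 1 a' → N 1 a' * (N 1 b * N 1 c) =
      N 1 p * N 1 q * N 1 r → x = a * b * c → nrm1 x ≤ Q := by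
    rintro a a' b c x h e rfl
    refine (hm a b c).trans ?_
    rw [hQ, ← e]
    exact mul_le_mul_of_nonneg_left (mul_le_mul_of_nonneg_right h
      (mul_nonneg (N_nonneg _ _) (N_nonneg _ _))) cG_nonneg
  have h0 : nrm1 (p * q * r) ≤ Q := key (nrm_le_N 1 p) (by ring) rfl
  have hd : ∀ d : Poly → Poly, (∀ a b, d (a * b) = d a * b + a * d b) →
      (∀ a, nrm (d a) ≤ N 1 a) → nrm1 (d (p * q * r)) ≤ 3 * Q := by
    intro d hd hn
    have e : d (p * q * r) = d p * q * r + d q * p * r + d r * p * q := by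
      rw [hd, hd]; ring
    rw [e]
    have := (nrm1_add (d p * q * r + d q * p * r) (d r * p * q)).trans
      (add_le_add_left (nrm1_add _ _) _)
    have h1 : nrm1 (d p * q * r) ≤ Q := key (hn p) (by ring) rfl
    have h2 : nrm1 (d q * p * r) ≤ Q := key (hn q) (by ring) rfl
    have h3 : nrm1 (d r * p * q) ≤ Q := key (hn r) (by ring) rfl
    linarith
  have h1 := hd dx dx_mul fun a => N_dx 0 a
  have h2 := hd dy dy_mul fun a => N_dy 0 a
  calc _ ≤ _ := nrm_le_sob1 _
    _ ≤ cG * (7 * Q) := mul_le_mul_of_nonneg_left (by rw [sob1]; linarith) cG_nonneg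
    _ = _ := by rw [hQ]; ring

lemma nrm1_le_nrm (p : Poly) : nrm1 p ≤ nrm 1 * nrm p := by
  simpa using nrm1_mul_le_nrm 1 p

/-- The constant of the Sobolev embedding into continuous functions. -/
def cS : ℝ := 1280 * nrm 1

lemma cS_nonneg : 0 ≤ cS := mul_nonneg (by norm_num) (nrm_nonneg _)

lemma abs_ev_le_N (p : Poly) {z : ℝ × ℝ} (hz : z ∈ disk) : |ev p z| ≤ cS * N 2 p := by
  have h1 : ∀ p, sob1 p ≤ nrm 1 * N 1 p := fun p => by
    rw [sob1, N_one]
    linarith [nrm1_le_nrm p, nrm1_le_nrm (dx p), nrm1_le_nrm (dy p)]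
  have h2 : sob2 p ≤ nrm 1 * N 2 p := by
    rw [sob2, N_two]
    linarith [h1 p, h1 (dx p), h1 (dy p)]
  rw [cS, mul_assoc]
  exact (abs_ev_le_sob2 p hz).trans (mul_le_mul_of_nonneg_left h2 (by norm_num))

lemma nrm_mul_le_sup (p q : Poly) : nrm (p * q) ≤ cS * N 2 p * nrm q :=
  nrm_le_of_abs_le fun _ hz => abs_ev_le_N p hz

/-- The product of a function in `H^{k+1}` and a function in `H^k` is in `H^k`, for `k ≥ 1`. -/
lemma N_mul_le (k : ℕ) : ∃ C, 0 ≤ C ∧ ∀ p q, N (k + 1) (p * q) ≤ C * (N (k + 2) p * N (k + 1) q) := by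
  induction k with
  | zero =>
    refine ⟨3 * cS + 2 * cG, by linarith [cS_nonneg, cG_nonneg], fun p q => ?_⟩
    have key : ∀ d : Poly → Poly, (∀ a b, d (a * b) = d a * b + a * d b) →
        (∀ a, nrm (d a) ≤ N 1 a) → (∀ a, N 1 (d a) ≤ N 2 a) →
        nrm (d (p * q)) ≤ (cS + cG) * (N 2 p * N 1 q) := by
      intro d hd h1 h2
      rw [hd]
      have a1 := nrm_mul_le (d p) q
      have a2 := nrm_mul_le_sup p (d q)
      have a3 : cG * (N 1 (d p) * N 1 q) ≤ cG * (N 2 p * N 1 q) :=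
        mul_le_mul_of_nonneg_left (mul_le_mul_of_nonneg_right (h2 p) (N_nonneg _ _)) cG_nonneg
      have a4 : cS * N 2 p * nrm (d q) ≤ cS * N 2 p * N 1 q :=
        mul_le_mul_of_nonneg_left (h1 q) (mul_nonneg cS_nonneg (N_nonneg _ _))
      linarith [nrm_add (d p * q) (p * d q)]
    have h1 := key dx dx_mul (fun a => N_dx 0 a) fun a => N_dx 1 a
    have h2 := key dy dy_mul (fun a => N_dy 0 a) fun a => N_dy 1 a
    have h3 := nrm_mul_le_sup p q
    have h4 : cS * N 2 p * nrm q ≤ cS * N 2 p * N 1 q :=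
      mul_le_mul_of_nonneg_left (nrm_le_N 1 q) (mul_nonneg cS_nonneg (N_nonneg _ _))
    rw [zero_add, N_one]
    linarith
  | succ k ih =>
    obtain ⟨C, hC, h⟩ := ih
    refine ⟨5 * C, by linarith, fun p q => ?_⟩
    have key : ∀ a b, N (k + 2) a ≤ N (k + 3) p → N (k + 1) b ≤ N (k + 2) q →
        N (k + 1) (a * b) ≤ C * (N (k + 3) p * N (k + 2) q) := fun a b h1 h2 =>
      (h a b).trans (mul_le_mul_of_nonneg_left
        (mul_le_mul h1 h2 (N_nonneg _ _) (N_nonneg _ _)) hC)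
    have h0 := key p q (N_le_succ _ _) (N_le_succ _ _)
    have h1 := key (dx p) q (N_dx _ _) (N_le_succ _ _)
    have h2 := key p (dx q) (N_le_succ _ _) (N_dx _ _)
    have h3 := key (dy p) q (N_dy _ _) (N_le_succ _ _)
    have h4 := key p (dy q) (N_le_succ _ _) (N_dy _ _)
    have h5 := N_add (k + 1) (dx p * q) (p * dx q)
    have h6 := N_add (k + 1) (dy p * q) (p * dy q)
    rw [N_succ (k + 1), dx_mul, dy_mul]
    linarith

/-- Domination up to a constant. -/
def Bd {α : Type*} (f g : α → ℝ) : Prop := ∃ C, 0 ≤ C ∧ ∀ x, f x ≤ C * g x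

namespace Bd

variable {α : Type*} {f g h f' : α → ℝ}

lemma of_le (h : ∀ x, f x ≤ g x) : Bd f g := ⟨1, zero_le_one, fun x => by simpa using h x⟩

lemma rfl' : Bd f f := of_le fun _ => le_rfl

lemma add (h1 : Bd f h) (h2 : Bd g h) : Bd (fun x => f x + g x) h := by
  obtain ⟨C, hC, h1⟩ := h1
  obtain ⟨D, hD, h2⟩ := h2
  exact ⟨C + D, add_nonneg hC hD, fun x => by rw [add_mul]; exact add_le_add (h1 x) (h2 x)⟩

lemma trans (h1 : Bd f g) (h2 : Bd g h) : Bd f h := by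
  obtain ⟨C, hC, h1⟩ := h1
  obtain ⟨D, hD, h2⟩ := h2
  refine ⟨C * D, mul_nonneg hC hD, fun x => (h1 x).trans ?_⟩
  rw [mul_assoc]
  exact mul_le_mul_of_nonneg_left (h2 x) hC

lemma mono (h1 : ∀ x, f' x ≤ f x) (h2 : Bd f g) : Bd f' g := (of_le h1).trans h2

lemma mono_right (h1 : Bd f g) (h2 : ∀ x, g x ≤ h x) : Bd f h := h1.trans (of_le h2)

lemma comp {β : Type*} (h : Bd f g) (u : β → α) : Bd (fun x => f (u x)) (fun x => g (u x)) := by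
  obtain ⟨C, hC, h⟩ := h
  exact ⟨C, hC, fun x => h (u x)⟩

end Bd

lemma Bd_N_add {α : Type*} {k : ℕ} {u v : α → Poly} {g : α → ℝ} (hu : Bd (fun x => N k (u x)) g)
    (hv : Bd (fun x => N k (v x)) g) : Bd (fun x => N k (u x + v x)) g :=
  (hu.add hv).mono fun _ => N_add _ _ _

lemma Bd_N_sub {α : Type*} {k : ℕ} {u v : α → Poly} {g : α → ℝ} (hu : Bd (fun x => N k (u x)) g)
    (hv : Bd (fun x => N k (v x)) g) : Bd (fun x => N k (u x - v x)) g :=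
  (hu.add hv).mono fun _ => N_sub _ _ _

/-- Multiplication by a fixed polynomial is bounded in every Sobolev norm. -/
lemma Bd_N_mul (k : ℕ) (a : Poly) : Bd (fun p => N k (a * p)) (N k) := by
  induction k generalizing a with
  | zero => exact ⟨cS * N 2 a, mul_nonneg cS_nonneg (N_nonneg _ _), nrm_mul_le_sup a⟩
  | succ k ih =>
    have h : ∀ d : Poly → Poly, (∀ a b, d (a * b) = d a * b + a * d b) →
        (∀ a, N k (d a) ≤ N (k + 1) a) → Bd (fun p => N k (d (a * p))) (N (k + 1)) := by
      intro d hd hn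
      simp only [hd]
      exact Bd_N_add ((ih _).mono_right (N_le_succ k)) (((ih a).comp d).mono_right hn)
    simp only [N_succ k (a * _)]
    exact (((ih a).mono_right (N_le_succ k)).add (h dx dx_mul (N_dx k))).add (h dy dy_mul (N_dy k))

lemma Bd_N_mul' {α : Type*} {k : ℕ} (a : Poly) {u : α → Poly} {g : α → ℝ}
    (hu : Bd (fun x => N k (u x)) g) : Bd (fun x => N k (a * u x)) g :=
  ((Bd_N_mul k a).comp u).trans hu

lemma Bd_N_eul (k : ℕ) : Bd (fun p => N k (eul p)) (N (k + 1)) :=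
  Bd_N_add (Bd_N_mul' xx (Bd.of_le (N_dx k))) (Bd_N_mul' yy (Bd.of_le (N_dy k)))

lemma Bd_N_rot (k : ℕ) : Bd (fun p => N k (rot p)) (N (k + 1)) :=
  Bd_N_sub (Bd_N_mul' xx (Bd.of_le (N_dy k))) (Bd_N_mul' yy (Bd.of_le (N_dx k)))

lemma Bd_N_lap (k : ℕ) : Bd (fun p => N k (lap p)) (N (k + 2)) :=
  Bd_N_add (Bd.of_le fun _ => (N_dx k _).trans (N_dx (k + 1) _))
    (Bd.of_le fun _ => (N_dy k _).trans (N_dy (k + 1) _))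

/-- Polynomials vanishing on the unit circle. -/
def IsDir (u : Poly) : Prop := ∃ q, u = bd * q

/-- Polynomials whose normal derivative vanishes on the unit circle. -/
def IsNeu (u : Poly) : Prop := IsDir (eul u)

lemma rot_bd_mul (q : Poly) : rot (bd * q) = bd * rot q := by
  simp [rot, bd, rr]; ring

lemma rot_eul (u : Poly) : rot (eul u) = eul (rot u) := by
  simp [rot, eul]; ring

lemma lap_rot (u : Poly) : lap (rot u) = rot (lap u) := by
  simp [rot, lap]; ring

lemma IsDir.rot {u : Poly} (h : IsDir u) : IsDir (rot u) := by
  obtain ⟨q, rfl⟩ := h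
  exact ⟨_, rot_bd_mul q⟩

lemma IsNeu.rot {u : Poly} (h : IsNeu u) : IsNeu (DiskGL.rot u) := by
  rw [IsNeu, ← rot_eul]; exact IsDir.rot h

lemma isDir_bd_mul (q : Poly) : IsDir (bd * q) := ⟨q, rfl⟩

lemma IsDir.sub {u v : Poly} (hu : IsDir u) (hv : IsDir v) : IsDir (u - v) := by
  obtain ⟨p, rfl⟩ := hu
  obtain ⟨q, rfl⟩ := hv
  exact ⟨p - q, by ring⟩

lemma IsNeu.sub {u v : Poly} (hu : IsNeu u) (hv : IsNeu v) : IsNeu (u - v) := by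
  have : eul (u - v) = eul u - eul v := by simp [eul]; ring
  rw [IsNeu, this]
  exact IsDir.sub hu hv

lemma circ_sub_bd (p q : Poly) : circ (p + bd * q) = circ p := by
  rw [circ_add, circ_mul_bd, add_zero]

lemma circ_mul_self_nonneg (p : Poly) : 0 ≤ circ (p * p) :=
  intervalIntegral.integral_nonneg neg_pi_le_pi fun _ _ => by rw [ev_mul]; exact mul_self_nonneg _

/-- The integrated Bochner identity. -/
lemma intD_hessian (u : Poly) :
    intD (dx (dx u) * dx (dx u)) + 2 * intD (dx (dy u) * dx (dy u)) + intD (dy (dy u) * dy (dy u)) +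
      circ (dx u * rot (dy u) - dy u * rot (dx u)) = intD (lap u * lap u) := by
  have e : dx u * rot (dy u) - dy u * rot (dx u) =
      xx * (dx u * dy (dy u) - dy u * dx (dy u)) + yy * (dy u * dx (dx u) - dx u * dx (dy u)) := by
    simp [rot]; ring
  rw [e, circ_add, ← intD_dx, ← intD_dy, ← intD_ofNat_mul, ← intD_add, ← intD_add, ← intD_add,
    ← intD_add]
  congr 1
  simp [lap]; ring

lemma intD_hessian_le {u a b s t : Poly} (hx : dx u = a + bd * s) (hy : dy u = b + bd * t)
    (h : 0 ≤ circ (a * rot b - b * rot a)) :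
    intD (dx (dx u) * dx (dx u)) + 2 * intD (dx (dy u) * dx (dy u)) + intD (dy (dy u) * dy (dy u))
      ≤ intD (lap u * lap u) := by
  have e : dx u * rot (dy u) - dy u * rot (dx u) = (a * rot b - b * rot a) +
      bd * (a * rot t + s * rot (dy u) - b * rot s - t * rot (dx u)) := by
    have h1 : rot (dy u) = rot b + bd * rot t := by
      rw [hy, ← rot_bd_mul]; simp [rot]; ring
    have h2 : rot (dx u) = rot a + bd * rot s := by
      rw [hx, ← rot_bd_mul]; simp [rot]; ring
    linear_combination (rot (dy u)) * hx - rot (dx u) * hy + a * h1 - b * h2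
  rw [← intD_hessian, e, circ_sub_bd]
  linarith

lemma circ_grad_nonneg (c : Poly) : 0 ≤ circ (xx * c * rot (yy * c) - yy * c * rot (xx * c)) := by
  have : xx * c * rot (yy * c) - yy * c * rot (xx * c) = rr * (c * c) := by
    simp [rot, rr]; ring
  rw [this, circ_mul_rr]
  exact circ_mul_self_nonneg c

lemma IsDir.intD_hessian_le {u : Poly} (h : IsDir u) :
    intD (dx (dx u) * dx (dx u)) + 2 * intD (dx (dy u) * dx (dy u)) + intD (dy (dy u) * dy (dy u))
      ≤ intD (lap u * lap u) := by
  obtain ⟨q, rfl⟩ := h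
  refine DiskGL.intD_hessian_le (a := xx * (-2 * q)) (b := yy * (-2 * q)) (s := dx q) (t := dy q)
    ?_ ?_ (circ_grad_nonneg _)
  · simp [bd, rr]; ring
  · simp [bd, rr]; ring

lemma IsNeu.intD_hessian_le {u : Poly} (h : IsNeu u) :
    intD (dx (dx u) * dx (dx u)) + 2 * intD (dx (dy u) * dx (dy u)) + intD (dy (dy u) * dy (dy u))
      ≤ intD (lap u * lap u) := by
  obtain ⟨q, h⟩ := h
  refine DiskGL.intD_hessian_le (a := -(yy * DiskGL.rot u)) (b := xx * DiskGL.rot u)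
    (s := xx * q + dx u) (t := yy * q + dy u) ?_ ?_ ?_
  · rw [mul_add, ← mul_assoc, mul_comm bd, mul_assoc, ← h]
    simp [eul, DiskGL.rot, bd, rr]; ring
  · rw [mul_add, ← mul_assoc, mul_comm bd, mul_assoc, ← h]
    simp [eul, DiskGL.rot, bd, rr]; ring
  · convert circ_grad_nonneg (DiskGL.rot u) using 2
    simp [DiskGL.rot]; ring

lemma N_two_le {u : Poly} (h : intD (dx (dx u) * dx (dx u)) + 2 * intD (dx (dy u) * dx (dy u)) +
    intD (dy (dy u) * dy (dy u)) ≤ intD (lap u * lap u)) :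
    N 2 u ≤ 4 * (nrm (lap u) + N 1 u) := by
  simp only [← nrm_sq] at h
  have h1 : nrm (dx (dx u)) ≤ nrm (lap u) := abs_le_of_sq_le_sq' (by
    nlinarith [sq_nonneg (nrm (dx (dy u))), sq_nonneg (nrm (dy (dy u)))]) (nrm_nonneg _) |>.2
  have h2 : nrm (dx (dy u)) ≤ nrm (lap u) := abs_le_of_sq_le_sq' (by
    nlinarith [sq_nonneg (nrm (dx (dx u))), sq_nonneg (nrm (dx (dy u))),
      sq_nonneg (nrm (dy (dy u)))]) (nrm_nonneg _) |>.2
  have h3 : nrm (dy (dy u)) ≤ nrm (lap u) := abs_le_of_sq_le_sq' (by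
    nlinarith [sq_nonneg (nrm (dx (dy u))), sq_nonneg (nrm (dx (dx u)))]) (nrm_nonneg _) |>.2
  rw [N_two, N_one, N_one, N_one, dy_dx]
  linarith [nrm_nonneg u, nrm_nonneg (dx u), nrm_nonneg (dy u)]

/-- The elliptic estimate of order `k` under a boundary condition. -/
def EllEst (B : Poly → Prop) (k : ℕ) : Prop :=
  Bd (fun u : {u // B u} => N (k + 2) u) (fun u => N k (lap u) + N 1 u)

lemma dx_eul (u : Poly) : dx (eul u) = xx * (rr * lap u - rot (rot u)) - yy * eul (rot u) +
    (eul (bd * dx u) + 2 * (rr * dx u) + bd * dx u) := by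
  simp [eul, rot, lap, rr, bd]; ring

lemma dy_eul (u : Poly) : dy (eul u) = yy * (rr * lap u - rot (rot u)) + xx * eul (rot u) +
    (eul (bd * dy u) + 2 * (rr * dy u) + bd * dy u) := by
  simp [eul, rot, lap, rr, bd]; ring

lemma lap_bd_mul (w : Poly) : lap (bd * w) = bd * lap w - 4 * eul w - 4 * w := by
  simp [eul, lap, rr, bd]; ring

lemma EllEst.succ {B : Poly → Prop} {k : ℕ} (hrot : ∀ u, B u → B (rot u)) (hD : EllEst IsDir k)
    (hB : EllEst B k) : EllEst B (k + 1) := by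
  rw [EllEst] at *
  set g : {u // B u} → ℝ := fun u => N (k + 1) (lap u) + N 1 u with hg
  have E0 : Bd (fun u : {u // B u} => N (k + 2) u) g :=
    hB.mono_right fun u => by simpa [hg] using N_le_succ k (lap u.1)
  have hl : Bd (fun u : {u // B u} => N (k + 1) (lap u)) g :=
    Bd.of_le fun u => by simpa [hg] using N_nonneg 1 u.1
  have E2' : ∀ {j}, j ≤ k + 2 → Bd (fun u : {u // B u} => N j u) g := fun hj =>
    E0.mono fun u => N_mono hj _
  have E1 : Bd (fun u : {u // B u} => N (k + 2) (rot u)) g := by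
    refine (hB.comp fun u : {u // B u} => ⟨rot u, hrot u u.2⟩).trans ?_
    simp only [lap_rot]
    exact (((Bd_N_rot k).comp fun u : {u // B u} => lap u).trans hl).add
      (((Bd_N_rot 1).comp fun u : {u // B u} => (u : Poly)).trans (E2' (by omega)))
  have E2 : ∀ d : Poly → Poly, (∀ u, lap (d u) = d (lap u)) → (∀ j u, N j (d u) ≤ N (j + 1) u) →
      Bd (fun u : {u // B u} => N (k + 2) (bd * d u)) g := by
    intro d hd hn
    refine (hD.comp fun u : {u // B u} => ⟨bd * d u, isDir_bd_mul _⟩).trans ?_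
    simp only [lap_bd_mul, hd]
    have h1 : Bd (fun u : {u // B u} => N (k + 1) (d u)) g := E0.mono fun u => hn _ _
    refine ((Bd_N_sub (Bd_N_sub (Bd_N_mul' _ (hl.mono fun u => hn k _))
      (Bd_N_mul' _ (((Bd_N_eul k).comp fun u : {u // B u} => d u).trans h1)))
      (Bd_N_mul' _ (h1.mono fun u => N_le_succ k _)))).add
      (Bd_N_mul' _ ((E2' (j := 2) (by omega)).mono fun u => hn _ _))
  have hdx := E2 dx (by intro u; simp [lap]) N_dx
  have hdy := E2 dy (by intro u; simp [lap]) N_dy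
  have A1 : Bd (fun u : {u // B u} => N (k + 1) (rr * lap u - rot (rot u))) g :=
    Bd_N_sub (Bd_N_mul' _ hl) (((Bd_N_rot (k + 1)).comp fun u : {u // B u} => rot u).trans E1)
  have A2 : Bd (fun u : {u // B u} => N (k + 1) (eul (rot u))) g :=
    ((Bd_N_eul (k + 1)).comp fun u : {u // B u} => rot u).trans E1
  have A3 : ∀ d : Poly → Poly, Bd (fun u : {u // B u} => N (k + 2) (bd * d u)) g →
      (∀ j u, N j (d u) ≤ N (j + 1) u) → Bd (fun u : {u // B u} => N (k + 1)
        (eul (bd * d u) + 2 * (rr * d u) + bd * d u)) g := by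
    intro d h hn
    exact Bd_N_add (Bd_N_add (((Bd_N_eul (k + 1)).comp fun u : {u // B u} => bd * d u).trans h)
      (Bd_N_mul' _ (Bd_N_mul' _ (E0.mono fun u => hn _ _)))) (h.mono fun u => N_le_succ _ _)
  have E3 : Bd (fun u : {u // B u} => N (k + 2) (eul u)) g := by
    simp only [N_succ (k + 1), dx_eul, dy_eul]
    refine ((((Bd_N_eul (k + 1)).comp fun u : {u // B u} => (u : Poly)).trans E0).add ?_).add ?_
    · exact Bd_N_add (Bd_N_sub (Bd_N_mul' _ A1) (Bd_N_mul' _ A2)) (A3 dx hdx N_dx)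
    · exact Bd_N_add (Bd_N_add (Bd_N_mul' _ A1) (Bd_N_mul' _ A2)) (A3 dy hdy N_dy)
  have ex : ∀ u, dx u = bd * dx u + xx * eul u - yy * rot u := fun u => by
    simp [eul, rot, rr, bd]; ring
  have ey : ∀ u, dy u = bd * dy u + yy * eul u + xx * rot u := fun u => by
    simp [eul, rot, rr, bd]; ring
  refine (E0.add ?_).add ?_
  · have := Bd_N_sub (Bd_N_add hdx (Bd_N_mul' xx E3)) (Bd_N_mul' yy E1)
    simpa only [← ex] using this
  · have := Bd_N_add (Bd_N_add hdy (Bd_N_mul' yy E3)) (Bd_N_mul' xx E1)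
    simpa only [← ey] using this

lemma ellEst_dir (k : ℕ) : EllEst IsDir k := by
  induction k with
  | zero => exact ⟨4, by norm_num, fun u => N_two_le u.2.intD_hessian_le⟩
  | succ k ih => exact EllEst.succ (fun _ h => h.rot) ih ih

lemma ellEst_neu (k : ℕ) : EllEst IsNeu k := by
  induction k with
  | zero => exact ⟨4, by norm_num, fun u => N_two_le u.2.intD_hessian_le⟩
  | succ k ih => exact EllEst.succ (fun _ h => h.rot) (ellEst_dir k) ih

/-- The polynomials all of whose monomials have degree less than `n`. -/
def Pd (n : ℕ) : Submodule ℝ Poly := restrictSupport ℝ {m | m.degree < n}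

lemma mem_Pd {n : ℕ} {p : Poly} : p ∈ Pd n ↔ ∀ m : Fin 2 →₀ ℕ, n ≤ m.degree → coeff m p = 0 := by
  change (↑p.support : Set (Fin 2 →₀ ℕ)) ⊆ _ ↔ _
  simp only [Set.subset_def, Finset.mem_coe, mem_support_iff, mem_ofPred_eq]
  refine forall_congr' fun m => ?_
  rw [not_imp_comm, not_lt]

instance (n : ℕ) : FiniteDimensional ℝ (Pd n) := by
  have : Finite {m : Fin 2 →₀ ℕ | m.degree < n} :=
    Set.Finite.subset (Finsupp.finite_of_degree_le n) fun m (hm : m.degree < n) =>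
      show m.degree ≤ n from hm.le
  exact Module.Finite.of_basis (basisRestrictSupport ℝ _)

lemma Pd_mono {m n : ℕ} (h : m ≤ n) : Pd m ≤ Pd n := fun _ hp =>
  mem_Pd.2 fun s hs => mem_Pd.1 hp s (h.trans hs)

lemma Pd_zero_eq {p : Poly} (h : p ∈ Pd 0) : p = 0 := by
  ext m; simpa using mem_Pd.1 h m (Nat.zero_le _)

lemma mem_Pd_totalDegree (p : Poly) : p ∈ Pd (p.totalDegree + 1) :=
  mem_Pd.2 fun m hm => coeff_eq_zero_of_totalDegree_lt (by
    rw [← Finsupp.degree_apply]; omega)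

lemma dx_mem_Pd {n : ℕ} {p : Poly} (h : p ∈ Pd (n + 1)) : dx p ∈ Pd n := mem_Pd.2 fun m hm => by
  rw [dx, coeff_pderiv, mem_Pd.1 h _ (by simpa using hm), zero_mul]

lemma dy_mem_Pd {n : ℕ} {p : Poly} (h : p ∈ Pd (n + 1)) : dy p ∈ Pd n := mem_Pd.2 fun m hm => by
  rw [dy, coeff_pderiv, mem_Pd.1 h _ (by simpa using hm), zero_mul]

lemma lap_mem_Pd {n : ℕ} {p : Poly} (h : p ∈ Pd (n + 1)) : lap p ∈ Pd n :=
  add_mem (dx_mem_Pd (Pd_mono n.le_succ (dx_mem_Pd h))) (dy_mem_Pd (Pd_mono n.le_succ (dy_mem_Pd h)))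

lemma coeff_eul (m : Fin 2 →₀ ℕ) (p : Poly) : coeff m (eul p) = m.degree * coeff m p := by
  induction p using MvPolynomial.induction_on' with
  | monomial u a =>
    have : eul (monomial u a) = monomial u (u.degree * a) := by
      rw [eul, xx, yy, dx, dy, X_mul_pderiv_monomial, X_mul_pderiv_monomial,
        Finsupp.degree_eq_sum, Fin.sum_univ_two, ← add_smul, ← Nat.cast_smul_eq_nsmul ℝ,
        smul_monomial, smul_eq_mul]
    rw [this, coeff_monomial, coeff_monomial]
    split_ifs with h <;> simp [h]
  | add p q hp hq =>
    have : eul (p + q) = eul p + eul q := by simp [eul]; ring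
    rw [this, coeff_add, coeff_add, hp, hq]; ring

lemma eul_mem_Pd {n : ℕ} {p : Poly} (h : p ∈ Pd n) : eul p ∈ Pd n := mem_Pd.2 fun m hm => by
  rw [coeff_eul, mem_Pd.1 h m hm, mul_zero]

lemma eul_sub_mem_Pd {n : ℕ} {p : Poly} (h : p ∈ Pd (n + 1)) : eul p - (n : ℝ) • p ∈ Pd n :=
  mem_Pd.2 fun m hm => by
    rw [coeff_sub, coeff_smul, coeff_eul, smul_eq_mul]
    rcases hm.eq_or_lt with rfl | hm
    · ring
    · rw [mem_Pd.1 h m hm]; ring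

lemma eul_add_smul_injective {k : ℝ} (hk : 0 < k) {p : Poly} (h : eul p + k • p = 0) : p = 0 := by
  ext m
  have := congrArg (coeff m) h
  rw [coeff_add, coeff_smul, coeff_eul, smul_eq_mul, ← add_mul, coeff_zero] at this
  simpa [show (m.degree : ℝ) + k ≠ 0 by positivity] using this

lemma exists_eul_eq (p : Poly) (h : coeff 0 p = 0) : ∃ q, eul q = p := by
  suffices ∀ p : Poly, ∃ q, eul q = p - C (coeff 0 p) by simpa [h] using this p
  intro p
  induction p using MvPolynomial.induction_on' with
  | monomial u a =>
    by_cases hu : u = 0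
    · exact ⟨0, by ext m; rw [coeff_eul]; simp [hu]⟩
    · refine ⟨monomial u (a / u.degree), ?_⟩
      ext m
      have : (u.degree : ℝ) ≠ 0 := by simpa [Finsupp.degree_eq_zero_iff] using hu
      rw [coeff_eul, coeff_sub, coeff_monomial, coeff_monomial]
      simp only [coeff_monomial, hu, if_false, map_zero, coeff_zero, sub_zero]
      split_ifs with h
      · subst h; field_simp
      · simp
  | add p q hp hq =>
    obtain ⟨p', hp'⟩ := hp
    obtain ⟨q', hq'⟩ := hq
    exact ⟨p' + q', by rw [show eul (p' + q') = eul p' + eul q' by simp [eul]; ring, hp', hq']; simp; ring⟩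

/-- The subspace of square integrable functions given by polynomials of degree less than `n`. -/
abbrev Wd (n : ℕ) : Submodule ℝ L2D := (Pd n).map ι

instance (n : ℕ) : FiniteDimensional ℝ (Wd n) := inferInstance

lemma exists_pr (n : ℕ) (f : L2D) : ∃ p ∈ Pd n, ι p = (Wd n).starProjection f :=
  (Wd n).starProjection_apply_mem f

/-- The orthogonal projection to the polynomials of degree less than `n`. -/
def pr (n : ℕ) (f : L2D) : Poly := (exists_pr n f).choose

lemma pr_mem (n : ℕ) (f : L2D) : pr n f ∈ Pd n := (exists_pr n f).choose_spec.1

lemma ι_pr (n : ℕ) (f : L2D) : ι (pr n f) = (Wd n).starProjection f := (exists_pr n f).choose_spec.2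

lemma inner_sub_pr {n : ℕ} (f : L2D) {q : Poly} (hq : q ∈ Pd n) :
    inner ℝ (f - ι (pr n f)) (ι q) = 0 := by
  rw [ι_pr]
  exact Submodule.starProjection_inner_eq_zero f _ ⟨q, hq, rfl⟩

lemma inner_pr {n : ℕ} (f : L2D) {q : Poly} (hq : q ∈ Pd n) :
    inner ℝ f (ι q) = intD (pr n f * q) := by
  have := inner_sub_pr f hq
  rw [inner_sub_left, inner_ι] at this
  linarith

lemma intD_sub_pr {n : ℕ} (p : Poly) {q : Poly} (hq : q ∈ Pd n) :
    intD ((p - pr n (ι p)) * q) = 0 := by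
  rw [← inner_ι, map_sub]; exact inner_sub_pr _ hq

/-- A second order operator whose eigenspaces are spanned by orthogonal polynomials. -/
def Lop (p : Poly) : Poly := lap p - eul (eul p) - 2 * eul p

lemma intD_Lop (p q : Poly) : intD (Lop p * q) =
    -(intD (bd * (dx p * dx q + dy p * dy q)) + intD (rot p * rot q)) := by
  have h1 := intD_dx (bd * (dx p * q))
  have h2 := intD_dy (bd * (dy p * q))
  have h3 := intD_rot (rot p * q)
  rw [show xx * (bd * (dx p * q)) = bd * (xx * (dx p * q)) by ring, circ_mul_bd] at h1
  rw [show yy * (bd * (dy p * q)) = bd * (yy * (dy p * q)) by ring, circ_mul_bd] at h2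
  have : Lop p * q = dx (bd * (dx p * q)) + dy (bd * (dy p * q)) + rot (rot p * q) -
      bd * (dx p * dx q + dy p * dy q) - rot p * rot q := by
    simp [Lop, lap, eul, rot, bd, rr]; ring
  rw [this]; simp only [intD_sub, intD_add, h1, h2, h3]; ring

lemma Lop_symm (p q : Poly) : intD (Lop p * q) = intD (p * Lop q) := by
  rw [mul_comm p, intD_Lop, intD_Lop, mul_comm (rot q), mul_comm (dx q), mul_comm (dy q)]

lemma Lop_sub (p q : Poly) : Lop (p - q) = Lop p - Lop q := by simp [Lop, lap, eul]; ring
lemma Lop_add (p q : Poly) : Lop (p + q) = Lop p + Lop q := by simp [Lop, lap, eul]; ring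

lemma Lop_mem_Pd {n : ℕ} {p : Poly} (h : p ∈ Pd n) : Lop p ∈ Pd n := by
  refine sub_mem (sub_mem ?_ (eul_mem_Pd (eul_mem_Pd h))) ?_
  · exact lap_mem_Pd (Pd_mono n.le_succ h)
  · rw [two_mul]; exact add_mem (eul_mem_Pd h) (eul_mem_Pd h)

/-- Orthogonality to the polynomials of degree less than `n`. -/
def Orth (n : ℕ) (p : Poly) : Prop := ∀ q ∈ Pd n, intD (p * q) = 0

lemma Lop_eq {n : ℕ} {q : Poly} (hq : q ∈ Pd (n + 1)) (ho : Orth n q) :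
    Lop q = (-(n * (n + 2)) : ℝ) • q := by
  have hs : Lop q + (n * (n + 2) : ℝ) • q ∈ Pd n := by
    have h1 := eul_sub_mem_Pd hq
    have h2 := eul_mem_Pd h1
    have : Lop q + (n * (n + 2) : ℝ) • q = lap q - (eul (eul q - (n : ℝ) • q) +
        ((n : ℝ) + 2) • (eul q - (n : ℝ) • q)) := by
      simp only [Lop, eul, smul_eq_C_mul]; simp [map_ofNat (C : ℝ →+* Poly) 2]; ring
    rw [this]
    exact sub_mem (lap_mem_Pd hq) (add_mem h2 (Submodule.smul_mem _ _ h1))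
  have h0 : nrm (Lop q + (n * (n + 2) : ℝ) • q) ^ 2 = 0 := by
    rw [nrm_sq, add_mul, intD_add, Lop_symm, ho _ (Lop_mem_Pd hs), smul_mul_assoc, intD_smul,
      ho _ hs]
    simp
  have := nrm_eq_zero (pow_eq_zero_iff (two_ne_zero) |>.1 h0)
  rw [neg_smul]; exact eq_neg_of_add_eq_zero_left this

/-- The quadratic form of `-Lop`. -/
def Dir (p : Poly) : ℝ := -intD (Lop p * p)

lemma Dir_eq (p : Poly) :
    Dir p = intD (bd * (dx p * dx p + dy p * dy p)) + intD (rot p * rot p) := by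
  rw [Dir, intD_Lop, neg_neg]

lemma Dir_split {n : ℕ} {p : Poly} (hp : p ∈ Pd (n + 1)) :
    ∃ p' ∈ Pd n, ∃ e ∈ Pd (n + 1), Orth n e ∧ p = p' + e ∧
      Dir p = Dir p' + n * (n + 2) * nrm e ^ 2 ∧ nrm p ^ 2 = nrm p' ^ 2 + nrm e ^ 2 := by
  set p' := pr n (ι p)
  have hp' : p' ∈ Pd n := pr_mem n _
  have he : p - p' ∈ Pd (n + 1) := sub_mem hp (Pd_mono n.le_succ hp')
  have ho : Orth n (p - p') := fun q hq => intD_sub_pr p hq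
  refine ⟨p', hp', p - p', he, ho, by ring, ?_, ?_⟩
  · have hL := Lop_eq he ho
    have e1 : Lop p = Lop p' + Lop (p - p') := by rw [Lop_sub]; ring
    have e2 : Lop p * p = Lop p' * p' + (p - p') * Lop p' + Lop (p - p') * p' +
        Lop (p - p') * (p - p') := by rw [e1]; ring
    rw [Dir, e2, hL]
    simp only [intD_add, smul_mul_assoc, intD_smul, ho _ hp', ho _ (Lop_mem_Pd hp'), nrm_sq, Dir]
    ring
  · have e2 : p * p = p' * p' + (p - p') * p' + (p - p') * p' + (p - p') * (p - p') := by ring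
    rw [nrm_sq, e2]
    simp only [intD_add, ho _ hp', nrm_sq]
    ring

lemma le_Dir {n : ℕ} {p : Poly} (ho : Orth n p) : n * (n + 2) * nrm p ^ 2 ≤ Dir p := by
  suffices ∀ m, ∀ p ∈ Pd m, Orth n p → n * (n + 2) * nrm p ^ 2 ≤ Dir p from
    this _ p (mem_Pd_totalDegree p) ho
  intro m
  induction m with
  | zero => rintro p hp -; rw [Pd_zero_eq hp]; simp [Dir]
  | succ m ih =>
    intro p hp ho
    by_cases hm : m + 1 ≤ n
    · have : p = 0 := nrm_eq_zero (pow_eq_zero_iff (two_ne_zero) |>.1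
        (by rw [nrm_sq]; exact ho p (Pd_mono hm hp)))
      rw [this]; simp [Dir]
    · obtain ⟨p', hp', e, -, he, rfl, h1, h2⟩ := Dir_split hp
      have := ih p' hp' fun q hq => by
        have h3 := ho q hq
        rw [add_mul, intD_add, he q (Pd_mono (by omega) hq)] at h3
        linarith
      have h5 : (n : ℝ) ≤ m := by exact_mod_cast (by omega : n ≤ m)
      have h4 : (n : ℝ) * (n + 2) ≤ m * (m + 2) := by gcongr
      rw [h1, h2]
      nlinarith [mul_le_mul_of_nonneg_right h4 (sq_nonneg (nrm e))]

lemma Dir_le {n : ℕ} {p : Poly} (hp : p ∈ Pd n) : Dir p ≤ n ^ 2 * nrm p ^ 2 := by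
  induction n generalizing p with
  | zero => rw [Pd_zero_eq hp]; simp [Dir]
  | succ n ih =>
    obtain ⟨p', hp', e, -, he, rfl, h1, h2⟩ := Dir_split hp
    rw [h1, h2]
    push_cast
    nlinarith [ih hp', sq_nonneg (nrm p'), sq_nonneg (nrm e), mul_nonneg n.cast_nonneg (sq_nonneg (nrm p'))]

lemma intD_mul_self_nonneg (p : Poly) : 0 ≤ intD (p * p) := by rw [← nrm_sq]; positivity

lemma Dir_le_grad (p : Poly) : Dir p ≤ nrm (dx p) ^ 2 + nrm (dy p) ^ 2 := by
  have : bd * (dx p * dx p + dy p * dy p) + rot p * rot p =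
    dx p * dx p + dy p * dy p - eul p * eul p := by simp [bd, rr, rot, eul]; ring
  rw [Dir_eq, ← intD_add, this, intD_sub, intD_add, nrm_sq, nrm_sq]
  linarith [intD_mul_self_nonneg (eul p)]

lemma nrm_sub_pr_le (n : ℕ) (p : Poly) :
    n * nrm (p - pr n (ι p)) ≤ nrm (dx p) + nrm (dy p) := by
  set r := p - pr n (ι p)
  have hr : Orth n r := fun q hq => intD_sub_pr p hq
  have h1 := le_Dir hr
  have h2 : Dir r ≤ Dir p := by
    have hs : Lop (pr n (ι p)) ∈ Pd n := Lop_mem_Pd (pr_mem n _)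
    have hh : Dir p = Dir r + Dir (pr n (ι p)) := by
      have e1 : p = r + pr n (ι p) := by simp [r]
      have e3 : Lop p = Lop r + Lop (pr n (ι p)) := by rw [← Lop_add, ← e1]
      have e2 : Lop p * p = Lop r * r + Lop (pr n (ι p)) * pr n (ι p) + r * Lop (pr n (ι p)) +
          Lop r * pr n (ι p) := by
        calc Lop p * p = (Lop r + Lop (pr n (ι p))) * (r + pr n (ι p)) := by rw [← e3, ← e1]
          _ = _ := by ring
      rw [Dir, e2, intD_add, intD_add, intD_add, Lop_symm r (pr n _), hr _ hs, Dir, Dir]; ring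
    have : 0 ≤ Dir (pr n (ι p)) := le_trans (by positivity) (le_Dir (n := 0) (p := pr n (ι p))
      fun q hq => by rw [Pd_zero_eq hq]; simp)
    linarith
  have h3 := Dir_le_grad p
  refine abs_le_of_sq_le_sq' ?_ (add_nonneg (nrm_nonneg _) (nrm_nonneg _)) |>.2
  nlinarith [nrm_nonneg (dx p), nrm_nonneg (dy p), mul_nonneg (nrm_nonneg (dx p)) (nrm_nonneg (dy p)),
    mul_nonneg n.cast_nonneg (sq_nonneg (nrm r))]

lemma intD_one_pos : 0 < intD 1 := by
  have : nrm 1 ≠ 0 := fun h => one_ne_zero (nrm_eq_zero h)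
  have h2 := nrm_sq 1
  rw [mul_one] at h2
  rw [← h2]; positivity

/-- The mean value on the disk. -/
def avg (p : Poly) : ℝ := intD p / intD 1

lemma intD_C (c : ℝ) : intD (C c) = c * intD 1 := by
  rw [← intD_C_mul, mul_one]

lemma intD_sub_avg (p : Poly) : intD (p - C (avg p)) = 0 := by
  rw [intD_sub, intD_C, avg, div_mul_cancel₀ _ intD_one_pos.ne', sub_self]

lemma mem_Pd_one {q : Poly} (h : q ∈ Pd 1) : q = C (coeff 0 q) := by
  ext m
  rw [coeff_C]
  split_ifs with h0
  · rw [h0]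
  · exact mem_Pd.1 h m (by rw [Nat.one_le_iff_ne_zero]; simpa [Finsupp.degree_eq_zero_iff] using Ne.symm h0)

lemma nrm_le_of_intD_eq_zero {p : Poly} (h : intD p = 0) : nrm p ≤ nrm (dx p) + nrm (dy p) := by
  have h1 := le_Dir (n := 1) (p := p) fun q hq => by
    rw [mem_Pd_one hq, mul_comm, intD_C_mul, h, mul_zero]
  have h3 := Dir_le_grad p
  refine abs_le_of_sq_le_sq' ?_ (add_nonneg (nrm_nonneg _) (nrm_nonneg _)) |>.2
  norm_num at h1
  nlinarith [nrm_nonneg (dx p), nrm_nonneg (dy p), mul_nonneg (nrm_nonneg (dx p)) (nrm_nonneg (dy p))]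

/-- Sequences bounded in the first Sobolev norm are precompact in `L²`. -/
lemma exists_subseq_cauchySeq {p : ℕ → Poly} {c : ℝ} (h : ∀ n, N 1 (p n) ≤ c) :
    ∃ φ : ℕ → ℕ, StrictMono φ ∧ CauchySeq fun n => ι (p (φ n)) := by
  have hc : 0 ≤ c := (N_nonneg _ _).trans (h 0)
  have hg : ∀ n, nrm (p n) ≤ c ∧ nrm (dx (p n)) + nrm (dy (p n)) ≤ c := fun n => by
    have := h n
    simp only [N_succ, N_zero'] at this
    exact ⟨by linarith [nrm_nonneg (dx (p n)), nrm_nonneg (dy (p n))],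
      by linarith [nrm_nonneg (p n)]⟩
  have htb : TotallyBounded (range fun n => ι (p n)) := by
    rw [Metric.totallyBounded_iff]
    intro ε hε
    obtain ⟨k, hk⟩ := exists_nat_gt (2 * c / ε)
    have hk0 : (0 : ℝ) < k := (by positivity : (0 : ℝ) ≤ 2 * c / ε).trans_lt hk
    have hK : IsCompact (Metric.closedBall (0 : Wd k) c) := isCompact_closedBall _ _
    obtain ⟨t, ht, hcov⟩ := Metric.totallyBounded_iff.1 hK.totallyBounded (ε / 2) (by positivity)
    refine ⟨Subtype.val '' t, ht.image _, ?_⟩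
    rintro _ ⟨n, rfl⟩
    have hmem : (⟨(Wd k).starProjection (ι (p n)), Submodule.starProjection_apply_mem _ _⟩ : Wd k) ∈
        Metric.closedBall (0 : Wd k) c := by
      rw [mem_closedBall_zero_iff]
      exact ((Wd k).norm_starProjection_apply_le _).trans (hg n).1
    obtain ⟨y, hy, hyd⟩ := mem_iUnion₂.1 (hcov hmem)
    refine mem_iUnion₂.2 ⟨y, ⟨y, hy, rfl⟩, ?_⟩
    rw [Metric.mem_ball] at hyd ⊢
    have h1 : dist (ι (p n)) ((Wd k).starProjection (ι (p n))) < ε / 2 := by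
      rw [dist_eq_norm, ← ι_pr, ← map_sub]
      have h2 := nrm_sub_pr_le k (p n)
      have h3 : k * (ε / 2) > c := by
        rw [div_lt_iff₀ hε] at hk; linarith
      have : k * nrm (p n - pr k (ι (p n))) < k * (ε / 2) := by linarith [(hg n).2]
      exact lt_of_mul_lt_mul_left this hk0.le
    calc _ ≤ _ := dist_triangle _ ((Wd k).starProjection (ι (p n))) _
      _ < ε / 2 + ε / 2 := add_lt_add h1 hyd
      _ = ε := by ring
  obtain ⟨a, -, φ, hφ, ha⟩ := (htb.closure.isCompact_of_isClosed isClosed_closure).tendsto_subseq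
    (x := fun n => ι (p n)) fun n => subset_closure ⟨n, rfl⟩
  exact ⟨φ, hφ, ha.cauchySeq⟩

lemma intD_bd_mul_self_nonneg (p : Poly) : 0 ≤ intD (bd * (p * p)) :=
  setIntegral_nonneg measurableSet_disk fun z hz => by
    have : z.1 ^ 2 + z.2 ^ 2 ≤ 1 := hz
    simp only [bd, rr, ev_mul, ev_sub, ev_one, ev_add, ev_pow, ev_xx, ev_yy]
    exact mul_nonneg (by linarith) (mul_self_nonneg _)

lemma intD_bd_grad_le {n : ℕ} {p : Poly} (hp : p ∈ Pd n) :
    intD (bd * (dx p * dx p)) + intD (bd * (dy p * dy p)) ≤ n ^ 2 * nrm p ^ 2 := by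
  have h := Dir_le hp
  rw [Dir_eq, mul_add, intD_add] at h
  linarith [intD_mul_self_nonneg (rot p)]

lemma nrm_sq_le_bd {n : ℕ} {g : Poly} (hg : g ∈ Pd n) :
    nrm g ^ 2 ≤ (n ^ 2 + 4) * intD (bd * (g * g)) := by
  rcases n.eq_zero_or_pos with rfl | hn
  · rw [Pd_zero_eq hg]; simp
  have h1 : nrm g ^ 2 = 2 * intD (bd * (g * g)) + intD (bd * (g * eul g)) := by
    have h := intD_eul (bd * (g * g))
    rw [circ_mul_bd] at h
    have e : eul (bd * (g * g)) = 2 * (bd * (g * g)) + 2 * (bd * (g * eul g)) - 2 * (g * g) := by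
      simp [eul, bd, rr]; ring
    rw [e] at h
    simp only [intD_sub, intD_add, intD_ofNat_mul] at h
    rw [nrm_sq]; linarith
  have h2 : intD (bd * (eul g * eul g)) ≤ n ^ 2 * nrm g ^ 2 := by
    refine le_trans ?_ (intD_bd_grad_le hg)
    rw [← intD_add, ← sub_nonneg, ← intD_sub]
    have e : bd * (dx g * dx g) + bd * (dy g * dy g) - bd * (eul g * eul g) =
        bd * (rot g * rot g) + (bd * (bd * (dx g * dx g)) + bd * (bd * (dy g * dy g))) := by
      simp [eul, bd, rr, rot]; ring
    rw [e, show bd * (bd * (dx g * dx g)) = (bd * dx g) * (bd * dx g) by ring,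
      show bd * (bd * (dy g * dy g)) = (bd * dy g) * (bd * dy g) by ring]
    simp only [intD_add]
    exact add_nonneg (intD_bd_mul_self_nonneg _)
      (add_nonneg (intD_mul_self_nonneg _) (intD_mul_self_nonneg _))
  have h3 := intD_bd_mul_self_nonneg (C ((n : ℝ) ^ 2) * g - eul g)
  have e : bd * ((C ((n : ℝ) ^ 2) * g - eul g) * (C ((n : ℝ) ^ 2) * g - eul g)) =
      C ((n : ℝ) ^ 4) * (bd * (g * g)) - 2 * (C ((n : ℝ) ^ 2) * (bd * (g * eul g))) +
      bd * (eul g * eul g) := by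
    simp only [map_pow]; ring
  rw [e] at h3
  simp only [intD_sub, intD_add, intD_ofNat_mul, intD_C_mul] at h3
  have hn' : (0 : ℝ) < n ^ 2 := by positivity
  refine le_of_mul_le_mul_left ?_ hn'
  nlinarith

/-- Inverse estimate for polynomials of bounded degree. -/
lemma nrm_grad_le {n : ℕ} {q : Poly} (hq : q ∈ Pd n) :
    nrm (dx q) ≤ (n + 2) ^ 2 * nrm q ∧ nrm (dy q) ≤ (n + 2) ^ 2 * nrm q := by
  have h := intD_bd_grad_le hq
  have key : ∀ g ∈ Pd n, intD (bd * (g * g)) ≤ n ^ 2 * nrm q ^ 2 →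
      nrm g ≤ (n + 2) ^ 2 * nrm q := by
    intro g hg hb
    have h1 := nrm_sq_le_bd hg
    refine abs_le_of_sq_le_sq' ?_ (mul_nonneg (by positivity) (nrm_nonneg q)) |>.2
    calc nrm g ^ 2 ≤ ((n : ℝ) ^ 2 + 4) * (n ^ 2 * nrm q ^ 2) :=
          h1.trans (mul_le_mul_of_nonneg_left hb (by positivity))
      _ ≤ ((n : ℝ) + 2) ^ 2 * ((n + 2) ^ 2 * nrm q ^ 2) := by
          gcongr
          · nlinarith [n.cast_nonneg (α := ℝ)]
          · linarith
      _ = _ := by ring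
  exact ⟨key _ (dx_mem_Pd (Pd_mono n.le_succ hq)) (by linarith [intD_bd_mul_self_nonneg (dy q)]),
    key _ (dy_mem_Pd (Pd_mono n.le_succ hq)) (by linarith [intD_bd_mul_self_nonneg (dx q)])⟩

lemma N_le_of_mem_Pd (k : ℕ) {n : ℕ} {q : Poly} (hq : q ∈ Pd n) :
    N k q ≤ (3 * (n + 2) ^ 2) ^ k * nrm q := by
  induction k generalizing q with
  | zero => simp
  | succ k ih =>
    have h1 := nrm_grad_le hq
    have hM : (0 : ℝ) ≤ (3 * (n + 2) ^ 2) ^ k := by positivity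
    have h0 : nrm q ≤ (n + 2) ^ 2 * nrm q :=
      le_mul_of_one_le_left (nrm_nonneg q) (by nlinarith [n.cast_nonneg (α := ℝ)])
    calc N (k + 1) q ≤ (3 * (n + 2) ^ 2) ^ k * nrm q + (3 * (n + 2) ^ 2) ^ k * nrm (dx q) +
          (3 * (n + 2) ^ 2) ^ k * nrm (dy q) :=
          add_le_add (add_le_add (ih hq) (ih (dx_mem_Pd (Pd_mono n.le_succ hq))))
            (ih (dy_mem_Pd (Pd_mono n.le_succ hq)))
      _ ≤ (3 * (n + 2) ^ 2) ^ k * ((n + 2) ^ 2 * nrm q) +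
          (3 * (n + 2) ^ 2) ^ k * ((n + 2) ^ 2 * nrm q) +
          (3 * (n + 2) ^ 2) ^ k * ((n + 2) ^ 2 * nrm q) := by
          gcongr
          exacts [h1.1, h1.2]
      _ = _ := by ring

lemma mul_mem_Pd {a b : ℕ} {p q : Poly} (hp : p ∈ Pd (a + 1)) (hq : q ∈ Pd (b + 1)) :
    p * q ∈ Pd (a + b + 1) := mem_Pd.2 fun m hm => by
  rw [coeff_mul]
  refine Finset.sum_eq_zero fun ij hij => ?_
  rw [Finset.HasAntidiagonal.mem_antidiagonal] at hij
  rw [← hij, map_add] at hm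
  rcases Nat.lt_or_ge a ij.1.degree with h | h
  · rw [mem_Pd.1 hp _ h, zero_mul]
  · rw [mem_Pd.1 hq _ (by omega), mul_zero]

lemma bd_mem_Pd : bd ∈ Pd 3 := by
  have h1 : (1 : Poly) ∈ Pd 3 := mem_Pd.2 fun m hm => by
    rw [coeff_one, if_neg]; rintro rfl; simp at hm
  have hX : ∀ i, (X i : Poly) ∈ Pd 2 := fun i => mem_Pd.2 fun m hm => by
    rw [coeff_X, if_neg]; rintro rfl; simp at hm
  rw [bd, rr, pow_two, pow_two]
  exact sub_mem h1 (add_mem (mul_mem_Pd (a := 1) (b := 1) (hX 0) (hX 0)) (mul_mem_Pd (a := 1) (b := 1) (hX 1) (hX 1)))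

lemma bd_ne_zero : bd ≠ 0 := fun h => by
  have := congrArg (fun p => ev p 0) h
  simp [bd, rr] at this

@[simp] lemma circ_dir_mul {u : Poly} (h : IsDir u) (w : Poly) : circ (u * w) = 0 := by
  obtain ⟨q, rfl⟩ := h
  rw [mul_assoc, circ_mul_bd]

lemma intD_lap_mul (u w : Poly) : intD (lap u * w) =
    circ (eul u * w) - intD (dx u * dx w + dy u * dy w) := by
  have e1 : lap u * w = dx (dx u * w) + dy (dy u * w) - (dx u * dx w + dy u * dy w) := by
    simp [lap]; ring
  have e2 : eul u * w = xx * (dx u * w) + yy * (dy u * w) := by rw [eul]; ring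
  rw [e1, intD_sub, intD_add, intD_dx, intD_dy, e2, circ_add]

lemma IsDir.add {u v : Poly} (hu : IsDir u) (hv : IsDir v) : IsDir (u + v) := by
  obtain ⟨p, rfl⟩ := hu
  obtain ⟨q, rfl⟩ := hv
  exact ⟨p + q, by ring⟩

lemma IsDir.nrm_le {u : Poly} (h : IsDir u) : nrm u ≤ nrm (dx u) + nrm (dy u) := by
  have h1 := intD_eul (u * u)
  rw [circ_dir_mul h] at h1
  have e : eul (u * u) = 2 * (u * (xx * dx u)) + 2 * (u * (yy * dy u)) := by simp [eul]; ring
  rw [e, intD_add, intD_ofNat_mul, intD_ofNat_mul, ← nrm_sq] at h1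
  have hx : nrm (xx * dx u) ≤ 1 * nrm (dx u) := nrm_le_of_abs_le fun z hz => by
    simpa using abs_fst_le_one hz
  have hy : nrm (yy * dy u) ≤ 1 * nrm (dy u) := nrm_le_of_abs_le fun z hz => by
    simpa using abs_snd_le_one hz
  have h2 := abs_le.1 (abs_intD_mul_le u (xx * dx u))
  have h3 := abs_le.1 (abs_intD_mul_le u (yy * dy u))
  rcases (nrm_nonneg u).eq_or_lt with h0 | h0
  · rw [← h0]; exact add_nonneg (nrm_nonneg _) (nrm_nonneg _)
  · refine le_of_mul_le_mul_left ?_ h0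
    nlinarith [h2.1, h3.1, mul_le_mul_of_nonneg_left hx h0.le, mul_le_mul_of_nonneg_left hy h0.le]

lemma grad_sq_le {u : Poly} (h : circ (eul u * u) = 0) :
    nrm (dx u) ^ 2 + nrm (dy u) ^ 2 ≤ nrm u * nrm (lap u) := by
  have h1 := intD_lap_mul u u
  rw [h, intD_add, ← nrm_sq, ← nrm_sq] at h1
  have h2 := abs_le.1 (abs_intD_mul_le (lap u) u)
  linarith [h2.1, mul_comm (nrm u) (nrm (lap u))]

lemma N_one_le_of_poincare {u : Poly} (h : circ (eul u * u) = 0)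
    (hp : nrm u ≤ nrm (dx u) + nrm (dy u)) : N 1 u ≤ 4 * nrm (lap u) := by
  have h1 := grad_sq_le h
  have hx := nrm_nonneg (dx u)
  have hy := nrm_nonneg (dy u)
  have hl := nrm_nonneg (lap u)
  have h3 : (nrm (dx u) + nrm (dy u)) ^ 2 ≤ 2 * ((nrm (dx u) + nrm (dy u)) * nrm (lap u)) := by
    nlinarith [sq_nonneg (nrm (dx u) - nrm (dy u)), mul_le_mul_of_nonneg_right hp hl]
  have h4 : nrm (dx u) + nrm (dy u) ≤ 2 * nrm (lap u) := by
    rcases (add_nonneg hx hy).eq_or_lt with h0 | h0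
    · rw [← h0]; positivity
    · refine le_of_mul_le_mul_left ?_ h0
      nlinarith
  simp only [N_succ, N_zero']
  linarith

lemma IsDir.N_one_le {u : Poly} (h : IsDir u) : N 1 u ≤ 4 * nrm (lap u) :=
  N_one_le_of_poincare (by rw [mul_comm, circ_dir_mul h]) h.nrm_le

lemma IsNeu.N_one_le {u : Poly} (h : IsNeu u) (h0 : intD u = 0) : N 1 u ≤ 4 * nrm (lap u) :=
  N_one_le_of_poincare (circ_dir_mul h u) (nrm_le_of_intD_eq_zero h0)

lemma exists_dir_solution (p : Poly) : ∃ u, IsDir u ∧ lap u = p := by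
  set n := p.totalDegree + 1
  have hT : ∀ q ∈ Pd n, lap (bd * q) ∈ Pd n := fun q hq =>
    add_mem (dx_mem_Pd (dx_mem_Pd (by rw [mul_comm]; exact mul_mem_Pd (a := p.totalDegree) (b := 2) hq bd_mem_Pd)))
      (dy_mem_Pd (dy_mem_Pd (by rw [mul_comm]; exact mul_mem_Pd (a := p.totalDegree) (b := 2) hq bd_mem_Pd)))
  let T : Pd n →ₗ[ℝ] Pd n :=
    { toFun q := ⟨lap (bd * q), hT q q.2⟩
      map_add' q r := by ext1; simp [lap]; ring
      map_smul' c q := by ext1; simp [lap] }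
  have hinj : Function.Injective T := (injective_iff_map_eq_zero T).2 fun q hq => by
    have h1 : lap (bd * q) = 0 := congrArg Subtype.val hq
    have h2 := (isDir_bd_mul (q : Poly)).N_one_le
    rw [h1, nrm_zero, mul_zero] at h2
    have h3 := nrm_eq_zero (le_antisymm ((nrm_le_N 1 _).trans h2) (nrm_nonneg _))
    exact Subtype.ext ((mul_eq_zero.1 h3).resolve_left bd_ne_zero)
  obtain ⟨q, hq⟩ := LinearMap.injective_iff_surjective.1 hinj ⟨p, mem_Pd_totalDegree p⟩
  exact ⟨bd * q, isDir_bd_mul _, congrArg Subtype.val hq⟩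

lemma lap_sub (p q : Poly) : lap (p - q) = lap p - lap q := by simp [lap]; ring
lemma lap_add (p q : Poly) : lap (p + q) = lap p + lap q := by simp [lap]; ring
lemma eul_sub (p q : Poly) : eul (p - q) = eul p - eul q := by simp [eul]; ring

/-- The solution of the Poisson equation with Dirichlet boundary condition. -/
def dsolve (p : Poly) : Poly := (exists_dir_solution p).choose

lemma isDir_dsolve (p : Poly) : IsDir (dsolve p) := (exists_dir_solution p).choose_spec.1

@[simp] lemma lap_dsolve (p : Poly) : lap (dsolve p) = p := (exists_dir_solution p).choose_spec.2

lemma IsDir.ext {u v : Poly} (hu : IsDir u) (hv : IsDir v) (h : lap u = lap v) : u = v := by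
  have h2 := (hu.sub hv).N_one_le
  rw [lap_sub, h, sub_self, nrm_zero, mul_zero] at h2
  exact sub_eq_zero.1 (nrm_eq_zero (le_antisymm ((nrm_le_N 1 _).trans h2) (nrm_nonneg _)))

lemma dsolve_sub (p q : Poly) : dsolve (p - q) = dsolve p - dsolve q :=
  (isDir_dsolve _).ext ((isDir_dsolve p).sub (isDir_dsolve q)) (by simp [lap_sub])

lemma dsolve_lap {u : Poly} (hu : IsDir u) : dsolve (lap u) = u :=
  (isDir_dsolve _).ext hu (lap_dsolve _)

lemma Bd_N_dsolve (k : ℕ) : Bd (fun p => N (k + 2) (dsolve p)) (N k) := by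
  have h := (ellEst_dir k).comp fun p : Poly => (⟨dsolve p, isDir_dsolve p⟩ : {u // IsDir u})
  simp only [lap_dsolve] at h
  exact h.trans (Bd.rfl'.add ⟨4, by norm_num, fun p => by
    have := (isDir_dsolve p).N_one_le
    rw [lap_dsolve] at this
    exact this.trans (mul_le_mul_of_nonneg_left (nrm_le_N _ _) (by norm_num))⟩)

lemma exists_neu_solution (p : Poly) :
    ∃ u, IsNeu u ∧ lap u = p - C (avg p) ∧ intD u = 0 := by
  set f := p - C (avg p)
  set w := dsolve (eul f + 2 * f)
  obtain ⟨u, hu⟩ := exists_eul_eq (w - C (coeff 0 w)) (by simp)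
  have h1 : lap u = f := by
    have h2 : lap (eul u) = eul (lap u) + 2 * lap u := by simp [lap, eul]; ring
    have h3 : lap (eul u) = eul f + 2 * f := by
      rw [hu, lap_sub, lap_dsolve]; simp [lap]
    refine sub_eq_zero.1 (eul_add_smul_injective (k := 2) two_pos ?_)
    rw [eul_sub, smul_eq_C_mul, map_ofNat]
    rw [h2] at h3
    linear_combination h3
  have hc : coeff 0 w = 0 := by
    have h4 := intD_lap_mul u 1
    simp only [mul_one, dx_one, dy_one, mul_zero, add_zero, intD_zero, sub_zero] at h4
    rw [h1, intD_sub_avg, hu] at h4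
    have h5 := circ_dir_mul (isDir_dsolve (eul f + 2 * f)) 1
    rw [mul_one] at h5
    have h6 := intD_eul (w - C (coeff 0 w))
    have h7 := intD_eul w
    rw [h5] at h7
    have e : eul (w - C (coeff 0 w)) = eul w := by simp [eul]
    rw [← h4, e, intD_sub, intD_C] at h6
    have : coeff 0 w * intD 1 = 0 := by linarith
    exact (mul_eq_zero.1 this).resolve_right intD_one_pos.ne'
  refine ⟨u - C (avg u), ?_, ?_, intD_sub_avg u⟩
  · have : eul (u - C (avg u)) = w := by
      rw [eul_sub, hu, hc]; simp [eul]
    rw [IsNeu, this]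
    exact isDir_dsolve _
  · rw [lap_sub, h1]; simp [lap]

/-- The mean-free solution of the Poisson equation with Neumann boundary condition. -/
def nsolve (p : Poly) : Poly := (exists_neu_solution p).choose

lemma isNeu_nsolve (p : Poly) : IsNeu (nsolve p) := (exists_neu_solution p).choose_spec.1

lemma lap_nsolve (p : Poly) : lap (nsolve p) = p - C (avg p) :=
  (exists_neu_solution p).choose_spec.2.1

lemma intD_nsolve (p : Poly) : intD (nsolve p) = 0 := (exists_neu_solution p).choose_spec.2.2

lemma avg_sub (p q : Poly) : avg (p - q) = avg p - avg q := by simp [avg, sub_div]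
lemma avg_add (p q : Poly) : avg (p + q) = avg p + avg q := by simp [avg, add_div]

lemma nsolve_unique {u v : Poly} (hu : IsNeu u) (hv : IsNeu v) (h : lap u = lap v)
    (h' : intD u = intD v) : u = v := by
  have h2 := (hu.sub hv).N_one_le (by rw [intD_sub, h', sub_self])
  rw [lap_sub, h, sub_self, nrm_zero, mul_zero] at h2
  exact sub_eq_zero.1 (nrm_eq_zero (le_antisymm ((nrm_le_N 1 _).trans h2) (nrm_nonneg _)))

lemma nsolve_sub (p q : Poly) : nsolve (p - q) = nsolve p - nsolve q :=
  nsolve_unique (isNeu_nsolve _) ((isNeu_nsolve p).sub (isNeu_nsolve q))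
    (by simp [lap_sub, lap_nsolve, avg_sub]; ring) (by simp [intD_nsolve])

lemma N_C (k : ℕ) (c : ℝ) : N k (C c) = |c| * nrm 1 := by
  have h0 : ∀ k, N k (0 : Poly) = 0 := fun k => N_zero k
  induction k with
  | zero =>
    have : (C c : Poly) = c • 1 := by rw [smul_eq_C_mul, mul_one]
    rw [N_zero', this, nrm_smul]
  | succ k ih => rw [N_succ, ih, dx_C, dy_C, h0]; ring

lemma Bd_N_avg (k : ℕ) : Bd (fun p => N k (C (avg p))) nrm := by
  refine ⟨nrm 1 / intD 1 * nrm 1, mul_nonneg (div_nonneg (nrm_nonneg _) intD_one_pos.le)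
    (nrm_nonneg _), fun p => ?_⟩
  have h := abs_intD_mul_le p 1
  rw [mul_one] at h
  change N k (C (avg p)) ≤ _
  rw [N_C, avg, abs_div, abs_of_pos intD_one_pos]
  calc _ ≤ nrm p * nrm 1 / intD 1 * nrm 1 := by
        gcongr
        exacts [nrm_nonneg _, intD_one_pos.le]
    _ = _ := by ring

lemma Bd_N_nsolve (k : ℕ) : Bd (fun p => N (k + 2) (nsolve p)) (N k) := by
  have h := (ellEst_neu k).comp fun p : Poly => (⟨nsolve p, isNeu_nsolve p⟩ : {u // IsNeu u})
  simp only [lap_nsolve] at h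
  have h1 : ∀ k, Bd (fun p => N k (p - C (avg p))) (N k) := fun k =>
    Bd_N_sub Bd.rfl' ((Bd_N_avg k).mono_right (nrm_le_N k))
  refine h.trans ((h1 k).add ?_)
  have h2 : Bd (fun p => N 1 (nsolve p)) (fun p => N 0 (p - C (avg p))) :=
    ⟨4, by norm_num, fun p => by
      have := (isNeu_nsolve p).N_one_le (intD_nsolve p)
      rwa [lap_nsolve] at this⟩
  exact h2.trans ((h1 0).mono_right (nrm_le_N k))

/-- A divergence-free polynomial field is a rotated gradient. -/
lemma exists_potential {a b : Poly} (h : dy a = dx b) : ∃ g, dx g = a ∧ dy g = b := by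
  obtain ⟨g, hg⟩ := exists_eul_eq (xx * a + yy * b) (by
    rw [coeff_add, xx, yy, coeff_X_mul', coeff_X_mul']; simp)
  refine ⟨g, ?_, ?_⟩
  · refine sub_eq_zero.1 (eul_add_smul_injective (k := 1) one_pos ?_)
    have := congrArg dx hg
    simp [eul] at this
    simp [eul]
    linear_combination this - yy * h
  · refine sub_eq_zero.1 (eul_add_smul_injective (k := 1) one_pos ?_)
    have := congrArg dy hg
    simp [eul] at this
    simp [eul]
    linear_combination this + xx * h

/-- Sequences of polynomials that are Cauchy in a Sobolev norm. -/
def Cau (k : ℕ) (p : ℕ → Poly) : Prop :=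
  ∀ ε > 0, ∃ M, ∀ m ≥ M, ∀ n ≥ M, N k (p m - p n) < ε

/-- Sequences of polynomials that converge to zero in a Sobolev norm. -/
def Nul (k : ℕ) (p : ℕ → Poly) : Prop := Tendsto (fun n => N k (p n)) atTop (𝓝 0)

lemma nul_of_le {k : ℕ} {p : ℕ → Poly} {f : ℕ → ℝ} (h : ∀ n, N k (p n) ≤ f n)
    (hf : Tendsto f atTop (𝓝 0)) : Nul k p :=
  squeeze_zero (fun _ => N_nonneg _ _) h hf

lemma nul_iff {k : ℕ} {p : ℕ → Poly} : Nul k p ↔ ∀ ε > 0, ∃ M, ∀ n ≥ M, N k (p n) < ε := by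
  simp only [Nul, Metric.tendsto_atTop, dist_zero_right, Real.norm_eq_abs, abs_of_nonneg (N_nonneg _ _)]

section

variable {k l : ℕ} {p q p' q' : ℕ → Poly}

lemma Nul.bd (hq : Nul l q) (h : ∃ C, 0 ≤ C ∧ ∀ n, N k (p n) ≤ C * N l (q n)) : Nul k p := by
  obtain ⟨C, -, hC⟩ := h
  exact nul_of_le hC (by simpa using hq.const_mul C)

lemma Nul.add (hp : Nul k p) (hq : Nul k q) : Nul k fun n => p n + q n :=
  nul_of_le (fun n => N_add k (p n) (q n)) (by simpa using Tendsto.add hp hq)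

lemma Nul.neg (hp : Nul k p) : Nul k fun n => -p n := by simpa [Nul] using hp

lemma Nul.sub (hp : Nul k p) (hq : Nul k q) : Nul k fun n => p n - q n := by
  simpa [sub_eq_add_neg] using hp.add hq.neg

lemma Nul.mono (h : l ≤ k) (hp : Nul k p) : Nul l p := nul_of_le (fun _ => N_mono h _) hp

lemma Nul.dx (hp : Nul (k + 1) p) : Nul k fun n => dx (p n) := nul_of_le (fun _ => N_dx _ _) hp

lemma Nul.dy (hp : Nul (k + 1) p) : Nul k fun n => dy (p n) := nul_of_le (fun _ => N_dy _ _) hp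

/-- Transfer of the Cauchy property along a map with Lipschitz bounds. -/
lemma Cau.bd (hq : Cau l q)
    (h : ∃ C, 0 ≤ C ∧ ∀ m n, N k (p m - p n) ≤ C * N l (q m - q n)) : Cau k p := by
  obtain ⟨C, hC0, hC⟩ := h
  intro ε hε
  obtain ⟨M, hM⟩ := hq (ε / (C + 1)) (by positivity)
  refine ⟨M, fun m hm n hn => (hC m n).trans_lt ?_⟩
  have h1 := hM m hm n hn
  rw [lt_div_iff₀ (by positivity)] at h1
  nlinarith [N_nonneg l (q m - q n)]

lemma Cau.mono (h : l ≤ k) (hp : Cau k p) : Cau l p :=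
  hp.bd ⟨1, by norm_num, fun _ _ => by simpa using N_mono h _⟩

lemma Cau.dx (hp : Cau (k + 1) p) : Cau k fun n => dx (p n) :=
  hp.bd ⟨1, by norm_num, fun _ _ => by rw [← dx_sub, one_mul]; exact N_dx _ _⟩

lemma Cau.dy (hp : Cau (k + 1) p) : Cau k fun n => dy (p n) :=
  hp.bd ⟨1, by norm_num, fun _ _ => by rw [← dy_sub, one_mul]; exact N_dy _ _⟩

lemma Cau.neg (hp : Cau k p) : Cau k fun n => -p n :=
  hp.bd ⟨1, by norm_num, fun m n => by
    rw [show -p m - -p n = -(p m - p n) by ring, N_neg, one_mul]⟩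

lemma Cau.add (hp : Cau k p) (hq : Cau k q) : Cau k fun n => p n + q n := by
  intro ε hε
  obtain ⟨M, hM⟩ := hp (ε / 2) (by positivity)
  obtain ⟨M', hM'⟩ := hq (ε / 2) (by positivity)
  refine ⟨max M M', fun m hm n hn => ?_⟩
  rw [show p m + q m - (p n + q n) = (p m - p n) + (q m - q n) by ring]
  linarith [N_add k (p m - p n) (q m - q n), hM m (le_of_max_le_left hm) n (le_of_max_le_left hn),
    hM' m (le_of_max_le_right hm) n (le_of_max_le_right hn)]

lemma Cau.sub (hp : Cau k p) (hq : Cau k q) : Cau k fun n => p n - q n := by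
  simpa [sub_eq_add_neg] using hp.add hq.neg

lemma cau_const (a : Poly) : Cau k fun _ => a := fun ε hε => ⟨0, fun _ _ _ _ => by simpa⟩

lemma Nul.cau (hp : Nul k p) : Cau k p := by
  intro ε hε
  obtain ⟨M, hM⟩ := nul_iff.1 hp (ε / 2) (by positivity)
  exact ⟨M, fun m hm n hn => by linarith [N_sub k (p m) (p n), hM m hm, hM n hn]⟩

lemma Cau.congr (hp : Cau k p) (h : Nul k fun n => q n - p n) : Cau k q := by
  simpa using hp.add h.cau

lemma Cau.bounded (hp : Cau k p) : ∃ C, 0 ≤ C ∧ ∀ n, N k (p n) ≤ C := by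
  obtain ⟨M, hM⟩ := hp 1 one_pos
  refine ⟨N k (p M) + 1 + ∑ i ∈ Finset.range M, N k (p i), by
    have := Finset.sum_nonneg fun i (_ : i ∈ Finset.range M) => N_nonneg k (p i)
    have := N_nonneg k (p M)
    positivity, fun n => ?_⟩
  have h0 := Finset.sum_nonneg fun i (_ : i ∈ Finset.range M) => N_nonneg k (p i)
  rcases lt_or_ge n M with h | h
  · have := Finset.single_le_sum (fun i _ => N_nonneg k (p i)) (Finset.mem_range.2 h)
    linarith [N_nonneg k (p M)]
  · have h1 := N_add k (p n - p M) (p M)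
    rw [sub_add_cancel] at h1
    linarith [hM n h M le_rfl]

lemma Cau.comp (hp : Cau k p) {φ : ℕ → ℕ} (hφ : StrictMono φ) : Cau k fun n => p (φ n) := by
  intro ε hε
  obtain ⟨M, hM⟩ := hp ε hε
  exact ⟨M, fun m hm n hn => hM _ (hm.trans (hφ.id_le m)) _ (hn.trans (hφ.id_le n))⟩

lemma Nul.mul {a b : ℕ} (h : ∃ C, 0 ≤ C ∧ ∀ p q : Poly, N k (p * q) ≤ C * (N a p * N b q))
    (hp : Nul a p) (hq : ∃ C, 0 ≤ C ∧ ∀ n, N b (q n) ≤ C) : Nul k fun n => p n * q n := by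
  obtain ⟨C, hC, h⟩ := h
  obtain ⟨D, hD, hq⟩ := hq
  refine nul_of_le (fun n => (h _ _).trans (mul_le_mul_of_nonneg_left
    (mul_le_mul_of_nonneg_left (hq n) (N_nonneg _ _)) hC)) ?_
  simpa using (hp.mul_const D).const_mul C

lemma Cau.mul {a b : ℕ} (h : ∃ C, 0 ≤ C ∧ ∀ p q : Poly, N k (p * q) ≤ C * (N a p * N b q))
    (hp : Cau a p) (hq : Cau b q) : Cau k fun n => p n * q n := by
  obtain ⟨C, hC, h⟩ := h
  obtain ⟨P, hP0, hP⟩ := hp.bounded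
  obtain ⟨Q, hQ0, hQ⟩ := hq.bounded
  intro ε hε
  obtain ⟨M, hM⟩ := hp (ε / (2 * (C + 1) * (Q + 1))) (by positivity)
  obtain ⟨M', hM'⟩ := hq (ε / (2 * (C + 1) * (P + 1))) (by positivity)
  refine ⟨max M M', fun m hm n hn => ?_⟩
  have h1 := hM m (le_of_max_le_left hm) n (le_of_max_le_left hn)
  have h2 := hM' m (le_of_max_le_right hm) n (le_of_max_le_right hn)
  rw [lt_div_iff₀ (by positivity)] at h1 h2
  have e1 : N a (p m - p n) * N b (q m) ≤ N a (p m - p n) * (Q + 1) :=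
    mul_le_mul_of_nonneg_left (by linarith [hQ m]) (N_nonneg _ _)
  have e2 : N a (p n) * N b (q m - q n) ≤ (P + 1) * N b (q m - q n) :=
    mul_le_mul_of_nonneg_right (by linarith [hP n]) (N_nonneg _ _)
  have e3 : C * (N a (p m - p n) * N b (q m)) ≤ (C + 1) * (N a (p m - p n) * (Q + 1)) :=
    mul_le_mul (by linarith) e1 (mul_nonneg (N_nonneg _ _) (N_nonneg _ _)) (by linarith)
  have e4 : C * (N a (p n) * N b (q m - q n)) ≤ (C + 1) * ((P + 1) * N b (q m - q n)) :=
    mul_le_mul (by linarith) e2 (mul_nonneg (N_nonneg _ _) (N_nonneg _ _)) (by linarith)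
  calc N k (p m * q m - p n * q n) = N k ((p m - p n) * q m + p n * (q m - q n)) := by
        congr 1; ring
    _ ≤ C * (N a (p m - p n) * N b (q m)) + C * (N a (p n) * N b (q m - q n)) :=
        (N_add _ _ _).trans (add_le_add (h _ _) (h _ _))
    _ < ε := by linarith

/-- Uniformly bounded functionals tending to zero pointwise tend to zero along Cauchy sequences. -/
lemma tendsto_functional {ℓ : ℕ → Poly → ℝ} (hadd : ∀ n p q, ℓ n (p + q) = ℓ n p + ℓ n q) {C : ℝ}
    (hC : ∀ n p, |ℓ n p| ≤ C * N k p) (h0 : ∀ p, Tendsto (fun n => ℓ n p) atTop (𝓝 0))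
    (hp : Cau k p) : Tendsto (fun n => ℓ n (p n)) atTop (𝓝 0) := by
  have hC0 : 0 ≤ |C| := abs_nonneg C
  rw [Metric.tendsto_atTop]
  intro ε hε
  obtain ⟨M, hM⟩ := hp (ε / (2 * (|C| + 1))) (by positivity)
  obtain ⟨M', hM'⟩ := Metric.tendsto_atTop.1 (h0 (p M)) (ε / 2) (by positivity)
  refine ⟨max M M', fun n hn => ?_⟩
  have h1 := hM n (le_of_max_le_left hn) M le_rfl
  have h2 := hM' n (le_of_max_le_right hn)
  rw [lt_div_iff₀ (by positivity)] at h1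
  rw [dist_zero_right, Real.norm_eq_abs] at h2 ⊢
  have h3 : ℓ n (p n) = ℓ n (p n - p M) + ℓ n (p M) := by rw [← hadd, sub_add_cancel]
  have h4 := hC n (p n - p M)
  have h5 : C * N k (p n - p M) ≤ |C| * N k (p n - p M) :=
    mul_le_mul_of_nonneg_right (le_abs_self C) (N_nonneg _ _)
  rw [h3]
  linarith [abs_add_le (ℓ n (p n - p M)) (ℓ n (p M)), N_nonneg k (p n - p M)]

/-- An `L²`-Cauchy sequence which is weakly null is null. -/
lemma nul_of_weakly (hp : Cau 0 p) (h : ∀ q, Tendsto (fun n => intD (p n * q)) atTop (𝓝 0)) :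
    Nul 0 p := by
  obtain ⟨C, -, hC⟩ := hp.bounded
  have := tendsto_functional (ℓ := fun n q => intD (p n * q)) (fun n a b => by rw [mul_add, intD_add])
    (C := C) (k := 0) (fun n q => (abs_intD_mul_le _ _).trans
      (mul_le_mul_of_nonneg_right (hC n) (nrm_nonneg q))) h hp
  simp only [← nrm_sq] at this
  have h2 := this.sqrt
  simpa [Nul, Real.sqrt_sq (nrm_nonneg _)] using h2

lemma circ_mul_sq_le (p q : Poly) : circ (p * q) ^ 2 ≤ circ (p * p) * circ (q * q) := by
  have h : ∀ t : ℝ, 0 ≤ circ (p * p) * (t * t) + 2 * circ (p * q) * t + circ (q * q) := fun t => by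
    have := circ_mul_self_nonneg (C t * p + q)
    have e : (C t * p + q) * (C t * p + q) = C (t * t) * (p * p) + C (2 * t) * (p * q) + q * q := by
      simp only [map_mul, map_ofNat]; ring
    rw [e, circ_add, circ_add] at this
    have hc : ∀ (c : ℝ) r, circ (C c * r) = c * circ r := fun c r => by simp [circ]
    rw [hc, hc] at this
    linarith
  have := discrim_le_zero h
  rw [discrim] at this
  nlinarith

lemma circ_mul_self_le (p : Poly) : circ (p * p) ≤ 2 * (nrm p * N 1 p) := by
  rw [← intD_eul]
  have e : eul (p * p) = 2 * (p * (xx * dx p)) + 2 * (p * (yy * dy p)) := by simp [eul]; ring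
  have hx : nrm (xx * dx p) ≤ 1 * nrm (dx p) := nrm_le_of_abs_le fun z hz => by
    simpa using abs_fst_le_one hz
  have hy : nrm (yy * dy p) ≤ 1 * nrm (dy p) := nrm_le_of_abs_le fun z hz => by
    simpa using abs_snd_le_one hz
  have h0 := nrm_nonneg p
  rw [e, intD_add, intD_ofNat_mul, intD_ofNat_mul, ← nrm_sq, N_succ, N_zero', N_zero', N_zero']
  nlinarith [intD_mul_le p (xx * dx p), intD_mul_le p (yy * dy p),
    mul_le_mul_of_nonneg_left hx h0, mul_le_mul_of_nonneg_left hy h0]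

lemma tendsto_circ_mul (hp : Cau 1 p) (h : Nul 0 p) (q : Poly) :
    Tendsto (fun n => circ (p n * q)) atTop (𝓝 0) := by
  obtain ⟨C, hC0, hC⟩ := hp.bounded
  have h1 : Tendsto (fun n => circ (p n * q) ^ 2) atTop (𝓝 0) := by
    refine squeeze_zero (fun _ => sq_nonneg _) (g := fun n => 2 * (nrm (p n) * C) * circ (q * q))
      (fun n => (circ_mul_sq_le _ _).trans (mul_le_mul_of_nonneg_right
        ((circ_mul_self_le _).trans ?_) (circ_mul_self_nonneg q))) ?_
    · gcongr
      exacts [nrm_nonneg _, hC n]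
    · have := ((Tendsto.mul_const C h).const_mul 2).mul_const (circ (q * q))
      simpa using this
  have h2 := h1.sqrt
  simp only [Real.sqrt_sq_eq_abs, Real.sqrt_zero] at h2
  exact (tendsto_zero_iff_abs_tendsto_zero _).2 h2

/-- The Sobolev norms are closable. -/
lemma Nul.of_cau (hp : Cau k p) (h : Nul 0 p) : Nul k p := by
  induction k generalizing p with
  | zero => exact h
  | succ k ih =>
    have h1 : Cau 1 p := hp.mono (by omega)
    have w : ∀ (x : Poly) (d : Poly → Poly), (∀ p, intD (d p) = circ (x * p)) →
        (∀ p q, d (p * q) = d p * q + p * d q) → Cau 0 (fun n => d (p n)) →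
        Nul 0 fun n => d (p n) := by
      intro x d hd hm hc
      refine nul_of_weakly hc fun q => ?_
      have e : ∀ n, intD (d (p n) * q) = circ (p n * (x * q)) - intD (p n * d q) := fun n => by
        have := hd (p n * q)
        rw [hm, intD_add] at this
        rw [show p n * (x * q) = x * (p n * q) by ring, ← this]; ring
      simp only [e]
      have h2 : Tendsto (fun n => intD (p n * d q)) atTop (𝓝 0) := by
        refine squeeze_zero_norm (a := fun n => nrm (p n) * nrm (d q))
          (fun n => abs_intD_mul_le _ _) ?_
        simpa using Tendsto.mul_const (nrm (d q)) h
      simpa using (tendsto_circ_mul h1 h (x * q)).sub h2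
    have hx := ih hp.dx (w xx _ intD_dx dx_mul h1.dx)
    have hy := ih hp.dy (w yy _ intD_dy dy_mul h1.dy)
    have := Tendsto.add (Tendsto.add (ih (hp.mono k.le_succ) h) hx) hy
    simpa [Nul, N_succ] using this

end

/-- The transport term `2 b · ∇ v`. -/
def adv (b c v : Poly) : Poly := 2 * (b * dx v + c * dy v)

lemma adv_add (b c v w : Poly) : adv b c (v + w) = adv b c v + adv b c w := by simp [adv]; ring
lemma adv_neg (b c v : Poly) : adv b c (-v) = -adv b c v := by simp [adv]; ring
lemma adv_sub (b c v w : Poly) : adv b c (v - w) = adv b c v - adv b c w := by simp [adv]; ring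
lemma adv_sub_left (b c b' c' v : Poly) :
    adv (b - b') (c - c') v = adv b c v - adv b' c' v := by simp [adv]; ring
@[simp] lemma adv_zero (b c : Poly) : adv b c 0 = 0 := by simp [adv]

lemma N_two_mul (k : ℕ) (p : Poly) : N k (2 * p) = 2 * N k p := by
  have := N_smul k 2 p
  rwa [smul_eq_C_mul, map_ofNat, abs_two] at this

lemma nrm_two_mul (p : Poly) : nrm (2 * p) = 2 * nrm p := N_two_mul 0 p

lemma N_dx_le_two (v : Poly) : N 1 (dx v) + N 1 (dy v) ≤ N 2 v := by
  have := N_succ 1 v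
  linarith [N_nonneg 1 v]

lemma nrm_adv_le (b c v : Poly) : nrm (adv b c v) ≤ 2 * cG * ((N 1 b + N 1 c) * N 2 v) := by
  rw [adv, nrm_two_mul]
  have h1 := nrm_mul_le b (dx v)
  have h2 := nrm_mul_le c (dy v)
  have h3 := nrm_add (b * dx v) (c * dy v)
  have h4 := N_dx_le_two v
  have hb := N_nonneg 1 b
  have hc := N_nonneg 1 c
  have hx := N_nonneg 1 (dx v)
  have hy := N_nonneg 1 (dy v)
  have : N 1 b * N 1 (dx v) + N 1 c * N 1 (dy v) ≤ (N 1 b + N 1 c) * N 2 v := by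
    nlinarith [mul_nonneg hb hy, mul_nonneg hc hx, mul_le_mul_of_nonneg_left h4 (add_nonneg hb hc)]
  nlinarith [mul_le_mul_of_nonneg_left this cG_nonneg]

lemma abs_intD_adv_mul_le (b c v w : Poly) :
    |intD (adv b c v * w)| ≤ 2 * cG * ((N 1 b + N 1 c) * (N 1 v * N 1 w)) := by
  have e : adv b c v * w = 2 * ((b * w) * dx v) + 2 * ((c * w) * dy v) := by simp [adv]; ring
  rw [e, intD_add, intD_ofNat_mul, intD_ofNat_mul]
  have h1 := abs_le.1 (abs_intD_mul_le (b * w) (dx v))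
  have h2 := abs_le.1 (abs_intD_mul_le (c * w) (dy v))
  have hx : nrm (dx v) ≤ N 1 v := N_dx 0 v
  have hy : nrm (dy v) ≤ N 1 v := N_dy 0 v
  have h3 := mul_le_mul (nrm_mul_le b w) hx (nrm_nonneg _)
    (mul_nonneg cG_nonneg (mul_nonneg (N_nonneg 1 b) (N_nonneg 1 w)))
  have h4 := mul_le_mul (nrm_mul_le c w) hy (nrm_nonneg _)
    (mul_nonneg cG_nonneg (mul_nonneg (N_nonneg 1 c) (N_nonneg 1 w)))
  rw [abs_le]
  constructor <;> nlinarith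

lemma N_one_sq_le {e : Poly} (h : intD e = 0) : N 1 e ^ 2 ≤ 8 * (nrm (dx e) ^ 2 + nrm (dy e) ^ 2) := by
  have h1 := nrm_le_of_intD_eq_zero h
  have h2 := N_succ 0 e
  simp only [N_zero', zero_add] at h2
  have hx := nrm_nonneg (dx e)
  have hy := nrm_nonneg (dy e)
  have h3 : N 1 e ≤ 2 * (nrm (dx e) + nrm (dy e)) := by linarith
  nlinarith [N_nonneg 1 e, sq_nonneg (nrm (dx e) - nrm (dy e))]

lemma N_sub_avg (k : ℕ) : ∃ K, 0 ≤ K ∧ ∀ p, N k (p - C (avg p)) ≤ K * N k p :=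
  Bd_N_sub (Bd.of_le fun _ => le_rfl) ((Bd_N_avg k).mono_right (nrm_le_N k))

/-- The Dirichlet form. -/
def grad2 (p q : Poly) : Poly := dx p * dx q + dy p * dy q

lemma grad2_add (p q r : Poly) : grad2 p (q + r) = grad2 p q + grad2 p r := by simp [grad2]; ring

lemma grad2_sub_left (p q r : Poly) : grad2 (p - q) r = grad2 p r - grad2 q r := by
  simp [grad2]; ring

lemma abs_intD_grad2_le (p q : Poly) : |intD (grad2 p q)| ≤ 2 * (N 1 p * N 1 q) := by
  have h1 := abs_intD_mul_le (dx p) (dx q)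
  have h2 := abs_intD_mul_le (dy p) (dy q)
  have h3 : nrm (dx p) * nrm (dx q) ≤ N 1 p * N 1 q :=
    mul_le_mul (N_dx 0 p) (N_dx 0 q) (nrm_nonneg _) (N_nonneg _ _)
  have h4 : nrm (dy p) * nrm (dy q) ≤ N 1 p * N 1 q :=
    mul_le_mul (N_dy 0 p) (N_dy 0 q) (nrm_nonneg _) (N_nonneg _ _)
  rw [grad2, intD_add]
  linarith [abs_add_le (intD (dx p * dx q)) (intD (dy p * dy q))]

section

variable {b c e e' u v f f' : ℕ → Poly}

lemma tendsto_self_form {K : ℝ} (hb : ∀ n, 2 * cG * (N 1 (b n) + N 1 (c n)) ≤ K)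
    (he : Cau 1 e) (he' : Cau 1 e') (h0 : ∀ n, intD (e n) = 0)
    (h : ∀ η, intD η = 0 →
      Tendsto (fun n => intD (grad2 (e n) η) + intD (adv (b n) (c n) (e' n) * η)) atTop (𝓝 0)) :
    Tendsto (fun n => intD (grad2 (e n) (e n)) + intD (adv (b n) (c n) (e' n) * e n)) atTop (𝓝 0) := by
  obtain ⟨A, hA0, hA⟩ := he.bounded
  obtain ⟨B, hB0, hB⟩ := he'.bounded
  obtain ⟨D, hD0, hD⟩ := N_sub_avg 1
  have key := tendsto_functional (k := 1) (C := 2 * A + K * B * D)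
    (ℓ := fun n η => intD (grad2 (e n) η) + intD (adv (b n) (c n) (e' n) * (η - C (avg η))))
    (fun n p q => by rw [grad2_add, avg_add, C_add, intD_add, show p + q - (C (avg p) + C (avg q)) =
      (p - C (avg p)) + (q - C (avg q)) by ring, mul_add, intD_add]; ring)
    (fun n p => ?_) (fun p => ?_) he
  · simpa [avg, h0] using key
  · have h1 := abs_intD_grad2_le (e n) p
    have h2 := abs_intD_adv_mul_le (b n) (c n) (e' n) (p - C (avg p))
    have hp := N_nonneg 1 p
    have hK : 0 ≤ K := le_trans (mul_nonneg (mul_nonneg zero_le_two cG_nonneg)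
      (add_nonneg (N_nonneg _ _) (N_nonneg _ _))) (hb n)
    have h3 : 2 * cG * (N 1 (b n) + N 1 (c n)) * (N 1 (e' n) * N 1 (p - C (avg p))) ≤
        K * (B * (D * N 1 p)) :=
      mul_le_mul (hb n) (mul_le_mul (hB n) (hD p) (N_nonneg _ _) hB0)
        (mul_nonneg (N_nonneg _ _) (N_nonneg _ _)) hK
    have h4 := mul_le_mul_of_nonneg_right (hA n) hp
    refine (abs_add_le _ _).trans ?_
    linarith
  · have := h (p - C (avg p)) (intD_sub_avg p)
    simpa [grad2, sub_eq_add_neg] using this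

/-- Uniqueness for the coupled Neumann system with a small transport term. -/
lemma nul_of_coupled (hb : ∀ n, 2 * cG * (N 1 (b n) + N 1 (c n)) ≤ 1 / 64)
    (he : Cau 1 e) (he' : Cau 1 e') (h0 : ∀ n, intD (e n) = 0) (h0' : ∀ n, intD (e' n) = 0)
    (h : ∀ η, intD η = 0 →
      Tendsto (fun n => intD (grad2 (e n) η) + intD (adv (b n) (c n) (e' n) * η)) atTop (𝓝 0))
    (h' : ∀ η, intD η = 0 →
      Tendsto (fun n => intD (grad2 (e' n) η) + intD (adv (b n) (c n) (-e n) * η)) atTop (𝓝 0)) :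
    Nul 1 e ∧ Nul 1 e' := by
  have k1 := tendsto_self_form hb he he' h0 h
  have k2 := tendsto_self_form hb he' he.neg h0' h'
  have k3 := (k1.add k2).const_mul 16
  simp only [add_zero, mul_zero] at k3
  have key : ∀ n, N 1 (e n) ^ 2 + N 1 (e' n) ^ 2 ≤ 16 * (intD (grad2 (e n) (e n)) +
      intD (adv (b n) (c n) (e' n) * e n) + (intD (grad2 (e' n) (e' n)) +
      intD (adv (b n) (c n) (-e n) * e' n))) := fun n => by
    have h1 := abs_le.1 (abs_intD_adv_mul_le (b n) (c n) (e' n) (e n))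
    have h2 := abs_le.1 (abs_intD_adv_mul_le (b n) (c n) (-e n) (e' n))
    rw [N_neg] at h2
    have h3 := mul_le_mul_of_nonneg_right (hb n) (mul_nonneg (N_nonneg 1 (e n)) (N_nonneg 1 (e' n)))
    have h4 := N_one_sq_le (h0 n)
    have h5 := N_one_sq_le (h0' n)
    simp only [grad2, intD_add, ← nrm_sq]
    nlinarith [sq_nonneg (N 1 (e n) - N 1 (e' n))]
  constructor
  · have := (squeeze_zero (fun n => sq_nonneg _) (fun n => (le_add_of_nonneg_right
      (sq_nonneg (N 1 (e' n)))).trans (key n)) k3).sqrt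
    simpa [Nul, Real.sqrt_sq (N_nonneg _ _)] using this
  · have := (squeeze_zero (fun n => sq_nonneg _) (fun n => (le_add_of_nonneg_left
      (sq_nonneg (N 1 (e n)))).trans (key n)) k3).sqrt
    simpa [Nul, Real.sqrt_sq (N_nonneg _ _)] using this

end

/-- Approximate inversion of `1 - T` for a contraction `T` on pairs. -/
lemma exists_approx_fixed {T : Poly × Poly → Poly × Poly} (hT : ∀ x y, T (x + y) = T x + T y)
    (hc : ∀ x, nrm (T x).1 + nrm (T x).2 ≤ 1 / 2 * (nrm x.1 + nrm x.2)) (f : Poly × Poly)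
    {ε : ℝ} (hε : 0 < ε) :
    ∃ g, nrm (g - T g - f).1 + nrm (g - T g - f).2 ≤ ε := by
  have hs : ∀ x y, T (x - y) = T x - T y := fun x y => by
    rw [eq_sub_iff_add_eq, ← hT, sub_add_cancel]
  have key : ∀ n : ℕ, ∃ g, nrm (g - T g - f).1 + nrm (g - T g - f).2 ≤
      (1 / 2) ^ n * (nrm f.1 + nrm f.2) := by
    intro n
    induction n with
    | zero =>
      have : T 0 = 0 := by simpa using hs 0 0
      exact ⟨0, by simp [this]⟩
    | succ n ih =>
      obtain ⟨g, hg⟩ := ih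
      refine ⟨g - (g - T g - f), ?_⟩
      rw [hs, show g - (g - T g - f) - (T g - T (g - T g - f)) - f = T (g - T g - f) by abel]
      refine (hc _).trans ?_
      rw [pow_succ]
      linarith
  have h1 : Tendsto (fun n : ℕ => (1 / 2 : ℝ) ^ n * (nrm f.1 + nrm f.2)) atTop (𝓝 0) := by
    simpa using (tendsto_pow_atTop_nhds_zero_of_lt_one (by norm_num : (0 : ℝ) ≤ 1 / 2)
      (by norm_num)).mul_const (nrm f.1 + nrm f.2)
  obtain ⟨n, hn⟩ := (h1.eventually (ge_mem_nhds hε)).exists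
  obtain ⟨g, hg⟩ := key n
  exact ⟨g, hg.trans hn⟩

lemma cau_of_le_sum {ι : Type*} [Fintype ι] {k : ℕ} {p : ℕ → Poly} {l : ι → ℕ} {q : ι → ℕ → Poly}
    (hq : ∀ i, Cau (l i) (q i)) {K : ℝ} (hK : 0 ≤ K)
    (h : ∀ m n, N k (p m - p n) ≤ K * ∑ i, N (l i) (q i m - q i n)) : Cau k p := by
  intro ε hε
  set δ := ε / (K * (Fintype.card ι + 1) + 1)
  have hδ : 0 < δ := by positivity
  choose M hM using fun i => hq i δ hδ
  refine ⟨∑ i, M i, fun m hm n hn => (h m n).trans_lt ?_⟩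
  have hle : ∀ i, M i ≤ ∑ i, M i := fun i =>
    Finset.single_le_sum (fun _ _ => Nat.zero_le _) (Finset.mem_univ i)
  have h1 : ∑ i, N (l i) (q i m - q i n) ≤ ∑ _i : ι, δ := Finset.sum_le_sum fun i _ =>
    (hM i m ((hle i).trans hm) n ((hle i).trans hn)).le
  rw [Finset.sum_const, Finset.card_univ, nsmul_eq_mul] at h1
  have h2 : δ * (K * (Fintype.card ι + 1) + 1) = ε := div_mul_cancel₀ _ (by positivity)
  have h3 := mul_le_mul_of_nonneg_left h1 hK
  nlinarith [mul_nonneg hK hδ.le]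

lemma nsolve_add (p q : Poly) : nsolve (p + q) = nsolve p + nsolve q := by
  rw [← sub_eq_iff_eq_add, ← nsolve_sub, add_sub_cancel_right]

lemma intD_grad2_neu {w : Poly} (hw : IsNeu w) (η : Poly) :
    intD (grad2 w η) = -intD (lap w * η) := by
  rw [intD_lap_mul, circ_dir_mul hw, grad2]; ring

lemma intD_grad2_nsolve (g : Poly) {η : Poly} (h : intD η = 0) :
    intD (grad2 (nsolve g) η) = -intD (g * η) := by
  rw [intD_grad2_neu (isNeu_nsolve g), lap_nsolve, sub_mul, intD_sub, intD_C_mul, h]; ring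

lemma isNeu_add_C {w : Poly} (hw : IsNeu w) (c : ℝ) : IsNeu (w + C c) := by
  have : eul (w + C c) = eul w := by simp [eul]
  rwa [IsNeu, this]

lemma adv_add_C (b c v : Poly) (t : ℝ) : adv b c (v + C t) = adv b c v := by simp [adv]

lemma grad2_add_C (v : Poly) (t : ℝ) (η : Poly) : grad2 (v + C t) η = grad2 v η := by simp [grad2]

lemma Bd_N_two_nsolve : ∃ K, 0 ≤ K ∧ ∀ p, N 2 (nsolve p) ≤ K * nrm p := Bd_N_nsolve 0

lemma Cau.nsolve {k : ℕ} {p : ℕ → Poly} (hp : Cau k p) : Cau (k + 2) fun n => nsolve (p n) := by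
  obtain ⟨K, hK0, hK⟩ := Bd_N_nsolve k
  exact hp.bd ⟨K, hK0, fun m n => by rw [← nsolve_sub]; exact hK _⟩

lemma Cau.dsolve {k : ℕ} {p : ℕ → Poly} (hp : Cau k p) : Cau (k + 2) fun n => dsolve (p n) := by
  obtain ⟨K, hK0, hK⟩ := Bd_N_dsolve k
  exact hp.bd ⟨K, hK0, fun m n => by rw [← dsolve_sub]; exact hK _⟩

lemma Cau.avg {k : ℕ} {p : ℕ → Poly} (hp : Cau 0 p) : Cau k fun n => C (avg (p n)) := by
  obtain ⟨K, hK0, hK⟩ := Bd_N_avg k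
  exact hp.bd ⟨K, hK0, fun m n => by rw [← C_sub, ← avg_sub]; exact hK _⟩

/-- Improved approximate solutions of the coupled Neumann system with a small transport term. -/
theorem exists_coupled_solution : ∃ ε > 0, ∀ b c u v f f' : ℕ → Poly,
    (∀ n, N 1 (b n) + N 1 (c n) ≤ ε) → Cau 1 b → Cau 1 c → Cau 1 u → Cau 1 v →
    Cau 0 f → Cau 0 f' →
    (∀ η, Tendsto (fun n => intD (grad2 (u n) η) +
      intD ((adv (b n) (c n) (v n) + f n) * η)) atTop (𝓝 0)) →
    (∀ η, Tendsto (fun n => intD (grad2 (v n) η) +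
      intD ((adv (b n) (c n) (-u n) + f' n) * η)) atTop (𝓝 0)) →
    ∃ w w' : ℕ → Poly, (∀ n, IsNeu (w n)) ∧ (∀ n, IsNeu (w' n)) ∧ Cau 2 w ∧ Cau 2 w' ∧
      Nul 1 (fun n => w n - u n) ∧ Nul 1 (fun n => w' n - v n) := by
  obtain ⟨K, hK0, hK⟩ := Bd_N_two_nsolve
  have hG := cG_nonneg
  refine ⟨1 / (2 * cG * (K + 1) * 2 + 128 * cG + 1), by positivity,
    fun b c u v f f' hε hb hc hu hv hf hf' h h' => ?_⟩
  set ε := 1 / (2 * cG * (K + 1) * 2 + 128 * cG + 1) with hεdef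
  have hε0 : 0 < ε := by positivity
  have hεm : ε * (2 * cG * (K + 1) * 2 + 128 * cG + 1) = 1 := one_div_mul_cancel (by positivity)
  have hA : ∀ b c p : Poly, nrm (adv b c (nsolve p)) ≤ 2 * cG * K * ((N 1 b + N 1 c) * nrm p) :=
    fun b c p => (nrm_adv_le b c _).trans (by
      have := mul_le_mul_of_nonneg_left (hK p) (add_nonneg (N_nonneg 1 b) (N_nonneg 1 c))
      nlinarith [mul_le_mul_of_nonneg_left this hG])
  have hA2 : ∀ n p, nrm (adv (b n) (c n) (nsolve p)) ≤ 1 / 2 * nrm p := fun n p => by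
    refine (hA _ _ p).trans ?_
    have h1 : 2 * cG * K * (N 1 (b n) + N 1 (c n)) ≤ 1 / 2 := by
      have := mul_le_mul_of_nonneg_left (hε n) (by positivity : 0 ≤ 2 * cG * K)
      nlinarith [mul_nonneg hε0.le hG]
    nlinarith [mul_le_mul_of_nonneg_right h1 (nrm_nonneg p)]
  let T : ℕ → Poly × Poly → Poly × Poly := fun n x =>
    (adv (b n) (c n) (nsolve x.2), -adv (b n) (c n) (nsolve x.1))
  have hT : ∀ n x y, T n (x + y) = T n x + T n y := fun n x y => by
    simp only [T, Prod.fst_add, Prod.snd_add, nsolve_add, adv_add, neg_add, Prod.mk_add_mk]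
  have hc' : ∀ n x, nrm (T n x).1 + nrm (T n x).2 ≤ 1 / 2 * (nrm x.1 + nrm x.2) := fun n x => by
    simp only [T, nrm_neg]
    linarith [hA2 n x.1, hA2 n x.2]
  choose g hg using fun n : ℕ => exists_approx_fixed (hT n) (hc' n) (f n, f' n)
    (ε := 1 / ((n : ℝ) + 1)) (by positivity)
  let r : ℕ → Poly × Poly := fun n => g n - T n (g n) - (f n, f' n)
  have hlim := tendsto_one_div_add_atTop_nhds_zero_nat (𝕜 := ℝ)
  have hr1 : Nul 0 fun n => (r n).1 := nul_of_le (fun n => by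
    have := hg n; have := nrm_nonneg (r n).2; rw [N_zero']; linarith) hlim
  have hr2 : Nul 0 fun n => (r n).2 := nul_of_le (fun n => by
    have := hg n; have := nrm_nonneg (r n).1; rw [N_zero']; linarith) hlim
  have e1 : ∀ n, (g n).1 = adv (b n) (c n) (nsolve (g n).2) + f n + (r n).1 := fun n => by
    simp [r, T]
  have e2 : ∀ n, (g n).2 = -adv (b n) (c n) (nsolve (g n).1) + f' n + (r n).2 := fun n => by
    simp [r, T]
  obtain ⟨F, hF0, hF⟩ := hf.bounded
  obtain ⟨F', hF0', hF'⟩ := hf'.bounded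
  have hbound : ∀ n, nrm (g n).1 + nrm (g n).2 ≤ 2 * (F + F' + 1) := fun n => by
    have h1 := nrm_add (adv (b n) (c n) (nsolve (g n).2) + f n) (r n).1
    have h2 := nrm_add (adv (b n) (c n) (nsolve (g n).2)) (f n)
    have h3 := nrm_add (-adv (b n) (c n) (nsolve (g n).1) + f' n) (r n).2
    have h4 := nrm_add (-adv (b n) (c n) (nsolve (g n).1)) (f' n)
    rw [← e1] at h1
    rw [← e2] at h3
    rw [nrm_neg] at h4
    have h5 := hg n
    have h6 : 1 / ((n : ℝ) + 1) ≤ 1 := by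
      rw [div_le_one (by positivity)]; linarith [n.cast_nonneg (α := ℝ)]
    have h7 : nrm (f n) ≤ F := hF n
    have h8 : nrm (f' n) ≤ F' := hF' n
    have h9 : nrm (r n).1 + nrm (r n).2 ≤ 1 / ((n : ℝ) + 1) := h5
    linarith [hA2 n (g n).1, hA2 n (g n).2]
  have hdiff : ∀ m n, nrm ((g m).1 - (g n).1) + nrm ((g m).2 - (g n).2) ≤
      2 * (nrm (f m - f n) + nrm (f' m - f' n) + nrm ((r m).1 - (r n).1) +
      nrm ((r m).2 - (r n).2) + 2 * cG * K * (2 * (F + F' + 1)) *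
        (N 1 (b m - b n) + N 1 (c m - c n))) := fun m n => by
    have d1 : (g m).1 - (g n).1 = adv (b m) (c m) (nsolve ((g m).2 - (g n).2)) +
        adv (b m - b n) (c m - c n) (nsolve (g n).2) + (f m - f n) + ((r m).1 - (r n).1) := by
      conv_lhs => rw [e1 m, e1 n]
      rw [nsolve_sub, adv_sub, adv_sub_left]; ring
    have d2 : (g m).2 - (g n).2 = -adv (b m) (c m) (nsolve ((g m).1 - (g n).1)) +
        -adv (b m - b n) (c m - c n) (nsolve (g n).1) + (f' m - f' n) + ((r m).2 - (r n).2) := by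
      conv_lhs => rw [e2 m, e2 n]
      rw [nsolve_sub, adv_sub, adv_sub_left]; ring
    have t4 : ∀ a b c d : Poly, nrm (a + b + c + d) ≤ nrm a + nrm b + nrm c + nrm d :=
      fun a b c d => by linarith [nrm_add (a + b + c) d, nrm_add (a + b) c, nrm_add a b]
    have h1 := (congrArg nrm d1).le.trans (t4 _ _ _ _)
    have h2 := (congrArg nrm d2).le.trans (t4 _ _ _ _)
    rw [nrm_neg, nrm_neg] at h2
    have h3 := hA (b m - b n) (c m - c n) (g n).1
    have h4 := hA (b m - b n) (c m - c n) (g n).2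
    have h5 := hA2 m ((g m).1 - (g n).1)
    have h6 := hA2 m ((g m).2 - (g n).2)
    have h7 := mul_le_mul_of_nonneg_left (hbound n) (mul_nonneg (by positivity : 0 ≤ 2 * cG * K)
      (add_nonneg (N_nonneg 1 (b m - b n)) (N_nonneg 1 (c m - c n))))
    linarith
  have hq : ∀ i : Fin 6, Cau (![0, 0, 0, 0, 1, 1] i)
      (![f, f', fun n => (r n).1, fun n => (r n).2, b, c] i) := fun i => by
    fin_cases i
    exacts [hf, hf', hr1.cau, hr2.cau, hb, hc]
  have hsum : ∀ m n, nrm ((g m).1 - (g n).1) + nrm ((g m).2 - (g n).2) ≤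
      2 * (1 + 2 * cG * K * (2 * (F + F' + 1))) * ∑ i : Fin 6, N (![0, 0, 0, 0, 1, 1] i)
        (![f, f', fun n => (r n).1, fun n => (r n).2, b, c] i m -
          ![f, f', fun n => (r n).1, fun n => (r n).2, b, c] i n) := fun m n => by
    refine (hdiff m n).trans ?_
    rw [Fin.sum_univ_six]
    change _ ≤ 2 * (1 + 2 * cG * K * (2 * (F + F' + 1))) * (nrm (f m - f n) + nrm (f' m - f' n) +
      nrm ((r m).1 - (r n).1) + nrm ((r m).2 - (r n).2) + N 1 (b m - b n) + N 1 (c m - c n))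
    have hQ : 0 ≤ 2 * cG * K * (2 * (F + F' + 1)) := by positivity
    have := mul_nonneg hQ (add_nonneg (add_nonneg (nrm_nonneg (f m - f n))
      (nrm_nonneg (f' m - f' n))) (add_nonneg (nrm_nonneg ((r m).1 - (r n).1))
      (nrm_nonneg ((r m).2 - (r n).2))))
    nlinarith [N_nonneg 1 (b m - b n), N_nonneg 1 (c m - c n)]
  have hg1 : Cau 0 fun n => (g n).1 := cau_of_le_sum hq (by positivity) fun m n =>
    (le_add_of_nonneg_right (nrm_nonneg _)).trans (hsum m n)
  have hg2 : Cau 0 fun n => (g n).2 := cau_of_le_sum hq (by positivity) fun m n =>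
    (le_add_of_nonneg_left (nrm_nonneg _)).trans (hsum m n)
  have hw : Cau 2 fun n => nsolve (g n).1 + C (avg (u n)) :=
    hg1.nsolve.add (hu.mono (Nat.zero_le _)).avg
  have hw' : Cau 2 fun n => nsolve (g n).2 + C (avg (v n)) :=
    hg2.nsolve.add (hv.mono (Nat.zero_le _)).avg
  have hmean : ∀ g u, intD (nsolve g + C (avg u) - u) = 0 := fun g u => by
    have := intD_sub_avg u
    rw [intD_sub] at this
    rw [intD_sub, intD_add, intD_nsolve]
    linarith
  have hrη : ∀ {r : ℕ → Poly}, Nul 0 r → ∀ η, Tendsto (fun n => intD (r n * η)) atTop (𝓝 0) :=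
    fun hr η => squeeze_zero_norm (fun n => abs_intD_mul_le _ η)
      (by simpa using Tendsto.mul_const (nrm η) hr)
  obtain ⟨k1, k2⟩ := nul_of_coupled (b := b) (c := c)
    (e := fun n => nsolve (g n).1 + C (avg (u n)) - u n)
    (e' := fun n => nsolve (g n).2 + C (avg (v n)) - v n) (fun n => by
      have := mul_le_mul_of_nonneg_left (hε n) (by positivity : 0 ≤ 2 * cG)
      nlinarith [mul_nonneg hε0.le hG, mul_nonneg (mul_nonneg hε0.le hG) hK0])
    ((hw.mono (by norm_num)).sub hu) ((hw'.mono (by norm_num)).sub hv)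
    (fun n => hmean _ _) (fun n => hmean _ _)
    (fun η h0 => by
      have := (((h η).add (hrη hr1 η)).neg)
      rw [add_zero, neg_zero] at this
      refine this.congr fun n => ?_
      rw [grad2_sub_left, grad2_add_C, intD_sub, intD_grad2_nsolve _ h0, adv_sub, adv_add_C]
      conv_rhs => rw [e1 n]
      simp only [sub_mul, add_mul, intD_add, intD_sub]
      ring)
    (fun η h0 => by
      have := (((h' η).add (hrη hr2 η)).neg)
      rw [add_zero, neg_zero] at this
      refine this.congr fun n => ?_
      rw [grad2_sub_left, grad2_add_C, intD_sub, intD_grad2_nsolve _ h0]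
      simp only [adv_neg, adv_sub, adv_add_C]
      conv_rhs => rw [e2 n]
      simp only [sub_mul, add_mul, intD_add, intD_sub, neg_mul, intD_neg]
      ring)
  exact ⟨_, _, fun n => isNeu_add_C (isNeu_nsolve _) _, fun n => isNeu_add_C (isNeu_nsolve _) _,
    hw, hw', k1, k2⟩

/-- The lower order terms of the Ginzburg–Landau equation in the gauge `a = ∇⊥ψ`. -/
def rest (α β : ℝ) (ψ u v : Poly) : Poly :=
  dy ψ * dy ψ * u + dx ψ * dx ψ * u - C α * u + C β * (u * u * u + v * v * u)

/-- The nonlinearity of the Ginzburg–Landau equation in the gauge `a = ∇⊥ψ`. -/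
def gl (α β : ℝ) (ψ u v : Poly) : Poly := adv (-dy ψ) (dx ψ) v + rest α β ψ u v

/-- First component of the supercurrent. -/
def cur1 (ψ u v : Poly) : Poly := u * dx v - v * dx u - (dy ψ * u * u + dy ψ * v * v)

/-- Second component of the supercurrent. -/
def cur2 (ψ u v : Poly) : Poly := u * dy v - v * dy u + (dx ψ * u * u + dx ψ * v * v)

section

variable {p q r p' q' r' : ℕ → Poly}

lemma nrm_triple_sub_le {B : ℝ} {p q r p' q' r' : Poly} (hq' : N 1 q' ≤ B) (hr' : N 1 r' ≤ B)
    (hp : N 1 p ≤ B) (hq : N 1 q ≤ B) :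
    nrm (p' * q' * r' - p * q * r) ≤
      7 * cG ^ 2 * B ^ 2 * (N 1 (p' - p) + N 1 (q' - q) + N 1 (r' - r)) := by
  have hB : 0 ≤ B := (N_nonneg _ _).trans hp
  have e : p' * q' * r' - p * q * r = (p' - p) * q' * r' + p * (q' - q) * r' + p * q * (r' - r) := by
    ring
  rw [e]
  have h1 := nrm_mul_mul_le (p' - p) q' r'
  have h2 := nrm_mul_mul_le p (q' - q) r'
  have h3 := nrm_mul_mul_le p q (r' - r)
  have g1 : N 1 (p' - p) * N 1 q' * N 1 r' ≤ B ^ 2 * N 1 (p' - p) := by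
    have := mul_le_mul hq' hr' (N_nonneg _ _) hB
    nlinarith [mul_le_mul_of_nonneg_left this (N_nonneg 1 (p' - p))]
  have g2 : N 1 p * N 1 (q' - q) * N 1 r' ≤ B ^ 2 * N 1 (q' - q) := by
    have := mul_le_mul hp hr' (N_nonneg _ _) hB
    nlinarith [mul_le_mul_of_nonneg_left this (N_nonneg 1 (q' - q))]
  have g3 : N 1 p * N 1 q * N 1 (r' - r) ≤ B ^ 2 * N 1 (r' - r) := by
    have := mul_le_mul hp hq (N_nonneg _ _) hB
    nlinarith [mul_le_mul_of_nonneg_left this (N_nonneg 1 (r' - r))]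
  have hc : 0 ≤ 7 * cG ^ 2 := by positivity
  have := mul_le_mul_of_nonneg_left g1 hc
  have := mul_le_mul_of_nonneg_left g2 hc
  have := mul_le_mul_of_nonneg_left g3 hc
  linarith [nrm_add ((p' - p) * q' * r' + p * (q' - q) * r') (p * q * (r' - r)),
    nrm_add ((p' - p) * q' * r') (p * (q' - q) * r')]

lemma Cau.triple (hp : Cau 1 p) (hq : Cau 1 q) (hr : Cau 1 r) :
    Cau 0 fun n => p n * q n * r n := by
  obtain ⟨P, hP0, hP⟩ := hp.bounded
  obtain ⟨Q, hQ0, hQ⟩ := hq.bounded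
  obtain ⟨R, hR0, hR⟩ := hr.bounded
  have h : ∀ i : Fin 3, Cau 1 (![p, q, r] i) := fun i => by fin_cases i; exacts [hp, hq, hr]
  refine cau_of_le_sum (K := 7 * cG ^ 2 * (P + Q + R) ^ 2) h (by positivity) fun m n => ?_
  rw [Fin.sum_univ_three]
  exact nrm_triple_sub_le (by linarith [hQ m]) (by linarith [hR m]) (by linarith [hP n])
    (by linarith [hQ n])

lemma Nul.triple (hp : Cau 1 p) (hq : Cau 1 q) (hr : Cau 1 r)
    (hp' : Nul 1 fun n => p' n - p n) (hq' : Nul 1 fun n => q' n - q n)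
    (hr' : Nul 1 fun n => r' n - r n) :
    Nul 0 fun n => p' n * q' n * r' n - p n * q n * r n := by
  obtain ⟨P, hP0, hP⟩ := hp.bounded
  obtain ⟨Q, hQ0, hQ⟩ := hq.bounded
  obtain ⟨Q', hQ0', hQ'⟩ := (hq.congr hq').bounded
  obtain ⟨R', hR0', hR'⟩ := (hr.congr hr').bounded
  refine nul_of_le (f := fun n => 7 * cG ^ 2 * (P + Q + Q' + R') ^ 2 *
    (N 1 (p' n - p n) + N 1 (q' n - q n) + N 1 (r' n - r n))) (fun n =>
    nrm_triple_sub_le (by linarith [hQ' n]) (by linarith [hR' n]) (by linarith [hP n])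
      (by linarith [hQ n])) ?_
  simpa using ((Tendsto.add (Tendsto.add hp' hq') hr').const_mul (7 * cG ^ 2 * (P + Q + Q' + R') ^ 2))

/-- Weakly null sequences. -/
def WN (p : ℕ → Poly) : Prop := ∀ η, Tendsto (fun n => intD (p n * η)) atTop (𝓝 0)

lemma Nul.wn (h : Nul 0 p) : WN p := fun η => squeeze_zero_norm (fun n => abs_intD_mul_le _ η)
  (by simpa using Tendsto.mul_const (nrm η) h)

lemma WN.add (hp : WN p) (hq : WN q) : WN fun n => p n + q n := fun η => by
  simpa [add_mul] using (hp η).add (hq η)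

lemma WN.neg (hp : WN p) : WN fun n => -p n := fun η => by simpa using (hp η).neg

lemma WN.sub (hp : WN p) (hq : WN q) : WN fun n => p n - q n := by
  simpa [sub_eq_add_neg] using hp.add hq.neg

lemma WN.congr (hp : WN p) (h : ∀ n, p n = q n) : WN q := by
  rwa [← funext h]

lemma wn_mul (hp : Cau 0 p) (hq : Cau 0 q) (hp' : Nul 0 fun n => p' n - p n)
    (hq' : Nul 0 fun n => q' n - q n) : WN fun n => p' n * q' n - p n * q n := fun η => by
  obtain ⟨P, hP0, hP⟩ := hp.bounded
  obtain ⟨Q, hQ0, hQ⟩ := (hq.congr hq').bounded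
  have h : ∀ a b : Poly, |intD (a * b * η)| ≤ nrm a * (cS * N 2 η * nrm b) := fun a b => by
    rw [mul_assoc, mul_comm b]
    exact (abs_intD_mul_le _ _).trans
      (mul_le_mul_of_nonneg_left (nrm_mul_le_sup η b) (nrm_nonneg _))
  have hc : 0 ≤ cS * N 2 η := mul_nonneg cS_nonneg (N_nonneg _ _)
  refine squeeze_zero_norm (a := fun n => nrm (p' n - p n) * (cS * N 2 η * Q) +
    P * (cS * N 2 η * nrm (q' n - q n))) (fun n => ?_) ?_
  · rw [show (p' n * q' n - p n * q n) * η = (p' n - p n) * q' n * η + p n * (q' n - q n) * η by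
      ring, intD_add]
    refine (norm_add_le _ _).trans (add_le_add ((h _ _).trans ?_) ((h _ _).trans ?_))
    · exact mul_le_mul_of_nonneg_left (mul_le_mul_of_nonneg_left (hQ n) hc) (nrm_nonneg _)
    · exact mul_le_mul_of_nonneg_right (hP n) (mul_nonneg hc (nrm_nonneg _))
  · have := (Tendsto.mul_const (cS * N 2 η * Q) hp').add
      ((Tendsto.const_mul (cS * N 2 η) hq').const_mul P)
    simpa using this

lemma Nul.C_mul {k : ℕ} (c : ℝ) (h : Nul k p) : Nul k fun n => C c * p n := by
  refine nul_of_le (f := fun n => |c| * N k (p n)) (fun n => ?_) (by simpa using Tendsto.const_mul |c| h)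
  rw [← smul_eq_C_mul, N_smul]

lemma Cau.C_mul {k : ℕ} (c : ℝ) (h : Cau k p) : Cau k fun n => C c * p n :=
  h.bd ⟨|c|, abs_nonneg c, fun m n => by rw [← mul_sub, ← smul_eq_C_mul, N_smul]⟩

end

section

variable {α β : ℝ} {F ψ u v ψ' u' v' : ℕ → Poly}

/-- Componentwise vanishing of the difference of two configurations. -/
structure Close (ψ u v ψ' u' v' : ℕ → Poly) : Prop where
  ψ : Nul 2 fun n => ψ' n - ψ n
  u : Nul 1 fun n => u' n - u n
  v : Nul 1 fun n => v' n - v n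

/-- Asymptotically critical sequences of the energy. -/
structure IsCrit (α β : ℝ) (F ψ u v : ℕ → Poly) : Prop where
  dir : ∀ n, IsDir (ψ n)
  eq_u : ∀ η, Tendsto (fun n => intD (grad2 (u n) η) + intD (gl α β (ψ n) (u n) (v n) * η)) atTop (𝓝 0)
  eq_v : ∀ η, Tendsto (fun n => intD (grad2 (v n) η) + intD (gl α β (ψ n) (v n) (-u n) * η)) atTop (𝓝 0)
  eq_ψ : ∀ χ, IsDir χ → Tendsto (fun n => intD ((lap (ψ n) - F n) * lap χ) +
    (intD (cur1 (ψ n) (u n) (v n) * -dy χ) + intD (cur2 (ψ n) (u n) (v n) * dx χ))) atTop (𝓝 0)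

lemma Close.trans {ψ'' u'' v'' : ℕ → Poly} (h : Close ψ u v ψ' u' v') (h' : Close ψ' u' v' ψ'' u'' v'') :
    Close ψ u v ψ'' u'' v'' :=
  ⟨by simpa using h'.ψ.add h.ψ, by simpa using h'.u.add h.u, by simpa using h'.v.add h.v⟩

lemma nul_rest (hψ : Cau 2 ψ) (hu : Cau 1 u) (hv : Cau 1 v) (hc : Close ψ u v ψ' u' v') :
    Nul 0 fun n => rest α β (ψ' n) (u' n) (v' n) - rest α β (ψ n) (u n) (v n) := by
  have hx : Nul 1 fun n => dx (ψ' n) - dx (ψ n) := by simpa using hc.ψ.dx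
  have hy : Nul 1 fun n => dy (ψ' n) - dy (ψ n) := by simpa using hc.ψ.dy
  have h1 := Nul.triple hψ.dy hψ.dy hu hy hy hc.u
  have h2 := Nul.triple hψ.dx hψ.dx hu hx hx hc.u
  have h3 := Nul.triple hu hu hu hc.u hc.u hc.u
  have h4 := Nul.triple hv hv hu hc.v hc.v hc.u
  have h5 := ((h1.add h2).sub ((hc.u.mono (Nat.zero_le _)).C_mul α)).add ((h3.add h4).C_mul β)
  refine h5.congr fun n => ?_
  congr 1
  simp only [rest]; ring

lemma wn_adv (hψ : Cau 2 ψ) (hv : Cau 1 v) (hψ' : Nul 2 fun n => ψ' n - ψ n)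
    (hv' : Nul 1 fun n => v' n - v n) :
    WN fun n => adv (-dy (ψ' n)) (dx (ψ' n)) (v' n) - adv (-dy (ψ n)) (dx (ψ n)) (v n) := by
  have hx : Nul 1 fun n => dx (ψ' n) - dx (ψ n) := by simpa using hψ'.dx
  have hy : Nul 1 fun n => dy (ψ' n) - dy (ψ n) := by simpa using hψ'.dy
  have hvx : Nul 0 fun n => dx (v' n) - dx (v n) := by simpa using hv'.dx
  have hvy : Nul 0 fun n => dy (v' n) - dy (v n) := by simpa using hv'.dy
  have h1 := wn_mul (hψ.dy.mono (Nat.zero_le _)) hv.dx (hy.mono (Nat.zero_le _)) hvx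
  have h2 := wn_mul (hψ.dx.mono (Nat.zero_le _)) hv.dy (hx.mono (Nat.zero_le _)) hvy
  refine ((h2.sub h1).add (h2.sub h1)).congr fun n => ?_
  simp only [adv]; ring

lemma wn_gl (hψ : Cau 2 ψ) (hu : Cau 1 u) (hv : Cau 1 v) (hc : Close ψ u v ψ' u' v') :
    WN fun n => gl α β (ψ' n) (u' n) (v' n) - gl α β (ψ n) (u n) (v n) :=
  ((wn_adv hψ hv hc.ψ hc.v).add (nul_rest hψ hu hv hc).wn).congr fun n => by simp only [gl]; ring

lemma Close.swap (hc : Close ψ u v ψ' u' v') : Close ψ v (fun n => -u n) ψ' v' (fun n => -u' n) :=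
  ⟨hc.ψ, hc.v, by simpa [neg_add_eq_sub, sub_eq_add_neg, add_comm] using hc.u.neg⟩

lemma tendsto_grad2 (h : Nul 1 fun n => u' n - u n) (η : Poly) :
    Tendsto (fun n => intD (grad2 (u' n) η) - intD (grad2 (u n) η)) atTop (𝓝 0) := by
  refine squeeze_zero_norm (a := fun n => 2 * (N 1 (u' n - u n) * N 1 η)) (fun n => ?_)
    (by simpa using (Tendsto.mul_const (N 1 η) h).const_mul 2)
  rw [← intD_sub, ← grad2_sub_left]
  exact abs_intD_grad2_le _ _

lemma IsCrit.transfer (h : IsCrit α β F ψ u v) (hψ : Cau 2 ψ) (hu : Cau 1 u) (hv : Cau 1 v)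
    (hc : Close ψ u v ψ' u' v') (hd : ∀ n, IsDir (ψ' n)) : IsCrit α β F ψ' u' v' := by
  have hx : Nul 1 fun n => dx (ψ' n) - dx (ψ n) := by simpa using hc.ψ.dx
  have hy : Nul 1 fun n => dy (ψ' n) - dy (ψ n) := by simpa using hc.ψ.dy
  have hux : Nul 0 fun n => dx (u' n) - dx (u n) := by simpa using hc.u.dx
  have huy : Nul 0 fun n => dy (u' n) - dy (u n) := by simpa using hc.u.dy
  have hvx : Nul 0 fun n => dx (v' n) - dx (v n) := by simpa using hc.v.dx
  have hvy : Nul 0 fun n => dy (v' n) - dy (v n) := by simpa using hc.v.dy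
  have z : (0 : ℕ) ≤ 1 := Nat.zero_le _
  have hu0 := hc.u.mono z
  have hv0 := hc.v.mono z
  have c1 : WN fun n => cur1 (ψ' n) (u' n) (v' n) - cur1 (ψ n) (u n) (v n) :=
    (((wn_mul (hu.mono z) hv.dx hu0 hvx).sub (wn_mul (hv.mono z) hu.dx hv0 hux)).sub
      ((Nul.triple hψ.dy hu hu hy hc.u hc.u).add (Nul.triple hψ.dy hv hv hy hc.v hc.v)).wn).congr
      fun n => by simp only [cur1]; ring
  have c2 : WN fun n => cur2 (ψ' n) (u' n) (v' n) - cur2 (ψ n) (u n) (v n) :=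
    (((wn_mul (hu.mono z) hv.dy hu0 hvy).sub (wn_mul (hv.mono z) hu.dy hv0 huy)).add
      ((Nul.triple hψ.dx hu hu hx hc.u hc.u).add (Nul.triple hψ.dx hv hv hx hc.v hc.v)).wn).congr
      fun n => by simp only [cur2]; ring
  have hl : Nul 0 fun n => lap (ψ' n) - lap (ψ n) := by
    have := hc.ψ.bd (k := 0) (p := fun n => lap (ψ' n - ψ n)) (by
      obtain ⟨K, h0, hK⟩ := Bd_N_lap 0
      exact ⟨K, h0, fun n => hK _⟩)
    simpa [lap_sub] using this
  refine ⟨hd, fun η => ?_, fun η => ?_, fun χ hχ => ?_⟩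
  · have := (h.eq_u η).add ((tendsto_grad2 hc.u η).add (wn_gl (α := α) (β := β) hψ hu hv hc η))
    simp only [add_zero] at this
    refine this.congr fun n => ?_
    rw [sub_mul, intD_sub]; ring
  · have := (h.eq_v η).add ((tendsto_grad2 hc.v η).add
      (wn_gl (α := α) (β := β) hψ hv hu.neg hc.swap η))
    simp only [add_zero] at this
    refine this.congr fun n => ?_
    rw [sub_mul, intD_sub]; ring
  · have := (h.eq_ψ χ hχ).add ((hl.wn (lap χ)).add ((c1 (-dy χ)).add (c2 (dx χ))))
    simp only [add_zero] at this
    refine this.congr fun n => ?_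
    simp only [sub_mul, intD_sub]; ring

end

section

variable {α β : ℝ} {F ψ u v : ℕ → Poly} {k : ℕ}

lemma Cau.mul_same {p q : ℕ → Poly} (hp : Cau (k + 2) p) (hq : Cau (k + 1) q) :
    Cau (k + 1) fun n => p n * q n := Cau.mul (N_mul_le k) hp hq

lemma cau_rest_zero (hψ : Cau 2 ψ) (hu : Cau 1 u) (hv : Cau 1 v) :
    Cau 0 fun n => rest α β (ψ n) (u n) (v n) :=
  (((Cau.triple hψ.dy hψ.dy hu).add (Cau.triple hψ.dx hψ.dx hu)).sub
    ((hu.mono (Nat.zero_le _)).C_mul α)).add (((Cau.triple hu hu hu).add (Cau.triple hv hv hu)).C_mul β)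

lemma cau_rest (hψ : Cau (k + 3) ψ) (hu : Cau (k + 2) u) (hv : Cau (k + 2) v) :
    Cau (k + 1) fun n => rest α β (ψ n) (u n) (v n) := by
  have hu' := hu.mono (Nat.le_succ (k + 1))
  have h1 := hψ.dy.mul_same (hψ.dy.mul_same hu')
  have h2 := hψ.dx.mul_same (hψ.dx.mul_same hu')
  have h3 := hu.mul_same (hu.mul_same hu')
  have h4 := hv.mul_same (hv.mul_same hu')
  have := ((h1.add h2).sub (hu'.C_mul α)).add ((h3.add h4).C_mul β)
  simpa only [rest, mul_assoc] using this

lemma cau_adv (hψ : Cau (k + 3) ψ) (hv : Cau (k + 2) v) :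
    Cau (k + 1) fun n => adv (-dy (ψ n)) (dx (ψ n)) (v n) := by
  have h1 := hψ.dy.neg.mul_same hv.dx
  have h2 := hψ.dx.mul_same hv.dy
  simpa only [adv, two_mul] using (h1.add h2).add (h1.add h2)

lemma cau_gl (hψ : Cau (k + 3) ψ) (hu : Cau (k + 2) u) (hv : Cau (k + 2) v) :
    Cau (k + 1) fun n => gl α β (ψ n) (u n) (v n) := (cau_adv hψ hv).add (cau_rest hψ hu hv)

lemma cau_cur1 (hψ : Cau (k + 2) ψ) (hu : Cau (k + 2) u) (hv : Cau (k + 2) v) :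
    Cau (k + 1) fun n => cur1 (ψ n) (u n) (v n) := by
  have := ((hu.mul_same hv.dx).sub (hv.mul_same hu.dx)).sub
    ((hu.mul_same (hu.mul_same hψ.dy)).add (hv.mul_same (hv.mul_same hψ.dy)))
  convert this using 2 with n
  simp only [cur1]; ring

lemma cau_cur2 (hψ : Cau (k + 2) ψ) (hu : Cau (k + 2) u) (hv : Cau (k + 2) v) :
    Cau (k + 1) fun n => cur2 (ψ n) (u n) (v n) := by
  have := ((hu.mul_same hv.dy).sub (hv.mul_same hu.dy)).add
    ((hu.mul_same (hu.mul_same hψ.dx)).add (hv.mul_same (hv.mul_same hψ.dx)))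
  convert this using 2 with n
  simp only [cur2]; ring

/-- The potential of the supercurrent. -/
def pot (ψ u v : Poly) : Poly := dsolve (dx (cur2 ψ u v) - dy (cur1 ψ u v))

lemma cau_pot (hψ : Cau (k + 2) ψ) (hu : Cau (k + 2) u) (hv : Cau (k + 2) v) :
    Cau (k + 2) fun n => pot (ψ n) (u n) (v n) :=
  ((cau_cur2 hψ hu hv).dx.sub (cau_cur1 hψ hu hv).dy).dsolve

lemma intD_dir_lap {u v : Poly} (hu : IsDir u) (hv : IsDir v) :
    intD (u * lap v) = intD (lap u * v) := by
  have h1 := intD_lap_mul u v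
  have h2 := intD_lap_mul v u
  rw [mul_comm (eul u), circ_dir_mul hv] at h1
  rw [mul_comm (eul v), circ_dir_mul hu] at h2
  rw [mul_comm u, h2, h1]
  congr 2; ring

/-- Asymptotic form of the second Ginzburg–Landau equation. -/
lemma IsCrit.nul_lap_sub (h : IsCrit α β F ψ u v) (hF : Cau 0 F) (hψ : Cau 2 ψ) (hu : Cau 2 u)
    (hv : Cau 2 v) : Nul 0 fun n => lap (ψ n) - F n - pot (ψ n) (u n) (v n) := by
  have hc : Cau 0 fun n => lap (ψ n) - F n - pot (ψ n) (u n) (v n) :=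
    ((hψ.dx.dx.add hψ.dy.dy).sub hF).sub ((cau_pot (k := 0) hψ hu hv).mono (Nat.zero_le _))
  refine nul_of_weakly hc fun η => ?_
  refine (h.eq_ψ (dsolve η) (isDir_dsolve η)).congr fun n => ?_
  have hd := isDir_dsolve η
  have e1 : intD (pot (ψ n) (u n) (v n) * η) =
      intD (dx (cur2 (ψ n) (u n) (v n)) * dsolve η) - intD (dy (cur1 (ψ n) (u n) (v n)) * dsolve η) := by
    conv_lhs => rw [← lap_dsolve η]
    rw [pot, intD_dir_lap (isDir_dsolve _) hd, lap_dsolve, sub_mul, intD_sub]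
  have e2 : ∀ j, intD (dx j * dsolve η) = -intD (j * dx (dsolve η)) := fun j => by
    have := intD_dx (dsolve η * j)
    rw [show xx * (dsolve η * j) = dsolve η * (xx * j) by ring, circ_dir_mul hd, dx_mul, intD_add]
      at this
    rw [mul_comm (dx j), mul_comm j]; linarith
  have e3 : ∀ j, intD (dy j * dsolve η) = -intD (j * dy (dsolve η)) := fun j => by
    have := intD_dy (dsolve η * j)
    rw [show yy * (dsolve η * j) = dsolve η * (yy * j) by ring, circ_dir_mul hd, dy_mul, intD_add]
      at this
    rw [mul_comm (dy j), mul_comm j]; linarith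
  rw [lap_dsolve, sub_mul _ (pot _ _ _), intD_sub, e1, e2, e3, mul_neg, intD_neg]
  ring

lemma Nul.dsolve_sub {p : ℕ → Poly} (hd : ∀ n, IsDir (ψ n)) (h : Nul 0 fun n => lap (ψ n) - p n) :
    Nul 2 fun n => dsolve (p n) - ψ n := by
  obtain ⟨K, hK0, hK⟩ := Bd_N_dsolve 0
  refine h.bd ⟨K, hK0, fun n => ?_⟩
  conv_lhs => rw [← dsolve_lap (hd n), ← DiskGL.dsolve_sub, ← N_neg, ← neg_sub]
  have := hK (p n - lap (ψ n))
  rw [← N_neg 0, neg_sub] at this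
  rwa [neg_sub, N_neg]

lemma IsCrit.improve_potential (h : IsCrit α β F ψ u v) (hF : Cau (k + 2) F) (hψ : Cau (k + 2) ψ)
    (hu : Cau (k + 2) u) (hv : Cau (k + 2) v) : ∃ ψ', Cau (k + 4) ψ' ∧ Close ψ u v ψ' u v ∧
      IsCrit α β F ψ' u v := by
  have z : 2 ≤ k + 2 := by omega
  have h1 := h.nul_lap_sub (hF.mono (by omega)) (hψ.mono z) (hu.mono z) (hv.mono z)
  have hc : Close ψ u v (fun n => dsolve (F n + pot (ψ n) (u n) (v n))) u v :=
    ⟨Nul.dsolve_sub h.dir (by simpa [sub_sub] using h1), by simp [Nul], by simp [Nul]⟩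
  exact ⟨_, (hF.add (cau_pot hψ hu hv)).dsolve, hc, h.transfer (hψ.mono z) (hu.mono (by omega))
    (hv.mono (by omega)) hc fun n => isDir_dsolve _⟩

lemma nul_neu_sub {g : ℕ → Poly} (hg : Cau 0 g) (hu : Cau 1 u)
    (h : ∀ η, Tendsto (fun n => intD (grad2 (u n) η) + intD (g n * η)) atTop (𝓝 0)) :
    Nul 1 fun n => nsolve (g n) + C (avg (u n)) - u n := by
  have hmean : ∀ g u, intD (nsolve g + C (avg u) - u) = 0 := fun g u => by
    have := intD_sub_avg u
    rw [intD_sub] at this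
    rw [intD_sub, intD_add, intD_nsolve]
    linarith
  refine (nul_of_coupled (b := fun _ => 0) (c := fun _ => 0) (e' := fun _ => 0) (fun n => ?_)
    (((hg.nsolve.add (hu.mono (Nat.zero_le _)).avg).mono (by norm_num)).sub hu) (cau_const 0)
    (fun n => hmean _ _) (by simp) (fun η h0 => ?_) (fun η h0 => ?_)).1
  · simp
  · have := (h η).neg
    rw [neg_zero] at this
    refine this.congr fun n => ?_
    rw [grad2_sub_left, grad2_add_C, intD_sub, intD_grad2_nsolve _ h0, adv_zero, zero_mul, intD_zero]
    ring
  · simp [adv, grad2]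

lemma IsCrit.improve_field (h : IsCrit α β F ψ u v) (hψ : Cau (k + 3) ψ)
    (hu : Cau (k + 2) u) (hv : Cau (k + 2) v) : ∃ u' v', Cau (k + 3) u' ∧ Cau (k + 3) v' ∧
      (∀ n, IsNeu (u' n)) ∧ (∀ n, IsNeu (v' n)) ∧ Close ψ u v ψ u' v' ∧ IsCrit α β F ψ u' v' := by
  have hgu := cau_gl (α := α) (β := β) hψ hu hv
  have hgv := cau_gl (α := α) (β := β) hψ hv hu.neg
  have o : 1 ≤ k + 2 := by omega
  have hc : Close ψ u v ψ (fun n => nsolve (gl α β (ψ n) (u n) (v n)) + C (avg (u n)))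
      (fun n => nsolve (gl α β (ψ n) (v n) (-u n)) + C (avg (v n))) :=
    ⟨by simp [Nul], nul_neu_sub (hgu.mono (Nat.zero_le _)) (hu.mono o) h.eq_u,
      nul_neu_sub (hgv.mono (Nat.zero_le _)) (hv.mono o) h.eq_v⟩
  exact ⟨_, _, hgu.nsolve.add (hu.mono (Nat.zero_le _)).avg, hgv.nsolve.add (hv.mono (Nat.zero_le _)).avg,
    fun n => isNeu_add_C (isNeu_nsolve _) _, fun n => isNeu_add_C (isNeu_nsolve _) _, hc,
    h.transfer (hψ.mono (by omega)) (hu.mono o) (hv.mono o) hc h.dir⟩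

lemma IsCrit.start (h : IsCrit α β F ψ u v) (hψ : Cau 2 ψ) (hu : Cau 1 u) (hv : Cau 1 v)
    {ε : ℝ} (hε : ∀ b c u v f f' : ℕ → Poly,
      (∀ n, N 1 (b n) + N 1 (c n) ≤ ε) → Cau 1 b → Cau 1 c → Cau 1 u → Cau 1 v →
      Cau 0 f → Cau 0 f' →
      (∀ η, Tendsto (fun n => intD (grad2 (u n) η) +
        intD ((adv (b n) (c n) (v n) + f n) * η)) atTop (𝓝 0)) →
      (∀ η, Tendsto (fun n => intD (grad2 (v n) η) +
        intD ((adv (b n) (c n) (-u n) + f' n) * η)) atTop (𝓝 0)) →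
      ∃ w w' : ℕ → Poly, (∀ n, IsNeu (w n)) ∧ (∀ n, IsNeu (w' n)) ∧ Cau 2 w ∧ Cau 2 w' ∧
        Nul 1 (fun n => w n - u n) ∧ Nul 1 (fun n => w' n - v n))
    (hs : ∀ n, N 2 (ψ n - ψ 0) ≤ ε) :
    ∃ u' v', Cau 2 u' ∧ Cau 2 v' ∧ Close ψ u v ψ u' v' ∧ IsCrit α β F ψ u' v' := by
  set b : ℕ → Poly := fun n => -dy (ψ n - ψ 0)
  set c : ℕ → Poly := fun n => dx (ψ n - ψ 0)
  have hfix : ∀ {w : ℕ → Poly}, Cau 1 w → Cau 0 fun n => adv (-dy (ψ 0)) (dx (ψ 0)) (w n) := by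
    intro w hw
    have m : ∀ a : Poly, ∃ K, 0 ≤ K ∧ ∀ p, N 0 (a * p) ≤ K * N 0 p := Bd_N_mul 0
    have m' : ∀ (a : Poly) {p : ℕ → Poly}, Cau 0 p → Cau 0 fun n => a * p n := fun a p hp => by
      obtain ⟨K, hK0, hK⟩ := m a
      exact hp.bd ⟨K, hK0, fun i j => by rw [← mul_sub]; exact hK _⟩
    exact m' 2 ((m' _ hw.dx).add (m' _ hw.dy))
  have hadv : ∀ n w, adv (b n) (c n) w + adv (-dy (ψ 0)) (dx (ψ 0)) w =
      adv (-dy (ψ n)) (dx (ψ n)) w := fun n w => by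
    simp only [b, c, adv, dx_sub, dy_sub]; ring
  obtain ⟨w, w', -, -, hw, hw', h1, h2⟩ := hε b c u v
    (fun n => adv (-dy (ψ 0)) (dx (ψ 0)) (v n) + rest α β (ψ n) (u n) (v n))
    (fun n => adv (-dy (ψ 0)) (dx (ψ 0)) (-u n) + rest α β (ψ n) (v n) (-u n))
    (fun n => by
      have := N_dx_le_two (ψ n - ψ 0)
      simp only [b, c, N_neg]
      linarith [hs n])
    (hψ.sub (cau_const _)).dy.neg (hψ.sub (cau_const _)).dx hu hv
    ((hfix hv).add (cau_rest_zero hψ hu hv)) ((hfix hu.neg).add (cau_rest_zero hψ hv hu.neg))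
    (fun η => (h.eq_u η).congr fun n => by rw [← add_assoc, hadv n _, gl])
    (fun η => (h.eq_v η).congr fun n => by rw [← add_assoc, hadv n _, gl])
  have hc : Close ψ u v ψ w w' := ⟨by simp [Nul], h1, h2⟩
  exact ⟨w, w', hw, hw', hc, h.transfer hψ hu hv hc h.dir⟩

/-- Regularity: asymptotically critical sequences are close to sequences that converge in every
Sobolev norm. -/
theorem IsCrit.regularity (h : IsCrit α β F ψ u v) (hF : ∀ k, Cau k F) (hψ : Cau 2 ψ) (hu : Cau 1 u)
    (hv : Cau 1 v) : ∃ M, ∀ k, ∃ ψ' u' v', Cau (k + 3) ψ' ∧ Cau (k + 3) u' ∧ Cau (k + 3) v' ∧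
      (∀ n, IsNeu (u' n)) ∧ (∀ n, IsNeu (v' n)) ∧
      Close (fun n => ψ (n + M)) (fun n => u (n + M)) (fun n => v (n + M)) ψ' u' v' ∧
      IsCrit α β (fun n => F (n + M)) ψ' u' v' := by
  obtain ⟨ε, hε0, hε⟩ := exists_coupled_solution
  obtain ⟨M, hM⟩ := hψ ε hε0
  have hm : StrictMono fun n => n + M := fun a b h => by simpa using h
  have ht := hm.tendsto_atTop
  have hs : IsCrit α β (fun n => F (n + M)) (fun n => ψ (n + M)) (fun n => u (n + M))
      (fun n => v (n + M)) := ⟨fun n => h.dir _, fun η => (h.eq_u η).comp ht,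
    fun η => (h.eq_v η).comp ht, fun χ hχ => (h.eq_ψ χ hχ).comp ht⟩
  have hF' : ∀ k, Cau k fun n => F (n + M) := fun k => (hF k).comp hm
  refine ⟨M, fun k => ?_⟩
  obtain ⟨u₁, v₁, hu₁, hv₁, hc₁, hs₁⟩ := hs.start (hψ.comp hm) (hu.comp hm) (hv.comp hm) hε
    fun n => (hM _ (by omega) _ (by omega)).le
  have step : ∀ k ψ' u' v', Cau (k + 2) ψ' → Cau (k + 2) u' → Cau (k + 2) v' →
      Close (fun n => ψ (n + M)) (fun n => u (n + M)) (fun n => v (n + M)) ψ' u' v' →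
      IsCrit α β (fun n => F (n + M)) ψ' u' v' → ∃ ψ' u' v', Cau (k + 3) ψ' ∧ Cau (k + 3) u' ∧
        Cau (k + 3) v' ∧ (∀ n, IsNeu (u' n)) ∧ (∀ n, IsNeu (v' n)) ∧
        Close (fun n => ψ (n + M)) (fun n => u (n + M)) (fun n => v (n + M)) ψ' u' v' ∧
        IsCrit α β (fun n => F (n + M)) ψ' u' v' := by
    intro k ψ' u' v' a1 a2 a3 a4 a5
    obtain ⟨ψ'', b1, b2, b3⟩ := a5.improve_potential (hF' _) a1 a2 a3
    obtain ⟨u'', v'', c1, c2, c3, c4, c5, c6⟩ := b3.improve_field (b1.mono (by omega)) a2 a3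
    exact ⟨ψ'', u'', v'', b1.mono (by omega), c1, c2, c3, c4, (a4.trans b2).trans c5, c6⟩
  induction k with
  | zero => exact step 0 _ _ _ (hψ.comp hm) hu₁ hv₁ hc₁ hs₁
  | succ k ih =>
    obtain ⟨ψ', u', v', a1, a2, a3, -, -, a4, a5⟩ := ih
    exact step (k + 1) _ _ _ a1 a2 a3 a4 a5

end

section smooth
variable {g : ℝ × ℝ → ℝ}

lemma contDiff_pd1 {E : Type*} [NormedAddCommGroup E] [NormedSpace ℝ E] {g : ℝ × ℝ → E}
    (hg : ContDiff ℝ (⊤ : ℕ∞) g) : ContDiff ℝ (⊤ : ℕ∞) (pd1 g) :=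
  (hg.fderiv_right (m := (⊤ : ℕ∞)) (by simp)).clm_apply contDiff_const

lemma contDiff_pd2 {E : Type*} [NormedAddCommGroup E] [NormedSpace ℝ E] {g : ℝ × ℝ → E}
    (hg : ContDiff ℝ (⊤ : ℕ∞) g) : ContDiff ℝ (⊤ : ℕ∞) (pd2 g) :=
  (hg.fderiv_right (m := (⊤ : ℕ∞)) (by simp)).clm_apply contDiff_const

lemma hasFDerivAt_pd {z : ℝ × ℝ} (hg : DifferentiableAt ℝ g z) :
    HasFDerivAt g (pd1 g z • ContinuousLinearMap.fst ℝ ℝ ℝ +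
      pd2 g z • ContinuousLinearMap.snd ℝ ℝ ℝ) z := by
  refine hg.hasFDerivAt.congr_fderiv (ContinuousLinearMap.ext fun v => ?_)
  have : v = v.1 • ((1 : ℝ), (0 : ℝ)) + v.2 • ((0 : ℝ), (1 : ℝ)) := by ext <;> simp
  conv_lhs => rw [this, map_add, map_smul, map_smul]
  simp [pd1, pd2, mul_comm]

lemma differentiableAt_of_smooth {E : Type*} [NormedAddCommGroup E] [NormedSpace ℝ E]
    {g : ℝ × ℝ → E} (hg : ContDiff ℝ (⊤ : ℕ∞) g) (z : ℝ × ℝ) : DifferentiableAt ℝ g z :=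
  (hg.differentiable (by simp)).differentiableAt

lemma hasFDerivAt_mul_ev (hg : ContDiff ℝ (⊤ : ℕ∞) g) (b : Poly) (z : ℝ × ℝ) :
    HasFDerivAt (fun z => g z * ev b z)
      ((g z * ev (dx b) z + pd1 g z * ev b z) • ContinuousLinearMap.fst ℝ ℝ ℝ +
      (g z * ev (dy b) z + pd2 g z * ev b z) • ContinuousLinearMap.snd ℝ ℝ ℝ) z := by
  refine ((hasFDerivAt_pd (differentiableAt_of_smooth hg z)).mul
    (hasFDerivAt_ev b z)).congr_fderiv (ContinuousLinearMap.ext fun v => ?_)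
  simp; ring

lemma integral_mul_dx (hg : ContDiff ℝ (⊤ : ℕ∞) g) (b : Poly) :
    ∫ z in disk, g z * ev (dx b) z = (∫ t in (-Real.pi)..Real.pi,
      Real.cos t * (g (Real.cos t, Real.sin t) * ev b (Real.cos t, Real.sin t))) -
      ∫ z in disk, pd1 g z * ev b z := by
  have c := hg.continuous
  have c1 := (contDiff_pd1 hg).continuous
  have c2 := (contDiff_pd2 hg).continuous
  have := integral_partial_fst (hasFDerivAt_mul_ev hg b) (by fun_prop) (by fun_prop)
  rw [integral_add (integrable_disk (by fun_prop)) (integrable_disk (by fun_prop))] at this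
  linarith

lemma integral_mul_dy (hg : ContDiff ℝ (⊤ : ℕ∞) g) (b : Poly) :
    ∫ z in disk, g z * ev (dy b) z = (∫ t in (-Real.pi)..Real.pi,
      Real.sin t * (g (Real.cos t, Real.sin t) * ev b (Real.cos t, Real.sin t))) -
      ∫ z in disk, pd2 g z * ev b z := by
  have c := hg.continuous
  have c1 := (contDiff_pd1 hg).continuous
  have c2 := (contDiff_pd2 hg).continuous
  have := integral_partial_snd (hasFDerivAt_mul_ev hg b) (by fun_prop) (by fun_prop)
  rw [integral_add (integrable_disk (by fun_prop)) (integrable_disk (by fun_prop))] at this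
  linarith

/-- The angular derivative. -/
def ang (g : ℝ × ℝ → ℝ) : ℝ × ℝ → ℝ := fun z => z.1 * pd2 g z - z.2 * pd1 g z

lemma contDiff_ang (hg : ContDiff ℝ (⊤ : ℕ∞) g) : ContDiff ℝ (⊤ : ℕ∞) (ang g) :=
  (contDiff_fst.mul (contDiff_pd2 hg)).sub (contDiff_snd.mul (contDiff_pd1 hg))

lemma integral_mul_rot (hg : ContDiff ℝ (⊤ : ℕ∞) g) (b : Poly) :
    ∫ z in disk, g z * ev (rot b) z = -∫ z in disk, ang g z * ev b z := by
  have c := hg.continuous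
  have c1 := (contDiff_pd1 hg).continuous
  have c2 := (contDiff_pd2 hg).continuous
  have h1 := integral_mul_dx hg (yy * b)
  have h2 := integral_mul_dy hg (xx * b)
  have e : ∀ z, g z * ev (rot b) z = g z * ev (dy (xx * b)) z - g z * ev (dx (yy * b)) z := by
    intro z; simp [rot]; ring
  have e' : ∀ z, ang g z * ev b z = pd2 g z * ev (xx * b) z - pd1 g z * ev (yy * b) z := by
    intro z; simp [ang]; ring
  simp_rw [e, e']
  rw [integral_sub (integrable_disk (by fun_prop)) (integrable_disk (by fun_prop)),
    integral_sub (integrable_disk (by fun_prop)) (integrable_disk (by fun_prop)), h1, h2]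
  have : ∀ t, Real.sin t * (g (Real.cos t, Real.sin t) * ev (xx * b) (Real.cos t, Real.sin t)) =
    Real.cos t * (g (Real.cos t, Real.sin t) * ev (yy * b) (Real.cos t, Real.sin t)) := by
    intro t; simp; ring
  simp_rw [this]
  ring

/-- The second order operator `Lop` on smooth functions. -/
def lopS (g : ℝ × ℝ → ℝ) : ℝ × ℝ → ℝ := fun z => pd1 (fun z => ev bd z * pd1 g z) z +
  pd2 (fun z => ev bd z * pd2 g z) z + ang (ang g) z

lemma contDiff_lopS (hg : ContDiff ℝ (⊤ : ℕ∞) g) : ContDiff ℝ (⊤ : ℕ∞) (lopS g) :=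
  ((contDiff_pd1 ((contDiff_ev _).mul (contDiff_pd1 hg))).add
    (contDiff_pd2 ((contDiff_ev _).mul (contDiff_pd2 hg)))).add (contDiff_ang (contDiff_ang hg))

lemma Lop_eq_div (q : Poly) : Lop q = dx (bd * dx q) + dy (bd * dy q) + rot (rot q) := by
  simp only [Lop, lap, eul, rot, bd, rr]
  simp
  ring

lemma integral_mul_Lop (hg : ContDiff ℝ (⊤ : ℕ∞) g) (q : Poly) :
    ∫ z in disk, g z * ev (Lop q) z = ∫ z in disk, lopS g z * ev q z := by
  have b1 : ContDiff ℝ (⊤ : ℕ∞) fun z => ev bd z * pd1 g z := (contDiff_ev _).mul (contDiff_pd1 hg)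
  have b2 : ContDiff ℝ (⊤ : ℕ∞) fun z => ev bd z * pd2 g z := (contDiff_ev _).mul (contDiff_pd2 hg)
  have c := hg.continuous
  have c1 := (contDiff_pd1 b1).continuous
  have c2 := (contDiff_pd2 b2).continuous
  have c3 := (contDiff_ang (contDiff_ang hg)).continuous
  have h1 := integral_mul_dx hg (bd * dx q)
  have h2 := integral_mul_dy hg (bd * dy q)
  have h3 := integral_mul_rot hg (rot q)
  rw [integral_mul_rot (contDiff_ang hg), neg_neg] at h3
  have h4 := integral_mul_dx b1 q
  have h5 := integral_mul_dy b2 q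
  have e1 : ∀ z, pd1 g z * ev (bd * dx q) z = ev bd z * pd1 g z * ev (dx q) z := by
    intro z; simp; ring
  have e2 : ∀ z, pd2 g z * ev (bd * dy q) z = ev bd z * pd2 g z * ev (dy q) z := by
    intro z; simp; ring
  have hb : ∀ t : ℝ, ev bd (Real.cos t, Real.sin t) = 0 := by intro t; simp [bd, rr]
  simp_rw [e1, ev_mul bd, hb] at h1
  simp_rw [e2, ev_mul bd, hb] at h2
  simp only [hb] at h4 h5
  simp only [zero_mul, mul_zero, intervalIntegral.integral_zero, zero_sub] at h1 h2 h4 h5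
  simp_rw [Lop_eq_div, lopS, ev_add, mul_add, add_mul]
  rw [integral_add (integrable_disk (by fun_prop)) (integrable_disk (by fun_prop)),
    integral_add (integrable_disk (by fun_prop)) (integrable_disk (by fun_prop)),
    integral_add (integrable_disk (by fun_prop)) (integrable_disk (by fun_prop)),
    integral_add (integrable_disk (by fun_prop)) (integrable_disk (by fun_prop)), h1, h2, h3, h4, h5]
  ring

end smooth

/-- Square integrable functions with rapidly decaying expansion in orthogonal polynomials. -/
def Rapid (f : L2D) : Prop := ∀ k : ℕ, ∃ C, ∀ n q, q ∈ Pd (n + 1) → Orth n q →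
  ((n : ℝ) + 1) ^ k * |inner ℝ f (ι q)| ≤ C * nrm q

lemma rapid_of_pow {f : L2D} (h : ∀ k : ℕ, ∃ C, ∀ n q, q ∈ Pd (n + 1) → Orth n q →
    ((n : ℝ) * (n + 2)) ^ k * |inner ℝ f (ι q)| ≤ C * nrm q) : Rapid f := fun k => by
  obtain ⟨c, hc⟩ := h k
  refine ⟨max ‖f‖ c, fun n q hq ho => ?_⟩
  rcases n.eq_zero_or_pos with rfl | hn
  · simp only [Nat.cast_zero, zero_add, one_pow, one_mul]
    exact (abs_real_inner_le_norm _ _).trans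
      (mul_le_mul_of_nonneg_right (le_max_left _ _) (nrm_nonneg q))
  · refine le_trans (mul_le_mul_of_nonneg_right (pow_le_pow_left₀ (by positivity) ?_ k)
      (abs_nonneg _)) ((hc n q hq ho).trans
      (mul_le_mul_of_nonneg_right (le_max_right _ _) (nrm_nonneg q)))
    have : (1 : ℝ) ≤ n := by exact_mod_cast hn
    nlinarith

lemma rapid_emb {g : ℝ × ℝ → ℝ} (hg : ContDiff ℝ (⊤ : ℕ∞) g) : Rapid (emb ⟨g, hg.continuous⟩) := by
  refine rapid_of_pow fun k => ?_
  induction k generalizing g with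
  | zero => exact ⟨‖emb ⟨g, hg.continuous⟩‖, fun n q _ _ => by
      simpa [nrm] using abs_real_inner_le_norm _ _⟩
  | succ k ih =>
    obtain ⟨c, hc⟩ := ih (contDiff_lopS hg)
    refine ⟨c, fun n q hq ho => (le_of_eq ?_).trans (hc n q hq ho)⟩
    have h := integral_mul_Lop hg q
    rw [Lop_eq hq ho] at h
    rw [inner_emb_ι, inner_emb_ι]
    simp only [ContinuousMap.coe_mk]
    rw [← h]
    have : ∀ z, g z * ev ((-(n * (n + 2)) : ℝ) • q) z = (-(n * (n + 2)) : ℝ) * (g z * ev q z) := by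
      intro z; simp; ring
    simp_rw [this]
    rw [integral_const_mul, abs_mul, abs_neg, abs_of_nonneg (by positivity : (0:ℝ) ≤ n * (n + 2))]
    ring

lemma Cau.Lop {k : ℕ} {p : ℕ → Poly} (hp : Cau (k + 2) p) : Cau k fun n => DiskGL.Lop (p n) := by
  have he : ∀ {j} {p : ℕ → Poly}, Cau (j + 1) p → Cau j fun n => eul (p n) := fun {j} {p} h => by
    have m : ∀ (a : Poly) {p : ℕ → Poly}, Cau j p → Cau j fun n => a * p n := fun a p hp => by
      obtain ⟨K, hK0, hK⟩ := Bd_N_mul j a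
      exact hp.bd ⟨K, hK0, fun i j => by rw [← mul_sub]; exact hK _⟩
    exact (m _ h.dx).add (m _ h.dy)
  have h2 := he (hp.mono (Nat.le_succ _))
  refine (((hp.dx.dx.add hp.dy.dy).sub (he (he hp))).sub (h2.add h2)).congr ?_
  simp [DiskGL.Lop, lap, two_mul, Nul]

lemma exists_pow_mul_abs_intD_le (k : ℕ) {p : ℕ → Poly} (hp : Cau (2 * k) p) : ∃ C, ∀ m n q,
    q ∈ Pd (n + 1) → Orth n q → ((n : ℝ) * (n + 2)) ^ k * |intD (p m * q)| ≤ C * nrm q := by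
  induction k generalizing p with
  | zero =>
    obtain ⟨c, hc⟩ := hp.bounded
    exact ⟨c, fun m n q _ _ => by
      simpa using (abs_intD_mul_le _ _).trans
        (mul_le_mul_of_nonneg_right (hc.2 m) (nrm_nonneg q))⟩
  | succ k ih =>
    obtain ⟨c, hc⟩ := ih (hp.Lop (k := 2 * k))
    refine ⟨c, fun m n q hq ho => (le_of_eq ?_).trans (hc m n q hq ho)⟩
    rw [Lop_symm, Lop_eq hq ho, mul_smul_comm, intD_smul, abs_mul, abs_neg,
      abs_of_nonneg (by positivity : (0:ℝ) ≤ n * (n + 2))]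
    ring

lemma rapid_of_cau {f : L2D} (h : ∀ k, ∃ p : ℕ → Poly, Cau k p ∧
    Tendsto (fun n => ι (p n)) atTop (𝓝 f)) : Rapid f := by
  refine rapid_of_pow fun k => ?_
  obtain ⟨p, hp, hf⟩ := h (2 * k)
  obtain ⟨c, hc⟩ := exists_pow_mul_abs_intD_le k hp
  refine ⟨c, fun n q hq ho => ?_⟩
  have ht : Tendsto (fun m => ((n : ℝ) * (n + 2)) ^ k * |intD (p m * q)|) atTop
      (𝓝 (((n : ℝ) * (n + 2)) ^ k * |inner ℝ f (ι q)|)) := by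
    simp_rw [← inner_ι]
    exact ((hf.inner tendsto_const_nhds).abs).const_mul _
  exact le_of_tendsto' ht fun m => hc m n q hq ho

/-- Growth of polynomials just outside of the disk. -/
lemma exists_growth (d : ℕ) : ∃ K, 0 ≤ K ∧ ∀ (n : ℕ) (r : Poly) (z : ℝ × ℝ), r ∈ Pd (n + d) →
    ((n : ℝ) + 1) ^ 2 * (z.1 ^ 2 + z.2 ^ 2 - 1) ≤ 1 → |ev r z| ≤ K * N 2 r := by
  have hcS := cS_nonneg
  refine ⟨cS * Real.cosh (d + 1), by positivity, fun n r z hr hz => ?_⟩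
  have h1c := Real.one_le_cosh (d + 1)
  by_cases hd : z ∈ disk
  · exact (abs_ev_le_N _ hd).trans (by
      rw [mul_right_comm]; exact le_mul_of_one_le_right (mul_nonneg hcS (N_nonneg _ _)) h1c)
  have hz1 : 1 < z.1 ^ 2 + z.2 ^ 2 := not_le.1 hd
  set ρ := √(z.1 ^ 2 + z.2 ^ 2) with hρ
  have hρ2 : ρ ^ 2 = z.1 ^ 2 + z.2 ^ 2 := Real.sq_sqrt (by positivity)
  have hρ1 : 1 ≤ ρ := Real.one_le_sqrt.2 hz1.le
  have hρ0 : ρ ≠ 0 := by positivity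
  let P : Polynomial ℝ := aeval (![Polynomial.C (z.1 / ρ) * Polynomial.X,
    Polynomial.C (z.2 / ρ) * Polynomial.X] : Fin 2 → Polynomial ℝ) r
  have hP : ∀ t, P.eval t = ev r (z.1 / ρ * t, z.2 / ρ * t) := fun t => by
    have : (Polynomial.evalRingHom t).comp (aeval (![Polynomial.C (z.1 / ρ) * Polynomial.X,
        Polynomial.C (z.2 / ρ) * Polynomial.X] : Fin 2 → Polynomial ℝ) : Poly →ₐ[ℝ] _).toRingHom =
        eval ![z.1 / ρ * t, z.2 / ρ * t] := by
      refine MvPolynomial.ringHom_ext (fun a => by simp) fun i => ?_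
      fin_cases i <;> simp
    exact congrArg (fun f : Poly →+* ℝ => f r) this
  have hdeg : P.degree ≤ ((n + d : ℕ) : WithBot ℕ) := by
    refine Polynomial.degree_le_of_natDegree_le ?_
    refine (aeval_natDegree_le (m := n + d) (n := 1) r ?_ _ fun i => ?_).trans (by simp)
    · refine Finset.sup_le fun m hm => ?_
      by_contra hlt
      refine (mem_support_iff.1 hm) (mem_Pd.1 hr m ?_)
      rw [Finsupp.degree_apply]
      exact (not_le.1 hlt).le
    · fin_cases i <;> exact (Polynomial.natDegree_C_mul_le _ _).trans Polynomial.natDegree_X_le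
  have hbd : ∀ t ∈ Icc (-1 : ℝ) 1, |P.eval t| ≤ cS * N 2 r := fun t ht => by
    rw [hP]
    refine abs_ev_le_N _ ?_
    change (z.1 / ρ * t) ^ 2 + (z.2 / ρ * t) ^ 2 ≤ 1
    have : (z.1 / ρ * t) ^ 2 + (z.2 / ρ * t) ^ 2 = t ^ 2 := by
      have : (z.1 / ρ * t) ^ 2 + (z.2 / ρ * t) ^ 2 = (z.1 ^ 2 + z.2 ^ 2) / ρ ^ 2 * t ^ 2 := by
        field_simp
      rw [this, hρ2, div_self (by positivity), one_mul]
    rw [this]; nlinarith [ht.1, ht.2]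
  have hev : P.eval ρ = ev r z := by
    rw [hP, div_mul_cancel₀ _ hρ0, div_mul_cancel₀ _ hρ0]
  set θ := Real.arcosh ρ
  have hθ : Real.cosh θ = ρ := Real.cosh_arcosh hρ1
  have hθ0 : 0 ≤ θ := Real.arcosh_nonneg hρ1
  have hn : (0:ℝ) < (n:ℝ) + 1 := by positivity
  have hθ1 : θ ≤ 1 / (n + 1) := by
    have h1 : ρ ^ 2 ≤ Real.cosh (1 / (n + 1)) ^ 2 := by
      have h2 : (1:ℝ) / (n + 1) ≤ Real.sinh (1 / (n + 1)) := Real.self_le_sinh_iff.2 (by positivity)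
      have h3 : (1 / ((n:ℝ) + 1)) ^ 2 ≤ Real.sinh (1 / (n + 1)) ^ 2 :=
        pow_le_pow_left₀ (by positivity) h2 2
      have h4 : z.1 ^ 2 + z.2 ^ 2 - 1 ≤ (1 / ((n:ℝ) + 1)) ^ 2 := by
        rw [div_pow, one_pow, le_div_iff₀ (by positivity)]; linarith
      rw [Real.cosh_sq, hρ2]; linarith
    have h2 : Real.cosh θ ≤ Real.cosh (1 / (n + 1)) := by
      rw [hθ]; exact (sq_le_sq₀ (by positivity) (Real.cosh_pos _).le).1 h1
    rw [Real.cosh_le_cosh, abs_of_nonneg hθ0, abs_of_nonneg (by positivity)] at h2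
    exact h2
  have hT : (Polynomial.Chebyshev.T ℝ (n + d : ℕ)).eval ρ ≤ Real.cosh (d + 1) := by
    rw [← hθ, Polynomial.Chebyshev.T_real_cosh, Real.cosh_le_cosh, abs_of_nonneg (by positivity),
      abs_of_nonneg (by positivity)]
    have : ((n + d : ℕ) : ℝ) * θ ≤ ((n + d : ℕ) : ℝ) * (1 / (n + 1)) :=
      mul_le_mul_of_nonneg_left hθ1 (by positivity)
    refine le_trans (by exact_mod_cast this) ?_
    push_cast
    rw [mul_one_div, div_le_iff₀ hn]
    nlinarith [n.cast_nonneg (α := ℝ), d.cast_nonneg (α := ℝ), mul_nonneg (n.cast_nonneg (α := ℝ)) (d.cast_nonneg (α := ℝ))]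
  rcases (mul_nonneg hcS (N_nonneg 2 r)).eq_or_lt with h0 | hpos
  · have hz : P = 0 := by
      refine Polynomial.eq_zero_of_infinite_isRoot _ (Set.Infinite.mono (s := Icc (-1:ℝ) 1) ?_
        (Icc_infinite (by norm_num)))
      intro t ht
      have := hbd t ht
      rw [← h0] at this
      exact abs_nonpos_iff.1 this
    rw [← hev, hz]; simp only [Polynomial.eval_zero, abs_zero]
    exact mul_nonneg (by positivity) (N_nonneg _ _)
  · have main : ∀ Q : Polynomial ℝ, Q.degree ≤ ((n + d : ℕ) : WithBot ℕ) →
        (∀ t ∈ Icc (-1 : ℝ) 1, |Q.eval t| ≤ cS * N 2 r) →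
        Q.eval ρ ≤ cS * Real.cosh (d + 1) * N 2 r := fun Q hQ hb => by
      have := Polynomial.Chebyshev.eval_iterate_derivative_le_of_forall_abs_le_one (k := 0)
        (P := Polynomial.C (cS * N 2 r)⁻¹ * Q) hρ1 ((Polynomial.degree_C_mul (inv_ne_zero hpos.ne')).trans_le hQ)
        fun t ht => by
          rw [Polynomial.eval_mul, Polynomial.eval_C, abs_mul, abs_inv, abs_of_pos hpos,
            inv_mul_le_iff₀ hpos, mul_one]
          exact hb t ht
      simp only [Function.iterate_zero, id, Polynomial.eval_mul, Polynomial.eval_C] at this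
      rw [inv_mul_le_iff₀ hpos] at this
      calc _ ≤ _ := this
        _ ≤ cS * N 2 r * Real.cosh (d + 1) := mul_le_mul_of_nonneg_left hT hpos.le
        _ = _ := by ring
    rw [← hev]
    refine abs_le.2 ⟨?_, main P hdeg hbd⟩
    have := main (-P) (by rwa [Polynomial.degree_neg]) fun t ht => by
      rw [Polynomial.eval_neg, abs_neg]; exact hbd t ht
    rw [Polynomial.eval_neg] at this
    linarith

/-- A smooth cutoff function and its derivatives. -/
lemma exists_cutoff : ∃ ρ : ℕ → ℝ → ℝ, (∀ j s, HasDerivAt (ρ j) (ρ (j + 1) s) s) ∧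
    (∀ s ≤ 0, ρ 0 s = 1) ∧ (∀ j, ∀ s ≤ 0, ρ (j + 1) s = 0) ∧ (∀ j, ∀ s ≥ 1, ρ j s = 0) ∧
    ∀ j, ∃ C, 0 ≤ C ∧ ∀ s, |ρ j s| ≤ C := by
  let χ : ℝ → ℝ := fun s => Real.smoothTransition (1 - s)
  have hχ : ContDiff ℝ (⊤ : ℕ∞) χ := Real.smoothTransition.contDiff.comp (by fun_prop)
  have hd : ∀ j s, HasDerivAt (iteratedDeriv j χ) (iteratedDeriv (j + 1) χ s) s := fun j s => by
    rw [iteratedDeriv_succ]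
    exact ((hχ.differentiable_iteratedDeriv j (by exact_mod_cast WithTop.coe_lt_top _)).differentiableAt).hasDerivAt
  have h0 : ∀ s ≤ 0, iteratedDeriv 0 χ s = 1 := fun s hs => by
    simp only [iteratedDeriv_zero, χ]
    exact Real.smoothTransition.one_of_one_le (by linarith)
  have hconst : ∀ (S : Set ℝ) (_ : UniqueDiffOn ℝ S) (j : ℕ) (c : ℝ)
      (_ : ∀ s ∈ S, iteratedDeriv j χ s = c), ∀ s ∈ S, iteratedDeriv (j + 1) χ s = 0 :=
    fun S hS j c hc s hs => (hS s hs).eq_deriv _ (hd j s).hasDerivWithinAt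
      ((hasDerivWithinAt_const s S c).congr hc (hc s hs))
  have h1 : ∀ j, ∀ s ∈ Iic (0:ℝ), iteratedDeriv (j + 1) χ s = 0 := fun j => by
    induction j with
    | zero => exact hconst _ (uniqueDiffOn_Iic _) 0 1 h0
    | succ j ih => exact hconst _ (uniqueDiffOn_Iic _) _ 0 ih
  have h2 : ∀ j, ∀ s ∈ Ici (1:ℝ), iteratedDeriv j χ s = 0 := fun j => by
    induction j with
    | zero =>
      intro s hs
      simp only [iteratedDeriv_zero, χ]
      exact Real.smoothTransition.zero_of_nonpos (by linarith [mem_Ici.1 hs])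
    | succ j ih => exact hconst _ (uniqueDiffOn_Ici _) _ 0 ih
  refine ⟨fun j => iteratedDeriv j χ, hd, h0, h1, h2, fun j => ?_⟩
  have hc : Continuous (iteratedDeriv j χ) :=
    continuous_iff_continuousAt.2 fun s => (hd j s).continuousAt
  obtain ⟨C, hC⟩ := (isCompact_Icc (a := (0:ℝ)) (b := 1)).exists_bound_of_continuousOn hc.continuousOn
  refine ⟨max 1 C, by positivity, fun s => ?_⟩
  change |iteratedDeriv j χ s| ≤ _
  rcases le_total s 0 with hs | hs
  · cases j with
    | zero => rw [h0 s hs]; simp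
    | succ j => rw [h1 j s hs]; simp
  rcases le_total 1 s with hs' | hs'
  · rw [h2 j s hs']; simp
  · exact (hC s ⟨hs, hs'⟩).trans (le_max_right _ _)

/-- Rapidly decaying sequences of polynomials of linearly growing degree. -/
def RapidSeq (r : ℕ → Poly) : Prop := (∃ d, ∀ n, r n ∈ Pd (n + d)) ∧
  ∀ k j : ℕ, ∃ C, 0 ≤ C ∧ ∀ n : ℕ, ((n : ℝ) + 1) ^ k * N j (r n) ≤ C

namespace RapidSeq
variable {r s : ℕ → Poly}

lemma of_nrm {d : ℕ} (hd : ∀ n, r n ∈ Pd (n + d))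
    (h : ∀ k : ℕ, ∃ C, ∀ n : ℕ, ((n : ℝ) + 1) ^ k * nrm (r n) ≤ C) : RapidSeq r := by
  refine ⟨⟨d, hd⟩, fun k j => ?_⟩
  obtain ⟨C, hC⟩ := h (k + 2 * j)
  have hC0 : 0 ≤ C := le_trans (mul_nonneg (by positivity) (nrm_nonneg _)) (hC 0)
  refine ⟨(3 * (d + 2) ^ 2) ^ j * C, by positivity, fun n => ?_⟩
  have h1 := N_le_of_mem_Pd j (hd n)
  have h2 : ((3:ℝ) * (((n + d : ℕ) : ℝ) + 2) ^ 2) ^ j ≤ (3 * ((d:ℝ) + 2) ^ 2) ^ j * ((n:ℝ) + 1) ^ (2 * j) := by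
    rw [pow_mul, ← mul_pow]
    refine pow_le_pow_left₀ (by positivity) ?_ j
    rw [mul_assoc, ← mul_pow]
    refine mul_le_mul_of_nonneg_left (pow_le_pow_left₀ (by positivity) ?_ 2) (by norm_num)
    push_cast
    nlinarith [mul_nonneg (n.cast_nonneg (α := ℝ)) (d.cast_nonneg (α := ℝ)), n.cast_nonneg (α := ℝ)]
  calc ((n:ℝ) + 1) ^ k * N j (r n)
      ≤ ((n:ℝ) + 1) ^ k * ((3 * ((d:ℝ) + 2) ^ 2) ^ j * ((n:ℝ) + 1) ^ (2 * j) * nrm (r n)) :=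
        mul_le_mul_of_nonneg_left (h1.trans (mul_le_mul_of_nonneg_right h2 (nrm_nonneg _)))
          (by positivity)
    _ = (3 * ((d:ℝ) + 2) ^ 2) ^ j * (((n:ℝ) + 1) ^ (k + 2 * j) * nrm (r n)) := by rw [pow_add]; ring
    _ ≤ _ := mul_le_mul_of_nonneg_left (hC n) (by positivity)

lemma dx (h : RapidSeq r) : RapidSeq fun n => DiskGL.dx (r n) := by
  obtain ⟨⟨d, hd⟩, h⟩ := h
  refine ⟨⟨d, fun n => dx_mem_Pd (Pd_mono (Nat.le_succ _) (hd n))⟩, fun k j => ?_⟩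
  obtain ⟨C, hC0, hC⟩ := h k (j + 1)
  exact ⟨C, hC0, fun n => (mul_le_mul_of_nonneg_left (N_dx j _) (by positivity)).trans (hC n)⟩

lemma dy (h : RapidSeq r) : RapidSeq fun n => DiskGL.dy (r n) := by
  obtain ⟨⟨d, hd⟩, h⟩ := h
  refine ⟨⟨d, fun n => dy_mem_Pd (Pd_mono (Nat.le_succ _) (hd n))⟩, fun k j => ?_⟩
  obtain ⟨C, hC0, hC⟩ := h k (j + 1)
  exact ⟨C, hC0, fun n => (mul_le_mul_of_nonneg_left (N_dy j _) (by positivity)).trans (hC n)⟩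

lemma mul (a : Poly) (h : RapidSeq r) : RapidSeq fun n => a * r n := by
  obtain ⟨⟨d, hd⟩, h⟩ := h
  refine ⟨⟨a.totalDegree + d + 1, fun n => ?_⟩, fun k j => ?_⟩
  · have := mul_mem_Pd (mem_Pd_totalDegree a) (Pd_mono (Nat.le_succ _) (hd n))
    exact Pd_mono (by omega) this
  · obtain ⟨C, hC0, hC⟩ := h k j
    obtain ⟨K, hK0, hK⟩ := Bd_N_mul j a
    refine ⟨K * C, by positivity, fun n => ?_⟩
    have := mul_le_mul_of_nonneg_left (hC n) hK0
    refine (mul_le_mul_of_nonneg_left (hK (r n)) (by positivity)).trans (le_of_eq_of_le ?_ this)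
    ring

lemma smul (h : RapidSeq r) : RapidSeq fun n => ((n : ℝ) + 1) ^ 2 • r n := by
  obtain ⟨⟨d, hd⟩, h⟩ := h
  refine ⟨⟨d, fun n => (Pd _).smul_mem _ (hd n)⟩, fun k j => ?_⟩
  obtain ⟨C, hC0, hC⟩ := h (k + 2) j
  refine ⟨C, hC0, fun n => (le_of_eq ?_).trans (hC n)⟩
  rw [N_smul, abs_of_nonneg (by positivity), pow_add]; ring

lemma bound (h : RapidSeq r) (j : ℕ) : ∃ u : ℕ → ℝ, Summable u ∧ ∀ n, N j (r n) ≤ u n := by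
  obtain ⟨C, hC0, hC⟩ := h.2 2 j
  refine ⟨fun n => C * (1 / ((n:ℝ) + 1) ^ 2), ?_, fun n => ?_⟩
  · have := (summable_nat_add_iff 1).2 (Real.summable_one_div_nat_pow (p := 2).2 (by norm_num))
    exact (this.congr fun n => by push_cast; rfl).mul_left C
  · change N j (r n) ≤ C * (1 / ((n:ℝ) + 1) ^ 2)
    rw [mul_one_div, le_div_iff₀ (by positivity), mul_comm]; exact hC n

end RapidSeq

/-- The derivatives of a smooth cutoff function. -/
def cut : ℕ → ℝ → ℝ := exists_cutoff.choose

lemma hasDerivAt_cut (j : ℕ) (s : ℝ) : HasDerivAt (cut j) (cut (j + 1) s) s :=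
  exists_cutoff.choose_spec.1 j s

lemma cut_zero {s : ℝ} (hs : s ≤ 0) : cut 0 s = 1 := exists_cutoff.choose_spec.2.1 s hs

lemma cut_eq_zero (j : ℕ) {s : ℝ} (hs : 1 ≤ s) : cut j s = 0 :=
  exists_cutoff.choose_spec.2.2.2.1 j s hs

lemma exists_abs_cut_le (j : ℕ) : ∃ C, 0 ≤ C ∧ ∀ s, |cut j s| ≤ C :=
  exists_cutoff.choose_spec.2.2.2.2 j

/-- The `n`-th polynomial of a sequence, cut off at distance about `n⁻²` from the disk. -/
def term (j : ℕ) (r : ℕ → Poly) (n : ℕ) (z : ℝ × ℝ) : ℝ :=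
  cut j (((n : ℝ) + 1) ^ 2 * (z.1 ^ 2 + z.2 ^ 2 - 1)) * ev (r n) z

lemma hasFDerivAt_term (j : ℕ) (r : ℕ → Poly) (n : ℕ) (z : ℝ × ℝ) : HasFDerivAt (term j r n)
    ((term (j + 1) (fun n => ((n : ℝ) + 1) ^ 2 • (2 * xx * r n)) n z + term j (fun n => dx (r n)) n z)
      • ContinuousLinearMap.fst ℝ ℝ ℝ +
    (term (j + 1) (fun n => ((n : ℝ) + 1) ^ 2 • (2 * yy * r n)) n z + term j (fun n => dy (r n)) n z)
      • ContinuousLinearMap.snd ℝ ℝ ℝ) z := by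
  have h1 := (hasFDerivAt_ev (rr - 1) z).const_mul (((n : ℝ) + 1) ^ 2)
  have h2 := (hasDerivAt_cut j (((n : ℝ) + 1) ^ 2 * ev (rr - 1) z)).comp_hasFDerivAt z h1
  have h3 := h2.mul (hasFDerivAt_ev (r n) z)
  have e : term j r n = fun z => cut j (((n : ℝ) + 1) ^ 2 * ev (rr - 1) z) * ev (r n) z := by
    ext z; simp [term, ev_rr]
  rw [e]
  refine h3.congr_fderiv ?_
  have e2 : z.1 ^ 2 + z.2 ^ 2 - 1 = ev (rr - 1) z := by simp [ev_rr]
  simp only [term, e2]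
  ext <;> simp [rr] <;> ring

lemma RapidSeq.abs_term_le {r : ℕ → Poly} (h : RapidSeq r) (j : ℕ) :
    ∃ u : ℕ → ℝ, Summable u ∧ ∀ n z, |term j r n z| ≤ u n := by
  obtain ⟨u, hu, hN⟩ := h.bound 2
  obtain ⟨⟨d, hd⟩, -⟩ := h
  obtain ⟨K, hK0, hK⟩ := exists_growth d
  obtain ⟨C, hC0, hC⟩ := exists_abs_cut_le j
  refine ⟨fun n => C * (K * u n), (hu.mul_left K).mul_left C, fun n z => ?_⟩
  have hun : 0 ≤ u n := (N_nonneg _ _).trans (hN n)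
  rcases le_total (((n : ℝ) + 1) ^ 2 * (z.1 ^ 2 + z.2 ^ 2 - 1)) 1 with hz | hz
  · rw [term, abs_mul]
    exact mul_le_mul (hC _) ((hK n _ z (hd n) hz).trans (mul_le_mul_of_nonneg_left (hN n) hK0))
      (abs_nonneg _) hC0
  · rw [term, cut_eq_zero j hz, zero_mul, abs_zero]
    positivity

lemma RapidSeq.summable_term {r : ℕ → Poly} (h : RapidSeq r) (j : ℕ) (z : ℝ × ℝ) :
    Summable fun n => term j r n z := by
  obtain ⟨u, hu, hb⟩ := h.abs_term_le j
  exact hu.of_norm_bounded fun n => hb n z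

lemma RapidSeq.hasFDerivAt_tsum_term {r : ℕ → Poly} (h : RapidSeq r) (j : ℕ) (z : ℝ × ℝ) :
    HasFDerivAt (fun z => ∑' n, term j r n z)
      (((∑' n, term (j + 1) (fun n => ((n : ℝ) + 1) ^ 2 • (2 * xx * r n)) n z) +
          ∑' n, term j (fun n => DiskGL.dx (r n)) n z) • ContinuousLinearMap.fst ℝ ℝ ℝ +
        ((∑' n, term (j + 1) (fun n => ((n : ℝ) + 1) ^ 2 • (2 * yy * r n)) n z) +
          ∑' n, term j (fun n => DiskGL.dy (r n)) n z) • ContinuousLinearMap.snd ℝ ℝ ℝ) z := by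
  have hx := (h.mul (2 * xx)).smul
  have hy := (h.mul (2 * yy)).smul
  obtain ⟨u1, hu1, hb1⟩ := hx.abs_term_le (j + 1)
  obtain ⟨u2, hu2, hb2⟩ := h.dx.abs_term_le j
  obtain ⟨u3, hu3, hb3⟩ := hy.abs_term_le (j + 1)
  obtain ⟨u4, hu4, hb4⟩ := h.dy.abs_term_le j
  have key := hasFDerivAt_tsum ((hu1.add hu2).add (hu3.add hu4)) (fun n z => hasFDerivAt_term j r n z)
    (fun n z => (norm_smul_fst_add_smul_snd_le _ _).trans (add_le_add
      ((abs_add_le _ _).trans (add_le_add (hb1 n z) (hb2 n z)))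
      ((abs_add_le _ _).trans (add_le_add (hb3 n z) (hb4 n z)))))
    (h.summable_term j 0) z
  refine key.congr_fderiv (HasSum.tsum_eq ?_)
  exact (((hx.summable_term (j + 1) z).hasSum.add (h.dx.summable_term j z).hasSum).smul_const _).add
    (((hy.summable_term (j + 1) z).hasSum.add (h.dy.summable_term j z).hasSum).smul_const _)

lemma RapidSeq.contDiff_tsum_term {r : ℕ → Poly} (h : RapidSeq r) (j : ℕ) :
    ContDiff ℝ (⊤ : ℕ∞) fun z => ∑' n, term j r n z := by
  refine contDiff_infty.2 fun m => ?_
  induction m generalizing j r with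
  | zero =>
    exact contDiff_zero.2 (continuous_iff_continuousAt.2 fun z =>
      (h.hasFDerivAt_tsum_term j z).continuousAt)
  | succ m ih =>
    refine contDiff_succ_iff_hasFDerivAt.2 ⟨_, ?_, fun z => h.hasFDerivAt_tsum_term j z⟩
    exact (((ih (h.mul (2 * xx)).smul (j + 1)).add (ih h.dx j)).smul contDiff_const).add
      (((ih (h.mul (2 * yy)).smul (j + 1)).add (ih h.dy j)).smul contDiff_const)

/-- The sum of a rapidly decaying sequence extends to a smooth function on the plane. -/
lemma RapidSeq.exists_smooth {r : ℕ → Poly} (h : RapidSeq r) : ∃ U : ℝ × ℝ → ℝ,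
    ContDiff ℝ (⊤ : ℕ∞) U ∧ ∀ z ∈ disk, HasSum (fun n => ev (r n) z) (U z) := by
  refine ⟨_, h.contDiff_tsum_term 0, fun z hz => ?_⟩
  have : (fun n => ev (r n) z) = fun n => term 0 r n z := by
    ext n
    have hz' : z.1 ^ 2 + z.2 ^ 2 ≤ 1 := hz
    rw [term, cut_zero (mul_nonpos_of_nonneg_of_nonpos (by positivity) (by linarith)), one_mul]
  rw [this]
  exact (h.summable_term 0 z).hasSum

lemma norm_sub_pr_le {n : ℕ} (f : L2D) {p : Poly} (hp : p ∈ Pd n) :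
    ‖f - ι (pr n f)‖ ≤ ‖f - ι p‖ := by
  have e : f - ι p = (f - ι (pr n f)) + ι (pr n f - p) := by rw [map_sub]; abel
  have h := norm_add_sq_eq_norm_sq_add_norm_sq_of_inner_eq_zero _ _
    (inner_sub_pr f ((Pd n).sub_mem (pr_mem n f) hp))
  rw [← e] at h
  nlinarith [norm_nonneg (f - ι p), norm_nonneg (f - ι (pr n f)), norm_nonneg (ι (pr n f - p))]

lemma tendsto_pr {f : L2D} (h : f ∈ closure (range ι)) : Tendsto (fun n => ι (pr n f)) atTop (𝓝 f) := by
  refine Metric.tendsto_atTop.2 fun ε hε => ?_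
  obtain ⟨_, ⟨p, rfl⟩, hp⟩ := Metric.mem_closure_iff.1 h ε hε
  refine ⟨p.totalDegree + 1, fun n hn => ?_⟩
  rw [dist_eq_norm] at hp
  rw [dist_comm, dist_eq_norm]
  exact (norm_sub_pr_le f (Pd_mono hn (mem_Pd_totalDegree p))).trans_lt hp

lemma cau_of_summable {k : ℕ} {p : ℕ → Poly} {u : ℕ → ℝ} (hu : Summable u)
    (h : ∀ n, N k (p (n + 1) - p n) ≤ u n) : Cau k p := by
  have key : ∀ n d, N k (p (n + d) - p n) ≤
      ∑ i ∈ Finset.range (n + d), u i - ∑ i ∈ Finset.range n, u i := fun n d => by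
    induction d with
    | zero => simp [N_zero]
    | succ d ih =>
      have e : p (n + (d + 1)) - p n = (p (n + d + 1) - p (n + d)) + (p (n + d) - p n) := by
        rw [← add_assoc]; abel
      rw [e, ← add_assoc, Finset.sum_range_succ]
      linarith [N_add k (p (n + d + 1) - p (n + d)) (p (n + d) - p n), h (n + d)]
  have hc := hu.hasSum.tendsto_sum_nat.cauchySeq
  intro ε hε
  obtain ⟨M, hM⟩ := Metric.cauchySeq_iff.1 hc ε hε
  have hle : ∀ m ≥ M, ∀ n ≥ M, n ≤ m → N k (p m - p n) < ε := fun m hm n hn hnm => by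
    obtain ⟨d, rfl⟩ := Nat.exists_eq_add_of_le hnm
    exact (key n d).trans_lt ((le_abs_self _).trans_lt (hM _ hm _ hn))
  refine ⟨M, fun m hm n hn => ?_⟩
  rcases le_total n m with h | h
  · exact hle m hm n hn h
  · rw [N_sub_comm]; exact hle n hn m hm h

/-- `P` converges to the smooth function `U` together with all derivatives. -/
structure Lim (P : ℕ → Poly) (U : ℝ × ℝ → ℝ) : Prop where
  smooth : ContDiff ℝ (⊤ : ℕ∞) U
  cau : ∀ k, Cau k P
  tendsto : ∀ z ∈ disk, Tendsto (fun n => ev (P n) z) atTop (𝓝 (U z))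

lemma Rapid.rapidSeq {f : L2D} (hf : Rapid f) : RapidSeq fun n => pr (n + 1) f - pr n f := by
  have hq : ∀ n, pr (n + 1) f - pr n f ∈ Pd (n + 1) := fun n =>
    (Pd _).sub_mem (pr_mem _ _) (Pd_mono n.le_succ (pr_mem _ _))
  have ho : ∀ n, Orth n (pr (n + 1) f - pr n f) := fun n r hr => by
    rw [sub_mul, intD_sub, ← inner_pr f hr, ← inner_pr f (Pd_mono n.le_succ hr), sub_self]
  refine RapidSeq.of_nrm (d := 1) hq fun k => ?_
  obtain ⟨C, hC⟩ := hf k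
  refine ⟨|C|, fun n => ?_⟩
  set q := pr (n + 1) f - pr n f with hqd
  have h1 : nrm q ^ 2 = inner ℝ f (ι q) := by
    rw [nrm_sq, inner_pr f (hq n)]
    have := ho n _ (pr_mem n f)
    rw [← hqd] at this
    have e : q * q = pr (n + 1) f * q - q * pr n f := by rw [hqd]; ring
    rw [e, intD_sub, this, sub_zero]
  have h2 := (hC n q (hq n) (ho n)).trans (mul_le_mul_of_nonneg_right (le_abs_self C) (nrm_nonneg q))
  rw [← h1, abs_of_nonneg (sq_nonneg _)] at h2
  rcases (nrm_nonneg q).eq_or_lt with h0 | h0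
  · rw [← h0, mul_zero]; exact abs_nonneg C
  · refine le_of_mul_le_mul_right ?_ h0
    calc _ = ((n : ℝ) + 1) ^ k * nrm q ^ 2 := by ring
      _ ≤ _ := h2

lemma Rapid.exists_lim {f : L2D} (hf : Rapid f) : ∃ U, Lim (fun n => pr n f) U := by
  have h := hf.rapidSeq
  obtain ⟨U, hU, hs⟩ := h.exists_smooth
  refine ⟨U, hU, fun k => ?_, fun z hz => ?_⟩
  · obtain ⟨u, hu, hb⟩ := h.bound k
    exact cau_of_summable hu hb
  · refine (hs z hz).tendsto_sum_nat.congr fun n => ?_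
    have h0 : pr 0 f = 0 := Pd_zero_eq (pr_mem 0 f)
    rw [← ev_sum, Finset.sum_range_sub (fun n => pr n f), h0, sub_zero]

lemma evc_eq_aeval (p : Poly) : evc p = aeval (![⟨Prod.fst, continuous_fst⟩, ⟨Prod.snd, continuous_snd⟩] :
    Fin 2 → C(ℝ × ℝ, ℝ)) p := by
  ext z
  have : (Pi.evalRingHom (fun _ => ℝ) z).comp (ContinuousMap.coeFnRingHom.comp
      (aeval (![⟨Prod.fst, continuous_fst⟩, ⟨Prod.snd, continuous_snd⟩] :
        Fin 2 → C(ℝ × ℝ, ℝ)) : Poly →ₐ[ℝ] _).toRingHom) = eval ![z.1, z.2] := by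
    refine MvPolynomial.ringHom_ext (fun a => by simp) fun i => ?_
    fin_cases i <;> simp
  exact (congrArg (fun f : Poly →+* ℝ => f p) this).symm

lemma norm_emb_le {h : C(ℝ × ℝ, ℝ)} {δ : ℝ} (hδ : 0 ≤ δ) (hh : ∀ z ∈ disk, |h z| ≤ δ) :
    ‖emb h‖ ≤ δ * nrm 1 := by
  have h3 : ‖emb h‖ ^ 2 ≤ (δ * nrm 1) ^ 2 := by
    rw [← real_inner_self_eq_norm_sq, inner_emb, mul_pow, nrm_sq, intD, ← integral_const_mul]
    refine setIntegral_mono_on (integrable_disk (by fun_prop)) (integrable_disk ?_)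
      measurableSet_disk fun z hz => ?_
    · exact continuous_const.mul (continuous_ev _)
    · have := hh z hz
      simp only [mul_one, ev_one]
      rw [← sq]
      exact sq_le_sq' (abs_le.1 this).1 (abs_le.1 this).2
  exact le_of_abs_le (abs_le_of_sq_le_sq h3 (mul_nonneg hδ (nrm_nonneg 1)))

/-- Density of the polynomials in the continuous functions. -/
lemma emb_mem_closure (g : C(ℝ × ℝ, ℝ)) : emb g ∈ closure (range ι) := by
  refine Metric.mem_closure_iff.2 fun ε hε => ?_
  let A : Subalgebra ℝ C(ℝ × ℝ, ℝ) := (aeval (![⟨Prod.fst, continuous_fst⟩,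
    ⟨Prod.snd, continuous_snd⟩] : Fin 2 → C(ℝ × ℝ, ℝ)) : Poly →ₐ[ℝ] _).range
  have hA : A.SeparatesPoints := fun z w hzw => by
    by_cases h : z.1 = w.1
    · refine ⟨Prod.snd, ⟨⟨Prod.snd, continuous_snd⟩, ⟨X 1, by simp⟩, rfl⟩, fun h' => hzw (Prod.ext h h')⟩
    · exact ⟨Prod.fst, ⟨⟨Prod.fst, continuous_fst⟩, ⟨X 0, by simp⟩, rfl⟩, h⟩
  set δ := ε / (nrm 1 + 1) with hδ
  have h1 := nrm_nonneg 1
  have hδ0 : 0 < δ := by positivity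
  obtain ⟨_, ⟨p, rfl⟩, hp⟩ :=
    ContinuousMap.exists_mem_subalgebra_near_continuous_of_isCompact_of_separatesPoints hA g
      isCompact_disk hδ0
  refine ⟨ι p, ⟨p, rfl⟩, ?_⟩
  have h2 : ι p - emb g = emb (evc p - g) := by rw [map_sub]; rfl
  rw [dist_comm, dist_eq_norm, h2]
  refine (norm_emb_le hδ0.le fun z hz => ?_).trans_lt ?_
  · rw [evc_eq_aeval]; exact (hp z hz).le
  rw [hδ, div_mul_eq_mul_div, div_lt_iff₀ (by positivity)]
  nlinarith

section

variable {P Q : ℕ → Poly} {U V : ℝ × ℝ → ℝ}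

lemma Nul.tendsto_ev (h : Nul 2 P) {z : ℝ × ℝ} (hz : z ∈ disk) :
    Tendsto (fun n => ev (P n) z) atTop (𝓝 0) :=
  squeeze_zero_norm (fun n => abs_ev_le_N _ hz) (by simpa using Tendsto.const_mul cS h)

lemma Cau.uniformCauchySeqOn (h : Cau 2 P) : UniformCauchySeqOn (fun n => ev (P n)) atTop disk := by
  refine Metric.uniformCauchySeqOn_iff.2 fun ε hε => ?_
  have hc := cS_nonneg
  obtain ⟨M, hM⟩ := h (ε / (cS + 1)) (by positivity)
  refine ⟨M, fun m hm n hn z hz => ?_⟩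
  rw [Real.dist_eq, ← ev_sub]
  have h1 := hM m hm n hn
  rw [lt_div_iff₀ (by positivity)] at h1
  nlinarith [abs_ev_le_N (P m - P n) hz, N_nonneg 2 (P m - P n)]

lemma Cau.exists_tendstoUniformlyOn (h : Cau 2 P) :
    ∃ W, TendstoUniformlyOn (fun n => ev (P n)) W atTop disk ∧ ContinuousOn W disk := by
  have hu := h.uniformCauchySeqOn
  have : ∀ z : ℝ × ℝ, ∃ w, z ∈ disk → Tendsto (fun n => ev (P n) z) atTop (𝓝 w) := fun z => by
    by_cases hz : z ∈ disk
    · obtain ⟨w, hw⟩ := cauchySeq_tendsto_of_complete (hu.cauchySeq hz)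
      exact ⟨w, fun _ => hw⟩
    · exact ⟨0, fun h => absurd h hz⟩
  choose W hW using this
  have ht := hu.tendstoUniformlyOn_of_tendsto fun z hz => hW z hz
  exact ⟨W, ht, ht.continuousOn (Frequently.of_forall fun n => (continuous_ev _).continuousOn)⟩

namespace Lim

lemma tendstoUniformlyOn (h : Lim P U) : TendstoUniformlyOn (fun n => ev (P n)) U atTop disk :=
  (h.cau 2).uniformCauchySeqOn.tendstoUniformlyOn_of_tendsto h.tendsto

lemma hasFDerivAt (h : Lim P U) : ∃ W₁ W₂ : ℝ × ℝ → ℝ,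
    (∀ z ∈ disk, Tendsto (fun n => ev (DiskGL.dx (P n)) z) atTop (𝓝 (W₁ z))) ∧
    (∀ z ∈ disk, Tendsto (fun n => ev (DiskGL.dy (P n)) z) atTop (𝓝 (W₂ z))) ∧
    EqOn (pd1 U) W₁ disk ∧ EqOn (pd2 U) W₂ disk := by
  obtain ⟨W₁, h1, hc1⟩ := (h.cau 3).dx.exists_tendstoUniformlyOn
  obtain ⟨W₂, h2, hc2⟩ := (h.cau 3).dy.exists_tendstoUniformlyOn
  have hd : ∀ z ∈ interior disk, HasFDerivAt U
      (W₁ z • ContinuousLinearMap.fst ℝ ℝ ℝ + W₂ z • ContinuousLinearMap.snd ℝ ℝ ℝ) z := fun z hz =>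
    hasFDerivAt_of_tendstoUniformlyOn (l := atTop) (f := fun n => ev (P n))
      (f' := fun n z => ev (DiskGL.dx (P n)) z • ContinuousLinearMap.fst ℝ ℝ ℝ +
        ev (DiskGL.dy (P n)) z • ContinuousLinearMap.snd ℝ ℝ ℝ)
      (g' := fun z => W₁ z • ContinuousLinearMap.fst ℝ ℝ ℝ + W₂ z • ContinuousLinearMap.snd ℝ ℝ ℝ)
      isOpen_interior (by
        rw [Metric.tendstoUniformlyOn_iff] at *
        intro ε hε
        filter_upwards [h1 (ε / 2) (by positivity), h2 (ε / 2) (by positivity)] with n e1 e2 z hz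
        have e1 := e1 z (interior_subset hz)
        have e2 := e2 z (interior_subset hz)
        rw [dist_eq_norm] at *
        refine lt_of_le_of_lt (b := ‖W₁ z - ev (DiskGL.dx (P n)) z‖ +
          ‖W₂ z - ev (DiskGL.dy (P n)) z‖) ?_ (by linarith)
        rw [add_sub_add_comm, ← sub_smul, ← sub_smul]
        exact norm_smul_fst_add_smul_snd_le _ _)
      (fun n z _ => hasFDerivAt_ev _ z) (fun z hz => h.tendsto z (interior_subset hz)) hz
  refine ⟨W₁, W₂, fun z hz => h1.tendsto_at hz, fun z hz => h2.tendsto_at hz, ?_, ?_⟩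
  · refine EqOn.of_subset_closure (s := interior disk) (fun z hz => ?_)
      (contDiff_pd1 h.smooth).continuous.continuousOn hc1 interior_subset
      disk_subset_closure_interior
    simp [pd1, (hd z hz).fderiv]
  · refine EqOn.of_subset_closure (s := interior disk) (fun z hz => ?_)
      (contDiff_pd2 h.smooth).continuous.continuousOn hc2 interior_subset
      disk_subset_closure_interior
    simp [pd2, (hd z hz).fderiv]

lemma dx (h : Lim P U) : Lim (fun n => DiskGL.dx (P n)) (pd1 U) := by
  obtain ⟨W₁, W₂, h1, -, e1, -⟩ := h.hasFDerivAt
  exact ⟨contDiff_pd1 h.smooth, fun k => (h.cau (k + 1)).dx, fun z hz => by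
    rw [e1 hz]; exact h1 z hz⟩

lemma dy (h : Lim P U) : Lim (fun n => DiskGL.dy (P n)) (pd2 U) := by
  obtain ⟨W₁, W₂, -, h2, -, e2⟩ := h.hasFDerivAt
  exact ⟨contDiff_pd2 h.smooth, fun k => (h.cau (k + 1)).dy, fun z hz => by
    rw [e2 hz]; exact h2 z hz⟩

lemma add (hP : Lim P U) (hQ : Lim Q V) : Lim (fun n => P n + Q n) (fun z => U z + V z) :=
  ⟨hP.smooth.add hQ.smooth, fun k => (hP.cau k).add (hQ.cau k), fun z hz => by
    simpa using (hP.tendsto z hz).add (hQ.tendsto z hz)⟩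

lemma neg (hP : Lim P U) : Lim (fun n => -P n) (fun z => -U z) :=
  ⟨hP.smooth.neg, fun k => (hP.cau k).neg, fun z hz => by simpa using (hP.tendsto z hz).neg⟩

lemma sub (hP : Lim P U) (hQ : Lim Q V) : Lim (fun n => P n - Q n) (fun z => U z - V z) :=
  ⟨hP.smooth.sub hQ.smooth, fun k => (hP.cau k).sub (hQ.cau k), fun z hz => by
    simpa using (hP.tendsto z hz).sub (hQ.tendsto z hz)⟩

lemma mul (hP : Lim P U) (hQ : Lim Q V) : Lim (fun n => P n * Q n) (fun z => U z * V z) :=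
  ⟨hP.smooth.mul hQ.smooth, fun k => ((hP.cau (k + 2)).mul_same (hQ.cau (k + 1))).mono k.le_succ,
    fun z hz => by simpa using (hP.tendsto z hz).mul (hQ.tendsto z hz)⟩

lemma const (c : ℝ) : Lim (fun _ => C c) (fun _ => c) :=
  ⟨contDiff_const, fun _ => cau_const _, fun z _ => by simp⟩

lemma tendsto_ι (h : Lim P U) : Tendsto (fun n => ι (P n)) atTop (𝓝 (emb ⟨U, h.smooth.continuous⟩)) := by
  refine Metric.tendsto_atTop.2 fun ε hε => ?_
  have h1 := nrm_nonneg 1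
  obtain ⟨M, hM⟩ := eventually_atTop.1
    (Metric.tendstoUniformlyOn_iff.1 h.tendstoUniformlyOn (ε / (nrm 1 + 1)) (by positivity))
  refine ⟨M, fun n hn => ?_⟩
  rw [dist_comm, dist_eq_norm]
  have e : emb ⟨U, h.smooth.continuous⟩ - ι (P n) = emb (⟨U, h.smooth.continuous⟩ - evc (P n)) := by
    rw [map_sub]; rfl
  rw [e]
  refine (norm_emb_le (by positivity) fun z hz => (hM n hn z hz).le).trans_lt ?_
  rw [div_mul_eq_mul_div, div_lt_iff₀ (by positivity)]
  nlinarith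

lemma tendsto_intD (h : Lim P U) : Tendsto (fun n => intD (P n)) atTop (𝓝 (∫ z in disk, U z)) := by
  have := Tendsto.inner (𝕜 := ℝ) h.tendsto_ι (tendsto_const_nhds (x := ι 1))
  simpa [inner_ι, inner_emb_ι] using this

lemma congr (h : Lim P U) (hQ : ∀ k, Nul k fun n => Q n - P n) : Lim Q U :=
  ⟨h.smooth, fun k => (h.cau k).congr (hQ k), fun z hz => by
    simpa using (hQ 2).tendsto_ev hz |>.add (h.tendsto z hz)⟩

lemma congr_right (h : Lim P U) (hV : ContDiff ℝ (⊤ : ℕ∞) V) (e : EqOn U V disk) : Lim P V :=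
  ⟨hV, h.cau, fun z hz => e hz ▸ h.tendsto z hz⟩

end Lim

lemma eqOn_of_emb_eq {f g : C(ℝ × ℝ, ℝ)} (h : emb f = emb g) : EqOn f g disk := by
  have h1 : emb (f - g) = 0 := by rw [map_sub, h, sub_self]
  have h2 := inner_emb (f - g) (f - g)
  rw [h1, inner_zero_left] at h2
  intro z hz
  exact sub_eq_zero.1 (eqOn_zero_of_setIntegral_sq (f - g).continuous.continuousOn h2.symm hz)

/-- Every smooth function is a limit of polynomials on the disk together with all derivatives. -/
lemma exists_lim_of_contDiff (hU : ContDiff ℝ (⊤ : ℕ∞) U) : ∃ P, Lim P U := by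
  obtain ⟨V, hV⟩ := (rapid_emb hU).exists_lim
  refine ⟨_, hV.congr_right hU ?_⟩
  exact eqOn_of_emb_eq (tendsto_nhds_unique hV.tendsto_ι (tendsto_pr (emb_mem_closure _)))

lemma nul_zero_of_tendsto {f : L2D} (hP : Tendsto (fun n => ι (P n)) atTop (𝓝 f))
    (hQ : Tendsto (fun n => ι (Q n)) atTop (𝓝 f)) : Nul 0 fun n => P n - Q n := by
  have := (hP.sub hQ).norm
  simpa [Nul, N_zero', nrm] using this

lemma Cau.exists_tendsto_ι (h : Cau 0 P) : ∃ f, Tendsto (fun n => ι (P n)) atTop (𝓝 f) := by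
  refine cauchySeq_tendsto_of_complete (Metric.cauchySeq_iff.2 fun ε hε => ?_)
  obtain ⟨M, hM⟩ := h ε hε
  exact ⟨M, fun m hm n hn => by rw [dist_eq_norm, ← map_sub]; simpa [N_zero', nrm] using hM m hm n hn⟩

/-- A function that is a limit of polynomials in every Sobolev norm is smooth. -/
lemma exists_lim_of_tendsto {f : L2D} (h : ∀ k, ∃ p : ℕ → Poly, Cau k p ∧
    Tendsto (fun n => ι (p n)) atTop (𝓝 f)) : ∃ Q U, Lim Q U ∧
      ∀ k p, Cau k p → Tendsto (fun n => ι (p n)) atTop (𝓝 f) → Nul k fun n => p n - Q n := by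
  obtain ⟨U, hU⟩ := (rapid_of_cau h).exists_lim
  obtain ⟨p, -, hp⟩ := h 0
  have hcl : f ∈ closure (range ι) := mem_closure_of_tendsto hp (Eventually.of_forall fun n => ⟨_, rfl⟩)
  exact ⟨_, U, hU, fun k q hq hqf => (Nul.of_cau (hq.sub (hU.cau k)) (nul_zero_of_tendsto hqf (tendsto_pr hcl)))⟩

lemma exists_lim_of_cau (h : ∀ k, Cau k P) : ∃ U, Lim P U := by
  obtain ⟨f, hf⟩ := (h 0).exists_tendsto_ι
  obtain ⟨Q, U, hU, hn⟩ := exists_lim_of_tendsto fun k => ⟨P, h k, hf⟩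
  exact ⟨U, hU.congr fun k => hn k P (h k) hf⟩

end

section

section

variable {H : Type*} [NormedAddCommGroup H] [InnerProductSpace ℝ H]

lemma norm_sub_sq_le_of_midpoint {a b c r : H} (h : c = (1 / 2 : ℝ) • (a + b) + r) :
    ‖a - b‖ ^ 2 ≤ 2 * ‖a‖ ^ 2 + 2 * ‖b‖ ^ 2 - 4 * ‖c‖ ^ 2 + 4 * (‖a‖ + ‖b‖ + 2 * ‖r‖) * ‖r‖ := by
  have h1 := parallelogram_law_with_norm ℝ a b
  have h2 : ‖c‖ ≤ 1 / 2 * ‖a + b‖ + ‖r‖ := by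
    rw [h]
    refine (norm_add_le _ _).trans_eq ?_
    rw [norm_smul]; norm_num
  have h3 : ‖c‖ ^ 2 ≤ (1 / 2 * ‖a + b‖ + ‖r‖) ^ 2 := pow_le_pow_left₀ (norm_nonneg _) h2 2
  nlinarith [mul_le_mul_of_nonneg_right (norm_add_le a b) (norm_nonneg r), sq_nonneg ‖r‖]

lemma tendsto_first_variation {x L : ℕ → H} {K : H} {m B : ℝ}
    (hx : Tendsto (fun n => ‖x n‖ ^ 2) atTop (𝓝 m)) (hL : ∀ n, ‖L n‖ ≤ B)
    (hB : ∀ n, ‖x n‖ ≤ B) (hmin : ∀ n (t : ℝ), m ≤ ‖x n + t • L n + t ^ 2 • K‖ ^ 2) :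
    Tendsto (fun n => inner ℝ (x n) (L n)) atTop (𝓝 0) := by
  have hB0 : 0 ≤ B := (norm_nonneg _).trans (hB 0)
  set c := (B + ‖K‖) ^ 2 + 2 * B * ‖K‖ with hc
  have hc0 : 0 ≤ c := by positivity
  have key : ∀ n (t : ℝ), |t| ≤ 1 → m ≤ ‖x n‖ ^ 2 + 2 * t * inner ℝ (x n) (L n) + t ^ 2 * c :=
    fun n t ht => by
    refine (hmin n t).trans ?_
    have e : x n + t • L n + t ^ 2 • K = x n + t • (L n + t • K) := by
      rw [smul_add, smul_smul, sq, add_assoc]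
    rw [e, norm_add_sq_real, inner_smul_right, inner_add_right, inner_smul_right, norm_smul, mul_pow,
      Real.norm_eq_abs, sq_abs]
    have h1 : ‖L n + t • K‖ ≤ B + ‖K‖ := by
      refine (norm_add_le _ _).trans (add_le_add (hL n) ?_)
      rw [norm_smul]
      exact mul_le_of_le_one_left (norm_nonneg _) ht
    have h2 : inner ℝ (x n) K ≤ B * ‖K‖ :=
      (real_inner_le_norm _ _).trans (mul_le_mul_of_nonneg_right (hB n) (norm_nonneg _))
    have h3 := pow_le_pow_left₀ (norm_nonneg _) h1 2
    nlinarith [mul_le_mul_of_nonneg_left h3 (sq_nonneg t), mul_le_mul_of_nonneg_left h2 (sq_nonneg t)]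
  refine Metric.tendsto_atTop.2 fun ε hε => ?_
  set τ := min 1 (ε / (c + 1)) with hτ
  have hτ0 : 0 < τ := by positivity
  have hτ1 : τ ≤ 1 := min_le_left _ _
  have hτc : τ * (c + 1) ≤ ε := (le_div_iff₀ (by positivity)).1 (min_le_right _ _)
  obtain ⟨M, hM⟩ := Metric.tendsto_atTop.1 hx (τ * ε) (by positivity)
  refine ⟨M, fun n hn => ?_⟩
  have h0 := hM n hn
  rw [Real.dist_eq] at h0
  have h0 := (abs_lt.1 h0).2
  have h1 := key n τ (by rwa [abs_of_pos hτ0])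
  have h2 := key n (-τ) (by rwa [abs_neg, abs_of_pos hτ0])
  have h3 : τ ^ 2 * c ≤ τ * ε := by nlinarith
  rw [Real.dist_eq, sub_zero]
  refine abs_lt.2 ⟨?_, ?_⟩ <;> refine lt_of_mul_lt_mul_left ?_ hτ0.le <;> nlinarith

end

lemma cau_iff {k : ℕ} {p : ℕ → Poly} :
    Cau k p ↔ Tendsto (fun i : ℕ × ℕ => N k (p i.1 - p i.2)) atTop (𝓝 0) := by
  rw [Metric.tendsto_nhds]
  simp only [dist_zero_right, Real.norm_eq_abs, abs_of_nonneg (N_nonneg _ _), eventually_atTop]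
  constructor
  · intro h ε hε
    obtain ⟨M, hM⟩ := h ε hε
    exact ⟨(M, M), fun i hi => hM _ hi.1 _ hi.2⟩
  · intro h ε hε
    obtain ⟨⟨M, M'⟩, hM⟩ := h ε hε
    exact ⟨max M M', fun m hm n hn => hM (m, n)
      ⟨(le_max_left _ _).trans hm, (le_max_right _ _).trans hn⟩⟩

lemma nrm_mul_sq_le_N (p q : Poly) : nrm (p * q) ^ 2 ≤ 2 * cG ^ 2 * N 1 p ^ 2 * (nrm q * N 1 q) := by
  have h1 := nrm_mul_sq_le p q
  have h2 := nrm_mul_le p p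
  have h3 := nrm_mul_self_le q
  have := mul_le_mul h2 h3 (nrm_nonneg _) (mul_nonneg cG_nonneg (mul_nonneg (N_nonneg _ _) (N_nonneg _ _)))
  nlinarith

lemma tendsto_nrm_mul {J : Type*} {l : Filter J} {p q : J → Poly} {B : ℝ} (hp : ∀ i, N 1 (p i) ≤ B)
    (hq : ∀ i, N 1 (q i) ≤ B) (h : Tendsto (fun i => nrm (q i)) l (𝓝 0)) :
    Tendsto (fun i => nrm (p i * q i)) l (𝓝 0) := by
  have h1 : Tendsto (fun i => nrm (p i * q i) ^ 2) l (𝓝 0) := by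
    refine squeeze_zero (g := fun i => 2 * cG ^ 2 * B ^ 2 * (nrm (q i) * B)) (fun i => sq_nonneg _)
      (fun i => (nrm_mul_sq_le_N _ _).trans ?_) (by
        simpa using (h.mul_const B).const_mul (2 * cG ^ 2 * B ^ 2))
    have := cG_nonneg
    gcongr
    · exact mul_nonneg (nrm_nonneg _) (N_nonneg _ _)
    · exact N_nonneg _ _
    · exact hp i
    · exact nrm_nonneg _
    · exact hq i
  simpa [Real.sqrt_sq (nrm_nonneg _)] using h1.sqrt

/-- The target of the map whose squared norm is the energy. -/
abbrev EnergySpace := PiLp 2 fun _ : Fin 6 => L2D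

/-- Real part of the first covariant derivative of `u + iv` in the gauge `a = ∇⊥ψ`. -/
def cov1 (ψ u v : Poly) : Poly := dx u + dy ψ * v

/-- Real part of the second covariant derivative of `u + iv` in the gauge `a = ∇⊥ψ`. -/
def cov2 (ψ u v : Poly) : Poly := dy u - dx ψ * v

/-- The deviation of the squared modulus from its preferred value. -/
def dev (κ : ℝ) (u v : Poly) : Poly := u * u + v * v - C κ

/-- The energy is the squared norm of this vector, up to a constant. -/
def vec (κ μ : ℝ) (f : L2D) (ψ u v : Poly) : EnergySpace :=
  WithLp.toLp 2 ![ι (lap ψ) - f, ι (cov1 ψ u v), ι (cov2 ψ u v), ι (cov1 ψ v (-u)), ι (cov2 ψ v (-u)),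
    μ • ι (dev κ u v)]

variable {κ μ : ℝ} {f : L2D} {ψ u v ψ' u' v' : Poly}

lemma norm_vec_sq : ‖vec κ μ f ψ u v‖ ^ 2 = ‖ι (lap ψ) - f‖ ^ 2 + nrm (cov1 ψ u v) ^ 2 +
    nrm (cov2 ψ u v) ^ 2 + nrm (cov1 ψ v (-u)) ^ 2 + nrm (cov2 ψ v (-u)) ^ 2 +
    μ ^ 2 * nrm (dev κ u v) ^ 2 := by
  rw [PiLp.norm_sq_eq_of_L2, Fin.sum_univ_six]
  simp [vec, nrm, norm_smul, mul_pow]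

lemma norm_vec_swap : ‖vec κ μ f ψ v (-u)‖ = ‖vec κ μ f ψ u v‖ := by
  rw [← sq_eq_sq₀ (norm_nonneg _) (norm_nonneg _), norm_vec_sq, norm_vec_sq]
  have h1 : cov1 ψ (-u) (-v) = -cov1 ψ u v := by simp [cov1]; ring
  have h2 : cov2 ψ (-u) (-v) = -cov2 ψ u v := by simp [cov2]; ring
  have h3 : dev κ v (-u) = dev κ u v := by simp [dev]; ring
  rw [h1, h2, h3, nrm_neg, nrm_neg]; ring

lemma norm_le_sum_six (x : EnergySpace) : ‖x‖ ≤ ‖x 0‖ + ‖x 1‖ + ‖x 2‖ + ‖x 3‖ + ‖x 4‖ + ‖x 5‖ := by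
  refine abs_le_of_sq_le_sq' ?_ (by positivity) |>.2
  rw [PiLp.norm_sq_eq_of_L2, Fin.sum_univ_six]
  have h := fun i => norm_nonneg (x i)
  nlinarith [mul_nonneg (h 0) (h 1), mul_nonneg (h 0) (h 2), mul_nonneg (h 0) (h 3),
    mul_nonneg (h 0) (h 4), mul_nonneg (h 0) (h 5), mul_nonneg (h 1) (h 2), mul_nonneg (h 1) (h 3),
    mul_nonneg (h 1) (h 4), mul_nonneg (h 1) (h 5), mul_nonneg (h 2) (h 3), mul_nonneg (h 2) (h 4),
    mul_nonneg (h 2) (h 5), mul_nonneg (h 3) (h 4), mul_nonneg (h 3) (h 5), mul_nonneg (h 4) (h 5)]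

end

section

variable {κ μ : ℝ} {f : L2D} {ψ u v ψ' u' v' : Poly}

lemma vec_apply_le (i : Fin 6) : ‖vec κ μ f ψ u v i‖ ≤ ‖vec κ μ f ψ u v‖ := PiLp.norm_apply_le _ i

lemma nrm_mul_self_le_add (u v : Poly) : nrm (u * u) ≤ nrm (u * u + v * v) := by
  refine abs_le_of_sq_le_sq' ?_ (nrm_nonneg _) |>.2
  have h : intD ((u * u + v * v) * (u * u + v * v)) = intD (u * u * (u * u)) +
      (2 * intD (u * v * (u * v)) + intD (v * v * (v * v))) := by
    rw [← intD_ofNat_mul, ← intD_add, ← intD_add]; congr 1; ring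
  rw [nrm_sq, nrm_sq, h, ← nrm_sq (u * v), ← nrm_sq (v * v)]
  nlinarith [sq_nonneg (nrm (u * v)), sq_nonneg (nrm (v * v))]

lemma nrm_sq_le_nrm_mul_self (u : Poly) : nrm u ^ 2 ≤ nrm (u * u) * nrm 1 := by
  rw [nrm_sq]; simpa using intD_mul_le (u * u) 1

/-- Coercivity of the energy on Coulomb gauge configurations. -/
lemma exists_bound_of_norm_vec_le (κ : ℝ) (hμ : 0 < μ) (f : L2D) (A : ℝ) : ∃ B, ∀ ψ u v, IsDir ψ →
    ‖vec κ μ f ψ u v‖ ≤ A → N 2 ψ ≤ B ∧ N 1 u ≤ B ∧ N 1 v ≤ B := by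
  obtain ⟨K, hK0, hK⟩ := Bd_N_dsolve 0
  set S := A / μ + nrm (C κ) with hS
  set B₁ := K * (A + ‖f‖) with hB₁
  set D := √(cG * (B₁ * B₁) * S) with hD
  set Z := √(S * nrm 1) + 2 * (A + D) with hZ
  refine ⟨max B₁ Z, fun ψ u v hψ hA => ?_⟩
  have hc := fun i => (vec_apply_le i).trans hA
  have h0 : ‖ι (lap ψ) - f‖ ≤ A := hc 0
  have h1 : nrm (cov1 ψ u v) ≤ A := hc 1
  have h2 : nrm (cov2 ψ u v) ≤ A := hc 2
  have h3 : nrm (cov1 ψ v (-u)) ≤ A := hc 3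
  have h4 : nrm (cov2 ψ v (-u)) ≤ A := hc 4
  have h5 : μ * nrm (dev κ u v) ≤ A := by
    have h : ‖μ • ι (dev κ u v)‖ ≤ A := hc 5
    rwa [norm_smul, Real.norm_of_nonneg hμ.le] at h
  have hψB : N 2 ψ ≤ B₁ := by
    have h : nrm (lap ψ) ≤ A + ‖f‖ := by
      have := norm_add_le (ι (lap ψ) - f) f
      rw [sub_add_cancel] at this
      exact this.trans (by gcongr)
    have h' := hK (lap ψ)
    simp only [dsolve_lap hψ] at h'
    exact h'.trans (mul_le_mul_of_nonneg_left h hK0)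
  have hs : nrm (u * u + v * v) ≤ S := by
    have := nrm_add (dev κ u v) (C κ)
    rw [dev, sub_add_cancel] at this
    refine this.trans (add_le_add ?_ le_rfl)
    rw [le_div_iff₀ hμ, mul_comm]; exact h5
  have hu := (nrm_mul_self_le_add u v).trans hs
  have hv := (nrm_mul_self_le_add v u).trans ((add_comm (v * v) (u * u)).symm ▸ hs)
  have hS0 : 0 ≤ S := (nrm_nonneg _).trans hu
  have hN : N 1 (dx ψ) ≤ B₁ ∧ N 1 (dy ψ) ≤ B₁ := ⟨(N_dx 1 ψ).trans hψB, (N_dy 1 ψ).trans hψB⟩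
  have hB0 : 0 ≤ B₁ := (N_nonneg _ _).trans hψB
  have hm : ∀ a w : Poly, N 1 a ≤ B₁ → nrm (w * w) ≤ S → nrm (a * w) ≤ D := fun a w ha hw => by
    refine Real.le_sqrt_of_sq_le ((nrm_mul_sq_le a w).trans (mul_le_mul ?_ hw (nrm_nonneg _) ?_))
    · refine (nrm_mul_le a a).trans (mul_le_mul_of_nonneg_left ?_ cG_nonneg)
      exact mul_le_mul ha ha (N_nonneg _ _) hB0
    · exact mul_nonneg cG_nonneg (mul_nonneg hB0 hB0)
  have h0' : ∀ w : Poly, nrm (w * w) ≤ S → nrm w ≤ √(S * nrm 1) := fun w hw =>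
    Real.le_sqrt_of_sq_le ((nrm_sq_le_nrm_mul_self w).trans
      (mul_le_mul_of_nonneg_right hw (nrm_nonneg _)))
  have e1 : dx u = cov1 ψ u v - dy ψ * v := by rw [cov1]; ring
  have e2 : dy u = cov2 ψ u v + dx ψ * v := by rw [cov2]; ring
  have e3 : dx v = cov1 ψ v (-u) + dy ψ * u := by rw [cov1]; ring
  have e4 : dy v = cov2 ψ v (-u) - dx ψ * u := by rw [cov2]; ring
  refine ⟨hψB.trans (le_max_left _ _), le_max_of_le_right ?_, le_max_of_le_right ?_⟩
  · rw [N_succ, N_zero', N_zero', N_zero', e1, e2]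
    linarith [nrm_sub (cov1 ψ u v) (dy ψ * v), nrm_add (cov2 ψ u v) (dx ψ * v), hm _ _ hN.1 hv,
      hm _ _ hN.2 hv, h0' _ hu]
  · rw [N_succ, N_zero', N_zero', N_zero', e3, e4]
    linarith [nrm_add (cov1 ψ v (-u)) (dy ψ * u), nrm_sub (cov2 ψ v (-u)) (dx ψ * u), hm _ _ hN.1 hu,
      hm _ _ hN.2 hu, h0' _ hv]

/-- Deviation of the energy map from being midpoint affine. -/
def midErr (μ : ℝ) (δψ δu δv : Poly) : EnergySpace :=
  WithLp.toLp 2 ![0, -(1 / 4 : ℝ) • ι (dy δψ * δv), (1 / 4 : ℝ) • ι (dx δψ * δv),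
    (1 / 4 : ℝ) • ι (dy δψ * δu), -(1 / 4 : ℝ) • ι (dx δψ * δu),
    -(μ / 4) • ι (δu * δu + δv * δv)]

lemma vec_midpoint (κ μ : ℝ) (f : L2D) (ψ u v ψ' u' v' : Poly) :
    vec κ μ f (C (1 / 2) * (ψ + ψ')) (C (1 / 2) * (u + u')) (C (1 / 2) * (v + v')) =
    (1 / 2 : ℝ) • (vec κ μ f ψ u v + vec κ μ f ψ' u' v') + midErr μ (ψ - ψ') (u - u') (v - v') := by
  have h2 : (C (1 / 2) : Poly) * 2 = 1 := by
    rw [← map_ofNat (C : ℝ →+* Poly) 2, ← map_mul]; norm_num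
  have h4 : (C (1 / 4) : Poly) = C (1 / 2) * C (1 / 2) := by rw [← map_mul]; norm_num
  have lin : ∀ p q r e : Poly, r = C (1 / 2) * (p + q) + e →
      ι r = (1 / 2 : ℝ) • (ι p + ι q) + ι e := by
    rintro p q _ e rfl
    rw [← smul_eq_C_mul, map_add, map_smul, map_add]
  ext1 i
  fin_cases i
  · change ι _ - f = (1 / 2 : ℝ) • ((ι _ - f) + (ι _ - f)) + 0
    have h : lap (C (1 / 2) * (ψ + ψ')) = C (1 / 2) * (lap ψ + lap ψ') + 0 := by
      simp only [lap, dx_add, dy_add, dx_mul, dy_mul, dx_C, dy_C, dx_zero, dy_zero]; ring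
    rw [lin _ _ _ _ h, map_zero]
    module
  · change ι _ = (1 / 2 : ℝ) • (ι _ + ι _) + -(1 / 4 : ℝ) • ι _
    rw [← map_smul]
    refine lin _ _ _ _ ?_
    simp only [smul_eq_C_mul, map_neg, h4, cov1, dy_sub, dx_add, dy_add, dx_mul, dy_mul, dx_C, dy_C]
    linear_combination (C (1 / 2) * (dy ψ * v + dy ψ' * v')) * h2
  · change ι _ = (1 / 2 : ℝ) • (ι _ + ι _) + (1 / 4 : ℝ) • ι _
    rw [← map_smul]
    refine lin _ _ _ _ ?_
    simp only [smul_eq_C_mul, h4, cov2, dx_sub, dx_add, dy_add, dx_mul, dy_mul, dx_C, dy_C]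
    linear_combination -(C (1 / 2) * (dx ψ * v + dx ψ' * v')) * h2
  · change ι _ = (1 / 2 : ℝ) • (ι _ + ι _) + (1 / 4 : ℝ) • ι _
    rw [← map_smul]
    refine lin _ _ _ _ ?_
    simp only [smul_eq_C_mul, h4, cov1, dy_sub, dx_add, dy_add, dx_mul, dy_mul, dx_C, dy_C]
    linear_combination -(C (1 / 2) * (dy ψ * u + dy ψ' * u')) * h2
  · change ι _ = (1 / 2 : ℝ) • (ι _ + ι _) + -(1 / 4 : ℝ) • ι _
    rw [← map_smul]
    refine lin _ _ _ _ ?_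
    simp only [smul_eq_C_mul, map_neg, h4, cov2, dx_sub, dx_add, dy_add, dx_mul, dy_mul, dx_C, dy_C]
    linear_combination (C (1 / 2) * (dx ψ * u + dx ψ' * u')) * h2
  · change μ • ι _ = (1 / 2 : ℝ) • (μ • ι _ + μ • ι _) + -(μ / 4) • ι _
    rw [lin (dev κ u v) (dev κ u' v') _ (-(1 / 4 : ℝ) • ((u - u') * (u - u') + (v - v') * (v - v'))) (by
      simp only [smul_eq_C_mul, map_neg, h4, dev]
      linear_combination (C (1 / 2) * (u * u + u' * u' + v * v + v' * v') + C κ) * h2), map_smul]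
    module

end

section

variable {p : ℕ → Poly}

lemma cau_of_cauchySeq (h : CauchySeq fun n => ι (p n)) : Cau 0 p := fun ε hε => by
  obtain ⟨M, hM⟩ := Metric.cauchySeq_iff.1 h ε hε
  exact ⟨M, fun m hm n hn => by simpa [nrm, dist_eq_norm] using hM m hm n hn⟩

lemma cau_succ {k : ℕ} (h : Cau k p) (hx : Cau k fun n => dx (p n)) (hy : Cau k fun n => dy (p n)) :
    Cau (k + 1) p := by
  rw [cau_iff] at *
  simpa [N_succ] using (h.add hx).add hy

/-- A product of bounded sequences in `H¹` that converge in `L²` converges in `L²`. -/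
lemma cau_mul_of_bounded {q : ℕ → Poly} {B : ℝ} (hp : ∀ n, N 1 (p n) ≤ B) (hq : ∀ n, N 1 (q n) ≤ B)
    (hp' : Cau 0 p) (hq' : Cau 0 q) : Cau 0 fun n => p n * q n := by
  have hB : 0 ≤ B := (N_nonneg _ _).trans (hp 0)
  rw [cau_iff] at *
  have sub : ∀ {r : ℕ → Poly}, (∀ n, N 1 (r n) ≤ B) → ∀ i : ℕ × ℕ, N 1 (r i.1 - r i.2) ≤ 2 * B :=
    fun hr i => (N_sub _ _ _).trans (by linarith [hr i.1, hr i.2])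
  have h1 := tendsto_nrm_mul (p := fun i : ℕ × ℕ => p i.1) (fun i => (hp i.1).trans (by linarith))
    (sub hq) hq'
  have h2 := tendsto_nrm_mul (p := fun i : ℕ × ℕ => q i.2) (fun i => (hq i.2).trans (by linarith))
    (sub hp) hp'
  refine squeeze_zero (fun _ => N_nonneg _ _) (fun i => ?_) (by simpa using h1.add h2)
  refine le_trans (le_of_eq ?_) (nrm_add _ _)
  rw [N_zero']; congr 1; ring

end

section

variable {κ μ : ℝ} {f : L2D}

/-- The infimum of the energy over polynomial configurations in Coulomb gauge. -/
def infE (κ μ : ℝ) (f : L2D) : ℝ := sInf {e | ∃ ψ u v, IsDir ψ ∧ e = ‖vec κ μ f ψ u v‖ ^ 2}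

lemma infE_le {ψ u v : Poly} (hψ : IsDir ψ) : infE κ μ f ≤ ‖vec κ μ f ψ u v‖ ^ 2 :=
  csInf_le ⟨0, by rintro _ ⟨ψ, u, v, -, rfl⟩; positivity⟩ ⟨ψ, u, v, hψ, rfl⟩

lemma exists_minimizing (κ μ : ℝ) (f : L2D) : ∃ ψ u v : ℕ → Poly, (∀ n, IsDir (ψ n)) ∧
    Tendsto (fun n => ‖vec κ μ f (ψ n) (u n) (v n)‖ ^ 2) atTop (𝓝 (infE κ μ f)) := by
  obtain ⟨e, -, he, hm⟩ := exists_seq_tendsto_sInf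
    (S := {e | ∃ ψ u v, IsDir ψ ∧ e = ‖vec κ μ f ψ u v‖ ^ 2}) ⟨_, 0, 0, 0, ⟨0, by simp⟩, rfl⟩
    ⟨0, by rintro _ ⟨ψ, u, v, -, rfl⟩; positivity⟩
  choose ψ u v hψ h using hm
  exact ⟨ψ, u, v, hψ, he.congr h⟩

lemma IsDir.C_mul {p : Poly} (c : ℝ) (h : IsDir p) : IsDir (C c * p) := by
  obtain ⟨q, rfl⟩ := h; exact ⟨C c * q, by ring⟩

lemma midErr_tendsto {J : Type*} {l : Filter J} {a b c : J → Poly} {B : ℝ} (ha : ∀ i, N 2 (a i) ≤ B)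
    (hb : ∀ i, N 1 (b i) ≤ B) (hc : ∀ i, N 1 (c i) ≤ B) (hb' : Tendsto (fun i => nrm (b i)) l (𝓝 0))
    (hc' : Tendsto (fun i => nrm (c i)) l (𝓝 0)) :
    Tendsto (fun i => ‖midErr μ (a i) (b i) (c i)‖) l (𝓝 0) := by
  have hx := fun i => (N_dx 1 (a i)).trans (ha i)
  have hy := fun i => (N_dy 1 (a i)).trans (ha i)
  have h1 := tendsto_nrm_mul hy hc hc'
  have h2 := tendsto_nrm_mul hx hc hc'
  have h3 := tendsto_nrm_mul hy hb hb'
  have h4 := tendsto_nrm_mul hx hb hb'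
  have h5 := (tendsto_nrm_mul hb hb hb').add (tendsto_nrm_mul hc hc hc')
  refine squeeze_zero (fun _ => norm_nonneg _) (fun i => (norm_le_sum_six _).trans (?_ : _ ≤
    nrm (dy (a i) * c i) + nrm (dx (a i) * c i) + nrm (dy (a i) * b i) + nrm (dx (a i) * b i) +
    |μ| * (nrm (b i * b i) + nrm (c i * c i))))
    (by simpa using (((h1.add h2).add h3).add h4).add (h5.const_mul |μ|))
  have e0 : midErr μ (a i) (b i) (c i) 0 = 0 := rfl
  have e1 : midErr μ (a i) (b i) (c i) 1 = -(1 / 4 : ℝ) • ι (dy (a i) * c i) := rfl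
  have e2 : midErr μ (a i) (b i) (c i) 2 = (1 / 4 : ℝ) • ι (dx (a i) * c i) := rfl
  have e3 : midErr μ (a i) (b i) (c i) 3 = (1 / 4 : ℝ) • ι (dy (a i) * b i) := rfl
  have e4 : midErr μ (a i) (b i) (c i) 4 = -(1 / 4 : ℝ) • ι (dx (a i) * b i) := rfl
  have e5 : midErr μ (a i) (b i) (c i) 5 = -(μ / 4) • ι (b i * b i + c i * c i) := rfl
  rw [e0, e1, e2, e3, e4, e5]
  simp only [norm_smul, norm_neg, norm_zero, Real.norm_eq_abs, abs_div]
  have h4 : |(1 : ℝ)| / |4| = 1 / 4 := by norm_num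
  have h4' : |(4 : ℝ)| = 4 := by norm_num
  rw [h4, h4']
  have := mul_le_mul_of_nonneg_left (nrm_add (b i * b i) (c i * c i)) (abs_nonneg μ)
  have n1 := nrm_nonneg (dy (a i) * c i)
  have n2 := nrm_nonneg (dx (a i) * c i)
  have n3 := nrm_nonneg (dy (a i) * b i)
  have n4 := nrm_nonneg (dx (a i) * b i)
  have n5 := mul_nonneg (abs_nonneg μ) (nrm_nonneg (b i * b i + c i * c i))
  simp only [nrm] at this n1 n2 n3 n4 n5 ⊢
  linarith

/-- Minimizing sequences that converge in the natural norms. -/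
lemma exists_minimizing_cau (κ : ℝ) (hμ : 0 < μ) (f : L2D) : ∃ ψ u v : ℕ → Poly, (∀ n, IsDir (ψ n)) ∧
    Cau 2 ψ ∧ Cau 1 u ∧ Cau 1 v ∧
    Tendsto (fun n => ‖vec κ μ f (ψ n) (u n) (v n)‖ ^ 2) atTop (𝓝 (infE κ μ f)) := by
  obtain ⟨ψ₀, u₀, v₀, hψ₀, hm₀⟩ := exists_minimizing κ μ f
  have hbd : ∃ A, ∀ n, ‖vec κ μ f (ψ₀ n) (u₀ n) (v₀ n)‖ ≤ A := by
    obtain ⟨A, hA⟩ := hm₀.bddAbove_range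
    exact ⟨√A, fun n => Real.le_sqrt_of_sq_le (hA ⟨n, rfl⟩)⟩
  obtain ⟨A, hA₀⟩ := hbd
  obtain ⟨B, hB⟩ := exists_bound_of_norm_vec_le κ hμ f A
  obtain ⟨φ₁, hφ₁, hu₁⟩ := exists_subseq_cauchySeq fun n => (hB _ _ _ (hψ₀ n) (hA₀ n)).2.1
  obtain ⟨φ₂, hφ₂, hv₂⟩ := exists_subseq_cauchySeq fun n => (hB _ _ _ (hψ₀ (φ₁ n)) (hA₀ (φ₁ n))).2.2
  have hφ := hφ₁.comp hφ₂
  set φ := φ₁ ∘ φ₂ with hφe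
  obtain ⟨ψ, hψe⟩ : ∃ ψ : ℕ → Poly, ψ = fun n => ψ₀ (φ n) := ⟨_, rfl⟩
  obtain ⟨u, hue⟩ : ∃ u : ℕ → Poly, u = fun n => u₀ (φ n) := ⟨_, rfl⟩
  obtain ⟨v, hve⟩ : ∃ v : ℕ → Poly, v = fun n => v₀ (φ n) := ⟨_, rfl⟩
  have hu0 : Cau 0 u := by rw [hue]; exact (cau_of_cauchySeq hu₁).comp hφ₂
  have hv0 : Cau 0 v := by rw [hve]; exact cau_of_cauchySeq hv₂
  have hψ : ∀ n, IsDir (ψ n) := by rw [hψe]; exact fun n => hψ₀ _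
  have hA : ∀ n, ‖vec κ μ f (ψ n) (u n) (v n)‖ ≤ A := by rw [hψe, hue, hve]; exact fun n => hA₀ _
  have hm : Tendsto (fun n => ‖vec κ μ f (ψ n) (u n) (v n)‖ ^ 2) atTop (𝓝 (infE κ μ f)) := by
    rw [hψe, hue, hve]; exact hm₀.comp hφ.tendsto_atTop
  clear hψe hue hve hm₀ hA₀ hu₁ hv₂
  have hBn := fun n => hB _ _ _ (hψ n) (hA n)
  have sub : ∀ {k : ℕ} {r : ℕ → Poly}, (∀ n, N k (r n) ≤ B) → ∀ i : ℕ × ℕ,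
      N k (r i.1 - r i.2) ≤ 2 * B :=
    fun hr i => (N_sub _ _ _).trans (by linarith [hr i.1, hr i.2])
  have hr := midErr_tendsto (μ := μ) (sub fun n => (hBn n).1) (sub fun n => (hBn n).2.1)
    (sub fun n => (hBn n).2.2) (cau_iff.1 hu0) (cau_iff.1 hv0)
  have hd : Tendsto (fun i : ℕ × ℕ => ‖vec κ μ f (ψ i.1) (u i.1) (v i.1) -
      vec κ μ f (ψ i.2) (u i.2) (v i.2)‖) atTop (𝓝 0) := by
    have h1 : Tendsto (fun i : ℕ × ℕ => ‖vec κ μ f (ψ i.1) (u i.1) (v i.1)‖ ^ 2) atTop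
        (𝓝 (infE κ μ f)) := by
      rw [← prod_atTop_atTop_eq]; exact hm.comp tendsto_fst
    have h2 : Tendsto (fun i : ℕ × ℕ => ‖vec κ μ f (ψ i.2) (u i.2) (v i.2)‖ ^ 2) atTop
        (𝓝 (infE κ μ f)) := by
      rw [← prod_atTop_atTop_eq]; exact hm.comp tendsto_snd
    have h3 := ((h1.const_mul 2).add (h2.const_mul 2)).sub_const (4 * infE κ μ f) |>.add
      (((hr.const_mul 2).const_add (2 * A)).const_mul 4 |>.mul hr)
    have h4 : Tendsto (fun i : ℕ × ℕ => ‖vec κ μ f (ψ i.1) (u i.1) (v i.1) -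
      vec κ μ f (ψ i.2) (u i.2) (v i.2)‖ ^ 2) atTop (𝓝 0) := by
      refine squeeze_zero (fun _ => sq_nonneg _) (fun i => (norm_sub_sq_le_of_midpoint
        (vec_midpoint κ μ f _ _ _ _ _ _)).trans ?_) (by convert h3 using 2; ring)
      have h5 := infE_le (κ := κ) (μ := μ) (f := f) (u := C (1 / 2) * (u i.1 + u i.2))
        (v := C (1 / 2) * (v i.1 + v i.2)) (((hψ i.1).add (hψ i.2)).C_mul (1 / 2))
      have h6 := mul_le_mul_of_nonneg_right (add_le_add (hA i.1) (hA i.2))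
        (norm_nonneg (midErr μ (ψ i.1 - ψ i.2) (u i.1 - u i.2) (v i.1 - v i.2)))
      linarith
    simpa [Real.sqrt_sq (norm_nonneg _)] using h4.sqrt
  have comp : ∀ {j : Fin 6} {w : ℕ → Poly} {g : L2D}, (∀ n, vec κ μ f (ψ n) (u n) (v n) j = ι (w n) - g) →
      Cau 0 w := fun {j w g} hw => by
    refine cau_iff.2 (squeeze_zero (fun _ => N_nonneg _ _) (fun i => ?_) hd)
    refine le_trans (le_of_eq ?_) (PiLp.norm_apply_le _ j)
    rw [PiLp.sub_apply, hw, hw, N_zero', nrm, map_sub, sub_sub_sub_cancel_right]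
  have hψ2 : Cau 2 ψ := by
    simpa only [dsolve_lap (hψ _)] using Cau.dsolve (comp (j := 0) (w := fun n => lap (ψ n)) (g := f) fun _ => rfl)
  have c1 := comp (j := 1) (w := fun n => cov1 (ψ n) (u n) (v n)) (g := 0) fun _ => (sub_zero _).symm
  have c2 := comp (j := 2) (w := fun n => cov2 (ψ n) (u n) (v n)) (g := 0) fun _ => (sub_zero _).symm
  have c3 := comp (j := 3) (w := fun n => cov1 (ψ n) (v n) (-u n)) (g := 0) fun _ => (sub_zero _).symm
  have c4 := comp (j := 4) (w := fun n => cov2 (ψ n) (v n) (-u n)) (g := 0) fun _ => (sub_zero _).symm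
  have hx : Cau 0 fun n => dx (ψ n) := hψ2.dx.mono zero_le_one
  have hy : Cau 0 fun n => dy (ψ n) := hψ2.dy.mono zero_le_one
  have bx := fun n => (N_dx 1 (ψ n)).trans (hBn n).1
  have by' := fun n => (N_dy 1 (ψ n)).trans (hBn n).1
  have bu := fun n => (hBn n).2.1
  have bv := fun n => (hBn n).2.2
  refine ⟨ψ, u, v, hψ, hψ2, cau_succ hu0 ?_ ?_, cau_succ hv0 ?_ ?_, hm⟩
  · simpa [cov1] using c1.sub (cau_mul_of_bounded by' bv hy hv0)
  · simpa [cov2] using c2.add (cau_mul_of_bounded bx bv hx hv0)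
  · simpa [cov1] using c3.add (cau_mul_of_bounded by' bu hy hu0)
  · simpa [cov2] using c4.sub (cau_mul_of_bounded bx bu hx hu0)

end

section

lemma circ_neg (p : Poly) : circ (-p) = -circ p := by simp [circ]

lemma Cau.mul_zero_of_one {p q : ℕ → Poly} (hp : Cau 1 p) (hq : Cau 1 q) : Cau 0 fun n => p n * q n :=
  Cau.mul (a := 1) (b := 1) ⟨cG, cG_nonneg, fun p q => nrm_mul_le p q⟩ hp hq

lemma exists_norm_le_of_cau {L : ℕ → EnergySpace} {w : Fin 6 → ℕ → Poly} {c : Fin 6 → ℝ} {g : Fin 6 → L2D}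
    (hw : ∀ i, Cau 0 (w i)) (hL : ∀ i n, L n i = c i • ι (w i n) - g i) : ∃ B, ∀ n, ‖L n‖ ≤ B := by
  choose B hB0 hB using fun i => (hw i).bounded
  have h : ∀ i n, ‖L n i‖ ≤ |c i| * B i + ‖g i‖ := fun i n => by
    rw [hL]
    refine (norm_sub_le _ _).trans ?_
    rw [norm_smul, Real.norm_eq_abs]
    gcongr
    exact hB i n
  exact ⟨_, fun n => (norm_le_sum_six (L n)).trans (add_le_add (add_le_add (add_le_add (add_le_add
    (add_le_add (h 0 n) (h 1 n)) (h 2 n)) (h 3 n)) (h 4 n)) (h 5 n))⟩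

variable {α β κ μ : ℝ} {f : L2D}

/-- First order variation of the energy map in `u`. -/
def varu (μ : ℝ) (ψ u η : Poly) : EnergySpace :=
  WithLp.toLp 2 ![0, ι (dx η), ι (dy η), ι (-(dy ψ * η)), ι (dx ψ * η), μ • ι (2 * (u * η))]

/-- First order variation of the energy map in `ψ`. -/
def varψ (u v χ : Poly) : EnergySpace :=
  WithLp.toLp 2 ![ι (lap χ), ι (dy χ * v), ι (-(dx χ * v)), ι (-(dy χ * u)), ι (dx χ * u), 0]

lemma vec_add_u (ψ u v η : Poly) (t : ℝ) : vec κ μ f ψ (u + C t * η) v = vec κ μ f ψ u v +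
    t • varu μ ψ u η + t ^ 2 • WithLp.toLp 2 ![0, 0, 0, 0, 0, μ • ι (η * η)] := by
  have lin : ∀ p q r s : Poly, r = p + C t * q + C (t ^ 2) * s → ι r = ι p + t • ι q + t ^ 2 • ι s := by
    rintro p q _ s rfl
    rw [← smul_eq_C_mul, ← smul_eq_C_mul, map_add, map_add, map_smul, map_smul]
  ext1 i
  fin_cases i
  · change ι (lap ψ) - f = (ι (lap ψ) - f) + t • (0 : L2D) + t ^ 2 • (0 : L2D)
    simp
  · change ι (cov1 ψ (u + C t * η) v) = ι (cov1 ψ u v) + t • ι (dx η) + t ^ 2 • (0 : L2D)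
    rw [lin (cov1 ψ u v) (dx η) _ 0 (by simp [cov1]; ring), map_zero]
  · change ι (cov2 ψ (u + C t * η) v) = ι (cov2 ψ u v) + t • ι (dy η) + t ^ 2 • (0 : L2D)
    rw [lin (cov2 ψ u v) (dy η) _ 0 (by simp [cov2]; ring), map_zero]
  · change ι (cov1 ψ v (-(u + C t * η))) = ι (cov1 ψ v (-u)) + t • ι (-(dy ψ * η)) + t ^ 2 • (0 : L2D)
    rw [lin (cov1 ψ v (-u)) (-(dy ψ * η)) _ 0 (by simp [cov1]; ring), map_zero]
  · change ι (cov2 ψ v (-(u + C t * η))) = ι (cov2 ψ v (-u)) + t • ι (dx ψ * η) + t ^ 2 • (0 : L2D)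
    rw [lin (cov2 ψ v (-u)) (dx ψ * η) _ 0 (by simp [cov2]; ring), map_zero]
  · change μ • ι (dev κ (u + C t * η) v) = μ • ι (dev κ u v) + t • (μ • ι (2 * (u * η))) +
      t ^ 2 • (μ • ι (η * η))
    rw [lin (dev κ u v) (2 * (u * η)) _ (η * η) (by simp [dev]; ring)]
    module

lemma vec_add_ψ (ψ u v χ : Poly) (t : ℝ) : vec κ μ f (ψ + C t * χ) u v = vec κ μ f ψ u v +
    t • varψ u v χ + t ^ 2 • 0 := by
  have lin : ∀ p q r : Poly, r = p + C t * q → ι r = ι p + t • ι q := by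
    rintro p q _ rfl
    rw [← smul_eq_C_mul, map_add, map_smul]
  rw [smul_zero, add_zero]
  ext1 i
  fin_cases i
  · change ι (lap (ψ + C t * χ)) - f = (ι (lap ψ) - f) + t • ι (lap χ)
    rw [lin (lap ψ) (lap χ) _ (by simp [lap]; ring)]
    abel
  · exact lin (cov1 ψ u v) (dy χ * v) _ (by simp [cov1]; ring)
  · exact lin (cov2 ψ u v) (-(dx χ * v)) _ (by simp [cov2]; ring)
  · exact lin (cov1 ψ v (-u)) (-(dy χ * u)) _ (by simp [cov1]; ring)
  · exact lin (cov2 ψ v (-u)) (dx χ * u) _ (by simp [cov2]; ring)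
  · change μ • ι (dev κ u v) = μ • ι (dev κ u v) + t • (0 : L2D)
    simp

lemma inner_vec_varu {ψ : Poly} (hψ : IsDir ψ) (u v η : Poly) (hα : α = 2 * μ ^ 2 * κ)
    (hβ : β = 2 * μ ^ 2) : inner ℝ (vec κ μ f ψ u v) (varu μ ψ u η) =
    intD (grad2 u η) + intD (gl α β ψ u v * η) := by
  rw [PiLp.inner_apply, Fin.sum_univ_six]
  change inner ℝ _ (0 : L2D) + inner ℝ (ι (cov1 ψ u v)) (ι (dx η)) + inner ℝ (ι (cov2 ψ u v)) (ι (dy η)) +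
    inner ℝ (ι (cov1 ψ v (-u))) (ι (-(dy ψ * η))) + inner ℝ (ι (cov2 ψ v (-u))) (ι (dx ψ * η)) +
    inner ℝ (μ • ι (dev κ u v)) (μ • ι (2 * (u * η))) = _
  have e : (μ • ι (2 * (u * η)) : L2D) = ι (C μ * (2 * (u * η))) := by rw [← smul_eq_C_mul, map_smul]
  have e' : (μ • ι (dev κ u v) : L2D) = ι (C μ * dev κ u v) := by rw [← smul_eq_C_mul, map_smul]
  rw [inner_zero_right, zero_add, e, e', inner_ι, inner_ι, inner_ι, inner_ι, inner_ι]
  have h0 : intD (dx (dy ψ * (v * η)) - dy (dx ψ * (v * η))) = 0 := by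
    have h := circ_dir_mul hψ.rot (v * η)
    rw [show rot ψ * (v * η) = xx * (dy ψ * (v * η)) + -(yy * (dx ψ * (v * η))) by
      simp only [rot]; ring, circ_add] at h
    rw [intD_sub, intD_dx, intD_dy, ← h, sub_eq_add_neg, circ_neg]
  simp only [← intD_add]
  rw [← sub_eq_zero, ← intD_sub, ← h0]
  congr 1
  subst hα hβ
  simp [grad2, gl, rest, adv, cov1, cov2, dev, map_ofNat (C : ℝ →+* Poly) 2]
  ring

lemma inner_vec_varψ (ψ u v χ : Poly) : inner ℝ (vec κ μ f ψ u v) (varψ u v χ) =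
    inner ℝ (ι (lap ψ) - f) (ι (lap χ)) + (intD (cur1 ψ u v * -dy χ) + intD (cur2 ψ u v * dx χ)) := by
  rw [PiLp.inner_apply, Fin.sum_univ_six]
  change inner ℝ (ι (lap ψ) - f) (ι (lap χ)) + inner ℝ (ι (cov1 ψ u v)) (ι (dy χ * v)) +
    inner ℝ (ι (cov2 ψ u v)) (ι (-(dx χ * v))) +
    inner ℝ (ι (cov1 ψ v (-u))) (ι (-(dy χ * u))) + inner ℝ (ι (cov2 ψ v (-u))) (ι (dx χ * u)) +
    inner ℝ _ (0 : L2D) = _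
  rw [inner_zero_right, add_zero, inner_ι, inner_ι, inner_ι, inner_ι]
  simp only [add_assoc, ← intD_add]
  congr 2
  simp [cur1, cur2, cov1, cov2]
  ring

variable {F ψ u v : ℕ → Poly}

lemma tendsto_critical_u (hα : α = 2 * μ ^ 2 * κ) (hβ : β = 2 * μ ^ 2) (hψ : ∀ n, IsDir (ψ n))
    (hψ2 : Cau 2 ψ) (hu : Cau 1 u)
    (hm : Tendsto (fun n => ‖vec κ μ f (ψ n) (u n) (v n)‖ ^ 2) atTop (𝓝 (infE κ μ f))) (η : Poly) :
    Tendsto (fun n => intD (grad2 (u n) η) + intD (gl α β (ψ n) (u n) (v n) * η)) atTop (𝓝 0) := by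
  have hη : Cau 1 fun _ => η := cau_const η
  obtain ⟨A, hA⟩ := hm.bddAbove_range
  have hA : ∀ n, ‖vec κ μ f (ψ n) (u n) (v n)‖ ≤ √A := fun n => Real.le_sqrt_of_sq_le (hA ⟨n, rfl⟩)
  obtain ⟨B, hB⟩ := exists_norm_le_of_cau (L := fun n => varu μ (ψ n) (u n) η)
    (w := ![0, fun _ => dx η, fun _ => dy η, fun n => -(dy (ψ n) * η), fun n => dx (ψ n) * η,
      fun n => 2 * (u n * η)]) (c := ![0, 1, 1, 1, 1, μ]) (g := 0)
    (fun i => by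
      fin_cases i
      · exact cau_const 0
      · exact cau_const _
      · exact cau_const _
      · exact (hψ2.dy.mul_zero_of_one hη).neg
      · exact hψ2.dx.mul_zero_of_one hη
      · simpa [two_mul] using (hu.mul_zero_of_one hη).add (hu.mul_zero_of_one hη))
    (fun i n => by fin_cases i <;> simp [varu])
  refine (tendsto_first_variation hm (B := max √A B) (fun n => (hB n).trans (le_max_right _ _))
    (fun n => (hA n).trans (le_max_left _ _)) (K := WithLp.toLp 2 ![0, 0, 0, 0, 0, μ • ι (η * η)])
    fun n t => ?_).congr fun n => inner_vec_varu (hψ n) _ _ _ hα hβ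
  rw [← vec_add_u]
  exact infE_le (hψ n)

lemma tendsto_critical_ψ (hψ : ∀ n, IsDir (ψ n)) (hu : Cau 1 u) (hv : Cau 1 v)
    (hm : Tendsto (fun n => ‖vec κ μ f (ψ n) (u n) (v n)‖ ^ 2) atTop (𝓝 (infE κ μ f)))
    {χ : Poly} (hχ : IsDir χ) :
    Tendsto (fun n => inner ℝ (ι (lap (ψ n)) - f) (ι (lap χ)) +
      (intD (cur1 (ψ n) (u n) (v n) * -dy χ) + intD (cur2 (ψ n) (u n) (v n) * dx χ))) atTop (𝓝 0) := by
  have hx : Cau 1 fun _ => dx χ := cau_const _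
  have hy : Cau 1 fun _ => dy χ := cau_const _
  obtain ⟨A, hA⟩ := hm.bddAbove_range
  have hA : ∀ n, ‖vec κ μ f (ψ n) (u n) (v n)‖ ≤ √A := fun n => Real.le_sqrt_of_sq_le (hA ⟨n, rfl⟩)
  obtain ⟨B, hB⟩ := exists_norm_le_of_cau (L := fun n => varψ (u n) (v n) χ)
    (w := ![fun _ => lap χ, fun n => dy χ * v n, fun n => -(dx χ * v n), fun n => -(dy χ * u n),
      fun n => dx χ * u n, 0]) (c := 1) (g := 0)
    (fun i => by
      fin_cases i
      · exact cau_const _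
      · exact hy.mul_zero_of_one hv
      · exact (hx.mul_zero_of_one hv).neg
      · exact (hy.mul_zero_of_one hu).neg
      · exact hx.mul_zero_of_one hu
      · exact cau_const 0)
    (fun i n => by fin_cases i <;> simp [varψ])
  refine (tendsto_first_variation hm (B := max √A B) (fun n => (hB n).trans (le_max_right _ _))
    (fun n => (hA n).trans (le_max_left _ _)) (K := 0)
    fun n t => ?_).congr fun n => inner_vec_varψ _ _ _ _
  rw [← vec_add_ψ]
  exact infE_le ((hψ n).add (hχ.C_mul t))

/-- Existence of asymptotically critical minimizing sequences. -/
lemma exists_isCrit (hμ : 0 < μ) (hα : α = 2 * μ ^ 2 * κ) (hβ : β = 2 * μ ^ 2)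
    (hF : Tendsto (fun n => ι (F n)) atTop (𝓝 f)) : ∃ ψ u v, IsCrit α β F ψ u v ∧
    Cau 2 ψ ∧ Cau 1 u ∧ Cau 1 v ∧
    Tendsto (fun n => ‖vec κ μ f (ψ n) (u n) (v n)‖ ^ 2) atTop (𝓝 (infE κ μ f)) := by
  obtain ⟨ψ, u, v, hψ, hψ2, hu, hv, hm⟩ := exists_minimizing_cau κ hμ f
  refine ⟨ψ, u, v, ⟨hψ, tendsto_critical_u hα hβ hψ hψ2 hu hm,
    tendsto_critical_u hα hβ hψ hψ2 hv (by simpa only [norm_vec_swap] using hm),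
    fun χ hχ => ?_⟩, hψ2, hu, hv, hm⟩
  have h1 : Tendsto (fun n => inner ℝ (f - ι (F n)) (ι (lap χ))) atTop (𝓝 0) := by
    have := Tendsto.inner (𝕜 := ℝ) ((tendsto_const_nhds (x := f)).sub hF)
      (tendsto_const_nhds (x := ι (lap χ)))
    simpa using this
  have h2 := (tendsto_critical_ψ hψ hu hv hm hχ).add h1
  rw [add_zero] at h2
  refine h2.congr fun n => ?_
  rw [← inner_ι (lap (ψ n) - F n), map_sub, inner_sub_left, inner_sub_left, inner_sub_left]
  ring

end

section

variable {α β : ℝ} {F ψ u v : ℕ → Poly}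

lemma Cau.lap {k : ℕ} {p : ℕ → Poly} (hp : Cau (k + 2) p) : Cau k fun n => DiskGL.lap (p n) :=
  hp.dx.dx.add hp.dy.dy

lemma Nul.lap {k : ℕ} {p : ℕ → Poly} (hp : Nul (k + 2) p) : Nul k fun n => DiskGL.lap (p n) :=
  hp.dx.dx.add hp.dy.dy

lemma tendsto_ι_of_nul {p q : ℕ → Poly} {f : L2D} (hp : Tendsto (fun n => ι (p n)) atTop (𝓝 f))
    (h : Nul 0 fun n => q n - p n) : Tendsto (fun n => ι (q n)) atTop (𝓝 f) := by
  have h0 : Tendsto (fun n => ι (q n - p n)) atTop (𝓝 0) :=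
    tendsto_zero_iff_norm_tendsto_zero.2 (by simpa [Nul, N_zero', nrm] using h)
  simpa using h0.add hp

lemma exists_cau_dir {f : L2D} (h : ∀ k, ∃ p : ℕ → Poly, (∀ n, IsDir (p n)) ∧ Cau k p ∧
    Tendsto (fun n => ι (p n)) atTop (𝓝 f)) : ∃ w : ℕ → Poly, (∀ n, IsDir (w n)) ∧ (∀ k, Cau k w) ∧
      Tendsto (fun n => ι (w n)) atTop (𝓝 f) := by
  obtain ⟨Q, U, hU, hQ⟩ := exists_lim_of_tendsto fun k => ⟨_, (h k).choose_spec.2⟩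
  refine ⟨fun n => dsolve (lap (Q n)), fun n => isDir_dsolve _, fun k =>
    ((hU.cau (k + 2)).lap.dsolve).mono (Nat.le_add_right k 2), ?_⟩
  obtain ⟨p, hd, hp, hpf⟩ := h 2
  refine tendsto_ι_of_nul hpf ((Nul.dsolve_sub hd ?_).mono (Nat.zero_le 2))
  simpa only [lap_sub] using (hQ 2 p hp hpf).lap

lemma exists_cau_neu {f : L2D} (h : ∀ k, ∃ p : ℕ → Poly, (∀ n, IsNeu (p n)) ∧ Cau k p ∧
    Tendsto (fun n => ι (p n)) atTop (𝓝 f)) : ∃ w : ℕ → Poly, (∀ n, IsNeu (w n)) ∧ (∀ k, Cau k w) ∧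
      Tendsto (fun n => ι (w n)) atTop (𝓝 f) := by
  obtain ⟨Q, U, hU, hQ⟩ := exists_lim_of_tendsto fun k => ⟨_, (h k).choose_spec.2⟩
  refine ⟨fun n => nsolve (lap (Q n)) + C (avg (Q n)), fun n => isNeu_add_C (isNeu_nsolve _) _,
    fun k => (((hU.cau (k + 2)).lap.nsolve).mono (Nat.le_add_right k 2)).add (hU.cau 0).avg, ?_⟩
  obtain ⟨p, hd, hp, hpf⟩ := h 2
  have hN := hQ 2 p hp hpf
  refine tendsto_ι_of_nul hpf ?_
  have e : ∀ n, nsolve (lap (Q n)) + C (avg (Q n)) - p n =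
      -(nsolve (lap (p n - Q n)) + C (avg (p n - Q n))) := fun n => by
    have : p n = nsolve (lap (p n)) + C (avg (p n)) := by
      refine nsolve_unique (hd n) (isNeu_add_C (isNeu_nsolve _) _) ?_ ?_
      · have h0 := intD_lap_mul (p n) 1
        rw [circ_dir_mul (hd n)] at h0
        have : lap (C (avg (p n))) = 0 := by simp [lap]
        rw [lap_add, lap_nsolve, this]
        simp at h0
        simp [avg, h0]
      · rw [intD_add, intD_nsolve, zero_add]
        have := intD_sub_avg (p n)
        rw [intD_sub] at this
        linarith
    conv_lhs => rw [this]
    rw [lap_sub, nsolve_sub, avg_sub, C_sub]; ring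
  simp only [e]
  have h2 : Nul 0 fun n => nsolve (lap (p n - Q n)) := by
    obtain ⟨K, hK0, hK⟩ := Bd_N_nsolve 0
    exact Nul.mono (Nat.zero_le 2) (hN.lap.bd ⟨K, hK0, fun n => hK _⟩)
  have h3 : Nul 0 fun n => (C (avg (p n - Q n)) : Poly) := by
    obtain ⟨K, hK0, hK⟩ := Bd_N_avg 0
    exact (hN.mono (Nat.zero_le 2)).bd ⟨K, hK0, fun n => hK _⟩
  exact (h2.add h3).neg

/-- Critical sequences may be replaced by ones that converge with all derivatives and satisfy
the boundary conditions exactly. -/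
lemma IsCrit.exists_smooth (h : IsCrit α β F ψ u v) (hF : ∀ k, Cau k F) (hψ : Cau 2 ψ) (hu : Cau 1 u)
    (hv : Cau 1 v) : ∃ M, ∃ ψ' u' v' : ℕ → Poly, (∀ k, Cau k ψ') ∧ (∀ k, Cau k u') ∧
      (∀ k, Cau k v') ∧ (∀ n, IsNeu (u' n)) ∧ (∀ n, IsNeu (v' n)) ∧
      Close (fun n => ψ (n + M)) (fun n => u (n + M)) (fun n => v (n + M)) ψ' u' v' ∧
      IsCrit α β (fun n => F (n + M)) ψ' u' v' := by
  obtain ⟨M, hM⟩ := h.regularity hF hψ hu hv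
  refine ⟨M, ?_⟩
  have hs : StrictMono fun n => n + M := fun a b h => by simpa using h
  obtain ⟨f, hf⟩ := ((hψ.comp hs).mono (Nat.zero_le 2)).exists_tendsto_ι
  obtain ⟨g, hg⟩ := ((hu.comp hs).mono (Nat.zero_le 1)).exists_tendsto_ι
  obtain ⟨h', hh⟩ := ((hv.comp hs).mono (Nat.zero_le 1)).exists_tendsto_ι
  choose ψ₁ u₁ v₁ hψ₁ hu₁ hv₁ hnu hnv hc hcr using hM
  have tψ : ∀ k, Tendsto (fun n => ι (ψ₁ k n)) atTop (𝓝 f) := fun k =>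
    tendsto_ι_of_nul hf ((hc k).ψ.mono (Nat.zero_le 2))
  have tu : ∀ k, Tendsto (fun n => ι (u₁ k n)) atTop (𝓝 g) := fun k =>
    tendsto_ι_of_nul hg ((hc k).u.mono (Nat.zero_le 1))
  have tv : ∀ k, Tendsto (fun n => ι (v₁ k n)) atTop (𝓝 h') := fun k =>
    tendsto_ι_of_nul hh ((hc k).v.mono (Nat.zero_le 1))
  obtain ⟨ψ', dψ, cψ, lψ⟩ := exists_cau_dir fun k =>
    ⟨ψ₁ k, (hcr k).dir, (hψ₁ k).mono (Nat.le_add_right k 3), tψ k⟩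
  obtain ⟨u', du, cu, lu⟩ := exists_cau_neu fun k =>
    ⟨u₁ k, hnu k, (hu₁ k).mono (Nat.le_add_right k 3), tu k⟩
  obtain ⟨v', dv, cv, lv⟩ := exists_cau_neu fun k =>
    ⟨v₁ k, hnv k, (hv₁ k).mono (Nat.le_add_right k 3), tv k⟩
  have a2 : 2 ≤ 0 + 3 := by norm_num
  have a1 : 1 ≤ 0 + 3 := by norm_num
  have hcl : Close (ψ₁ 0) (u₁ 0) (v₁ 0) ψ' u' v' :=
    ⟨Nul.of_cau ((cψ 2).sub ((hψ₁ 0).mono a2)) (nul_zero_of_tendsto lψ (tψ 0)),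
      Nul.of_cau ((cu 1).sub ((hu₁ 0).mono a1)) (nul_zero_of_tendsto lu (tu 0)),
      Nul.of_cau ((cv 1).sub ((hv₁ 0).mono a1)) (nul_zero_of_tendsto lv (tv 0))⟩
  exact ⟨ψ', u', v', cψ, cu, cv, du, dv, (hc 0).trans hcl,
    (hcr 0).transfer ((hψ₁ 0).mono a2) ((hu₁ 0).mono a1) ((hv₁ 0).mono a1) hcl dψ⟩

end

section

variable {α β : ℝ} {F : ℕ → Poly}

lemma IsCrit.nul_lap_sub_gl {ψ u v : ℕ → Poly}
    (h : ∀ η, Tendsto (fun n => intD (grad2 (u n) η) + intD (gl α β (ψ n) (u n) (v n) * η)) atTop (𝓝 0))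
    (hψ : ∀ k, Cau k ψ) (hu : ∀ k, Cau k u) (hv : ∀ k, Cau k v) (hn : ∀ n, IsNeu (u n)) (k : ℕ) :
    Nul k fun n => gl α β (ψ n) (u n) (v n) - lap (u n) := by
  have hc : ∀ k, Cau k fun n => gl α β (ψ n) (u n) (v n) - lap (u n) := fun k =>
    ((cau_gl (hψ (k + 3)) (hu (k + 2)) (hv (k + 2))).mono k.le_succ).sub (hu (k + 2)).lap
  refine Nul.of_cau (hc k) (nul_of_weakly (hc 0) fun η => (h η).congr fun n => ?_)
  rw [intD_grad2_neu (hn n), sub_mul, intD_sub]; ring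

section current

variable {ψ u v : Poly}

lemma lap_pot : lap (pot ψ u v) = dx (cur2 ψ u v) - dy (cur1 ψ u v) := lap_dsolve _

lemma isDir_pot : IsDir (pot ψ u v) := isDir_dsolve _

lemma div_cur : dx (cur1 ψ u v) + dy (cur2 ψ u v) =
    v * (gl α β ψ u v - lap u) - u * (gl α β ψ v (-u) - lap v) := by
  simp [cur1, cur2, gl, rest, adv, lap, dy_dx]; ring

lemma circ_mul_normal_cur (hψ : IsDir ψ) (hu : IsNeu u) (hv : IsNeu v) (g : Poly) :
    circ (g * (xx * cur1 ψ u v + yy * cur2 ψ u v)) = 0 := by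
  have e : g * (xx * cur1 ψ u v + yy * cur2 ψ u v) =
      eul v * (g * u) + -(eul u * (g * v)) + -(rot ψ * (g * (u * u + v * v))) := by
    simp [cur1, cur2, eul, rot]; ring
  have hr : IsDir (rot ψ) := hψ.rot
  rw [e, circ_add, circ_add, circ_neg, circ_neg, circ_dir_mul hv, circ_dir_mul hu, circ_dir_mul hr]
  norm_num

lemma exists_potential_cur : ∃ g, intD g = 0 ∧ dx g = dy (pot ψ u v) + cur1 ψ u v ∧
    dy g = cur2 ψ u v - dx (pot ψ u v) := by
  obtain ⟨g, h1, h2⟩ := exists_potential (a := dy (pot ψ u v) + cur1 ψ u v)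
    (b := cur2 ψ u v - dx (pot ψ u v)) (by
      have := lap_pot (ψ := ψ) (u := u) (v := v)
      rw [lap] at this
      simp only [dx_sub, dy_add]
      linear_combination this)
  refine ⟨g - C (avg g), intD_sub_avg g, ?_, ?_⟩ <;> simp [h1, h2]

/-- The supercurrent is a rotated gradient up to its divergence. -/
lemma nrm_current_le (hψ : IsDir ψ) (hu : IsNeu u) (hv : IsNeu v) :
    nrm (dy (pot ψ u v) + cur1 ψ u v) ≤ 2 * nrm (dx (cur1 ψ u v) + dy (cur2 ψ u v)) ∧
    nrm (cur2 ψ u v - dx (pot ψ u v)) ≤ 2 * nrm (dx (cur1 ψ u v) + dy (cur2 ψ u v)) := by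
  obtain ⟨g, h0, h1, h2⟩ := exists_potential_cur (ψ := ψ) (u := u) (v := v)
  have hp := nrm_le_of_intD_eq_zero h0
  rw [← h1, ← h2]
  set D := dx (cur1 ψ u v) + dy (cur2 ψ u v) with hD
  set h := pot ψ u v
  have hh : IsDir h := isDir_pot
  have e : dx g * dx g + dy g * dy g = dy (h * dx g) - dx (h * dy g) +
      (dx (g * cur1 ψ u v) + dy (g * cur2 ψ u v)) - D * g := by
    conv_lhs => rw [show dx g * dx g + dy g * dy g = dx g * (dy h + cur1 ψ u v) +
      dy g * (cur2 ψ u v - dx h) by rw [← h1, ← h2]]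
    simp [hD, dy_dx]; ring
  have key : nrm (dx g) ^ 2 + nrm (dy g) ^ 2 = -intD (D * g) := by
    have c1 : intD (dy (h * dx g)) = 0 := by
      rw [intD_dy, show yy * (h * dx g) = h * (yy * dx g) by ring, circ_dir_mul hh]
    have c2 : intD (dx (h * dy g)) = 0 := by
      rw [intD_dx, show xx * (h * dy g) = h * (xx * dy g) by ring, circ_dir_mul hh]
    have c3 : intD (dx (g * cur1 ψ u v) + dy (g * cur2 ψ u v)) = 0 := by
      rw [intD_add, intD_dx, intD_dy, ← circ_add, ← circ_mul_normal_cur hψ hu hv g]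
      congr 1; ring
    rw [nrm_sq, nrm_sq, ← intD_add, e, intD_sub, intD_add, intD_sub, c1, c2, c3]
    ring
  have hb := abs_intD_mul_le D g
  have hd := nrm_nonneg D
  have h3 := nrm_nonneg (dx g)
  have h4 := nrm_nonneg (dy g)
  have h5 : nrm (dx g) ^ 2 + nrm (dy g) ^ 2 ≤ nrm D * (nrm (dx g) + nrm (dy g)) := by
    rw [key]
    exact (neg_le_abs _).trans (hb.trans (mul_le_mul_of_nonneg_left hp hd))
  constructor
  · by_contra! hc
    nlinarith [sq_nonneg (nrm (dx g) - nrm (dy g)), sq_nonneg (nrm (dy g) - nrm D)]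
  · by_contra! hc
    nlinarith [sq_nonneg (nrm (dx g) - nrm (dy g)), sq_nonneg (nrm (dx g) - nrm D)]

end current

lemma nul_mul_cau {k : ℕ} {p q : ℕ → Poly} (hp : Nul (k + 2) p) (hq : Cau (k + 1) q) :
    Nul (k + 1) fun n => p n * q n := by
  obtain ⟨D, hD0, hD⟩ := hq.bounded
  exact Nul.mul (N_mul_le k) hp ⟨D, hD0, hD⟩

/-- The sequence converges with all derivatives to a solution of the Ginzburg–Landau system. -/
structure IsSol (α β : ℝ) (F ψ u v : ℕ → Poly) : Prop where
  dir : ∀ n, IsDir (ψ n)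
  neu_u : ∀ n, IsNeu (u n)
  neu_v : ∀ n, IsNeu (v n)
  lap_u : Nul 2 fun n => gl α β (ψ n) (u n) (v n) - lap (u n)
  lap_v : Nul 2 fun n => gl α β (ψ n) (v n) (-u n) - lap (v n)
  lap_ψ : Nul 2 fun n => lap (ψ n) - F n - pot (ψ n) (u n) (v n)
  cur₁ : Nul 2 fun n => dy (lap (ψ n) - F n) + cur1 (ψ n) (u n) (v n)
  cur₂ : Nul 2 fun n => cur2 (ψ n) (u n) (v n) - dx (lap (ψ n) - F n)

lemma IsCrit.isSol {ψ u v : ℕ → Poly} (h : IsCrit α β F ψ u v) (hF : ∀ k, Cau k F)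
    (hψ : ∀ k, Cau k ψ) (hu : ∀ k, Cau k u) (hv : ∀ k, Cau k v) (nu : ∀ n, IsNeu (u n))
    (nv : ∀ n, IsNeu (v n)) : IsSol α β F ψ u v := by
  have h1 : ∀ k, Nul k fun n => gl α β (ψ n) (u n) (v n) - lap (u n) :=
    IsCrit.nul_lap_sub_gl h.eq_u hψ hu hv nu
  have h2 : ∀ k, Nul k fun n => gl α β (ψ n) (v n) (-u n) - lap (v n) :=
    IsCrit.nul_lap_sub_gl h.eq_v hψ hv (fun k => (hu k).neg) nv
  have cp : ∀ k, Cau k fun n => pot (ψ n) (u n) (v n) := fun k =>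
    (cau_pot (hψ (k + 2)) (hu (k + 2)) (hv (k + 2))).mono (Nat.le_add_right k 2)
  have cl : ∀ k, Cau k fun n => lap (ψ n) - F n := fun k => (hψ (k + 2)).lap.sub (hF k)
  have c1 : ∀ k, Cau k fun n => cur1 (ψ n) (u n) (v n) := fun k =>
    (cau_cur1 (hψ (k + 2)) (hu (k + 2)) (hv (k + 2))).mono k.le_succ
  have c2 : ∀ k, Cau k fun n => cur2 (ψ n) (u n) (v n) := fun k =>
    (cau_cur2 (hψ (k + 2)) (hu (k + 2)) (hv (k + 2))).mono k.le_succ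
  have h3 : Nul 3 fun n => lap (ψ n) - F n - pot (ψ n) (u n) (v n) :=
    Nul.of_cau ((cl 3).sub (cp 3)) (h.nul_lap_sub (hF 0) (hψ 2) (hu 2) (hv 2))
  have hd : Nul 0 fun n => dx (cur1 (ψ n) (u n) (v n)) + dy (cur2 (ψ n) (u n) (v n)) := by
    have := (nul_mul_cau (k := 0) (h1 2) (hv 1)).sub (nul_mul_cau (k := 0) (h2 2) (hu 1))
    convert this.mono (Nat.zero_le 1) using 2 with n
    rw [div_cur (α := α) (β := β)]; ring
  have hd' : Tendsto (fun n => 2 * nrm (dx (cur1 (ψ n) (u n) (v n)) + dy (cur2 (ψ n) (u n) (v n))))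
      atTop (𝓝 0) := by simpa [Nul, N_zero'] using Tendsto.const_mul 2 hd
  have h4 : Nul 2 fun n => dy (pot (ψ n) (u n) (v n)) + cur1 (ψ n) (u n) (v n) :=
    Nul.of_cau ((cp 3).dy.add (c1 2)) (nul_of_le (fun n => by
      rw [N_zero']; exact (nrm_current_le (h.dir n) (nu n) (nv n)).1) hd')
  have h5 : Nul 2 fun n => cur2 (ψ n) (u n) (v n) - dx (pot (ψ n) (u n) (v n)) :=
    Nul.of_cau ((c2 2).sub (cp 3).dx) (nul_of_le (fun n => by
      rw [N_zero']; exact (nrm_current_le (h.dir n) (nu n) (nv n)).2) hd')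
  refine ⟨h.dir, nu, nv, h1 2, h2 2, h3.mono (Nat.le_succ 2), ?_, ?_⟩
  · convert h3.dy.add h4 using 2 with n
    simp
    ring
  · convert h5.sub h3.dx using 2 with n
    simp

end

section

variable {α β : ℝ} {F ψ u v P Q : ℕ → Poly} {Ψ U V F₀ : ℝ × ℝ → ℝ}

lemma Lim.eqOn (hP : Lim P U) (hQ : Lim Q V) (h : Nul 2 fun n => P n - Q n) : EqOn U V disk :=
  fun z hz => by
    have h1 := (hP.tendsto z hz).sub (hQ.tendsto z hz)
    have h2 := h.tendsto_ev hz
    simp only [ev_sub] at h2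
    exact sub_eq_zero.1 (tendsto_nhds_unique h1 h2)

lemma Lim.eq_zero (hP : Lim P U) (h : Nul 2 P) {z : ℝ × ℝ} (hz : z ∈ disk) : U z = 0 :=
  tendsto_nhds_unique (hP.tendsto z hz) (h.tendsto_ev hz)

lemma Lim.eq_zero_of_isDir (hP : Lim P U) (h : ∀ n, IsDir (P n)) {z : ℝ × ℝ}
    (hz : z.1 ^ 2 + z.2 ^ 2 = 1) : U z = 0 := by
  refine tendsto_nhds_unique (hP.tendsto z hz.le) (tendsto_const_nhds.congr fun n => ?_)
  obtain ⟨q, hq⟩ := h n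
  rw [hq, ev_mul, bd, ev_sub, ev_rr, hz]
  simp

/-- The complex function with given real and imaginary parts. -/
def mkC (U V : ℝ × ℝ → ℝ) : ℝ × ℝ → ℂ := fun z => (U z : ℂ) + (V z : ℂ) * I

lemma contDiff_mkC (hU : ContDiff ℝ (⊤ : ℕ∞) U) (hV : ContDiff ℝ (⊤ : ℕ∞) V) :
    ContDiff ℝ (⊤ : ℕ∞) (mkC U V) :=
  (ofRealCLM.contDiff.comp hU).add ((ofRealCLM.contDiff.comp hV).mul contDiff_const)

lemma fderiv_mkC (hU : ContDiff ℝ (⊤ : ℕ∞) U) (hV : ContDiff ℝ (⊤ : ℕ∞) V) (z w : ℝ × ℝ) :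
    fderiv ℝ (mkC U V) z w = (fderiv ℝ U z w : ℂ) + (fderiv ℝ V z w : ℂ) * I := by
  have h1 := ofRealCLM.hasFDerivAt.comp z (hU.differentiable (by simp) z).hasFDerivAt
  have h2 := (ofRealCLM.hasFDerivAt.comp z (hV.differentiable (by simp) z).hasFDerivAt).mul_const' I
  have h3 : HasFDerivAt (mkC U V) _ z := h1.add h2
  rw [h3.fderiv]
  simp [mul_comm I]

lemma D1_mkC (a : ℝ × ℝ → ℝ) (hU : ContDiff ℝ (⊤ : ℕ∞) U) (hV : ContDiff ℝ (⊤ : ℕ∞) V) :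
    D1 a (mkC U V) = mkC (fun z => pd1 U z - a z * V z) (fun z => pd1 V z + a z * U z) := by
  funext z
  apply Complex.ext <;> simp [D1, pd1, fderiv_mkC hU hV, mkC]
  ring

lemma D2_mkC (a : ℝ × ℝ → ℝ) (hU : ContDiff ℝ (⊤ : ℕ∞) U) (hV : ContDiff ℝ (⊤ : ℕ∞) V) :
    D2 a (mkC U V) = mkC (fun z => pd2 U z - a z * V z) (fun z => pd2 V z + a z * U z) := by
  funext z
  apply Complex.ext <;> simp [D2, pd2, fderiv_mkC hU hV, mkC]
  ring

lemma norm_mkC_sq (z : ℝ × ℝ) : ‖mkC U V z‖ ^ 2 = U z ^ 2 + V z ^ 2 := by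
  rw [Complex.sq_norm, normSq_apply]
  simp [mkC]; ring

lemma mkC_conj_mul_im (A B : ℝ × ℝ → ℝ) (z : ℝ × ℝ) :
    ((starRingEnd ℂ) (mkC U V z) * mkC A B z).im = U z * B z - V z * A z := by
  simp [mkC]; ring

/-- The field pair with potential `∇⊥Ψ` and order parameter `U + iV`. -/
def potPair (hΨ : ContDiff ℝ (⊤ : ℕ∞) Ψ) (hU : ContDiff ℝ (⊤ : ℕ∞) U) (hV : ContDiff ℝ (⊤ : ℕ∞) V) :
    DiskPair where
  a1 := fun z => -pd2 Ψ z
  a2 := pd1 Ψ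
  φ := mkC U V
  smooth_a1 := (contDiff_pd2 hΨ).neg
  smooth_a2 := contDiff_pd1 hΨ
  smooth_φ := contDiff_mkC hU hV

lemma lim_xx : Lim (fun _ => xx) Prod.fst := ⟨contDiff_fst, fun _ => cau_const _, fun z _ => by simp⟩

lemma lim_yy : Lim (fun _ => yy) Prod.snd := ⟨contDiff_snd, fun _ => cau_const _, fun z _ => by simp⟩

lemma IsSol.isGLSolutionD (h : IsSol α β F ψ u v) (hF : Lim F F₀) (hψ : Lim ψ Ψ) (hu : Lim u U)
    (hv : Lim v V) : IsGLSolutionD α β F₀ (potPair hψ.smooth hu.smooth hv.smooth) := by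
  have a1 := hψ.dy.neg
  have a2 := hψ.dx
  have lA1 := hu.dx.sub (a1.mul hv)
  have lB1 := hv.dx.add (a1.mul hu)
  have lA2 := hu.dy.sub (a2.mul hv)
  have lB2 := hv.dy.add (a2.mul hu)
  have lcurv := (a2.dx.sub a1.dy).sub hF
  have lsq := (hu.mul hu).add (hv.mul hv)
  have eD1 := D1_mkC (fun z => -pd2 Ψ z) hu.smooth hv.smooth
  have eD2 := D2_mkC (pd1 Ψ) hu.smooth hv.smooth
  refine ⟨fun z hz => ?_, fun z hz => ?_, fun z hz => ?_, fun z hz => ⟨?_, ?_⟩⟩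
  · have := ((lcurv.dy).add ((hu.mul lB1).sub (hv.mul lA1))).eq_zero (by
      convert h.cur₁ using 2 with n
      simp [cur1, lap]; ring) hz
    simp only [potPair, eD1, mkC_conj_mul_im]
    exact this
  · have := ((lcurv.dx.neg).add ((hu.mul lB2).sub (hv.mul lA2))).eq_zero (by
      convert h.cur₂ using 2 with n
      simp [cur2, lap]; ring) hz
    simp only [potPair, eD2, mkC_conj_mul_im]
    exact this
  · have hre := ((((lA1.dx.sub (a1.mul lB1)).add (lA2.dy.sub (a2.mul lB2))).neg.sub
        ((Lim.const α).mul hu)).add (((Lim.const β).mul lsq).mul hu)).eq_zero (by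
      convert h.lap_u using 2 with n
      simp [gl, rest, adv, lap, dy_dx]; ring) hz
    have him := ((((lB1.dx.add (a1.mul lA1)).add (lB2.dy.add (a2.mul lA2))).neg.sub
        ((Lim.const α).mul hv)).add (((Lim.const β).mul lsq).mul hv)).eq_zero (by
      convert h.lap_v using 2 with n
      simp [gl, rest, adv, lap, dy_dx]; ring) hz
    have e : (‖mkC U V z‖ : ℂ) ^ 2 = ((U z * U z + V z * V z : ℝ) : ℂ) := by
      rw [← ofReal_pow, norm_mkC_sq]; congr 1; ring
    simp only [sub_neg_eq_add, neg_mul] at hre him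
    simp only [potPair, eD1, eD2, D1_mkC _ lA1.smooth lB1.smooth, D2_mkC _ lA2.smooth lB2.smooth, e]
    apply Complex.ext
    · simp [mkC]
      linarith
    · simp [mkC]
      linarith
  · have h1 : Nul 2 fun n => lap (ψ n) - F n - pot (ψ n) (u n) (v n) := h.lap_ψ
    have h2 := h1.tendsto_ev (z := z) hz.le
    have h3 := tendsto_nhds_unique (lcurv.tendsto z hz.le) (h2.congr fun n => by
      obtain ⟨q, hq⟩ := isDir_pot (ψ := ψ n) (u := u n) (v := v n)
      have : ev (pot (ψ n) (u n) (v n)) z = 0 := by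
        rw [hq, ev_mul, bd, ev_sub, ev_rr, hz]; simp
      rw [ev_sub, this, sub_zero]
      simp [lap])
    exact sub_eq_zero.1 h3
  · have hr : ∀ n, IsDir (rot (ψ n)) := fun n => (h.dir n).rot
    have r := ((lim_xx.mul hψ.dy).sub (lim_yy.mul hψ.dx)).eq_zero_of_isDir hr hz
    have n1 := ((lim_xx.mul hu.dx).add (lim_yy.mul hu.dy)).eq_zero_of_isDir h.neu_u hz
    have n2 := ((lim_xx.mul hv.dx).add (lim_yy.mul hv.dy)).eq_zero_of_isDir h.neu_v hz
    simp only [potPair, eD1, eD2]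
    apply Complex.ext
    · simp [mkC]
      linear_combination n1 + V z * r
    · simp [mkC]
      linear_combination n2 - U z * r

end

section

variable {α β : ℝ} {F ψ u v P Q : ℕ → Poly} {Ψ U V F₀ : ℝ × ℝ → ℝ}

lemma Lim.tendsto_nrm_sq (h : Lim P U) :
    Tendsto (fun n => nrm (P n) ^ 2) atTop (𝓝 (∫ z in disk, U z ^ 2)) := by
  simpa only [nrm_sq, ← pow_two (U _)] using (h.mul h).tendsto_intD

lemma integral_disk_const (c : ℝ) : ∫ _ in disk, c = c * intD 1 := by
  simp [intD, mul_comm]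

lemma intD_one_eq_integral (c : ℝ) : c * intD 1 = ∫ _ in disk, c := (integral_disk_const c).symm

lemma integral_add_six {f₀ f₁ f₂ f₃ f₄ f₅ : ℝ × ℝ → ℝ} (h₀ : Continuous f₀) (h₁ : Continuous f₁)
    (h₂ : Continuous f₂) (h₃ : Continuous f₃) (h₄ : Continuous f₄) (h₅ : Continuous f₅) :
    ∫ z in disk, (f₀ z + f₁ z + f₂ z + f₃ z + f₄ z + f₅ z) = (∫ z in disk, f₀ z) + (∫ z in disk, f₁ z) +
      (∫ z in disk, f₂ z) + (∫ z in disk, f₃ z) + (∫ z in disk, f₄ z) + ∫ z in disk, f₅ z := by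
  have i0 := integrable_disk h₀
  have i1 := i0.add (integrable_disk h₁)
  have i2 := i1.add (integrable_disk h₂)
  have i3 := i2.add (integrable_disk h₃)
  have i4 := i3.add (integrable_disk h₄)
  rw [← integral_add' i0 (integrable_disk h₁), ← integral_add' i1 (integrable_disk h₂),
    ← integral_add' i2 (integrable_disk h₃), ← integral_add' i3 (integrable_disk h₄),
    ← integral_add' i4 (integrable_disk h₅)]
  rfl

/-- The squared norm of the energy vector converges to the energy up to a constant. -/
lemma tendsto_norm_vec (hβ : 0 < β) (hF : ContDiff ℝ (⊤ : ℕ∞) F₀) (hψ : Lim ψ Ψ) (hu : Lim u U)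
    (hv : Lim v V) : Tendsto (fun n => ‖vec (α / β) √(β / 2) (emb ⟨F₀, hF.continuous⟩)
      (ψ n) (u n) (v n)‖ ^ 2) atTop
      (𝓝 (2 * energyD α β F₀ (potPair hψ.smooth hu.smooth hv.smooth) + α ^ 2 / (2 * β) * intD 1)) := by
  have a1 := hψ.dy.neg
  have a2 := hψ.dx
  have lc := a2.dx.sub a1.dy
  have lA1 := hu.dx.sub (a1.mul hv)
  have lB1 := hv.dx.add (a1.mul hu)
  have lA2 := hu.dy.sub (a2.mul hv)
  have lB2 := hv.dy.add (a2.mul hu)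
  have ld := ((hu.mul hu).add (hv.mul hv)).sub (Lim.const (α / β))
  have hcF : Continuous fun z => pd1 (pd1 Ψ) z - pd2 (fun z => -pd2 Ψ z) z - F₀ z :=
    lc.smooth.continuous.sub hF.continuous
  have t0 : Tendsto (fun n => ‖ι (lap (ψ n)) - emb ⟨F₀, hF.continuous⟩‖ ^ 2) atTop
      (𝓝 (∫ z in disk, (pd1 (pd1 Ψ) z - pd2 (fun z => -pd2 Ψ z) z - F₀ z) ^ 2)) := by
    have e : ∫ z in disk, (pd1 (pd1 Ψ) z - pd2 (fun z => -pd2 Ψ z) z - F₀ z) ^ 2 =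
        ‖emb ⟨_, lc.smooth.continuous⟩ - emb ⟨F₀, hF.continuous⟩‖ ^ 2 := by
      rw [← map_sub, ← real_inner_self_eq_norm_sq, inner_emb]
      simp only [pow_two]; rfl
    rw [e]
    refine Tendsto.congr (fun n => ?_) ((lc.tendsto_ι.sub_const _).norm.pow 2)
    rw [dy_neg, sub_neg_eq_add, lap]
  have key : 2 * energyD α β F₀ (potPair hψ.smooth hu.smooth hv.smooth) + α ^ 2 / (2 * β) * intD 1 =
      (∫ z in disk, (pd1 (pd1 Ψ) z - pd2 (fun z => -pd2 Ψ z) z - F₀ z) ^ 2) +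
      (∫ z in disk, (pd1 U z - -pd2 Ψ z * V z) ^ 2) + (∫ z in disk, (pd2 U z - pd1 Ψ z * V z) ^ 2) +
      (∫ z in disk, (pd1 V z + -pd2 Ψ z * U z) ^ 2) + (∫ z in disk, (pd2 V z + pd1 Ψ z * U z) ^ 2) +
      β / 2 * ∫ z in disk, (U z * U z + V z * V z - α / β) ^ 2 := by
    have sq : ∀ {W : ℝ × ℝ → ℝ}, Continuous W → Continuous fun z => W z ^ 2 := fun h => h.pow 2
    have c0 := sq hcF
    have c1 := sq lA1.smooth.continuous
    have c2 := sq lA2.smooth.continuous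
    have c3 := sq lB1.smooth.continuous
    have c4 := sq lB2.smooth.continuous
    have c5 := (sq ld.smooth.continuous).const_mul (β / 2)
    rw [← integral_const_mul, ← integral_add_six c0 c1 c2 c3 c4 c5,
      ← eq_sub_iff_add_eq, intD_one_eq_integral, ← integral_sub (integrable_disk (by
        fun_prop)) (integrable_disk continuous_const), energyD, ← mul_assoc]
    norm_num
    refine integral_congr_ae (ae_of_all _ fun z => ?_)
    simp only [potPair, D1_mkC _ hu.smooth hv.smooth, D2_mkC _ hu.smooth hv.smooth, curv]
    rw [show ∀ w : ℂ, ‖w‖ ^ 4 = (‖w‖ ^ 2) ^ 2 from fun w => by ring]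
    simp only [norm_mkC_sq]
    field_simp
    ring
  rw [key]
  have hm : √(β / 2) ^ 2 = β / 2 := Real.sq_sqrt (by positivity)
  refine (((((t0.add lA1.tendsto_nrm_sq).add lA2.tendsto_nrm_sq).add lB1.tendsto_nrm_sq).add
    lB2.tendsto_nrm_sq).add (ld.tendsto_nrm_sq.const_mul (β / 2))).congr fun n => ?_
  rw [norm_vec_sq, hm]
  simp only [cov1, cov2, dev]
  congr! 4 <;> ring_nf

end

section

variable {α β : ℝ} {F ψ u v P Q : ℕ → Poly} {Ψ U V F₀ : ℝ × ℝ → ℝ}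

/-- Every smooth vector field on the disk is the sum of a rotated gradient and a gradient. -/
lemma exists_hodge {a b : ℝ × ℝ → ℝ} (ha : ContDiff ℝ (⊤ : ℕ∞) a) (hb : ContDiff ℝ (⊤ : ℕ∞) b) :
    ∃ ψ Ψ X, Lim ψ Ψ ∧ (∀ n, IsDir (ψ n)) ∧ ContDiff ℝ (⊤ : ℕ∞) X ∧
      EqOn (fun z => -pd2 Ψ z) (fun z => a z - pd1 X z) disk ∧
      EqOn (pd1 Ψ) (fun z => b z - pd2 X z) disk ∧
      EqOn (curv (fun z => -pd2 Ψ z) (pd1 Ψ)) (curv a b) disk := by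
  obtain ⟨A, hA⟩ := exists_lim_of_contDiff ha
  obtain ⟨B, hB⟩ := exists_lim_of_contDiff hb
  set ψ : ℕ → Poly := fun n => dsolve (dx (B n) - dy (A n)) with hψ
  have cψ : ∀ k, Cau k ψ := fun k =>
    (((hB.cau (k + 1)).dx.sub (hA.cau (k + 1)).dy).dsolve).mono (Nat.le_add_right k 2)
  obtain ⟨Ψ, hΨ⟩ := exists_lim_of_cau cψ
  have hlap : ∀ n, lap (ψ n) = dx (B n) - dy (A n) := fun n => lap_dsolve _
  have hg : ∀ n, ∃ g, intD g = 0 ∧ dx g = A n + dy (ψ n) ∧ dy g = B n - dx (ψ n) := fun n => by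
    obtain ⟨g, h1, h2⟩ := exists_potential (a := A n + dy (ψ n)) (b := B n - dx (ψ n)) (by
      have := hlap n
      rw [lap] at this
      simp only [dx_sub, dy_add]
      linear_combination this)
    exact ⟨g - C (avg g), intD_sub_avg g, by simp [h1], by simp [h2]⟩
  choose g hg0 hgx hgy using hg
  have cx : ∀ k, Cau k fun n => dx (g n) := fun k => by
    simpa only [hgx] using (hA.cau k).add (cψ (k + 1)).dy
  have cy : ∀ k, Cau k fun n => dy (g n) := fun k => by
    simpa only [hgy] using (hB.cau k).sub (cψ (k + 1)).dx
  have cg : ∀ k, Cau k g := fun k => by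
    induction k with
    | zero =>
      intro ε hε
      obtain ⟨M, hM⟩ := cx 0 (ε / 2) (by positivity)
      obtain ⟨M', hM'⟩ := cy 0 (ε / 2) (by positivity)
      refine ⟨max M M', fun m hm n hn => ?_⟩
      have h1 := hM m (le_of_max_le_left hm) n (le_of_max_le_left hn)
      have h2 := hM' m (le_of_max_le_right hm) n (le_of_max_le_right hn)
      rw [← dx_sub] at h1
      rw [← dy_sub] at h2
      have := nrm_le_of_intD_eq_zero (p := g m - g n) (by rw [intD_sub, hg0, hg0, sub_zero])
      simp only [N_zero'] at *
      linarith
    | succ k ih => exact cau_succ ih (cx k) (cy k)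
  obtain ⟨X, hX⟩ := exists_lim_of_cau cg
  refine ⟨ψ, Ψ, X, hΨ, fun n => isDir_dsolve _, hX.smooth, ?_, ?_, ?_⟩
  · refine hΨ.dy.neg.eqOn (hA.sub hX.dx) ?_
    simp [hgx, Nul]
  · refine hΨ.dx.eqOn (hB.sub hX.dy) ?_
    simp [hgy, Nul]
  · refine (hΨ.dx.dx.sub hΨ.dy.neg.dy).eqOn (hB.dx.sub hA.dy) ?_
    have : ∀ n, dx (dx (ψ n)) - dy (-dy (ψ n)) - (dx (B n) - dy (A n)) = 0 := fun n => by
      rw [dy_neg, sub_neg_eq_add, ← lap, hlap, sub_self]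
    simp only [this]
    simp [Nul]

lemma fderiv_gauge {X : ℝ × ℝ → ℝ} {φ : ℝ × ℝ → ℂ} (hX : ContDiff ℝ (⊤ : ℕ∞) X)
    (hφ : ContDiff ℝ (⊤ : ℕ∞) φ) (z w : ℝ × ℝ) :
    fderiv ℝ (fun z => cexp (X z * I) * φ z) z w =
      cexp (X z * I) * (fderiv ℝ φ z w + fderiv ℝ X z w * I * φ z) := by
  have h1 := (ofRealCLM.hasFDerivAt.comp z (hX.differentiable (by simp) z).hasFDerivAt).mul_const' I
  have h2 := (hφ.differentiable (by simp) z).hasFDerivAt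
  have h3 : HasFDerivAt (fun z => cexp (X z * I) * φ z) _ z := h1.cexp.mul h2
  rw [h3.fderiv]
  simp
  ring

lemma contDiff_gauge {X : ℝ × ℝ → ℝ} {φ : ℝ × ℝ → ℂ} (hX : ContDiff ℝ (⊤ : ℕ∞) X)
    (hφ : ContDiff ℝ (⊤ : ℕ∞) φ) : ContDiff ℝ (⊤ : ℕ∞) fun z => cexp (X z * I) * φ z :=
  (((ofRealCLM.contDiff.comp hX).mul contDiff_const).cexp).mul hφ

lemma norm_D1_gauge {X a a' : ℝ × ℝ → ℝ} {φ : ℝ × ℝ → ℂ} (hX : ContDiff ℝ (⊤ : ℕ∞) X)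
    (hφ : ContDiff ℝ (⊤ : ℕ∞) φ) {z : ℝ × ℝ} (h : a' z = a z - pd1 X z) :
    ‖D1 a' (fun z => cexp (X z * I) * φ z) z‖ = ‖D1 a φ z‖ := by
  have : D1 a' (fun z => cexp (X z * I) * φ z) z = cexp (X z * I) * D1 a φ z := by
    simp only [D1, pd1, fderiv_gauge hX hφ, h]
    push_cast
    ring
  rw [this, norm_mul, norm_exp_ofReal_mul_I, one_mul]

lemma norm_D2_gauge {X a a' : ℝ × ℝ → ℝ} {φ : ℝ × ℝ → ℂ} (hX : ContDiff ℝ (⊤ : ℕ∞) X)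
    (hφ : ContDiff ℝ (⊤ : ℕ∞) φ) {z : ℝ × ℝ} (h : a' z = a z - pd2 X z) :
    ‖D2 a' (fun z => cexp (X z * I) * φ z) z‖ = ‖D2 a φ z‖ := by
  have : D2 a' (fun z => cexp (X z * I) * φ z) z = cexp (X z * I) * D2 a φ z := by
    simp only [D2, pd2, fderiv_gauge hX hφ, h]
    push_cast
    ring
  rw [this, norm_mul, norm_exp_ofReal_mul_I, one_mul]

lemma mkC_re_im (φ : ℝ × ℝ → ℂ) : mkC (fun z => (φ z).re) (fun z => (φ z).im) = φ :=
  funext fun z => re_add_im (φ z)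

/-- The infimum in the Coulomb gauge is a lower bound for the energy of every field pair. -/
lemma infE_le_energyD (hβ : 0 < β) (hF : ContDiff ℝ (⊤ : ℕ∞) F₀) (P : DiskPair) :
    infE (α / β) √(β / 2) (emb ⟨F₀, hF.continuous⟩) ≤
      2 * energyD α β F₀ P + α ^ 2 / (2 * β) * intD 1 := by
  obtain ⟨ψ, Ψ, X, hψ, hd, hX, h1, h2, hc⟩ := exists_hodge P.smooth_a1 P.smooth_a2
  have hφ := contDiff_gauge hX P.smooth_φ
  have hU : ContDiff ℝ (⊤ : ℕ∞) fun z => (cexp (X z * I) * P.φ z).re := reCLM.contDiff.comp hφ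
  have hV : ContDiff ℝ (⊤ : ℕ∞) fun z => (cexp (X z * I) * P.φ z).im := imCLM.contDiff.comp hφ
  obtain ⟨u, hu⟩ := exists_lim_of_contDiff hU
  obtain ⟨v, hv⟩ := exists_lim_of_contDiff hV
  have e : energyD α β F₀ (potPair hψ.smooth hu.smooth hv.smooth) = energyD α β F₀ P := by
    rw [energyD, energyD]
    congr 1
    refine setIntegral_congr_fun measurableSet_disk fun z hz => ?_
    simp only [potPair, mkC_re_im,
      norm_D1_gauge (a := P.a1) (a' := fun z => -pd2 Ψ z) hX P.smooth_φ (h1 hz),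
      norm_D2_gauge hX P.smooth_φ (h2 hz), hc hz, norm_mul, norm_exp_ofReal_mul_I, one_mul]
  rw [← e]
  exact ge_of_tendsto' (tendsto_norm_vec hβ hF hψ hu hv) fun n => infE_le (hd n)

end

section

variable {α β κ μ : ℝ} {f : L2D} {F ψ u v P Q : ℕ → Poly} {Ψ U V F₀ : ℝ × ℝ → ℝ}

lemma Lim.shift (h : Lim P U) (M : ℕ) : Lim (fun n => P (n + M)) U where
  smooth := h.smooth
  cau k := (h.cau k).comp fun a b h => by simpa using h
  tendsto z hz := (h.tendsto z hz).comp (tendsto_add_atTop_nat M)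

lemma le_of_tendsto_norm_vec {e B : ℝ} (hu : Nul 0 u) (hv : Nul 0 v) (bu : ∀ n, N 1 (u n) ≤ B)
    (bv : ∀ n, N 1 (v n) ≤ B)
    (h : Tendsto (fun n => ‖vec κ μ f (ψ n) (u n) (v n)‖ ^ 2) atTop (𝓝 e)) :
    μ ^ 2 * (κ ^ 2 * intD 1) ≤ e := by
  have z : ∀ {w : ℕ → Poly}, Nul 0 w → (∀ n, N 1 (w n) ≤ B) →
      Tendsto (fun n => ι (w n * w n)) atTop (𝓝 0) := fun hw bw =>
    tendsto_zero_iff_norm_tendsto_zero.2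
      (tendsto_nrm_mul bw bw (by simpa [Nul, N_zero'] using hw))
  have h1 : Tendsto (fun n => nrm (dev κ (u n) (v n))) atTop (𝓝 (nrm (C κ))) := by
    have := (((z hu bu).add (z hv bv)).sub (tendsto_const_nhds (x := ι (C κ)))).norm
    simpa [nrm, dev] using this
  have h2 : nrm (C κ) ^ 2 = κ ^ 2 * intD 1 := by
    rw [nrm_sq, ← C_mul, intD_C, sq]
  rw [← h2]
  refine le_of_tendsto_of_tendsto' ((h1.pow 2).const_mul (μ ^ 2)) h fun n => ?_
  rw [norm_vec_sq]
  have := sq_nonneg (nrm (cov1 (ψ n) (u n) (v n)))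
  have := sq_nonneg (nrm (cov2 (ψ n) (u n) (v n)))
  have := sq_nonneg (nrm (cov1 (ψ n) (v n) (-u n)))
  have := sq_nonneg (nrm (cov2 (ψ n) (v n) (-u n)))
  have := sq_nonneg ‖ι (lap (ψ n)) - f‖
  linarith

lemma Lim.nul_zero (h : Lim P U) (hU : ∀ z ∈ disk, U z = 0) : Nul 0 P := by
  obtain ⟨g, hg⟩ := (h.cau 0).exists_tendsto_ι
  have h0 : Lim (fun _ => (0 : Poly)) U :=
    ⟨h.smooth, fun k ε hε => ⟨0, fun _ _ _ _ => by simpa using hε⟩,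
      fun z hz => by simp [hU z hz]⟩
  simpa using nul_zero_of_tendsto h.tendsto_ι h0.tendsto_ι

/-- The pair with the potential of `P` and the order parameter of `P` multiplied by a constant. -/
def scalePair (P : DiskPair) (s : ℝ) : DiskPair where
  a1 := P.a1
  a2 := P.a2
  φ := fun z => (s : ℂ) * P.φ z
  smooth_a1 := P.smooth_a1
  smooth_a2 := P.smooth_a2
  smooth_φ := contDiff_const.mul P.smooth_φ

lemma D1_const_mul {a : ℝ × ℝ → ℝ} {φ : ℝ × ℝ → ℂ} (hφ : ContDiff ℝ (⊤ : ℕ∞) φ) (s : ℂ) (z : ℝ × ℝ) :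
    D1 a (fun z => s * φ z) z = s * D1 a φ z := by
  rw [D1, D1, pd1, fderiv_const_mul (hφ.differentiable (by simp) z)]
  simp [pd1]
  ring

lemma D2_const_mul {a : ℝ × ℝ → ℝ} {φ : ℝ × ℝ → ℂ} (hφ : ContDiff ℝ (⊤ : ℕ∞) φ) (s : ℂ) (z : ℝ × ℝ) :
    D2 a (fun z => s * φ z) z = s * D2 a φ z := by
  rw [D2, D2, pd2, fderiv_const_mul (hφ.differentiable (by simp) z)]
  simp [pd2]
  ring

lemma contDiff_D1 (P : DiskPair) : ContDiff ℝ (⊤ : ℕ∞) (D1 P.a1 P.φ) :=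
  (P.smooth_φ.fderiv_right (by simp)).clm_apply contDiff_const |>.add
    ((contDiff_const.mul (ofRealCLM.contDiff.comp P.smooth_a1)).mul P.smooth_φ)

lemma contDiff_D2 (P : DiskPair) : ContDiff ℝ (⊤ : ℕ∞) (D2 P.a2 P.φ) :=
  (P.smooth_φ.fderiv_right (by simp)).clm_apply contDiff_const |>.add
    ((contDiff_const.mul (ofRealCLM.contDiff.comp P.smooth_a2)).mul P.smooth_φ)

lemma energyD_scalePair {P : DiskPair} (hc : ∀ x ∈ disk, curv P.a1 P.a2 x = F₀ x) (s : ℝ) :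
    energyD α β F₀ (scalePair P s) = (1 / 2) * (s ^ 2 *
      ((∫ x in disk, (‖D1 P.a1 P.φ x‖ ^ 2 + ‖D2 P.a2 P.φ x‖ ^ 2)) - α * ∫ x in disk, ‖P.φ x‖ ^ 2) +
      β / 2 * s ^ 4 * ∫ x in disk, ‖P.φ x‖ ^ 4) := by
  have i1 : Integrable (fun x => ‖D1 P.a1 P.φ x‖ ^ 2 + ‖D2 P.a2 P.φ x‖ ^ 2) (volume.restrict disk) :=
    integrable_disk (((contDiff_D1 P).continuous.norm.pow 2).add ((contDiff_D2 P).continuous.norm.pow 2))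
  have i2 : Integrable (fun x => ‖P.φ x‖ ^ 2) (volume.restrict disk) :=
    integrable_disk (P.smooth_φ.continuous.norm.pow 2)
  have i4 : Integrable (fun x => ‖P.φ x‖ ^ 4) (volume.restrict disk) :=
    integrable_disk (P.smooth_φ.continuous.norm.pow 4)
  have e : ∀ x ∈ disk, (curv (scalePair P s).a1 (scalePair P s).a2 x - F₀ x) ^ 2 +
      ‖D1 (scalePair P s).a1 (scalePair P s).φ x‖ ^ 2 + ‖D2 (scalePair P s).a2 (scalePair P s).φ x‖ ^ 2 -
      α * ‖(scalePair P s).φ x‖ ^ 2 + β / 2 * ‖(scalePair P s).φ x‖ ^ 4 =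
      s ^ 2 * (‖D1 P.a1 P.φ x‖ ^ 2 + ‖D2 P.a2 P.φ x‖ ^ 2) - s ^ 2 * α * ‖P.φ x‖ ^ 2 +
      β / 2 * s ^ 4 * ‖P.φ x‖ ^ 4 := fun x hx => by
    simp only [scalePair, hc x hx, D1_const_mul P.smooth_φ, D2_const_mul P.smooth_φ, norm_mul,
      norm_real, mul_pow, Real.norm_eq_abs, sq_abs, Even.pow_abs (n := 4) (by decide)]
    ring
  rw [energyD, setIntegral_congr_fun measurableSet_disk e, integral_add, integral_sub,
    integral_const_mul, integral_const_mul, integral_const_mul]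
  rotate_left
  · exact i1.const_mul _
  · exact i2.const_mul _
  · exact (i1.const_mul _).sub (i2.const_mul _)
  · exact i4.const_mul _
  ring

lemma exists_normalized (hF : ContDiff ℝ (⊤ : ℕ∞) F₀) : ∃ P : DiskPair,
    (∀ x ∈ disk, curv P.a1 P.a2 x = F₀ x) ∧ (∫ x in disk, ‖P.φ x‖ ^ 2) = 1 := by
  obtain ⟨F, hF⟩ := exists_lim_of_contDiff hF
  obtain ⟨Ψ, hΨ⟩ := exists_lim_of_cau (P := fun n => dsolve (F n)) fun k =>
    ((hF.cau k).dsolve).mono (Nat.le_add_right k 2)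
  have hp := intD_one_pos
  refine ⟨⟨fun z => -pd2 Ψ z, pd1 Ψ, fun _ => (√(intD 1)⁻¹ : ℝ), hΨ.dy.neg.smooth, hΨ.dx.smooth,
    contDiff_const⟩, ?_, ?_⟩
  · refine (hΨ.dx.dx.sub hΨ.dy.neg.dy).eqOn hF ?_
    have : ∀ n, DiskGL.dx (DiskGL.dx (dsolve (F n))) - DiskGL.dy (-DiskGL.dy (dsolve (F n))) - F n = 0 :=
      fun n => by rw [dy_neg, sub_neg_eq_add, ← lap, lap_dsolve, sub_self]
    simp only [this]
    simp [Nul]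
  · simp only [norm_real, Real.norm_eq_abs, sq_abs, Real.sq_sqrt (inv_nonneg.2 hp.le),
      integral_disk_const]
    exact inv_mul_cancel₀ hp.ne'

lemma exists_energyD_neg (hβ : 0 < β) (hF : ContDiff ℝ (⊤ : ℕ∞) F₀) (h : lambda1D F₀ < α) :
    ∃ P, energyD α β F₀ P < 0 := by
  obtain ⟨P₀, h1, h2⟩ := exists_normalized hF
  rw [lambda1D] at h
  obtain ⟨_, ⟨P, hc, hn, rfl⟩, ht⟩ := exists_lt_of_csInf_lt (by exact ⟨_, P₀, h1, h2, rfl⟩) h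
  set t := ∫ x in disk, (‖D1 P.a1 P.φ x‖ ^ 2 + ‖D2 P.a2 P.φ x‖ ^ 2) with t_def
  set q := ∫ x in disk, ‖P.φ x‖ ^ 4 with q_def
  have hq : 0 ≤ q := integral_nonneg fun x => by positivity
  have hd : 0 < β * q + 1 := by positivity
  set σ := (α - t) / (β * q + 1) with hσ
  have hσ0 : 0 < σ := div_pos (sub_pos.2 ht) hd
  refine ⟨scalePair P √σ, ?_⟩
  rw [energyD_scalePair hc, ← t_def, ← q_def, hn, show √σ ^ 4 = (√σ ^ 2) ^ 2 by ring, Real.sq_sqrt hσ0.le]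
  have e : σ * (β * q + 1) = α - t := div_mul_cancel₀ _ hd.ne'
  have : 0 ≤ σ ^ 2 * (β * q) := by positivity
  nlinarith [mul_pos hσ0 hσ0]

lemma energyD_nonneg {P : DiskPair} (h : ∀ x ∈ disk, P.φ x = 0) : 0 ≤ energyD α β F₀ P := by
  refine mul_nonneg (by norm_num) (setIntegral_nonneg measurableSet_disk fun x hx => ?_)
  rw [h x hx]
  simp
  positivity

lemma bddBelow_energySetD (hβ : 0 < β) (hF : ContDiff ℝ (⊤ : ℕ∞) F₀) :
    BddBelow (energySetD α β F₀) := by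
  refine ⟨-(α ^ 2 / (2 * β) * intD 1) / 2, ?_⟩
  rintro _ ⟨P, rfl⟩
  have h1 := infE_le_energyD (α := α) hβ hF P
  have h2 : 0 ≤ infE (α / β) √(β / 2) (emb ⟨F₀, hF.continuous⟩) :=
    Real.sInf_nonneg (by rintro _ ⟨ψ, u, v, -, rfl⟩; positivity)
  linarith

lemma exists_irreducible_solution (hβ : 0 < β) (hF₀ : ContDiff ℝ (⊤ : ℕ∞) F₀)
    (hneg : ∃ P, energyD α β F₀ P < 0) :
    ∃ P, IsGLSolutionD α β F₀ P ∧ ∃ x ∈ disk, P.φ x ≠ 0 := by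
  obtain ⟨F, hF⟩ := exists_lim_of_contDiff hF₀
  have hμ : 0 < √(β / 2) := Real.sqrt_pos.2 (by positivity)
  have hμ2 : √(β / 2) ^ 2 = β / 2 := Real.sq_sqrt (by positivity)
  obtain ⟨ψ, u, v, hcrit, cψ, cu, cv, hm⟩ := exists_isCrit (α := α) (β := β) (κ := α / β) hμ
    (by rw [hμ2]; field_simp) (by rw [hμ2]; ring) hF.tendsto_ι
  obtain ⟨M, ψ', u', v', cψ', cu', cv', nu, nv, hcl, hcrit'⟩ :=
    hcrit.exists_smooth hF.cau cψ cu cv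
  have hFM := hF.shift M
  have hsol := hcrit'.isSol hFM.cau cψ' cu' cv' nu nv
  obtain ⟨Ψ, hΨ⟩ := exists_lim_of_cau cψ'
  obtain ⟨U, hU⟩ := exists_lim_of_cau cu'
  obtain ⟨V, hV⟩ := exists_lim_of_cau cv'
  refine ⟨_, hsol.isGLSolutionD hFM hΨ hU hV, ?_⟩
  by_contra! h0
  have hz : ∀ z ∈ disk, U z = 0 ∧ V z = 0 := fun z hz => by
    have : mkC U V z = 0 := h0 z hz
    constructor
    · simpa [mkC] using congrArg re this
    · simpa [mkC] using congrArg im this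
  have tail : ∀ {w w' : ℕ → Poly}, Nul 1 (fun n => w' n - w (n + M)) → Nul 0 w' →
      Nul 0 fun n => w (n + M) := fun h1 h2 => by
    simpa using h2.sub (h1.mono (Nat.zero_le 1))
  obtain ⟨B, -, hB⟩ := cu.bounded
  obtain ⟨B', -, hB'⟩ := cv.bounded
  have key := le_of_tendsto_norm_vec (tail hcl.u (hU.nul_zero fun z h => (hz z h).1))
    (tail hcl.v (hV.nul_zero fun z h => (hz z h).2)) (fun n => (hB _).trans (le_max_left B B'))
    (fun n => (hB' _).trans (le_max_right B B')) (hm.comp (tendsto_add_atTop_nat M))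
  obtain ⟨P, hP⟩ := hneg
  have h1 := infE_le_energyD (α := α) hβ hF₀ P
  rw [hμ2, show β / 2 * ((α / β) ^ 2 * intD 1) = α ^ 2 / (2 * β) * intD 1 by field_simp] at key
  linarith

end

end DiskGL

/-- if `α > λ₁` then an irreducible GL solution with de Gennes–Neumann
boundary conditions exists, and every energy-minimizing field pair is irreducible. -/
theorem statement14 (α β : ℝ) (hα : 0 < α) (hβ : 0 < β) (F₀ : ℝ × ℝ → ℝ)
    (hF₀ : ContDiff ℝ (⊤ : ℕ∞) F₀) (h : α > lambda1D F₀) :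
    (∃ P : DiskPair, IsGLSolutionD α β F₀ P ∧ ∃ x ∈ disk, P.φ x ≠ 0) ∧
    (∀ P : DiskPair, energyD α β F₀ P = sInf (energySetD α β F₀) →
      ∃ x ∈ disk, P.φ x ≠ 0) := by
  have hneg := DiskGL.exists_energyD_neg hβ hF₀ h
  refine ⟨DiskGL.exists_irreducible_solution hβ hF₀ hneg, fun P hP => ?_⟩
  by_contra! h0
  obtain ⟨Q, hQ⟩ := hneg
  have h1 := csInf_le (DiskGL.bddBelow_energySetD (α := α) hβ hF₀) ⟨Q, rfl⟩
  have h2 := DiskGL.energyD_nonneg (α := α) (β := β) (F₀ := F₀) h0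
  linarith
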